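/- (Spectral instability of generic channel flows.) Let U : [0,2] → ℝ be a real-analytic shear profile, symmetric about z = 1 (U(2 − z) = U(z) for all z ∈ [0,2]), with U'(0) > 0 and U'(1) = 0. Then there exist functions α_low(R), α_up(R) with 0 < α_low(R) < α_up(R), a critical Reynolds number R_c > 0, and constants 0 < k₁ ≤ k₂, such that for every R ≥ R_c and every α ∈ (α_low(R), α_up(R)) there exist c = c(R,α) ∈ ℂ with Im c > 0 and a nonzero four times continuously differentiable function φ : [0,2] → ℂ satisfying the Orr–Sommerfeld equation (1/(iαR))(φ'''' − 2α²φ'' + α⁴φ) = (U − c)(φ'' − α²φ) − U''φ on (0,2), with no-slip boundary conditions φ(0) = φ'(0) = 0 and φ(2) = φ'(2) = 0; the growth rate satisfies k₁(αR)^{−1/2} ≤ α·Im c ≤ k₂(αR)^{−1/2}; and the eigenfunction has the symmetry φ(2 − z) = φ(z) for all z ∈ [0,2] (so that the horizontal velocity component ∂_zφ is odd about z = 1 and the vertical component, proportional to φ, is even about z = 1). -/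

import Mathlib

open Filter

open Filter Topology MeasureTheory Set

noncomputable section
open Filter Topology MeasureTheory Set ComplexConjugate
namespace OS

abbrev CC := C(Icc (0:ℝ) 1, ℂ × ℂ)
abbrev EE := (ℂ × ℂ) →L[ℂ] (ℂ × ℂ)

/-- the Volterra kernel integrand -/
def volI (La : ℝ) (M : ℝ → EE) (v : CC) (x t : ℝ) : ℂ × ℂ :=
  ((x - t) * Real.exp (-(La * (x - t)))) • M t (v (projIcc 0 1 zero_le_one t))

lemma volI_cont (La : ℝ) {M : ℝ → EE} (hM : Continuous M) (v : CC) :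
    Continuous (Function.uncurry (volI La M v)) := by
  unfold volI Function.uncurry
  have h1 : Continuous fun t : ℝ => M t (v (projIcc 0 1 zero_le_one t)) :=
    hM.clm_apply (v.continuous.comp continuous_projIcc)
  have h2 : Continuous fun p : ℝ × ℝ => (p.1 - p.2) * Real.exp (-(La * (p.1 - p.2))) := by fun_prop
  exact h2.smul (h1.comp continuous_snd)

def volF (La : ℝ) (M : ℝ → EE) (v : CC) (x : ℝ) : ℂ × ℂ := ∫ t in (0:ℝ)..x, volI La M v x t

lemma volF_cont (La : ℝ) {M : ℝ → EE} (hM : Continuous M) (v : CC) :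
    Continuous (volF La M v) := by
  unfold volF
  exact intervalIntegral.continuous_parametric_intervalIntegral_of_continuous
    (volI_cont La hM v) continuous_id

lemma volF_norm {La : ℝ} (hLa : 0 < La) {M : ℝ → EE} {C : ℝ}
    (hC : ∀ t ∈ Icc (0:ℝ) 1, ‖M t‖ ≤ C) (v : CC) {x : ℝ} (hx : x ∈ Icc (0:ℝ) 1) :
    ‖volF La M v x‖ ≤ C / La * ‖v‖ := by
  have hC0 : 0 ≤ C := (norm_nonneg _).trans (hC 0 (by simp))
  have h := intervalIntegral.norm_integral_le_of_norm_le_const (a := 0) (b := x)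
    (f := volI La M v x) (C := C / La * ‖v‖) ?_
  · refine h.trans ?_
    rw [sub_zero, abs_of_nonneg hx.1]
    have : 0 ≤ C / La * ‖v‖ := by positivity
    nlinarith [hx.2]
  · intro t ht
    rw [uIoc_of_le hx.1] at ht
    unfold volI
    rw [norm_smul]
    have h1 : ‖M t (v (projIcc 0 1 zero_le_one t))‖ ≤ C * ‖v‖ :=
      (ContinuousLinearMap.le_opNorm _ _).trans
        (mul_le_mul (hC t ⟨ht.1.le, ht.2.trans hx.2⟩) (v.norm_coe_le_norm _) (norm_nonneg _) hC0)
    have h2 : ‖(x - t) * Real.exp (-(La * (x - t)))‖ ≤ 1 / La := by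
      rw [Real.norm_of_nonneg (mul_nonneg (by linarith [ht.2]) (Real.exp_pos _).le), Real.exp_neg,
        ← div_eq_mul_inv, div_le_div_iff₀ (Real.exp_pos _) hLa]
      nlinarith [Real.add_one_le_exp (La * (x - t))]
    calc _ ≤ 1 / La * (C * ‖v‖) := mul_le_mul h2 h1 (norm_nonneg _) (by positivity)
      _ = _ := by ring

lemma M_bdd {M : ℝ → EE} (hM : Continuous M) : ∃ C, ∀ t ∈ Icc (0:ℝ) 1, ‖M t‖ ≤ C :=
  isCompact_Icc.exists_bound_of_continuousOn hM.continuousOn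

def volL (La : ℝ) (hLa : 0 < La) (M : ℝ → EE) (hM : Continuous M) : CC →L[ℂ] CC :=
  LinearMap.mkContinuous
    { toFun := fun v => ⟨fun x => volF La M v x, (volF_cont La hM v).comp continuous_subtype_val⟩
      map_add' := by
        intro u v
        ext1 x
        simp only [ContinuousMap.coe_mk, ContinuousMap.add_apply, volF]
        rw [← intervalIntegral.integral_add]
        · congr 1; ext1 t; simp [volI]
        · exact ((volI_cont La hM u).comp (by fun_prop : Continuous fun t : ℝ => ((x:ℝ), t))).intervalIntegrable _ _
        · exact ((volI_cont La hM v).comp (by fun_prop : Continuous fun t : ℝ => ((x:ℝ), t))).intervalIntegrable _ _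
      map_smul' := by
        intro a v
        ext1 x
        simp only [ContinuousMap.coe_mk, ContinuousMap.smul_apply, volF, RingHom.id_apply]
        rw [← intervalIntegral.integral_smul]
        congr 1; ext1 t
        simp only [volI, ContinuousMap.smul_apply, map_smul]
        rw [smul_comm] }
    ((M_bdd hM).choose / La) (by
      intro v
      rw [ContinuousMap.norm_le _ (mul_nonneg (div_nonneg ((norm_nonneg _).trans ((M_bdd hM).choose_spec 0 (by simp))) hLa.le) (norm_nonneg _))]
      intro x
      exact volF_norm hLa (M_bdd hM).choose_spec v x.2)

lemma volL_apply (La : ℝ) (hLa : 0 < La) (M : ℝ → EE) (hM : Continuous M) (v : CC) (x : Icc (0:ℝ) 1) :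
    volL La hLa M hM v x = volF La M v x := rfl

lemma volL_norm {La : ℝ} (hLa : 0 < La) {M : ℝ → EE} (hM : Continuous M) {C : ℝ}
    (hC : ∀ t ∈ Icc (0:ℝ) 1, ‖M t‖ ≤ C) : ‖volL La hLa M hM‖ ≤ C / La := by
  have hC0 : 0 ≤ C := (norm_nonneg _).trans (hC 0 (by simp))
  refine ContinuousLinearMap.opNorm_le_bound _ (by positivity) fun v => ?_
  rw [ContinuousMap.norm_le _ (by positivity)]
  exact fun x => volF_norm hLa hC v x.2

lemma neumann {X : Type*} [NormedAddCommGroup X] [NormedSpace ℂ X] [CompleteSpace X]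
    (K0 K1 : X →L[ℂ] X) (w : X) (ρ : ℝ) (h : ‖K0‖ + |ρ| * ‖K1‖ < 1) :
    ∃ v : ℂ → X, DifferentiableOn ℂ v (Metric.ball 0 ρ) ∧
      ∀ c ∈ Metric.ball (0:ℂ) ρ, v c = w + (K0 (v c) + c • K1 (v c)) := by
  have hunit : ∀ c ∈ Metric.ball (0:ℂ) ρ, IsUnit (1 - (K0 + c • K1)) := by
    intro c hc
    refine isUnit_one_sub_of_norm_lt_one ?_
    have hcn : ‖c‖ ≤ |ρ| := (mem_ball_zero_iff.1 hc).le.trans (le_abs_self _)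
    refine lt_of_le_of_lt ((norm_add_le _ _).trans (add_le_add le_rfl ?_)) h
    rw [norm_smul]
    exact mul_le_mul_of_nonneg_right hcn (norm_nonneg _)
  refine ⟨fun c => Ring.inverse (1 - (K0 + c • K1)) w, ?_, ?_⟩
  · intro c hc
    refine DifferentiableAt.differentiableWithinAt ?_
    have h7 : DifferentiableAt ℂ (fun c : ℂ => (1 - (K0 + c • K1) : X →L[ℂ] X)) c := by fun_prop
    have h3 : DifferentiableAt ℂ (fun c : ℂ => Ring.inverse (1 - (K0 + c • K1))) c :=
      DifferentiableAt.comp (g := Ring.inverse) c (differentiableAt_inverse (𝕜 := ℂ) (hunit c hc)) h7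
    exact h3.clm_apply (differentiableAt_const _)
  · intro c hc
    have h5 := congrArg (fun T : X →L[ℂ] X => T w) (Ring.mul_inverse_cancel _ (hunit c hc))
    simp only [mul_apply_eq_comp, sub_apply, one_apply_eq_self, add_apply, smul_apply] at h5
    exact sub_eq_iff_eq_add.1 h5

/-- Parametrised solution of u'' = (M0 + c M1) u, u(0)=u0, u'(0)=0 on [0,1], with analytic dependence. -/
lemma vol_solve (M0 M1 : ℝ → EE) (h0 : Continuous M0) (h1 : Continuous M1) (ρ : ℝ) (u0 : ℂ × ℂ) :
    ∃ u : ℂ → CC, DifferentiableOn ℂ u (Metric.ball 0 ρ) ∧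
      ∀ c ∈ Metric.ball (0:ℂ) ρ, ∀ x : Icc (0:ℝ) 1,
        u c x = u0 + ∫ t in (0:ℝ)..x, ((x:ℝ) - t) • (M0 t + c • M1 t) (u c (projIcc 0 1 zero_le_one t)) := by
  obtain ⟨C0, hC0⟩ := M_bdd h0
  obtain ⟨C1, hC1⟩ := M_bdd h1
  have p0 : 0 ≤ C0 := (norm_nonneg _).trans (hC0 0 (by simp))
  have p1 : 0 ≤ C1 := (norm_nonneg _).trans (hC1 0 (by simp))
  set La : ℝ := 2 * (C0 + |ρ| * C1 + 1) with hLadef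
  have hLa : 0 < La := by positivity
  set K0 := volL La hLa M0 h0
  set K1 := volL La hLa M1 h1
  -- exponential multiplication map
  set w : CC := ⟨fun x => Real.exp (-(La * x)) • u0, by fun_prop⟩ with hw
  let E : CC →L[ℂ] CC := LinearMap.mkContinuous
    { toFun := fun v => ⟨fun x => Real.exp (La * x) • v x, by fun_prop⟩
      map_add' := by intro u v; ext1 x; simp
      map_smul' := by intro a v; ext1 x; exact smul_comm (Real.exp (La * x)) a (v x) }
    (Real.exp La) (by
      intro v
      rw [ContinuousMap.norm_le _ (by positivity)]
      intro x
      change ‖Real.exp (La * x) • v x‖ ≤ _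
      rw [norm_smul, Real.norm_of_nonneg (Real.exp_pos _).le]
      refine mul_le_mul ?_ (v.norm_coe_le_norm _) (norm_nonneg _) (Real.exp_pos _).le
      exact Real.exp_le_exp.2 (by nlinarith [x.2.2]))
  have hE : ∀ v x, E v x = Real.exp (La * x) • v x := fun v x => rfl
  have hsmall : ‖K0‖ + |ρ| * ‖K1‖ < 1 := by
    calc ‖K0‖ + |ρ| * ‖K1‖ ≤ C0 / La + |ρ| * (C1 / La) := by
          have a1 : ‖K0‖ ≤ C0 / La := volL_norm hLa h0 hC0
          have a2 : ‖K1‖ ≤ C1 / La := volL_norm hLa h1 hC1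
          gcongr
      _ = (C0 + |ρ| * C1) / La := by ring
      _ < 1 := by
        rw [div_lt_one hLa]
        have : 0 ≤ |ρ| * C1 := by positivity
        linarith
  obtain ⟨v, hvd, hfix⟩ := neumann K0 K1 w ρ hsmall
  refine ⟨fun c => E (v c), E.differentiable.comp_differentiableOn hvd, ?_⟩
  · intro c hc x
    replace hfix := hfix c hc
    have hx : v c x = w x + (volF La M0 (v c) x + c • volF La M1 (v c) x) := by
      conv_lhs => rw [hfix]
      rfl
    rw [hE, hx, smul_add]
    congr 1
    · change Real.exp (La * x) • (Real.exp (-(La * x)) • u0) = u0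
      rw [smul_smul, ← Real.exp_add]; simp
    · unfold volF
      have i0 : IntervalIntegrable (fun t => volI La M0 (v c) x t) volume 0 x := ((volI_cont La h0 (v c)).comp (by fun_prop : Continuous fun t : ℝ => ((x:ℝ), t))).intervalIntegrable (μ := volume) 0 x
      have i1 : IntervalIntegrable (fun t => volI La M1 (v c) x t) volume 0 x := ((volI_cont La h1 (v c)).comp (by fun_prop : Continuous fun t : ℝ => ((x:ℝ), t))).intervalIntegrable (μ := volume) 0 x
      have i2 : IntervalIntegrable (fun t => c • volI La M1 (v c) x t) volume 0 x := i1.smul c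
      rw [← intervalIntegral.integral_smul c, ← intervalIntegral.integral_add i0 i2, ← intervalIntegral.integral_smul]
      refine intervalIntegral.integral_congr fun t ht => ?_
      have hp : (projIcc (0:ℝ) 1 zero_le_one t : ℝ) = t := by
        rw [uIcc_of_le x.2.1] at ht
        rw [projIcc_of_mem zero_le_one ⟨ht.1, ht.2.trans x.2.2⟩]
      simp only [volI, hE, hp]
      simp only [add_apply, smul_apply]
      have e1 : Real.exp (-(La * (x - t))) = Real.exp (-(La * x)) * Real.exp (La * t) := by
        rw [← Real.exp_add]; congr 1; ring
      have e2 : Real.exp (La * x) * Real.exp (-(La * x)) = 1 := by rw [← Real.exp_add]; simp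
      rw [e1]
      have hs : ∀ (r : ℝ) (T : EE) (z : ℂ × ℂ), T (r • z) = r • T z := by
        intro r T z
        exact (T.restrictScalars ℝ).map_smul r z
      rw [hs, hs]
      simp only [smul_add, smul_smul]
      rw [smul_comm c (_ : ℝ), smul_smul, smul_comm c (_:ℝ)]
      have e3 : Real.exp (La * x) * ((x - t) * (Real.exp (-(La * x)) * Real.exp (La * t))) = (x - t) * Real.exp (La * t) := by
        linear_combination ((x:ℝ) - t) * Real.exp (La * t) * e2
      rw [e3, smul_smul ((x:ℝ) - t)]

lemma int_hasDeriv {E : Type*} [NormedAddCommGroup E] [NormedSpace ℝ E] [CompleteSpace E] {h : ℝ → E} (hh : Continuous h) (x : ℝ) :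
    HasDerivAt (fun x => ∫ t in (0:ℝ)..x, h t) (h x) x :=
  intervalIntegral.integral_hasDerivAt_right (hh.intervalIntegrable _ _)
    (hh.stronglyMeasurableAtFilter _ _) hh.continuousAt

lemma int_cont {E : Type*} [NormedAddCommGroup E] [NormedSpace ℝ E] [CompleteSpace E] {h : ℝ → E} (hh : Continuous h) : Continuous (fun x => ∫ t in (0:ℝ)..x, h t) :=
  continuous_iff_continuousAt.2 fun x => (int_hasDeriv hh x).continuousAt

lemma double_int {E : Type*} [NormedAddCommGroup E] [NormedSpace ℝ E] [CompleteSpace E] {h : ℝ → E} (hh : Continuous h) (x : ℝ) :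
    ∫ t in (0:ℝ)..x, (x - t) • h t = ∫ s in (0:ℝ)..x, ∫ t in (0:ℝ)..s, h t := by
  have key : ∀ x, HasDerivAt (fun x : ℝ => x • (∫ t in (0:ℝ)..x, h t) - ∫ t in (0:ℝ)..x, t • h t)
      (∫ t in (0:ℝ)..x, h t) x := by
    intro x
    have h1 := (hasDerivAt_id x).smul (int_hasDeriv hh x)
    have h2 := int_hasDeriv (h := fun t => t • h t) (by fun_prop) x
    refine (h1.sub h2).congr_deriv ?_
    simp
  have e := intervalIntegral.integral_eq_sub_of_hasDerivAt (a := 0) (b := x) (fun y _ => key y)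
    ((int_cont hh).intervalIntegrable _ _)
  rw [e]
  simp only [sub_smul, intervalIntegral.integral_same, smul_zero, sub_zero]
  rw [intervalIntegral.integral_sub, intervalIntegral.integral_smul]
  · exact (by fun_prop : Continuous fun t => x • h t).intervalIntegrable _ _
  · exact (by fun_prop : Continuous fun t => t • h t).intervalIntegrable _ _

lemma int_odd_of_even {h : ℝ → ℂ} (hh : ∀ x, h (-x) = h x) (x : ℝ) :
    ∫ t in (0:ℝ)..(-x), h t = - ∫ t in (0:ℝ)..x, h t := by
  have := intervalIntegral.integral_comp_neg (a := 0) (b := x) h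
  simp only [hh, neg_zero] at this
  rw [this, intervalIntegral.integral_symm]

lemma int_even_of_odd {h : ℝ → ℂ} (hh : ∀ x, h (-x) = - h x) (x : ℝ) :
    ∫ t in (0:ℝ)..(-x), h t = ∫ t in (0:ℝ)..x, h t := by
  have := intervalIntegral.integral_comp_neg (a := 0) (b := x) h
  simp only [hh, neg_zero, intervalIntegral.integral_neg] at this
  rw [intervalIntegral.integral_symm, ← this, neg_neg]

/-- Even solutions of `φ'''' = A φ'' + B φ` on `[0,1]`, extended smoothly. -/
structure EvenSol (A B : ℝ → ℂ) (φ φ1 ψ ψ1 h : ℝ → ℂ) : Prop where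
  d0 : ∀ x, HasDerivAt φ (φ1 x) x
  d1 : ∀ x, HasDerivAt φ1 (ψ x) x
  d2 : ∀ x, HasDerivAt ψ (ψ1 x) x
  d3 : ∀ x, HasDerivAt ψ1 (h x) x
  hc : Continuous h
  eq : ∀ x ∈ Icc (0:ℝ) 1, h x = A x * ψ x + B x * φ x
  z1 : φ1 0 = 0
  z3 : ψ1 0 = 0
  ev : ∀ x, φ (-x) = φ x
  ev2 : ∀ x, ψ (-x) = ψ x
  ev4 : ∀ x, h (-x) = h x

def intFun : CC →L[ℂ] ℂ :=
  LinearMap.mkContinuous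
    { toFun := fun v => ∫ t in (0:ℝ)..1, (v (projIcc 0 1 zero_le_one t)).2
      map_add' := by
        intro u v
        have hc : ∀ v : CC, Continuous fun t : ℝ => (v (projIcc 0 1 zero_le_one t)).2 := fun v =>
          continuous_snd.comp (v.continuous.comp continuous_projIcc)
        rw [← intervalIntegral.integral_add ((hc u).intervalIntegrable _ _) ((hc v).intervalIntegrable _ _)]
        rfl
      map_smul' := by
        intro a v
        simp only [RingHom.id_apply]
        rw [← intervalIntegral.integral_smul]
        rfl }
    1 (by
      intro v
      have := intervalIntegral.norm_integral_le_of_norm_le_const (a := 0) (b := 1)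
        (f := fun t => (v (projIcc 0 1 zero_le_one t)).2) (C := ‖v‖) (fun t _ =>
          (norm_snd_le _).trans (v.norm_coe_le_norm _))
      simpa using this)

theorem ode_solve (A0 A1 B0 B1 : ℝ → ℂ) (hA0 : Continuous A0) (hA1 : Continuous A1)
    (hB0 : Continuous B0) (hB1 : Continuous B1) (ρ : ℝ) (p0 s0 : ℂ) :
    ∃ φ φ1 ψ ψ1 h : ℂ → ℝ → ℂ,
      (∀ c ∈ Metric.ball (0:ℂ) ρ, EvenSol (fun x => A0 x + c * A1 x) (fun x => B0 x + c * B1 x)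
        (φ c) (φ1 c) (ψ c) (ψ1 c) (h c) ∧ φ c 0 = p0 ∧ ψ c 0 = s0) ∧
      DifferentiableOn ℂ (fun c => φ c 1) (Metric.ball 0 ρ) ∧
      DifferentiableOn ℂ (fun c => φ1 c 1) (Metric.ball 0 ρ) := by
  let π1 := ContinuousLinearMap.fst ℂ ℂ ℂ
  let π2 := ContinuousLinearMap.snd ℂ ℂ ℂ
  let i1 := ContinuousLinearMap.inl ℂ ℂ ℂ
  let i2 := ContinuousLinearMap.inr ℂ ℂ ℂ
  let M0 : ℝ → EE := fun t => i1.comp π2 + (A0 t • i2.comp π2 + B0 t • i2.comp π1)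
  let M1 : ℝ → EE := fun t => (A1 t • i2.comp π2 + B1 t • i2.comp π1)
  have hM0 : Continuous M0 := by fun_prop
  have hM1 : Continuous M1 := by fun_prop
  have hMM : ∀ t c (z : ℂ × ℂ), (M0 t + c • M1 t) z =
      (z.2, (A0 t + c * A1 t) * z.2 + (B0 t + c * B1 t) * z.1) := by
    intro t c z
    ext
    · simp [M0, M1, i1, i2, π1, π2]
    · simp [M0, M1, i1, i2, π1, π2]; ring
  obtain ⟨u, hud, hu⟩ := vol_solve M0 M1 hM0 hM1 ρ (p0, s0)
  let P : ℂ → ℝ → ℂ × ℂ := fun c t => u c (projIcc 0 1 zero_le_one |t|)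
  have hP : ∀ c, Continuous (P c) := fun c =>
    (u c).continuous.comp (continuous_projIcc.comp continuous_abs)
  have hPe : ∀ c t, P c (-t) = P c t := fun c t => by simp [P]
  let h : ℂ → ℝ → ℂ := fun c t => (A0 |t| + c * A1 |t|) * (P c t).2 + (B0 |t| + c * B1 |t|) * (P c t).1
  have hh : ∀ c, Continuous (h c) := by
    intro c
    have := hP c
    fun_prop
  have hhe : ∀ c t, h c (-t) = h c t := fun c t => by simp [h, hPe]
  let ψ1 : ℂ → ℝ → ℂ := fun c x => ∫ t in (0:ℝ)..x, h c t
  let ψ : ℂ → ℝ → ℂ := fun c x => s0 + ∫ t in (0:ℝ)..x, ψ1 c t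
  let φ1 : ℂ → ℝ → ℂ := fun c x => ∫ t in (0:ℝ)..x, ψ c t
  let φ : ℂ → ℝ → ℂ := fun c x => p0 + ∫ t in (0:ℝ)..x, φ1 c t
  have cψ1 : ∀ c, Continuous (ψ1 c) := fun c => int_cont (hh c)
  have cψ : ∀ c, Continuous (ψ c) := fun c => continuous_const.add (int_cont (cψ1 c))
  have cφ1 : ∀ c, Continuous (φ1 c) := fun c => int_cont (cψ c)
  have oψ1 : ∀ c x, ψ1 c (-x) = - ψ1 c x := fun c x => int_odd_of_even (hhe c) x
  have eψ : ∀ c x, ψ c (-x) = ψ c x := fun c x => by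
    simp only [ψ]; rw [int_even_of_odd (oψ1 c) x]
  have oφ1 : ∀ c x, φ1 c (-x) = - φ1 c x := fun c x => int_odd_of_even (eψ c) x
  have eφ : ∀ c x, φ c (-x) = φ c x := fun c x => by
    simp only [φ]; rw [int_even_of_odd (oφ1 c) x]
  have hPp : ∀ c t, t ∈ Icc (0:ℝ) 1 → u c (projIcc 0 1 zero_le_one t) = P c t := by
    intro c t ht; simp only [P]; rw [abs_of_nonneg ht.1]
  have hPeq : ∀ c ∈ Metric.ball (0:ℂ) ρ, ∀ x ∈ Icc (0:ℝ) 1,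
      P c x = (p0 + ∫ t in (0:ℝ)..x, (x - t) • (P c t).2, s0 + ∫ t in (0:ℝ)..x, (x - t) • h c t) := by
    intro c hc x hx
    have e := hu c hc ⟨x, hx⟩
    have e2 : P c x = u c ⟨x, hx⟩ := by
      rw [← hPp c x hx, projIcc_of_mem zero_le_one hx]
    have e3 : (∫ t in (0:ℝ)..x, (x - t) • (M0 t + c • M1 t) (u c (projIcc 0 1 zero_le_one t)))
       = ∫ t in (0:ℝ)..x, (((x - t) • (P c t).2, (x - t) • h c t) : ℂ × ℂ) := by
      refine intervalIntegral.integral_congr fun t ht => ?_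
      rw [uIcc_of_le hx.1] at ht
      have ht' : t ∈ Icc (0:ℝ) 1 := ⟨ht.1, ht.2.trans hx.2⟩
      simp only [hMM, hPp c t ht', h, abs_of_nonneg ht.1]
      rfl
    have := hP c
    have := hh c
    have j : IntervalIntegrable (fun t => (((x - t) • (P c t).2, (x - t) • h c t) : ℂ × ℂ)) volume 0 x :=
      (by fun_prop : Continuous _).intervalIntegrable _ _
    rw [e2, e, e3]
    ext1
    · have := (ContinuousLinearMap.fst ℂ ℂ ℂ).intervalIntegral_comp_comm j
      simp only [ContinuousLinearMap.coe_fst'] at this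
      simp only [Prod.fst_add, ← this]
    · have := (ContinuousLinearMap.snd ℂ ℂ ℂ).intervalIntegral_comp_comm j
      simp only [ContinuousLinearMap.coe_snd'] at this
      simp only [Prod.snd_add, ← this]
  have hψP : ∀ c ∈ Metric.ball (0:ℂ) ρ, ∀ x ∈ Icc (0:ℝ) 1, ψ c x = (P c x).2 := by
    intro c hc x hx
    rw [hPeq c hc x hx, double_int (hh c)]
  have hφP : ∀ c ∈ Metric.ball (0:ℂ) ρ, ∀ x ∈ Icc (0:ℝ) 1, φ c x = (P c x).1 := by
    intro c hc x hx
    have := hP c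
    rw [hPeq c hc x hx]
    have e : (∫ t in (0:ℝ)..x, (x - t) • (P c t).2) = ∫ t in (0:ℝ)..x, (x - t) • ψ c t := by
      refine intervalIntegral.integral_congr fun t ht => ?_
      rw [uIcc_of_le hx.1] at ht
      simp only [hψP c hc t ⟨ht.1, ht.2.trans hx.2⟩]
    rw [e, double_int (cψ c)]
  refine ⟨φ, φ1, ψ, ψ1, h, ?_, ?_, ?_⟩
  · intro c hc
    refine ⟨⟨fun x => (int_hasDeriv (cφ1 c) x).const_add p0, fun x => int_hasDeriv (cψ c) x,
      fun x => (int_hasDeriv (cψ1 c) x).const_add s0, fun x => int_hasDeriv (hh c) x, hh c, ?_,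
      by simp [φ1], by simp [ψ1], eφ c, eψ c, hhe c⟩, by simp [φ], by simp [ψ]⟩
    intro x hx
    rw [hψP c hc x hx, hφP c hc x hx]
    simp only [h, abs_of_nonneg hx.1]
  · have e : ∀ c ∈ Metric.ball (0:ℂ) ρ, φ c 1 = (u c ⟨1, by simp⟩).1 := by
      intro c hc
      rw [hφP c hc 1 (by simp), ← hPp c 1 (by simp), projIcc_of_mem zero_le_one (by simp)]
    refine DifferentiableOn.congr ?_ e
    exact ((ContinuousLinearMap.fst ℂ ℂ ℂ).comp
      (ContinuousMap.evalCLM ℂ (⟨1, by simp⟩ : Icc (0:ℝ) 1))).differentiable.comp_differentiableOn hud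
  · have e : ∀ c ∈ Metric.ball (0:ℂ) ρ, φ1 c 1 = intFun (u c) := by
      intro c hc
      change _ = ∫ t in (0:ℝ)..1, _
      refine intervalIntegral.integral_congr fun t ht => ?_
      rw [uIcc_of_le zero_le_one] at ht
      simp only [hψP c hc t ht, hPp c t ht]
    exact (intFun.differentiable.comp_differentiableOn hud).congr e

end OS

end

noncomputable section
open Filter Topology MeasureTheory Set ComplexConjugate
namespace OS

/-- Weighted energy lemma. -/
theorem WEL {u u1 u2 G G1 h d : ℝ → ℂ} {om om1 : ℝ → ℝ} {ν α2 ci La : ℝ}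
    (du : ∀ x, HasDerivAt u (u1 x) x) (du1 : ∀ x, HasDerivAt u1 (u2 x) x) (cu2 : Continuous u2)
    (dG : ∀ x, HasDerivAt G (G1 x) x) (cG1 : Continuous G1) (ch : Continuous h)
    (dom : ∀ x, HasDerivAt om (om1 x) x) (com1 : Continuous om1)
    (hν : 0 < ν) (hα2 : 0 ≤ α2) (hci : 0 < ci)
    (hd : ∀ x ∈ Icc (0:ℝ) 1, (d x).im = -ci)
    (heq : ∀ x ∈ Icc (0:ℝ) 1, d x * u x + Complex.I * ν * (u2 x - α2 * u x) = G1 x + h x)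
    (u10 : u1 0 = 0) (u01 : u 1 = 0) (G0 : G 0 = 0)
    (om0 : ∀ x ∈ Icc (0:ℝ) 1, 0 ≤ om x) (omL : ∀ x ∈ Icc (0:ℝ) 1, |om1 x| ≤ La * om x)
    (hLa : ν * La ^ 2 ≤ ci / 4) :
    ∫ x in (0:ℝ)..1, om x * ‖u x‖ ^ 2 ≤
      2 / (ν * ci) * (∫ x in (0:ℝ)..1, om x * ‖G x‖ ^ 2) + 2 / ci ^ 2 * ∫ x in (0:ℝ)..1, om x * ‖h x‖ ^ 2 := by
  have cu : Continuous u := continuous_iff_continuousAt.2 fun x => (du x).continuousAt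
  have cu1 : Continuous u1 := continuous_iff_continuousAt.2 fun x => (du1 x).continuousAt
  have cG : Continuous G := continuous_iff_continuousAt.2 fun x => (dG x).continuousAt
  have com : Continuous om := continuous_iff_continuousAt.2 fun x => (dom x).continuousAt
  let Φ : ℝ → ℂ := fun x => (om x : ℂ) * ((Complex.I * ν * u1 x - G x) * conj (u x))
  let Φ1 : ℝ → ℂ := fun x => (om1 x : ℂ) * ((Complex.I * ν * u1 x - G x) * conj (u x)) +
    (om x : ℂ) * ((Complex.I * ν * u2 x - G1 x) * conj (u x) + (Complex.I * ν * u1 x - G x) * conj (u1 x))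
  have dΦ : ∀ x, HasDerivAt Φ (Φ1 x) x := by
    intro x
    have h1 : HasDerivAt (fun x => (om x : ℂ)) (om1 x : ℂ) x := (dom x).ofReal_comp
    have h2 : HasDerivAt (fun x => conj (u x)) (conj (u1 x)) x := (du x).star
    have h3 := (((du1 x).const_mul (Complex.I * ν)).sub (dG x)).mul h2
    exact h1.mul h3
  have cΦ1 : Continuous Φ1 := by fun_prop
  have hint : ∫ x in (0:ℝ)..1, (Φ1 x).im = 0 := by
    have := intervalIntegral.integral_eq_sub_of_hasDerivAt (a := 0) (b := 1) (f := fun x => (Φ x).im)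
      (f' := fun x => (Φ1 x).im) (fun x _ => Complex.imCLM.hasFDerivAt.comp_hasDerivAt x (dΦ x))
      ((Complex.continuous_im.comp cΦ1).intervalIntegrable _ _)
    rw [this]
    simp [Φ, u10, u01, G0]
  have key : ∀ x ∈ Icc (0:ℝ) 1, ci / 2 * (om x * ‖u x‖ ^ 2) ≤
      (Φ1 x).im + (1 / ν * (om x * ‖G x‖ ^ 2) + 1 / ci * (om x * ‖h x‖ ^ 2)) := by
    intro x hx
    have e := heq x hx
    have hO := om0 x hx
    have hL := omL x hx
    have hdx := hd x hx
    -- the imaginary part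
    have e1 : Complex.I * ν * u2 x - G1 x = h x - d x * u x + Complex.I * ν * α2 * u x := by
      linear_combination e
    have e2 : (Φ1 x).im = om1 x * ((Complex.I * ν * u1 x - G x) * conj (u x)).im +
        om x * ((h x * conj (u x)).im + ci * ‖u x‖ ^ 2 + ν * α2 * ‖u x‖ ^ 2 + ν * ‖u1 x‖ ^ 2
          - (G x * conj (u1 x)).im) := by
      simp only [Φ1, e1]
      rw [← Complex.normSq_eq_norm_sq, ← Complex.normSq_eq_norm_sq, Complex.normSq_apply, Complex.normSq_apply]
      simp only [Complex.add_im, Complex.mul_im, Complex.mul_re, Complex.sub_re, Complex.sub_im, Complex.add_re,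
        Complex.ofReal_re, Complex.ofReal_im, Complex.I_re, Complex.I_im, Complex.conj_re, Complex.conj_im, hdx]
      ring
    have b1 : |((Complex.I * ν * u1 x - G x) * conj (u x)).im| ≤ (ν * ‖u1 x‖ + ‖G x‖) * ‖u x‖ := by
      refine (Complex.abs_im_le_norm _).trans ?_
      rw [norm_mul, RCLike.norm_conj]
      gcongr
      refine (norm_sub_le _ _).trans ?_
      simp [abs_of_pos hν]
    have b2 : |(h x * conj (u x)).im| ≤ ‖h x‖ * ‖u x‖ := by
      refine (Complex.abs_im_le_norm _).trans ?_
      rw [norm_mul, RCLike.norm_conj]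
    have b3 : |(G x * conj (u1 x)).im| ≤ ‖G x‖ * ‖u1 x‖ := by
      refine (Complex.abs_im_le_norm _).trans ?_
      rw [norm_mul, RCLike.norm_conj]
    have c1 : -(om x * (La * (ν * ‖u1 x‖ + ‖G x‖) * ‖u x‖)) ≤ om1 x * ((Complex.I * ν * u1 x - G x) * conj (u x)).im := by
      have : |om1 x * ((Complex.I * ν * u1 x - G x) * conj (u x)).im| ≤ (La * om x) * ((ν * ‖u1 x‖ + ‖G x‖) * ‖u x‖) := by
        rw [abs_mul]
        exact mul_le_mul hL b1 (abs_nonneg _) ((abs_nonneg _).trans hL)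
      have := neg_le_of_abs_le this
      linarith
    generalize ‖u x‖ = a at *
    generalize ‖u1 x‖ = b at *
    generalize ‖G x‖ = g at *
    generalize ‖h x‖ = H at *
    have d1 : La * (ν * b + g) * a ≤ ν * b ^ 2 / 2 + g ^ 2 / (2 * ν) + ci / 4 * a ^ 2 := by
      have t1 : La * (ν * b) * a ≤ ν * b ^ 2 / 2 + ν * La ^ 2 * a ^ 2 / 2 := by
        nlinarith [mul_nonneg hν.le (sq_nonneg (b - La * a))]
      have t2 : La * g * a ≤ g ^ 2 / (2 * ν) + ν * La ^ 2 * a ^ 2 / 2 := by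
        have : 0 ≤ (g - ν * La * a) ^ 2 / (2 * ν) := by positivity
        have e : (g - ν * La * a) ^ 2 / (2 * ν) = g ^ 2 / (2 * ν) + ν * La ^ 2 * a ^ 2 / 2 - La * g * a := by
          field_simp; ring
        linarith
      nlinarith [mul_le_mul_of_nonneg_right hLa (sq_nonneg a)]
    have d2 : H * a ≤ ci / 4 * a ^ 2 + 1 / ci * H ^ 2 := by
      have : 0 ≤ (ci * a - 2 * H) ^ 2 / (4 * ci) := by positivity
      have e : (ci * a - 2 * H) ^ 2 / (4 * ci) = ci / 4 * a ^ 2 + 1 / ci * H ^ 2 - H * a := by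
        field_simp; ring
      linarith
    have d3 : g * b ≤ ν * b ^ 2 / 2 + g ^ 2 / (2 * ν) := by
      have : 0 ≤ (g - ν * b) ^ 2 / (2 * ν) := by positivity
      have e : (g - ν * b) ^ 2 / (2 * ν) = ν * b ^ 2 / 2 + g ^ 2 / (2 * ν) - g * b := by
        field_simp; ring
      linarith
    have d4 : 0 ≤ ν * α2 * a ^ 2 := by positivity
    have gg : g ^ 2 / (2 * ν) + g ^ 2 / (2 * ν) = 1 / ν * g ^ 2 := by field_simp; norm_num
    have := abs_le.1 b2
    have := abs_le.1 b3
    rw [e2]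
    have fin : 0 ≤ om x * ((h x * conj (u x)).im + ci * a ^ 2 + ν * α2 * a ^ 2 + ν * b ^ 2
          - (G x * conj (u1 x)).im - La * (ν * b + g) * a - ci / 2 * a ^ 2 + 1 / ν * g ^ 2 + 1 / ci * H ^ 2) := by
      apply mul_nonneg hO
      linarith
    linarith
  have cc : ∀ f : ℝ → ℂ, Continuous f → IntervalIntegrable (fun x => om x * ‖f x‖ ^ 2) volume 0 1 := by
    intro f hf
    exact (by fun_prop : Continuous _).intervalIntegrable _ _
  have iG := cc G cG
  have ih := cc h ch
  have iu := cc u cu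
  have iΦ : IntervalIntegrable (fun x => (Φ1 x).im) volume 0 1 :=
    (Complex.continuous_im.comp cΦ1).intervalIntegrable _ _
  have I := intervalIntegral.integral_mono_on zero_le_one (iu.const_mul (ci / 2))
    (iΦ.add ((iG.const_mul (1 / ν)).add (ih.const_mul (1 / ci)))) key
  rw [intervalIntegral.integral_add iΦ ((iG.const_mul (1 / ν)).add (ih.const_mul (1 / ci))),
    intervalIntegral.integral_add (iG.const_mul (1 / ν)) (ih.const_mul (1 / ci)), hint] at I
  simp only [intervalIntegral.integral_const_mul] at I
  generalize (∫ x in (0:ℝ)..1, om x * ‖u x‖ ^ 2) = X at *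
  generalize (∫ x in (0:ℝ)..1, om x * ‖G x‖ ^ 2) = Y at *
  generalize (∫ x in (0:ℝ)..1, om x * ‖h x‖ ^ 2) = Z at *
  have : 2 / (ν * ci) * Y + 2 / ci ^ 2 * Z = 2 / ci * (0 + (1 / ν * Y + 1 / ci * Z)) := by
    field_simp; ring
  rw [this]
  calc X = 2 / ci * (ci / 2 * X) := by field_simp
    _ ≤ _ := by gcongr

/-- Cauchy–Schwarz on an interval for continuous real functions. -/
lemma cs_int {a b : ℝ} (hab : a ≤ b) {f g : ℝ → ℝ} (hf : ContinuousOn f (Icc a b)) (hg : ContinuousOn g (Icc a b)) :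
    (∫ x in a..b, f x * g x) ^ 2 ≤ (∫ x in a..b, f x ^ 2) * ∫ x in a..b, g x ^ 2 := by
  rw [← uIcc_of_le hab] at hf hg
  have i1 : IntervalIntegrable (fun x => f x ^ 2) volume a b := (hf.pow 2).intervalIntegrable
  have i2 : IntervalIntegrable (fun x => g x ^ 2) volume a b := (hg.pow 2).intervalIntegrable
  have i3 : IntervalIntegrable (fun x => f x * g x) volume a b := (hf.mul hg).intervalIntegrable
  have h : ∀ t : ℝ, 0 ≤ (∫ x in a..b, g x ^ 2) * (t * t) + (2 * ∫ x in a..b, f x * g x) * t + ∫ x in a..b, f x ^ 2 := by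
    intro t
    have : 0 ≤ ∫ x in a..b, (f x + t * g x) ^ 2 := intervalIntegral.integral_nonneg hab fun x _ => sq_nonneg _
    have e : (fun x => (f x + t * g x) ^ 2) = fun x => f x ^ 2 + ((2 * t) * (f x * g x) + t ^ 2 * g x ^ 2) := by
      ext x; ring
    rw [e, intervalIntegral.integral_add i1 ((i3.const_mul _).add (i2.const_mul _)),
      intervalIntegral.integral_add (i3.const_mul _) (i2.const_mul _)] at this
    simp only [intervalIntegral.integral_const_mul] at this
    linarith
  have := discrim_le_zero h
  unfold discrim at this
  nlinarith

end OS

end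

noncomputable section
open Filter Topology MeasureTheory Set ComplexConjugate
namespace OS

/-- The (shifted) profile in the variable `x = 1 - z`, with centre `0` and wall `1`. -/
structure Prof where
  V : ℝ → ℝ
  V1 : ℝ → ℝ
  V2 : ℝ → ℝ
  V3 : ℝ → ℝ
  V4 : ℝ → ℝ
  a : ℝ
  dV : ∀ x, HasDerivAt V (V1 x) x
  dV1 : ∀ x, HasDerivAt V1 (V2 x) x
  dV2 : ∀ x, HasDerivAt V2 (V3 x) x
  dV3 : ∀ x, HasDerivAt V3 (V4 x) x
  cV4 : Continuous V4
  a_pos : 0 < a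
  V10 : V1 0 = 0
  V30 : V3 0 = 0
  V01 : V 1 = 0
  V11 : V1 1 = -a
  an : AnalyticOnNhd ℝ V (Icc 0 1)

lemma cont_of_deriv {E : Type*} [NormedAddCommGroup E] [NormedSpace ℝ E] {f f' : ℝ → E}
    (h : ∀ x, HasDerivAt f (f' x) x) : Continuous f :=
  continuous_iff_continuousAt.2 fun x => (h x).continuousAt

namespace Prof
variable (P : Prof)
@[fun_prop] lemma cV : Continuous P.V := cont_of_deriv P.dV
@[fun_prop] lemma cV1 : Continuous P.V1 := cont_of_deriv P.dV1
@[fun_prop] lemma cV2 : Continuous P.V2 := cont_of_deriv P.dV2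
@[fun_prop] lemma cV3 : Continuous P.V3 := cont_of_deriv P.dV3
@[fun_prop] lemma cV4' : Continuous P.V4 := P.cV4

/-- `d = V - c` -/
def d (c : ℂ) (x : ℝ) : ℂ := (P.V x : ℂ) - c

lemma dd (c : ℂ) (x : ℝ) : HasDerivAt (P.d c) (P.V1 x : ℂ) x :=
  ((P.dV x).ofReal_comp).sub_const c

@[fun_prop] lemma cd (c : ℂ) : Continuous (P.d c) := cont_of_deriv (P.dd c)

lemma d_im (c : ℂ) (x : ℝ) : (P.d c x).im = -c.im := by simp [d]

lemma d_ne {c : ℂ} (hc : 0 < c.im) (x : ℝ) : P.d c x ≠ 0 := by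
  intro h
  have := P.d_im c x
  rw [h] at this
  simp at this
  linarith

/-- The Orr-Sommerfeld coefficient functions. -/
def cA (ν α2 : ℝ) (c : ℂ) (x : ℝ) : ℂ := 2 * α2 + Complex.I / ν * P.d c x
def cB (ν α2 : ℝ) (c : ℂ) (x : ℝ) : ℂ := -(α2:ℂ) ^ 2 - Complex.I / ν * (α2 * P.d c x + P.V2 x)

end Prof

/-- Data extracted from an even solution of Orr–Sommerfeld. -/
structure Mode (P : Prof) (ν α2 : ℝ) (c : ℂ) (f f1 f2 q rh rh1 rh2 : ℝ → ℂ) : Prop where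
  df : ∀ x, HasDerivAt f (f1 x) x
  df1 : ∀ x, HasDerivAt f1 (f2 x) x
  cf2 : Continuous f2
  hq : ∀ x, q x = P.d c x ^ 2 * f1 x
  dq : ∀ x, HasDerivAt q (P.d c x * (rh x + α2 * (P.d c x * f x))) x
  drh : ∀ x, HasDerivAt rh (rh1 x) x
  drh1 : ∀ x, HasDerivAt rh1 (rh2 x) x
  crh2 : Continuous rh2
  eq : ∀ x ∈ Icc (0:ℝ) 1, P.d c x * rh x + Complex.I * ν * (rh2 x - α2 * rh x) =
    -(Complex.I * ν * (P.V4 x * f x + 2 * P.V3 x * f1 x + P.V2 x * f2 x - α2 * (P.V2 x * f x)))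
  f10 : f1 0 = 0
  rh10 : rh1 0 = 0
  q0 : q 0 = 0

theorem mode_of_sol (P : Prof) {ν α2 : ℝ} {c : ℂ} (hν : 0 < ν) (hc : 0 < c.im) {φ φ1 ψ ψ1 h : ℝ → ℂ}
    (hs : EvenSol (P.cA ν α2 c) (P.cB ν α2 c) φ φ1 ψ ψ1 h) :
    ∃ f f1 f2 q rh rh1 rh2 : ℝ → ℂ, Mode P ν α2 c f f1 f2 q rh rh1 rh2 ∧ (∀ x, φ x = P.d c x * f x) ∧
      (∀ x, q x = P.d c x * φ1 x - P.V1 x * φ x) := by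
  have hd := P.d_ne hc
  have cφ : Continuous φ := cont_of_deriv hs.d0
  have cφ1 : Continuous φ1 := cont_of_deriv hs.d1
  have cψ : Continuous ψ := cont_of_deriv hs.d2
  have cψ1 : Continuous ψ1 := cont_of_deriv hs.d3
  have ch := hs.hc
  let f : ℝ → ℂ := fun x => φ x / P.d c x
  let q : ℝ → ℂ := fun x => P.d c x * φ1 x - P.V1 x * φ x
  let f1 : ℝ → ℂ := fun x => q x / P.d c x ^ 2
  let q1 : ℝ → ℂ := fun x => P.d c x * ψ x - P.V2 x * φ x
  let f2 : ℝ → ℂ := fun x => (q1 x * P.d c x ^ 2 - q x * (2 * P.d c x * P.V1 x)) / (P.d c x ^ 2) ^ 2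
  let rh : ℝ → ℂ := fun x => ψ x - α2 * φ x - P.V2 x * f x
  let rh1 : ℝ → ℂ := fun x => ψ1 x - α2 * φ1 x - (P.V3 x * f x + P.V2 x * f1 x)
  let rh2 : ℝ → ℂ := fun x => h x - α2 * ψ x - ((P.V4 x * f x + P.V3 x * f1 x) + (P.V3 x * f1 x + P.V2 x * f2 x))
  have dV1c : ∀ x, HasDerivAt (fun x => (P.V1 x : ℂ)) (P.V2 x : ℂ) x := fun x => (P.dV1 x).ofReal_comp
  have dV2c : ∀ x, HasDerivAt (fun x => (P.V2 x : ℂ)) (P.V3 x : ℂ) x := fun x => (P.dV2 x).ofReal_comp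
  have dV3c : ∀ x, HasDerivAt (fun x => (P.V3 x : ℂ)) (P.V4 x : ℂ) x := fun x => (P.dV3 x).ofReal_comp
  have dq : ∀ x, HasDerivAt q (q1 x) x := by
    intro x
    refine (((P.dd c x).mul (hs.d1 x)).sub ((dV1c x).mul (hs.d0 x))).congr_deriv ?_
    simp only [q1]; ring
  have df : ∀ x, HasDerivAt f (f1 x) x := by
    intro x
    refine ((hs.d0 x).div (P.dd c x) (hd x)).congr_deriv ?_
    simp only [f1, q]; ring
  have df1 : ∀ x, HasDerivAt f1 (f2 x) x := by
    intro x
    have := (dq x).div ((P.dd c x).pow 2) (pow_ne_zero 2 (hd x))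
    refine this.congr_deriv ?_
    simp only [f2]; norm_num
  have cq : Continuous q := cont_of_deriv dq
  have cf : Continuous f := cont_of_deriv df
  have cf1 : Continuous f1 := cont_of_deriv df1
  have cq1 : Continuous q1 := by fun_prop
  have cf2 : Continuous f2 := by
    refine Continuous.div (by fun_prop) (by fun_prop) fun x => pow_ne_zero _ (pow_ne_zero _ (hd x))
  have hφf : ∀ x, φ x = P.d c x * f x := fun x => (mul_div_cancel₀ _ (hd x)).symm
  refine ⟨f, f1, f2, q, rh, rh1, rh2, ⟨df, df1, cf2, ?_, ?_, ?_, ?_, ?_, ?_, ?_, ?_, ?_⟩, hφf, fun x => rfl⟩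
  · intro x
    exact (mul_div_cancel₀ _ (pow_ne_zero 2 (hd x))).symm
  · intro x
    refine (dq x).congr_deriv ?_
    simp only [q1, rh]
    rw [← hφf x]
    have : (P.V2 x : ℂ) * φ x = P.d c x * (P.V2 x * f x) := by rw [hφf x]; ring
    rw [this]; ring
  · intro x
    exact ((hs.d2 x).sub ((hs.d0 x).const_mul _)).sub ((dV2c x).mul (df x))
  · intro x
    exact ((hs.d3 x).sub ((hs.d1 x).const_mul _)).sub (((dV3c x).mul (df x)).add ((dV2c x).mul (df1 x)))
  · fun_prop
  · intro x hx
    have e := hs.eq x hx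
    have hν' : (ν : ℂ) ≠ 0 := by exact_mod_cast hν.ne'
    have e' : Complex.I * ν * h x = Complex.I * ν * (2 * α2 * ψ x - (α2:ℂ) ^ 2 * φ x)
        - P.d c x * ψ x + (α2 * P.d c x + P.V2 x) * φ x := by
      rw [e]
      simp only [Prof.cA, Prof.cB]
      field_simp
      ring_nf
      rw [Complex.I_sq]
      ring
    simp only [rh, rh2]
    linear_combination e' + (P.V2 x : ℂ) * (hφf x)
  · simp [f1, q, hs.z1, P.V10]
  · simp [rh1, f1, q, hs.z1, hs.z3, P.V10, P.V30]
  · simp [q, hs.z1, P.V10]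

end OS

end

noncomputable section
open Filter Topology MeasureTheory Set ComplexConjugate
namespace OS

lemma gron {G : ℝ → ℝ} (hG : Continuous G) {a0 L : ℝ} (hL : 0 ≤ L) (ha0 : 0 ≤ a0)
    (h : ∀ x ∈ Icc (0:ℝ) 1, G x ≤ a0 + L * ∫ t in (0:ℝ)..x, G t) :
    ∀ x ∈ Icc (0:ℝ) 1, G x ≤ a0 * Real.exp L := by
  have dI : ∀ x, HasDerivAt (fun x => ∫ t in (0:ℝ)..x, G t) (G x) x := fun x =>
    intervalIntegral.integral_hasDerivAt_right (hG.intervalIntegrable _ _)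
      (hG.stronglyMeasurableAtFilter _ _) hG.continuousAt
  let F : ℝ → ℝ := fun x => (a0 + L * ∫ t in (0:ℝ)..x, G t) * Real.exp (-(L * x))
  have dF : ∀ x, HasDerivAt F (L * (G x - (a0 + L * ∫ t in (0:ℝ)..x, G t)) * Real.exp (-(L * x))) x := by
    intro x
    have h1 := ((dI x).const_mul L).const_add a0
    have h2 : HasDerivAt (fun x => Real.exp (-(L * x))) (Real.exp (-(L * x)) * (-(L * 1))) x :=
      (((hasDerivAt_id x).const_mul L).neg).exp
    refine (h1.mul h2).congr_deriv ?_
    ring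
  have anti : AntitoneOn F (Icc 0 1) := by
    refine antitoneOn_of_deriv_nonpos (convex_Icc _ _) (cont_of_deriv dF).continuousOn
      (fun x _ => (dF x).differentiableAt.differentiableWithinAt) ?_
    intro x hx
    rw [interior_Icc] at hx
    rw [(dF x).deriv]
    have := h x (Ioo_subset_Icc_self hx)
    exact mul_nonpos_of_nonpos_of_nonneg (mul_nonpos_of_nonneg_of_nonpos hL (by linarith)) (Real.exp_pos _).le
  intro x hx
  have h1 : F x ≤ F 0 := anti (by simp) hx hx.1
  simp only [F, intervalIntegral.integral_same, mul_zero, add_zero, neg_zero, Real.exp_zero, mul_one] at h1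
  have h2 : (a0 + L * ∫ t in (0:ℝ)..x, G t) ≤ a0 * Real.exp (L * x) := by
    rw [Real.exp_neg, ← div_eq_mul_inv, div_le_iff₀ (Real.exp_pos _)] at h1
    exact h1
  refine (h x hx).trans (h2.trans ?_)
  gcongr
  nlinarith [hx.2]

lemma int_mono_right {g : ℝ → ℝ} (hg : Continuous g) (h0 : ∀ x ∈ Icc (0:ℝ) 1, 0 ≤ g x) {x y : ℝ}
    (hx : 0 ≤ x) (hxy : x ≤ y) (hy : y ≤ 1) : ∫ t in (0:ℝ)..x, g t ≤ ∫ t in (0:ℝ)..y, g t := by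
  rw [← intervalIntegral.integral_add_adjacent_intervals (hg.intervalIntegrable 0 x) (hg.intervalIntegrable x y)]
  have : 0 ≤ ∫ t in x..y, g t := intervalIntegral.integral_nonneg hxy fun t ht => h0 t ⟨hx.trans ht.1, ht.2.trans hy⟩
  linarith

lemma int_nonneg' {g : ℝ → ℝ} {x : ℝ} (h0 : ∀ x ∈ Icc (0:ℝ) 1, 0 ≤ g x)
    (hx : x ∈ Icc (0:ℝ) 1) : 0 ≤ ∫ t in (0:ℝ)..x, g t :=
  intervalIntegral.integral_nonneg hx.1 fun t ht => h0 t ⟨ht.1, ht.2.trans hx.2⟩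

lemma int_mono' {f g : ℝ → ℝ} (hf : Continuous f) (hg : Continuous g) {x : ℝ} (hx : x ∈ Icc (0:ℝ) 1)
    (h0 : ∀ t ∈ Icc (0:ℝ) x, f t ≤ g t) : ∫ t in (0:ℝ)..x, f t ≤ ∫ t in (0:ℝ)..x, g t :=
  intervalIntegral.integral_mono_on hx.1 (hf.intervalIntegrable _ _) (hg.intervalIntegrable _ _) h0

def w2 (P : Prof) (μ x : ℝ) : ℝ := P.V x ^ 2 + μ ^ 2
def ee (k : ℕ) (μ x : ℝ) : ℝ := x ^ (2 * k) + μ ^ 2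
def ps (μ x : ℝ) : ℝ := μ ^ 2 / ((1 - x) ^ 2 + μ ^ 2)

/-- Profile hypotheses at scale μ. Here `m = μ^p`, `σ² / μ² = μ^{-P}`. -/
structure VH (P : Prof) (k : ℕ) (K μ m σ : ℝ) : Prop where
  hK : 1 ≤ K
  μ0 : 0 < μ
  μ1 : μ ≤ 1
  m0 : 0 < m
  mμ : m ≤ μ
  σ0 : 0 < σ
  bV : ∀ x ∈ Icc (0:ℝ) 1, |P.V x| ≤ K
  bV1 : ∀ x ∈ Icc (0:ℝ) 1, |P.V1 x| ≤ K
  bV2 : ∀ x ∈ Icc (0:ℝ) 1, |P.V2 x| ≤ K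
  bV3 : ∀ x ∈ Icc (0:ℝ) 1, |P.V3 x| ≤ K
  bV4 : ∀ x ∈ Icc (0:ℝ) 1, |P.V4 x| ≤ K
  H1 : ∫ x in (0:ℝ)..1, 1 / w2 P μ x ≤ K * σ ^ 2 / μ ^ 2
  H2 : ∫ x in (0:ℝ)..1, ee k μ x / w2 P μ x ≤ K / m
  H3 : ∫ x in (0:ℝ)..1, ps μ x / w2 P μ x ≤ K / μ
  H4 : ∫ x in (0:ℝ)..1, (1 - x) * ps μ x / w2 P μ x ≤ K
  H5 : ∀ x ∈ Icc (0:ℝ) 1, w2 P μ x ≤ K * ee k μ x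
  H6 : ∀ x ∈ Icc (0:ℝ) 1, ps μ x ≤ K * ee k μ x

/-- Parameter hypotheses. -/
structure PH (k : ℕ) (K M μ m ν α2 : ℝ) (c : ℂ) : Prop where
  hM : 1 ≤ M
  cM : ‖c‖ ≤ M * μ
  ci : μ ≤ M * c.im
  ν0 : 0 < ν
  νM : ν ≤ M * m * μ ^ 2
  α0 : 0 ≤ α2
  αM : α2 ≤ M * m
  La : ν * ((K + 2 * k) / μ) ^ 2 ≤ c.im / 4

/-- The wall-layer function `S`. -/
structure SH (P : Prof) (M μ ν α2 : ℝ) (c : ℂ) (S S1 S2 qS : ℝ → ℂ) : Prop where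
  dS : ∀ x, HasDerivAt S (S1 x) x
  dS1 : ∀ x, HasDerivAt S1 (S2 x) x
  cS2 : Continuous S2
  eq : ∀ x ∈ Icc (0:ℝ) 1, P.d c x * S x + Complex.I * ν * (S2 x - α2 * S x) = 0
  S10 : S1 0 = 0
  S01 : S 1 = 1
  dq : ∀ x, HasDerivAt qS (P.d c x * S x) x
  q0 : qS 0 = 0
  qb : ∀ x ∈ Icc (0:ℝ) 1, ‖qS x‖ ≤ M * ps μ x * ‖qS 1‖

structure Setup (P : Prof) (k : ℕ) (K M μ m σ ν α2 : ℝ) (c : ℂ) (S S1 S2 qS f f1 f2 q rh rh1 rh2 : ℝ → ℂ) : Prop where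
  vh : VH P k K μ m σ
  ph : PH k K M μ m ν α2 c
  sh : SH P M μ ν α2 c S S1 S2 qS
  mo : Mode P ν α2 c f f1 f2 q rh rh1 rh2
  q1 : q 1 = 0

section
variable {P : Prof} {k : ℕ} {K M μ m σ ν α2 : ℝ} {c : ℂ}

lemma PH.im_pos (hv : VH P k K μ m σ) (hp : PH k K M μ m ν α2 c) : 0 < c.im := by
  have := hp.ci
  have := hv.μ0
  by_contra h
  push Not at h
  nlinarith [hp.hM]

@[fun_prop] lemma cont_w2 : Continuous (w2 P μ) := by unfold w2; fun_prop
@[fun_prop] lemma cont_ee : Continuous (ee k μ) := by unfold ee; fun_prop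
lemma w2_pos (hμ : 0 < μ) (x : ℝ) : 0 < w2 P μ x := by unfold w2; positivity
lemma ee_pos (hμ : 0 < μ) (x : ℝ) : 0 < ee k μ x := by
  unfold ee
  have : 0 ≤ x ^ (2 * k) := by rw [pow_mul]; positivity
  positivity
lemma ps_pos (hμ : 0 < μ) (x : ℝ) : 0 < ps μ x := by unfold ps; positivity
lemma cont_ps (hμ : 0 < μ) : Continuous (ps μ) := by
  unfold ps
  exact Continuous.div (by fun_prop) (by fun_prop) fun x => by positivity
lemma ee_mono {x y : ℝ} (hx : 0 ≤ x) (hxy : x ≤ y) : ee k μ x ≤ ee k μ y := by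
  unfold ee; gcongr
lemma ee_one (hv : VH P k K μ m σ) : ee k μ 1 ≤ 2 := by
  unfold ee; nlinarith [hv.μ0, hv.μ1, one_pow (M := ℝ) (2 * k)]
lemma ee_ge (x : ℝ) : μ ^ 2 ≤ ee k μ x := by
  unfold ee
  have : 0 ≤ x ^ (2 * k) := by rw [pow_mul]; positivity
  linarith

lemma w2_le (hv : VH P k K μ m σ) (hp : PH k K M μ m ν α2 c) (x : ℝ) :
    w2 P μ x ≤ 5 * M ^ 4 * ‖P.d c x‖ ^ 2 := by
  have him := PH.im_pos hv hp
  have hM := hp.hM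
  have hci := hp.ci
  have hcM := hp.cM
  have hμ := hv.μ0
  have e1 : P.V x ^ 2 ≤ 2 * ‖P.d c x‖ ^ 2 + 2 * ‖c‖ ^ 2 := by
    have : ‖(P.V x : ℂ)‖ ≤ ‖P.d c x‖ + ‖c‖ := by
      have := norm_add_le (P.d c x) c
      simpa [Prof.d] using this
    rw [Complex.norm_real, Real.norm_eq_abs] at this
    rw [← sq_abs]
    nlinarith [abs_nonneg (P.V x), sq_nonneg (‖P.d c x‖ - ‖c‖)]
  have e2 : c.im ^ 2 ≤ ‖P.d c x‖ ^ 2 := by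
    have := Complex.abs_im_le_norm (P.d c x)
    rw [P.d_im, abs_neg] at this
    rw [← sq_abs]; gcongr
  have e3 : μ ^ 2 ≤ M ^ 2 * ‖P.d c x‖ ^ 2 := by
    calc μ ^ 2 ≤ (M * c.im) ^ 2 := by gcongr
      _ = M ^ 2 * c.im ^ 2 := by ring
      _ ≤ _ := by gcongr
  have e4 : ‖c‖ ^ 2 ≤ M ^ 2 * μ ^ 2 := by
    calc ‖c‖ ^ 2 ≤ (M * μ) ^ 2 := by gcongr
      _ = _ := by ring
  have M2 : 1 ≤ M ^ 2 := one_le_pow₀ hM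
  have e5 : M ^ 2 * μ ^ 2 ≤ M ^ 4 * ‖P.d c x‖ ^ 2 := by
    calc _ ≤ M ^ 2 * (M ^ 2 * ‖P.d c x‖ ^ 2) := by gcongr
      _ = _ := by ring
  have e6 : 1 * ‖P.d c x‖ ^ 2 ≤ M ^ 4 * ‖P.d c x‖ ^ 2 := by gcongr; exact one_le_pow₀ hM
  have e7 : μ ^ 2 ≤ M ^ 2 * μ ^ 2 := by nlinarith [sq_nonneg μ]
  unfold w2
  linarith

lemma d_le (hv : VH P k K μ m σ) (hp : PH k K M μ m ν α2 c) (x : ℝ) :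
    ‖P.d c x‖ ^ 2 ≤ 5 * M ^ 4 * w2 P μ x := by
  have hM := hp.hM
  have hcM := hp.cM
  have hμ := hv.μ0
  have e1 : ‖P.d c x‖ ≤ |P.V x| + ‖c‖ := by
    have := norm_sub_le (P.V x : ℂ) c
    simpa [Prof.d] using this
  have e2 : ‖P.d c x‖ ^ 2 ≤ 2 * P.V x ^ 2 + 2 * ‖c‖ ^ 2 := by
    rw [← sq_abs (P.V x)]
    nlinarith [norm_nonneg (P.d c x), sq_nonneg (|P.V x| - ‖c‖)]
  have e4 : ‖c‖ ^ 2 ≤ M ^ 2 * μ ^ 2 := by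
    calc ‖c‖ ^ 2 ≤ (M * μ) ^ 2 := by gcongr
      _ = _ := by ring
  have M2 : 1 ≤ M ^ 2 := one_le_pow₀ hM
  have M4 : M ^ 2 ≤ M ^ 4 := pow_le_pow_right₀ hM (by norm_num)
  have := sq_nonneg (P.V x)
  have := sq_nonneg μ
  unfold w2
  nlinarith [mul_nonneg (sub_nonneg.2 (M2.trans M4)) (sq_nonneg (P.V x)), mul_nonneg (sub_nonneg.2 M4) (sq_nonneg μ)]

/-- the weight `om = w2 / e^2` -/
def omg (P : Prof) (k : ℕ) (μ x : ℝ) : ℝ := w2 P μ x / ee k μ x ^ 2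
def omg1 (P : Prof) (k : ℕ) (μ x : ℝ) : ℝ :=
  (2 * P.V x * P.V1 x * ee k μ x ^ 2 - w2 P μ x * (2 * ee k μ x * ((2 * k : ℕ) * x ^ (2 * k - 1)))) / (ee k μ x ^ 2) ^ 2

lemma omg_pos (hμ : 0 < μ) (x : ℝ) : 0 < omg P k μ x :=
  div_pos (w2_pos hμ x) (pow_pos (ee_pos hμ x) 2)

lemma domg (hμ : 0 < μ) (x : ℝ) : HasDerivAt (omg P k μ) (omg1 P k μ x) x := by
  have h1 : HasDerivAt (w2 P μ) (2 * P.V x * P.V1 x) x := by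
    refine (((P.dV x).pow 2).add_const (μ ^ 2)).congr_deriv ?_
    norm_num
  have h2 : HasDerivAt (ee k μ) ((2 * k : ℕ) * x ^ (2 * k - 1)) x :=
    (hasDerivAt_pow (2 * k) x).add_const (μ ^ 2)
  refine (h1.div (h2.pow 2) (pow_ne_zero 2 (ee_pos hμ x).ne')).congr_deriv ?_
  unfold omg1
  norm_num

lemma comg1 (hμ : 0 < μ) : Continuous (omg1 P k μ) := by
  unfold omg1
  exact Continuous.div (by fun_prop) (by fun_prop) fun x => pow_ne_zero _ (pow_ne_zero 2 (ee_pos hμ x).ne')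

lemma omg_slow (hv : VH P k K μ m σ) (x : ℝ) (hx : x ∈ Icc (0:ℝ) 1) :
    |omg1 P k μ x| ≤ (K + 2 * k) / μ * omg P k μ x := by
  have hμ := hv.μ0
  have he := ee_pos (k := k) hμ x
  have hw := w2_pos (P := P) hμ x
  set E := (2 * k : ℕ) * x ^ (2 * k - 1) with hE
  have hE0 : 0 ≤ E := by have := hx.1; positivity
  have b1 : E * μ ≤ k * ee k μ x := by
    rcases Nat.eq_zero_or_pos k with hk | hk
    · simp [hE, hk]
    · have : x ^ (2 * k - 1) ≤ x ^ k := pow_le_pow_of_le_one hx.1 hx.2 (by omega)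
      have h2 : 2 * (x ^ k * μ) ≤ ee k μ x := by
        unfold ee
        rw [mul_comm 2 k, pow_mul]
        nlinarith [sq_nonneg (x ^ k - μ)]
      calc E * μ ≤ ((2 * k : ℕ) * x ^ k) * μ := by rw [hE]; gcongr
        _ = k * (2 * (x ^ k * μ)) := by push_cast; ring
        _ ≤ _ := by gcongr
  have b2 : |2 * P.V x * P.V1 x| * μ ≤ K * w2 P μ x := by
    rw [abs_mul, abs_mul, abs_two]
    have := hv.bV1 x hx
    calc 2 * |P.V x| * |P.V1 x| * μ ≤ 2 * |P.V x| * K * μ := by gcongr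
      _ = K * (2 * |P.V x| * μ) := by ring
      _ ≤ _ := by
        unfold w2
        have := hv.hK
        gcongr
        rw [← sq_abs (P.V x)]
        nlinarith [sq_nonneg (|P.V x| - μ)]
  have e1 : omg1 P k μ x = (2 * P.V x * P.V1 x) / ee k μ x ^ 2 - 2 * w2 P μ x * E / ee k μ x ^ 3 := by
    unfold omg1
    field_simp
    ring
  rw [e1, div_mul_eq_mul_div, le_div_iff₀ hμ]
  calc |2 * P.V x * P.V1 x / ee k μ x ^ 2 - 2 * w2 P μ x * E / ee k μ x ^ 3| * μ
      ≤ (|2 * P.V x * P.V1 x| / ee k μ x ^ 2 + 2 * w2 P μ x * E / ee k μ x ^ 3) * μ := by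
        gcongr
        refine (abs_sub _ _).trans ?_
        rw [abs_div, abs_of_pos (pow_pos he 2), abs_of_nonneg (by positivity : 0 ≤ 2 * w2 P μ x * E / ee k μ x ^ 3)]
    _ = (|2 * P.V x * P.V1 x| * μ) / ee k μ x ^ 2 + 2 * w2 P μ x * (E * μ) / ee k μ x ^ 3 := by ring
    _ ≤ (K * w2 P μ x) / ee k μ x ^ 2 + 2 * w2 P μ x * (k * ee k μ x) / ee k μ x ^ 3 := by gcongr
    _ = _ := by unfold omg; field_simp
end

end OS

end

noncomputable section
open Filter Topology MeasureTheory Set ComplexConjugate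
namespace OS

lemma close_arith {C Qr N B F Q0 β m σ : ℝ} (hC : 1 ≤ C) (hQr : 0 ≤ Qr) (hN : 0 ≤ N) (hB : 0 ≤ B) (hF : 0 ≤ F)
    (hβ : 0 ≤ β) (hm : 0 < m) (hσ : 0 < σ) (hms : m ≤ 1 / (80 * C ^ 3)) (hσs : σ ≤ 1 / (80 * C ^ 3))
    (e0 : Q0 = Qr + m * (F + N)) (e1 : B ≤ C * Q0) (e2 : N ≤ C * B) (e3 : Qr ≤ C * σ * (Q0 + B + m * F))
    (e4 : F ≤ C * (β + (Qr + m * N) / m)) :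
    F ≤ 2 * C * β ∧ B ≤ 8 * C ^ 2 * (m * β) ∧ N ≤ 8 * C ^ 3 * (m * β) ∧ Qr ≤ 20 * C ^ 3 * (m * σ * β) := by
  have C2 : 1 ≤ C ^ 2 := one_le_pow₀ hC
  have C3 : 1 ≤ C ^ 3 := one_le_pow₀ hC
  have C23 : C ^ 2 ≤ C ^ 3 := pow_le_pow_right₀ hC (by norm_num)
  have C12 : C ≤ C ^ 2 := by nlinarith
  rw [le_div_iff₀ (by positivity)] at hms hσs
  have m3 : m * C ^ 3 ≤ 1 / 80 := by linarith
  have s3 : σ * C ^ 3 ≤ 1 / 80 := by linarith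
  have m2 : m * C ^ 2 ≤ 1 / 80 := le_trans (by gcongr) m3
  have s2 : σ * C ^ 2 ≤ 1 / 80 := le_trans (by gcongr) s3
  have hQ0 : 0 ≤ Q0 := by rw [e0]; positivity
  have n1 : N ≤ C ^ 2 * Q0 := by
    calc N ≤ C * (C * Q0) := e2.trans (by gcongr)
      _ = _ := by ring
  have q1 : Q0 ≤ 2 * (Qr + m * F) := by
    have : m * N ≤ 1 / 80 * Q0 := by
      calc m * N ≤ m * (C ^ 2 * Q0) := by gcongr
        _ = (m * C ^ 2) * Q0 := by ring
        _ ≤ _ := by gcongr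
    nlinarith
  have hmF : 0 ≤ m * F := by positivity
  have r1 : Qr ≤ 10 * C ^ 2 * σ * (m * F) := by
    have t : Qr ≤ C * σ * (4 * C * Qr + 5 * C * (m * F)) := by
      refine e3.trans (mul_le_mul_of_nonneg_left ?_ (by positivity))
      have u1 : Q0 ≤ C * Q0 := by nlinarith
      have u2 : m * F ≤ C * (m * F) := by nlinarith
      have u3 : C * Q0 ≤ C * (2 * (Qr + m * F)) := by gcongr
      nlinarith
    have t2 : C * σ * (4 * C * Qr + 5 * C * (m * F)) = 4 * (σ * C ^ 2) * Qr + 5 * C ^ 2 * σ * (m * F) := by ring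
    have t3 : (σ * C ^ 2) * Qr ≤ 1 / 80 * Qr := by gcongr
    have t4 : 0 ≤ C ^ 2 * σ * (m * F) := by positivity
    nlinarith
  have q2 : Q0 ≤ 4 * (m * F) := by
    have : 10 * C ^ 2 * σ * (m * F) ≤ 1 * (m * F) := by
      gcongr; linarith
    linarith
  have b1 : B ≤ 4 * C * (m * F) := by
    calc B ≤ C * (4 * (m * F)) := e1.trans (by gcongr)
      _ = _ := by ring
  have n2 : N ≤ 4 * C ^ 2 * (m * F) := by
    calc N ≤ C * (4 * C * (m * F)) := e2.trans (by gcongr)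
      _ = _ := by ring
  have f1 : F ≤ 2 * C * β := by
    have t : (Qr + m * N) / m ≤ 10 * C ^ 2 * σ * F + 4 * C ^ 2 * (m * F) := by
      rw [div_le_iff₀ hm]
      have : m * N ≤ m * (4 * C ^ 2 * (m * F)) := by gcongr
      nlinarith
    have t2 : F ≤ C * (β + (10 * C ^ 2 * σ * F + 4 * C ^ 2 * (m * F))) := e4.trans (by gcongr)
    have t3 : (σ * C ^ 3) * F ≤ 1 / 80 * F := by gcongr
    have t4 : (m * C ^ 3) * F ≤ 1 / 80 * F := by gcongr
    nlinarith
  have hCC : m * F ≤ m * (2 * C * β) := by gcongr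
  refine ⟨f1, ?_, ?_, ?_⟩
  · calc B ≤ 4 * C * (m * (2 * C * β)) := b1.trans (by gcongr)
      _ = _ := by ring
  · calc N ≤ 4 * C ^ 2 * (m * (2 * C * β)) := n2.trans (by gcongr)
      _ = _ := by ring
  · calc Qr ≤ 10 * C ^ 2 * σ * (m * (2 * C * β)) := r1.trans (by gcongr)
      _ = _ := by ring

section
variable {P : Prof} {k : ℕ} {K M μ m σ ν α2 : ℝ} {c : ℂ} {S S1 S2 qS f f1 f2 q rh rh1 rh2 : ℝ → ℂ}

/-- the wall part of `f` -/
def fSf (P : Prof) (c : ℂ) (b : ℂ) (qS : ℝ → ℂ) (x : ℝ) : ℂ := ∫ t in (0:ℝ)..x, b * qS t / P.d c t ^ 2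

namespace Setup
variable (h : Setup P k K M μ m σ ν α2 c S S1 S2 qS f f1 f2 q rh rh1 rh2)
include h

lemma im_pos : 0 < c.im := PH.im_pos h.vh h.ph
lemma dne (x : ℝ) : P.d c x ≠ 0 := P.d_ne h.im_pos x
lemma cf : Continuous f := cont_of_deriv h.mo.df
lemma cf1 : Continuous f1 := cont_of_deriv h.mo.df1
lemma cq : Continuous q := cont_of_deriv h.mo.dq
lemma crh : Continuous rh := cont_of_deriv h.mo.drh
lemma cS : Continuous S := cont_of_deriv h.sh.dS
lemma cqS : Continuous qS := cont_of_deriv h.sh.dq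
lemma cquot : Continuous fun t => rh 1 * qS t / P.d c t ^ 2 := by
  have := h.cqS
  exact Continuous.div (by fun_prop) (by fun_prop) fun x => pow_ne_zero 2 (h.dne x)
lemma dfS (x : ℝ) : HasDerivAt (fSf P c (rh 1) qS) (rh 1 * qS x / P.d c x ^ 2) x := int_hasDeriv h.cquot x
lemma cfS : Continuous (fSf P c (rh 1) qS) := cont_of_deriv h.dfS

lemma Kd : 1 ≤ 5 * M ^ 4 := by have := one_le_pow₀ h.ph.hM (n := 4); linarith

lemma inv_d (x : ℝ) : 1 / ‖P.d c x‖ ^ 2 ≤ 5 * M ^ 4 / w2 P μ x := by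
  have hd : 0 < ‖P.d c x‖ := norm_pos_iff.2 (h.dne x)
  rw [div_le_div_iff₀ (by positivity) (w2_pos h.vh.μ0 x), one_mul]
  exact w2_le h.vh h.ph x

lemma quot_le {x : ℝ} (hx : x ∈ Icc (0:ℝ) 1) : ‖rh 1 * qS x / P.d c x ^ 2‖ ≤
    5 * M ^ 5 * (‖rh 1‖ * ‖qS 1‖) * (ps μ x / w2 P μ x) := by
  rw [norm_div, norm_mul, norm_pow, div_eq_mul_one_div]
  have hM := h.ph.hM
  have := (ps_pos h.vh.μ0 x).le
  have := (w2_pos (P := P) h.vh.μ0 x).le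
  calc _ ≤ (‖rh 1‖ * (M * ps μ x * ‖qS 1‖)) * (5 * M ^ 4 / w2 P μ x) := by
        exact mul_le_mul (mul_le_mul_of_nonneg_left (h.sh.qb x hx) (norm_nonneg _)) (h.inv_d x) (by positivity) (by positivity)
    _ = _ := by ring

lemma cpw : Continuous fun x => ps μ x / w2 P μ x :=
  Continuous.div (cont_ps h.vh.μ0) (by fun_prop) fun x => (w2_pos h.vh.μ0 x).ne'

lemma fS_le {x : ℝ} (hx : x ∈ Icc (0:ℝ) 1) : ‖fSf P c (rh 1) qS x‖ ≤
    5 * M ^ 5 * (‖rh 1‖ * ‖qS 1‖) * ∫ t in (0:ℝ)..x, ps μ t / w2 P μ t := by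
  unfold fSf
  refine (intervalIntegral.norm_integral_le_integral_norm hx.1).trans ?_
  rw [← intervalIntegral.integral_const_mul]
  have := h.cpw
  exact int_mono' h.cquot.norm (by fun_prop) hx fun t ht => h.quot_le ⟨ht.1, ht.2.trans hx.2⟩

lemma pw_nonneg (x : ℝ) : 0 ≤ ps μ x / w2 P μ x :=
  div_nonneg (ps_pos h.vh.μ0 x).le (w2_pos h.vh.μ0 x).le

lemma fS_sup {x : ℝ} (hx : x ∈ Icc (0:ℝ) 1) : ‖fSf P c (rh 1) qS x‖ ≤
    5 * M ^ 5 * (‖rh 1‖ * ‖qS 1‖) * (K / μ) := by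
  have hM := h.ph.hM
  refine (h.fS_le hx).trans ?_
  gcongr
  exact (int_mono_right h.cpw (fun x _ => h.pw_nonneg x) hx.1 hx.2 le_rfl).trans h.vh.H3

lemma fS_L1 : ∫ x in (0:ℝ)..1, ‖fSf P c (rh 1) qS x‖ ≤ 5 * M ^ 5 * K * (‖rh 1‖ * ‖qS 1‖) := by
  have hM := h.ph.hM
  have c1 := h.cpw
  have h1 := int_mono' h.cfS.norm (g := fun x => 5 * M ^ 5 * (‖rh 1‖ * ‖qS 1‖) * ∫ t in (0:ℝ)..x, ps μ t / w2 P μ t)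
    (continuous_const.mul (int_cont c1)) (x := 1) (by simp) (fun t ht => h.fS_le ht)
  refine h1.trans ?_
  rw [intervalIntegral.integral_const_mul, ← double_int c1]
  have : (∫ t in (0:ℝ)..1, (1 - t) • (ps μ t / w2 P μ t)) ≤ K := by
    refine le_trans (le_of_eq ?_) h.vh.H4
    congr 1; ext t; simp [mul_div_assoc]
  calc _ ≤ 5 * M ^ 5 * (‖rh 1‖ * ‖qS 1‖) * K := by gcongr
    _ = _ := by ring

lemma cr : Continuous fun x => rh x - rh 1 * S x := by
  have := h.crh; have := h.cS; fun_prop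

lemma comg : Continuous (omg P k μ) := cont_of_deriv (domg h.vh.μ0)

lemma Ir_le {x : ℝ} (hx : x ∈ Icc (0:ℝ) 1) : ∫ t in (0:ℝ)..x, ‖P.d c t‖ * ‖rh t - rh 1 * S t‖ ≤
    5 * M ^ 4 * ee k μ x * √(∫ t in (0:ℝ)..1, omg P k μ t * ‖rh t - rh 1 * S t‖ ^ 2) := by
  have hμ := h.vh.μ0
  have cr := h.cr
  have co := h.comg
  have op := omg_pos (P := P) (k := k) hμ
  have hK := h.Kd
  have he := ee_pos (k := k) hμ x
  have so : ∀ t, 0 < √(omg P k μ t) := fun t => Real.sqrt_pos.2 (op t)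
  have cs := cs_int hx.1 (f := fun t => √(omg P k μ t) * ‖rh t - rh 1 * S t‖) (g := fun t => ‖P.d c t‖ / √(omg P k μ t))
    (by fun_prop) (Continuous.continuousOn (Continuous.div (by fun_prop) (by fun_prop) fun t => (so t).ne'))
  have e1 : (fun t => √(omg P k μ t) * ‖rh t - rh 1 * S t‖ * (‖P.d c t‖ / √(omg P k μ t))) =
      fun t => ‖P.d c t‖ * ‖rh t - rh 1 * S t‖ := by
    ext t; have := (so t).ne'; field_simp
  have e2 : (fun t => (√(omg P k μ t) * ‖rh t - rh 1 * S t‖) ^ 2) = fun t => omg P k μ t * ‖rh t - rh 1 * S t‖ ^ 2 := by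
    ext t; rw [mul_pow, Real.sq_sqrt (op t).le]
  have e3 : (fun t => (‖P.d c t‖ / √(omg P k μ t)) ^ 2) = fun t => ‖P.d c t‖ ^ 2 / omg P k μ t := by
    ext t; rw [div_pow, Real.sq_sqrt (op t).le]
  rw [e1, e2, e3] at cs
  have b1 : ∫ t in (0:ℝ)..x, ‖P.d c t‖ ^ 2 / omg P k μ t ≤ 5 * M ^ 4 * ee k μ x ^ 2 := by
    have := int_mono' (f := fun t => ‖P.d c t‖ ^ 2 / omg P k μ t) (g := fun t => 5 * M ^ 4 * ee k μ x ^ 2)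
      (Continuous.div (by fun_prop) (by fun_prop) fun t => (op t).ne') (by fun_prop) hx ?_
    · refine this.trans ?_
      rw [intervalIntegral.integral_const, smul_eq_mul]
      have : 0 ≤ 5 * M ^ 4 * ee k μ x ^ 2 := by positivity
      nlinarith [hx.2]
    · intro t ht
      rw [div_le_iff₀ (op t)]
      have h1 := d_le h.vh h.ph t
      have het := ee_pos (k := k) hμ t
      have hw := w2_pos (P := P) hμ t
      have h2 : ee k μ t ≤ ee k μ x := ee_mono ht.1 ht.2
      calc _ ≤ 5 * M ^ 4 * w2 P μ t := h1
        _ = 5 * M ^ 4 * ee k μ t ^ 2 * omg P k μ t := by unfold omg; field_simp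
        _ ≤ _ := by have := (op t).le; gcongr
  have b2 : ∫ t in (0:ℝ)..x, omg P k μ t * ‖rh t - rh 1 * S t‖ ^ 2 ≤ ∫ t in (0:ℝ)..1, omg P k μ t * ‖rh t - rh 1 * S t‖ ^ 2 :=
    int_mono_right (by fun_prop) (fun t _ => mul_nonneg (op t).le (sq_nonneg _)) hx.1 hx.2 le_rfl
  have n1 : 0 ≤ ∫ t in (0:ℝ)..1, omg P k μ t * ‖rh t - rh 1 * S t‖ ^ 2 :=
    int_nonneg' (fun t _ => mul_nonneg (op t).le (sq_nonneg _)) (by simp)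
  refine le_of_sq_le_sq ?_ (by positivity) 
  rw [mul_pow, Real.sq_sqrt n1]
  refine cs.trans ?_
  calc _ ≤ (∫ t in (0:ℝ)..1, omg P k μ t * ‖rh t - rh 1 * S t‖ ^ 2) * (5 * M ^ 4 * ee k μ x ^ 2) := by
        gcongr
        exact intervalIntegral.integral_nonneg hx.1 fun t _ => div_nonneg (sq_nonneg _) (op t).le
    _ = (5 * M ^ 4 * 1 * ee k μ x ^ 2) * (∫ t in (0:ℝ)..1, omg P k μ t * ‖rh t - rh 1 * S t‖ ^ 2) := by ring
    _ ≤ (5 * M ^ 4 * (5 * M ^ 4) * ee k μ x ^ 2) * (∫ t in (0:ℝ)..1, omg P k μ t * ‖rh t - rh 1 * S t‖ ^ 2) := by gcongr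
    _ = _ := by ring

lemma dq0 (x : ℝ) : HasDerivAt (fun x => q x - rh 1 * qS x)
    (P.d c x * (rh x - rh 1 * S x) + α2 * P.d c x ^ 2 * f x) x := by
  refine ((h.mo.dq x).sub ((h.sh.dq x).const_mul (rh 1))).congr_deriv ?_
  ring

lemma q0_int (x : ℝ) : q x - rh 1 * qS x =
    ∫ t in (0:ℝ)..x, (P.d c t * (rh t - rh 1 * S t) + α2 * P.d c t ^ 2 * f t) := by
  have c1 := h.cr
  have c2 := h.cf
  have := intervalIntegral.integral_eq_sub_of_hasDerivAt (a := 0) (b := x) (fun y _ => h.dq0 y)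
    ((by fun_prop : Continuous _).intervalIntegrable _ _)
  rw [this, h.mo.q0, h.sh.q0]; simp

lemma int_f_le {x : ℝ} (hx : x ∈ Icc (0:ℝ) 1) : ∫ t in (0:ℝ)..x, ‖f t‖ ≤
    (∫ t in (0:ℝ)..x, ‖f t - fSf P c (rh 1) qS t‖) + ∫ t in (0:ℝ)..1, ‖fSf P c (rh 1) qS t‖ := by
  have c1 := h.cf
  have c2 := h.cfS
  have h1 : ∫ t in (0:ℝ)..x, ‖f t‖ ≤ ∫ t in (0:ℝ)..x, (‖f t - fSf P c (rh 1) qS t‖ + ‖fSf P c (rh 1) qS t‖) :=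
    int_mono' c1.norm (by fun_prop) hx fun t _ => by
      have := norm_add_le (f t - fSf P c (rh 1) qS t) (fSf P c (rh 1) qS t)
      simpa using this
  rw [intervalIntegral.integral_add ((by fun_prop : Continuous _).intervalIntegrable _ _) ((by fun_prop : Continuous _).intervalIntegrable _ _)] at h1
  have h2 := int_mono_right c2.norm (fun t _ => norm_nonneg _) hx.1 hx.2 le_rfl
  linarith

lemma q0_le {x : ℝ} (hx : x ∈ Icc (0:ℝ) 1) : ‖q x - rh 1 * qS x‖ ≤
    5 * M ^ 5 * K * ee k μ x * (√(∫ t in (0:ℝ)..1, omg P k μ t * ‖rh t - rh 1 * S t‖ ^ 2) +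
      m * ((∫ t in (0:ℝ)..x, ‖f t - fSf P c (rh 1) qS t‖) + ∫ t in (0:ℝ)..1, ‖fSf P c (rh 1) qS t‖)) := by
  have hμ := h.vh.μ0
  have hM := h.ph.hM
  have hK := h.vh.hK
  have hm := h.vh.m0
  have he := ee_pos (k := k) hμ x
  have c1 := h.cr
  have c2 := h.cf
  set Qr := √(∫ t in (0:ℝ)..1, omg P k μ t * ‖rh t - rh 1 * S t‖ ^ 2)
  have hQr : 0 ≤ Qr := Real.sqrt_nonneg _
  rw [h.q0_int]
  refine (intervalIntegral.norm_integral_le_integral_norm hx.1).trans ?_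
  have h1 : ∫ t in (0:ℝ)..x, ‖P.d c t * (rh t - rh 1 * S t) + α2 * P.d c t ^ 2 * f t‖ ≤
      ∫ t in (0:ℝ)..x, (‖P.d c t‖ * ‖rh t - rh 1 * S t‖ + M * m * (5 * M ^ 4 * (K * ee k μ x)) * ‖f t‖) := by
    refine int_mono' (by fun_prop) (by fun_prop) hx fun t ht => ?_
    refine (norm_add_le _ _).trans ?_
    have ht' : t ∈ Icc (0:ℝ) 1 := ⟨ht.1, ht.2.trans hx.2⟩
    rw [norm_mul, norm_mul, norm_mul, norm_pow, Complex.norm_real, Real.norm_of_nonneg h.ph.α0]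
    have a1 := h.ph.αM
    have a2 : ‖P.d c t‖ ^ 2 ≤ 5 * M ^ 4 * (K * ee k μ x) := by
      refine (d_le h.vh h.ph t).trans ?_
      gcongr
      refine (h.vh.H5 t ht').trans ?_
      gcongr
      exact ee_mono ht.1 ht.2
    gcongr
  refine h1.trans ?_
  rw [intervalIntegral.integral_add ((by fun_prop : Continuous _).intervalIntegrable _ _) ((by fun_prop : Continuous _).intervalIntegrable _ _),
    intervalIntegral.integral_const_mul]
  have h2 := h.Ir_le hx
  have h3 := h.int_f_le hx
  have h4 : 5 * M ^ 4 * ee k μ x * Qr ≤ 5 * M ^ 5 * K * ee k μ x * Qr := by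
    have : 5 * M ^ 4 * 1 ≤ 5 * M ^ 5 * K := by
      have : M ^ 4 ≤ M ^ 5 := pow_le_pow_right₀ hM (by norm_num)
      gcongr
    rw [mul_one] at this
    gcongr
  calc _ ≤ 5 * M ^ 5 * K * ee k μ x * Qr + M * m * (5 * M ^ 4 * (K * ee k μ x)) *
      ((∫ t in (0:ℝ)..x, ‖f t - fSf P c (rh 1) qS t‖) + ∫ t in (0:ℝ)..1, ‖fSf P c (rh 1) qS t‖) := by
        refine add_le_add (h2.trans h4) ?_
        gcongr
    _ = _ := by ring

lemma df0 (x : ℝ) : HasDerivAt (fun x => f x - fSf P c (rh 1) qS x) ((q x - rh 1 * qS x) / P.d c x ^ 2) x := by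
  refine ((h.mo.df x).sub (h.dfS x)).congr_deriv ?_
  rw [h.mo.hq x, sub_div, mul_div_cancel_left₀ _ (pow_ne_zero 2 (h.dne x))]

lemma cq0d : Continuous fun x => (q x - rh 1 * qS x) / P.d c x ^ 2 := by
  have := h.cq; have := h.cqS
  exact Continuous.div (by fun_prop) (by fun_prop) fun x => pow_ne_zero 2 (h.dne x)

lemma f0_int (x : ℝ) : f x - fSf P c (rh 1) qS x = f 0 + ∫ t in (0:ℝ)..x, (q t - rh 1 * qS t) / P.d c t ^ 2 := by
  have := intervalIntegral.integral_eq_sub_of_hasDerivAt (a := 0) (b := x) (fun y _ => h.df0 y)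
    (h.cq0d.intervalIntegrable _ _)
  rw [this]; simp [fSf]

lemma f0_gron {x : ℝ} (hx : x ∈ Icc (0:ℝ) 1) : ‖f x - fSf P c (rh 1) qS x‖ ≤
    (‖f 0‖ + 25 * M ^ 9 * K ^ 2 * ((√(∫ t in (0:ℝ)..1, omg P k μ t * ‖rh t - rh 1 * S t‖ ^ 2) +
      m * ∫ t in (0:ℝ)..1, ‖fSf P c (rh 1) qS t‖) / m)) * Real.exp (25 * M ^ 9 * K ^ 2) := by
  have hμ := h.vh.μ0
  have hM := h.ph.hM
  have hK := h.vh.hK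
  have hm := h.vh.m0
  have c1 := h.cf
  have c2 := h.cfS
  set Qr := √(∫ t in (0:ℝ)..1, omg P k μ t * ‖rh t - rh 1 * S t‖ ^ 2)
  have hQr : 0 ≤ Qr := Real.sqrt_nonneg _
  set N := ∫ t in (0:ℝ)..1, ‖fSf P c (rh 1) qS t‖
  have hN : 0 ≤ N := int_nonneg' (fun t _ => norm_nonneg _) (by simp)
  refine gron (G := fun x => ‖f x - fSf P c (rh 1) qS x‖) (by fun_prop) (by positivity) (by positivity) ?_ x hx
  intro x hx
  set J := ∫ t in (0:ℝ)..x, ‖f t - fSf P c (rh 1) qS t‖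
  have hJ : 0 ≤ J := int_nonneg' (fun t _ => norm_nonneg _) hx
  have cew : Continuous fun t => ee k μ t / w2 P μ t :=
    Continuous.div (by fun_prop) (by fun_prop) fun t => (w2_pos hμ t).ne'
  rw [h.f0_int]
  refine (norm_add_le _ _).trans ?_
  have h1 : ‖∫ t in (0:ℝ)..x, (q t - rh 1 * qS t) / P.d c t ^ 2‖ ≤
      ∫ t in (0:ℝ)..x, (25 * M ^ 9 * K * (Qr + m * (J + N))) * (ee k μ t / w2 P μ t) := by
    refine (intervalIntegral.norm_integral_le_integral_norm hx.1).trans ?_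
    refine int_mono' h.cq0d.norm (by fun_prop) hx fun t ht => ?_
    have ht' : t ∈ Icc (0:ℝ) 1 := ⟨ht.1, ht.2.trans hx.2⟩
    rw [norm_div, norm_pow, div_eq_mul_one_div]
    have b1 := h.q0_le ht'
    have b2 := h.inv_d t
    have b3 : (∫ t in (0:ℝ)..t, ‖f t - fSf P c (rh 1) qS t‖) ≤ J :=
      int_mono_right (by fun_prop) (fun t _ => norm_nonneg _) ht.1 ht.2 hx.2
    have het := (ee_pos (k := k) hμ t).le
    have hw := (w2_pos (P := P) hμ t).le
    calc _ ≤ (5 * M ^ 5 * K * ee k μ t * (Qr + m * (J + N))) * (5 * M ^ 4 / w2 P μ t) := by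
          refine mul_le_mul (b1.trans ?_) b2 (by positivity) (by positivity)
          gcongr
      _ = _ := by ring
  rw [intervalIntegral.integral_const_mul] at h1
  have h2 : ∫ t in (0:ℝ)..x, ee k μ t / w2 P μ t ≤ K / m :=
    (int_mono_right cew (fun t _ => div_nonneg (ee_pos hμ t).le (w2_pos hμ t).le) hx.1 hx.2 le_rfl).trans h.vh.H2
  calc _ ≤ ‖f 0‖ + (25 * M ^ 9 * K * (Qr + m * (J + N))) * (K / m) := by
        gcongr
        exact h1.trans (by gcongr)
    _ = _ := by field_simp; ring

/-- sup norm constant -/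
lemma f1_le {F : ℝ} (hF : ∀ x ∈ Icc (0:ℝ) 1, ‖f x - fSf P c (rh 1) qS x‖ ≤ F) {x : ℝ} (hx : x ∈ Icc (0:ℝ) 1) :
    ‖f1 x‖ ≤ 25 * M ^ 9 * K * (ee k μ x / w2 P μ x) * ((√(∫ t in (0:ℝ)..1, omg P k μ t * ‖rh t - rh 1 * S t‖ ^ 2) +
      m * (F + ∫ t in (0:ℝ)..1, ‖fSf P c (rh 1) qS t‖)) + ‖rh 1‖ * ‖qS 1‖) := by
  have hμ := h.vh.μ0
  have hM := h.ph.hM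
  have hK := h.vh.hK
  have hm := h.vh.m0
  have c1 := h.cf
  have c2 := h.cfS
  have he := (ee_pos (k := k) hμ x).le
  have hw := (w2_pos (P := P) hμ x).le
  set Qr := √(∫ t in (0:ℝ)..1, omg P k μ t * ‖rh t - rh 1 * S t‖ ^ 2)
  have hQr : 0 ≤ Qr := Real.sqrt_nonneg _
  set N := ∫ t in (0:ℝ)..1, ‖fSf P c (rh 1) qS t‖
  have hN : 0 ≤ N := int_nonneg' (fun t _ => norm_nonneg _) (by simp)
  have hF0 : 0 ≤ F := (norm_nonneg _).trans (hF x hx)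
  have b1 : ∫ t in (0:ℝ)..x, ‖f t - fSf P c (rh 1) qS t‖ ≤ F := by
    have := int_mono' (f := fun t => ‖f t - fSf P c (rh 1) qS t‖) (g := fun _ => F) (by fun_prop) (by fun_prop) hx
      fun t ht => hF t ⟨ht.1, ht.2.trans hx.2⟩
    rw [intervalIntegral.integral_const, smul_eq_mul] at this
    nlinarith [hx.2]
  have b2 := h.q0_le hx
  have b3 := h.sh.qb x hx
  have b4 := h.vh.H6 x hx
  have b5 : ‖q x‖ ≤ 5 * M ^ 5 * K * ee k μ x * ((Qr + m * (F + N)) + ‖rh 1‖ * ‖qS 1‖) := by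
    have t1 : ‖q x‖ ≤ ‖q x - rh 1 * qS x‖ + ‖rh 1 * qS x‖ := by
      have := norm_add_le (q x - rh 1 * qS x) (rh 1 * qS x)
      simpa using this
    have t2 : ‖rh 1 * qS x‖ ≤ 5 * M ^ 5 * K * ee k μ x * (‖rh 1‖ * ‖qS 1‖) := by
      rw [norm_mul]
      have M5 : M * 1 ≤ M * (5 * M ^ 4) := by have := h.Kd; gcongr
      calc _ ≤ ‖rh 1‖ * (M * (K * ee k μ x) * ‖qS 1‖) := by
            gcongr
            exact b3.trans (by gcongr)
        _ = (M * 1) * (K * ee k μ x * (‖rh 1‖ * ‖qS 1‖)) := by ring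
        _ ≤ (M * (5 * M ^ 4)) * (K * ee k μ x * (‖rh 1‖ * ‖qS 1‖)) := by gcongr
        _ = _ := by ring
    have t3 : ‖q x - rh 1 * qS x‖ ≤ 5 * M ^ 5 * K * ee k μ x * (Qr + m * (F + N)) := b2.trans (by gcongr)
    linarith
  have e1 : ‖f1 x‖ = ‖q x‖ * (1 / ‖P.d c x‖ ^ 2) := by
    have : ‖P.d c x‖ ≠ 0 := norm_ne_zero_iff.2 (h.dne x)
    rw [h.mo.hq x, norm_mul, norm_pow]; field_simp
  rw [e1]
  calc _ ≤ (5 * M ^ 5 * K * ee k μ x * ((Qr + m * (F + N)) + ‖rh 1‖ * ‖qS 1‖)) * (5 * M ^ 4 / w2 P μ x) :=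
        mul_le_mul b5 (h.inv_d x) (by positivity) (by positivity)
    _ = _ := by ring

set_option maxHeartbeats 1600000 in
lemma r_le {F : ℝ} (hF : ∀ x ∈ Icc (0:ℝ) 1, ‖f x - fSf P c (rh 1) qS x‖ ≤ F) :
    √(∫ t in (0:ℝ)..1, omg P k μ t * ‖rh t - rh 1 * S t‖ ^ 2) ≤
    125 * M ^ 12 * K ^ 4 * σ * ((√(∫ t in (0:ℝ)..1, omg P k μ t * ‖rh t - rh 1 * S t‖ ^ 2) +
      m * (F + ∫ t in (0:ℝ)..1, ‖fSf P c (rh 1) qS t‖)) + ‖rh 1‖ * ‖qS 1‖ + m * F) := by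
  have hμ := h.vh.μ0
  have hμ1 := h.vh.μ1
  have hM := h.ph.hM
  have hK := h.vh.hK
  have hm := h.vh.m0
  have hmμ := h.vh.mμ
  have hσ := h.vh.σ0
  have hν := h.ph.ν0
  have hci := h.im_pos
  have cf := h.cf
  have cf1 := h.cf1
  have co := h.comg
  have op := omg_pos (P := P) (k := k) hμ
  have cV2 : Continuous P.V2 := cont_of_deriv P.dV2
  have cV3 : Continuous P.V3 := cont_of_deriv P.dV3
  have cV4 := P.cV4
  have cf2 := h.mo.cf2
  have hF0 : 0 ≤ F := (norm_nonneg _).trans (hF 0 (by simp))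
  have M2 : 1 ≤ M ^ 2 := one_le_pow₀ hM
  set Qr := √(∫ t in (0:ℝ)..1, omg P k μ t * ‖rh t - rh 1 * S t‖ ^ 2) with hQd
  have hQr : 0 ≤ Qr := Real.sqrt_nonneg _
  set N := ∫ t in (0:ℝ)..1, ‖fSf P c (rh 1) qS t‖
  have hN : 0 ≤ N := int_nonneg' (fun t _ => norm_nonneg _) (by simp)
  set B := ‖rh 1‖ * ‖qS 1‖ with hB
  have hB0 : 0 ≤ B := by positivity
  set T := (Qr + m * (F + N)) + B + m * F with hT
  have hT0 : 0 ≤ T := by positivity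
  set L := 25 * M ^ 9 * K ^ 2 with hL
  have hL0 : 0 ≤ L := by positivity
  -- pointwise
  have p1 : ∀ x ∈ Icc (0:ℝ) 1, omg P k μ x * ‖f1 x‖ ^ 2 ≤ L ^ 2 * T ^ 2 * (1 / w2 P μ x) := by
    intro x hx
    have he := ee_pos (k := k) hμ x
    have hw := w2_pos (P := P) hμ x
    have t : ‖f1 x‖ ≤ L * (ee k μ x / w2 P μ x) * T := by
      refine (h.f1_le hF hx).trans ?_
      have : 25 * M ^ 9 * K ≤ L := by
        rw [hL]
        have : K ≤ K ^ 2 := by nlinarith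
        gcongr
      gcongr
      rw [hT]
      have : 0 ≤ m * F := by positivity
      linarith
    calc _ ≤ omg P k μ x * (L * (ee k μ x / w2 P μ x) * T) ^ 2 := by have := (op x).le; gcongr
      _ = _ := by unfold omg; field_simp
  have p2 : ∀ x ∈ Icc (0:ℝ) 1, omg P k μ x * (m * ‖f x‖) ^ 2 ≤ L ^ 2 * T ^ 2 * (1 / w2 P μ x) := by
    intro x hx
    have he := ee_pos (k := k) hμ x
    have hw := w2_pos (P := P) hμ x
    have t : m * ‖f x‖ ≤ (5 * M ^ 5 * K) * T := by
      have t1 : ‖f x‖ ≤ F + 5 * M ^ 5 * B * (K / μ) := by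
        have := norm_add_le (f x - fSf P c (rh 1) qS x) (fSf P c (rh 1) qS x)
        simp only [sub_add_cancel] at this
        exact this.trans (add_le_add (hF x hx) (h.fS_sup hx))
      have t2 : m * (5 * M ^ 5 * B * (K / μ)) ≤ 5 * M ^ 5 * K * B := by
        calc _ = 5 * M ^ 5 * K * B * (m / μ) := by ring
          _ ≤ 5 * M ^ 5 * K * B * 1 := by gcongr; rw [div_le_one hμ]; exact hmμ
          _ = _ := by ring
      have t3 : 1 * (m * F) ≤ 5 * M ^ 5 * K * (m * F) := by
        gcongr
        have := one_le_pow₀ hM (n := 5)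
        nlinarith
      have t4 : 0 ≤ 5 * M ^ 5 * K * (Qr + m * (F + N)) := by positivity
      have : m * ‖f x‖ ≤ m * (F + 5 * M ^ 5 * B * (K / μ)) := by gcongr
      rw [hT]
      nlinarith
    have t5 : omg P k μ x ≤ K ^ 2 * (1 / w2 P μ x) := by
      have := h.vh.H5 x hx
      unfold omg
      rw [mul_one_div, div_le_div_iff₀ (by positivity) hw]
      calc _ = w2 P μ x ^ 2 := by ring
        _ ≤ (K * ee k μ x) ^ 2 := by gcongr
        _ = _ := by ring
    calc _ ≤ (K ^ 2 * (1 / w2 P μ x)) * ((5 * M ^ 5 * K) * T) ^ 2 := by gcongr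
      _ = (5 * M ^ 5 * K ^ 2) ^ 2 * T ^ 2 * (1 / w2 P μ x) := by ring
      _ ≤ _ := by
        have : M ^ 5 ≤ M ^ 9 := pow_le_pow_right₀ hM (by norm_num)
        rw [hL]
        gcongr
        norm_num
  let G : ℝ → ℂ := fun x => -(Complex.I * ν * (P.V2 x * f1 x))
  let G1 : ℝ → ℂ := fun x => -(Complex.I * ν * (P.V3 x * f1 x + P.V2 x * f2 x))
  let hh : ℝ → ℂ := fun x => -(Complex.I * ν * (P.V4 x * f x + P.V3 x * f1 x - α2 * (P.V2 x * f x)))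
  have p3 : ∀ x ∈ Icc (0:ℝ) 1, omg P k μ x * ‖G x‖ ^ 2 ≤ ν ^ 2 * K ^ 2 * (L ^ 2 * T ^ 2) * (1 / w2 P μ x) := by
    intro x hx
    have t : ‖G x‖ ≤ ν * (K * ‖f1 x‖) := by
      simp only [G, norm_neg, norm_mul, Complex.norm_I, Complex.norm_real, one_mul, Real.norm_eq_abs, abs_of_pos hν]
      gcongr
      exact h.vh.bV2 x hx
    calc _ ≤ omg P k μ x * (ν * (K * ‖f1 x‖)) ^ 2 := by have := (op x).le; gcongr
      _ = ν ^ 2 * K ^ 2 * (omg P k μ x * ‖f1 x‖ ^ 2) := by ring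
      _ ≤ ν ^ 2 * K ^ 2 * (L ^ 2 * T ^ 2 * (1 / w2 P μ x)) := mul_le_mul_of_nonneg_left (p1 x hx) (by positivity)
      _ = _ := by ring
  have p4 : ∀ x ∈ Icc (0:ℝ) 1, omg P k μ x * ‖hh x‖ ^ 2 ≤ (ν / m) ^ 2 * K ^ 2 * (10 * M ^ 2 * (L ^ 2 * T ^ 2)) * (1 / w2 P μ x) := by
    intro x hx
    have t : ‖hh x‖ ≤ ν * (K * (2 * M * ‖f x‖ + ‖f1 x‖)) := by
      simp only [hh, norm_neg, norm_mul, Complex.norm_I, Complex.norm_real, one_mul, Real.norm_eq_abs, abs_of_pos hν]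
      gcongr
      refine (norm_sub_le _ _).trans ?_
      refine (add_le_add_left (norm_add_le _ _) _).trans ?_
      simp only [norm_mul, Complex.norm_real, Real.norm_eq_abs, abs_of_nonneg h.ph.α0]
      have t1 : |P.V4 x| * ‖f x‖ ≤ K * ‖f x‖ := by gcongr; exact h.vh.bV4 x hx
      have t2 : |P.V3 x| * ‖f1 x‖ ≤ K * ‖f1 x‖ := by gcongr; exact h.vh.bV3 x hx
      have t3 : α2 * (|P.V2 x| * ‖f x‖) ≤ M * (K * ‖f x‖) := by
        have := h.ph.αM
        gcongr
        · nlinarith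
        · exact h.vh.bV2 x hx
      have t4 : 1 * (K * ‖f x‖) ≤ M * (K * ‖f x‖) := by gcongr
      nlinarith
    have t' : omg P k μ x * (m * ‖hh x‖) ^ 2 ≤ ν ^ 2 * K ^ 2 * (10 * M ^ 2 * (L ^ 2 * T ^ 2)) * (1 / w2 P μ x) := by
      have hm1 : m ≤ 1 := hmμ.trans hμ1
      have u1 : m * ‖hh x‖ ≤ ν * (K * (2 * M * (m * ‖f x‖) + ‖f1 x‖)) := by
        calc _ ≤ m * (ν * (K * (2 * M * ‖f x‖ + ‖f1 x‖))) := by gcongr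
          _ = ν * (K * (2 * M * (m * ‖f x‖) + m * ‖f1 x‖)) := by ring
          _ ≤ ν * (K * (2 * M * (m * ‖f x‖) + 1 * ‖f1 x‖)) := by gcongr
          _ = _ := by ring
      have u2 : (2 * M * (m * ‖f x‖) + ‖f1 x‖) ^ 2 ≤ 8 * M ^ 2 * (m * ‖f x‖) ^ 2 + 2 * M ^ 2 * ‖f1 x‖ ^ 2 := by
        nlinarith [sq_nonneg (2 * M * (m * ‖f x‖) - ‖f1 x‖), mul_nonneg (sub_nonneg.2 M2) (sq_nonneg ‖f1 x‖)]
      have := (op x).le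
      calc _ ≤ omg P k μ x * (ν * (K * (2 * M * (m * ‖f x‖) + ‖f1 x‖))) ^ 2 := by gcongr
        _ = ν ^ 2 * K ^ 2 * (omg P k μ x * (2 * M * (m * ‖f x‖) + ‖f1 x‖) ^ 2) := by ring
        _ ≤ ν ^ 2 * K ^ 2 * (omg P k μ x * (8 * M ^ 2 * (m * ‖f x‖) ^ 2 + 2 * M ^ 2 * ‖f1 x‖ ^ 2)) := by gcongr
        _ = ν ^ 2 * K ^ 2 * (8 * M ^ 2 * (omg P k μ x * (m * ‖f x‖) ^ 2) + 2 * M ^ 2 * (omg P k μ x * ‖f1 x‖ ^ 2)) := by ring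
        _ ≤ ν ^ 2 * K ^ 2 * (8 * M ^ 2 * (L ^ 2 * T ^ 2 * (1 / w2 P μ x)) + 2 * M ^ 2 * (L ^ 2 * T ^ 2 * (1 / w2 P μ x))) := by
          have := p1 x hx
          have := p2 x hx
          gcongr
        _ = _ := by ring
    calc _ = (1 / m) ^ 2 * (omg P k μ x * (m * ‖hh x‖) ^ 2) := by field_simp
      _ ≤ (1 / m) ^ 2 * (ν ^ 2 * K ^ 2 * (10 * M ^ 2 * (L ^ 2 * T ^ 2)) * (1 / w2 P μ x)) := by gcongr
      _ = _ := by ring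
  have cw : Continuous fun x => 1 / w2 P μ x := Continuous.div (by fun_prop) (by fun_prop) fun x => (w2_pos hμ x).ne'
  have cG1 : Continuous G1 := by fun_prop
  have chh : Continuous hh := by fun_prop
  have cG : Continuous G := by fun_prop
  have i1 : ∫ x in (0:ℝ)..1, omg P k μ x * ‖G x‖ ^ 2 ≤ ν ^ 2 * K ^ 2 * (L ^ 2 * T ^ 2) * (K * σ ^ 2 / μ ^ 2) := by
    have := int_mono' (f := fun x => omg P k μ x * ‖G x‖ ^ 2) (g := fun x => ν ^ 2 * K ^ 2 * (L ^ 2 * T ^ 2) * (1 / w2 P μ x)) (by fun_prop) (cw.const_smul (ν ^ 2 * K ^ 2 * (L ^ 2 * T ^ 2))) (x := 1) (by simp) p3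
    refine this.trans ?_
    rw [intervalIntegral.integral_const_mul]
    exact mul_le_mul_of_nonneg_left h.vh.H1 (by positivity)
  have i2 : ∫ x in (0:ℝ)..1, omg P k μ x * ‖hh x‖ ^ 2 ≤ (ν / m) ^ 2 * K ^ 2 * (10 * M ^ 2 * (L ^ 2 * T ^ 2)) * (K * σ ^ 2 / μ ^ 2) := by
    have := int_mono' (f := fun x => omg P k μ x * ‖hh x‖ ^ 2) (g := fun x => (ν / m) ^ 2 * K ^ 2 * (10 * M ^ 2 * (L ^ 2 * T ^ 2)) * (1 / w2 P μ x)) (by fun_prop) (cw.const_smul ((ν / m) ^ 2 * K ^ 2 * (10 * M ^ 2 * (L ^ 2 * T ^ 2)))) (x := 1) (by simp) p4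
    refine this.trans ?_
    rw [intervalIntegral.integral_const_mul]
    exact mul_le_mul_of_nonneg_left h.vh.H1 (by positivity)
  have W := WEL (u := fun x => rh x - rh 1 * S x) (u1 := fun x => rh1 x - rh 1 * S1 x) (u2 := fun x => rh2 x - rh 1 * S2 x)
    (G := G) (G1 := G1) (h := hh) (d := P.d c) (om := omg P k μ) (om1 := omg1 P k μ) (ν := ν) (α2 := α2) (ci := c.im) (La := (K + 2 * k) / μ)
    (fun x => (h.mo.drh x).sub ((h.sh.dS x).const_mul _)) (fun x => (h.mo.drh1 x).sub ((h.sh.dS1 x).const_mul _))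
    (h.mo.crh2.sub (h.sh.cS2.const_smul (rh 1)))
    (fun x => by
      have := ((P.dV2 x).ofReal_comp.mul (h.mo.df1 x)).const_mul (Complex.I * ν)
      exact this.neg)
    cG1 chh (domg hμ) (comg1 hμ) hν h.ph.α0 hci (fun x _ => P.d_im c x)
    (fun x hx => by
      have e1 := h.mo.eq x hx
      have e2 := h.sh.eq x hx
      simp only [G1, hh]
      linear_combination e1 - rh 1 * e2)
    (by simp [h.mo.rh10, h.sh.S10]) (by simp [h.sh.S01]) (by simp [G, h.mo.f10])
    (fun x _ => (op x).le) (omg_slow h.vh) h.ph.La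
  have hci' := h.ph.ci
  have hνM := h.ph.νM
  have a1 : ν / c.im ≤ M ^ 2 * m * μ := by
    rw [div_le_iff₀ hci]
    calc ν ≤ M * m * μ * μ := by linarith [hνM, (by ring : M * m * μ ^ 2 = M * m * μ * μ)]
      _ ≤ M * m * μ * (M * c.im) := by gcongr
      _ = _ := by ring
  have a2 : 2 / (ν * c.im) * (ν ^ 2 * K ^ 2 * (L ^ 2 * T ^ 2) * (K * σ ^ 2 / μ ^ 2)) ≤ 2 * M ^ 6 * K ^ 3 * L ^ 2 * T ^ 2 * σ ^ 2 := by
    calc _ = (ν / c.im) * (2 * K ^ 3 * L ^ 2 * T ^ 2 * σ ^ 2 / μ ^ 2) := by field_simp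
      _ ≤ (M ^ 2 * μ * μ) * (2 * K ^ 3 * L ^ 2 * T ^ 2 * σ ^ 2 / μ ^ 2) := by
        gcongr
        exact a1.trans (by gcongr)
      _ = M ^ 2 * (2 * K ^ 3 * L ^ 2 * T ^ 2 * σ ^ 2) := by field_simp
      _ ≤ M ^ 6 * (2 * K ^ 3 * L ^ 2 * T ^ 2 * σ ^ 2) := by
        gcongr
        norm_num
      _ = _ := by ring
  have a3 : 2 / c.im ^ 2 * ((ν / m) ^ 2 * K ^ 2 * (10 * M ^ 2 * (L ^ 2 * T ^ 2)) * (K * σ ^ 2 / μ ^ 2)) ≤ 20 * M ^ 6 * K ^ 3 * L ^ 2 * T ^ 2 * σ ^ 2 := by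
    calc _ = (ν / c.im) ^ 2 * (20 * M ^ 2 * K ^ 3 * L ^ 2 * T ^ 2 * σ ^ 2 / μ ^ 2 / m ^ 2) := by field_simp; ring
      _ ≤ (M ^ 2 * m * μ) ^ 2 * (20 * M ^ 2 * K ^ 3 * L ^ 2 * T ^ 2 * σ ^ 2 / μ ^ 2 / m ^ 2) := by
        gcongr
      _ = _ := by field_simp
  have fin : Qr ^ 2 ≤ (125 * M ^ 12 * K ^ 4 * σ * T) ^ 2 := by
    rw [hQd, Real.sq_sqrt (int_nonneg' (fun t _ => mul_nonneg (op t).le (sq_nonneg _)) (by simp))]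
    refine W.trans ?_
    have w1 := mul_le_mul_of_nonneg_left i1 (by positivity : 0 ≤ 2 / (ν * c.im))
    have w2' := mul_le_mul_of_nonneg_left i2 (by positivity : 0 ≤ 2 / c.im ^ 2)
    have K34 : K ^ 3 ≤ K ^ 4 := pow_le_pow_right₀ hK (by norm_num)
    calc _ ≤ 22 * M ^ 6 * K ^ 3 * L ^ 2 * T ^ 2 * σ ^ 2 := by linarith
      _ ≤ 25 * M ^ 6 * K ^ 4 * L ^ 2 * T ^ 2 * σ ^ 2 := by gcongr; norm_num
      _ = _ := by rw [hL]; ring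
  exact le_of_sq_le_sq fin (by positivity)

end Setup

/-- closing theorem -/
theorem closing (K M : ℝ) (hK : 1 ≤ K) (hM : 1 ≤ M) : ∃ C s0 : ℝ, 1 ≤ C ∧ 0 < s0 ∧
    ∀ {P : Prof} {k : ℕ} {μ m σ ν α2 : ℝ} {c : ℂ} {S S1 S2 qS f f1 f2 q rh rh1 rh2 : ℝ → ℂ},
    Setup P k K M μ m σ ν α2 c S S1 S2 qS f f1 f2 q rh rh1 rh2 → m ≤ s0 → σ ≤ s0 →
    (∀ x ∈ Icc (0:ℝ) 1, ‖f x - fSf P c (rh 1) qS x‖ ≤ C * ‖f 0‖) ∧ ‖rh 1‖ * ‖qS 1‖ ≤ C * (m * ‖f 0‖) ∧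
    (∫ t in (0:ℝ)..1, ‖fSf P c (rh 1) qS t‖) ≤ C * (m * ‖f 0‖) ∧
    √(∫ t in (0:ℝ)..1, omg P k μ t * ‖rh t - rh 1 * S t‖ ^ 2) ≤ C * (m * σ * ‖f 0‖) := by
  set C := 125 * M ^ 12 * K ^ 4 * Real.exp (25 * M ^ 9 * K ^ 2) with hC
  have hexp : 1 ≤ Real.exp (25 * M ^ 9 * K ^ 2) := Real.one_le_exp (by positivity)
  have M12 : 1 ≤ M ^ 12 := one_le_pow₀ hM
  have K4 : 1 ≤ K ^ 4 := one_le_pow₀ hK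
  have A : 1 ≤ 125 * M ^ 12 * K ^ 4 := by nlinarith
  have A0 : 125 * M ^ 12 * K ^ 4 ≤ C := by rw [hC]; exact le_mul_of_one_le_right (by positivity) hexp
  have hC1 : 1 ≤ C := A.trans A0
  have C3 : 1 ≤ C ^ 3 := one_le_pow₀ hC1
  have C23 : C ^ 2 ≤ C ^ 3 := pow_le_pow_right₀ hC1 (by norm_num)
  have C13 : C ≤ C ^ 3 := by simpa using pow_le_pow_right₀ hC1 (by norm_num : 1 ≤ 3)
  have g10 : 10 * M ^ 5 * K ≤ C := by
    refine le_trans ?_ A0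
    have : M ^ 5 ≤ M ^ 12 := pow_le_pow_right₀ hM (by norm_num)
    have : K ≤ K ^ 4 := by simpa using pow_le_pow_right₀ hK (by norm_num : 1 ≤ 4)
    gcongr
    norm_num
  refine ⟨20 * C ^ 3, 1 / (80 * C ^ 3), by linarith, by positivity, ?_⟩
  intro P k μ m σ ν α2 c S S1 S2 qS f f1 f2 q rh rh1 rh2 h hms hσs
  have hm := h.vh.m0
  have hσ := h.vh.σ0
  have hμ := h.vh.μ0
  obtain ⟨xm, hxm, hmax⟩ := isCompact_Icc.exists_isMaxOn (s := Icc (0:ℝ) 1) ⟨0, by simp⟩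
    (f := fun x => ‖f x - fSf P c (rh 1) qS x‖) (by have := h.cf; have := h.cfS; fun_prop)
  have hF : ∀ x ∈ Icc (0:ℝ) 1, ‖f x - fSf P c (rh 1) qS x‖ ≤ ‖f xm - fSf P c (rh 1) qS xm‖ := fun x hx => hmax hx
  have e3 := h.r_le hF
  have e4 := h.f0_gron hxm
  have e2 := h.fS_L1
  have e1 := h.q0_le (x := 1) (by simp)
  set F := ‖f xm - fSf P c (rh 1) qS xm‖
  set Qr := √(∫ t in (0:ℝ)..1, omg P k μ t * ‖rh t - rh 1 * S t‖ ^ 2) with hQd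
  have hQr : 0 ≤ Qr := Real.sqrt_nonneg _
  set N := ∫ t in (0:ℝ)..1, ‖fSf P c (rh 1) qS t‖
  have hN : 0 ≤ N := int_nonneg' (fun t _ => norm_nonneg _) (by simp)
  have hF0 : 0 ≤ F := norm_nonneg _
  have c1 := h.cf
  have c2 := h.cfS
  rw [h.q1, zero_sub, norm_neg, norm_mul] at e1
  have J : (∫ t in (0:ℝ)..1, ‖f t - fSf P c (rh 1) qS t‖) ≤ F := by
    have := int_mono' (f := fun t => ‖f t - fSf P c (rh 1) qS t‖) (g := fun _ => F) (x := 1) (by fun_prop) (by fun_prop) (by simp) hF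
    simpa using this
  have e1' : ‖rh 1‖ * ‖qS 1‖ ≤ C * (Qr + m * (F + N)) := by
    refine e1.trans ?_
    have : ee k μ 1 ≤ 2 := ee_one h.vh
    have J0 : 0 ≤ ∫ t in (0:ℝ)..1, ‖f t - fSf P c (rh 1) qS t‖ := int_nonneg' (fun t _ => norm_nonneg _) (by simp)
    calc _ ≤ 5 * M ^ 5 * K * 2 * (Qr + m * (F + N)) := by gcongr
      _ = 10 * M ^ 5 * K * (Qr + m * (F + N)) := by ring
      _ ≤ _ := by gcongr
  have e2' : N ≤ C * (‖rh 1‖ * ‖qS 1‖) := by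
    refine e2.trans ?_
    gcongr
    refine le_trans ?_ g10
    gcongr
    norm_num
  have e4' : F ≤ C * (‖f 0‖ + (Qr + m * N) / m) := by
    refine e4.trans ?_
    have g : 25 * M ^ 9 * K ^ 2 ≤ 125 * M ^ 12 * K ^ 4 := by
      have : M ^ 9 ≤ M ^ 12 := pow_le_pow_right₀ hM (by norm_num)
      have : K ^ 2 ≤ K ^ 4 := pow_le_pow_right₀ hK (by norm_num)
      gcongr
      norm_num
    calc _ ≤ (125 * M ^ 12 * K ^ 4 * ‖f 0‖ + 125 * M ^ 12 * K ^ 4 * ((Qr + m * N) / m)) * Real.exp (25 * M ^ 9 * K ^ 2) := by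
          gcongr
          exact le_mul_of_one_le_left (norm_nonneg _) A
      _ = _ := by rw [hC]; ring
  have e3' : Qr ≤ C * σ * ((Qr + m * (F + N)) + ‖rh 1‖ * ‖qS 1‖ + m * F) := by
    refine e3.trans ?_
    gcongr
  obtain ⟨r1, r2, r3, r4⟩ := close_arith hC1 hQr hN (by positivity) hF0 (norm_nonneg (f 0)) hm hσ hms hσs rfl e1' e2' e3' e4'
  refine ⟨fun x hx => (hF x hx).trans (r1.trans ?_), r2.trans ?_, r3.trans ?_, r4⟩
  · gcongr
    linarith
  · gcongr
    linarith
  · gcongr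
    linarith
end
end OS

end

noncomputable section
open Filter Topology MeasureTheory Set ComplexConjugate
namespace OS

lemma mono_of_deriv01 {g g1 : ℝ → ℝ} (dg : ∀ x, HasDerivAt g (g1 x) x) (h : ∀ x ∈ Icc (0:ℝ) 1, 0 ≤ g1 x) :
    MonotoneOn g (Icc 0 1) := by
  refine monotoneOn_of_deriv_nonneg (convex_Icc _ _) (cont_of_deriv dg).continuousOn
      (fun x _ => (dg x).differentiableAt.differentiableWithinAt) ?_
  intro x hx
  rw [interior_Icc] at hx
  rw [(dg x).deriv]
  exact h x (Ioo_subset_Icc_self hx)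

lemma compar {g g1 g2 : ℝ → ℝ} {l : ℝ} (hl : 0 < l) (dg : ∀ x, HasDerivAt g (g1 x) x)
    (dg1 : ∀ x, HasDerivAt g1 (g2 x) x) (h0 : ∀ x, 0 ≤ g x) (h2 : ∀ x ∈ Icc (0:ℝ) 1, l ^ 2 * g x ≤ g2 x)
    (h10 : g1 0 = 0) : MonotoneOn g (Icc 0 1) ∧ ∀ x ∈ Icc (0:ℝ) 1, g x ≤ 2 * Real.exp (-(l * (1 - x))) * g 1 := by
  have m1 : MonotoneOn g1 (Icc 0 1) := mono_of_deriv01 dg1 fun x hx =>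
    (mul_nonneg (sq_nonneg _) (h0 x)).trans (h2 x hx)
  have p1 : ∀ x ∈ Icc (0:ℝ) 1, 0 ≤ g1 x := fun x hx => by
    rw [← h10]; exact m1 (by simp) hx hx.1
  have m0 := mono_of_deriv01 dg p1
  refine ⟨m0, fun x hx => ?_⟩
  have dE : ∀ s x : ℝ, HasDerivAt (fun x => Real.exp (s * x)) (Real.exp (s * x) * s) x := fun s x => by
    simpa using ((hasDerivAt_id x).const_mul s).exp
  have m2 : MonotoneOn (fun x => (g1 x - l * g x) * Real.exp (l * x)) (Icc 0 1) := by
    refine mono_of_deriv01 (g1 := fun x => (g2 x - l ^ 2 * g x) * Real.exp (l * x)) (fun x => ?_) fun x hx => ?_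
    · refine (((dg1 x).sub ((dg x).const_mul l)).mul (dE l x)).congr_deriv ?_
      simp; ring
    · exact mul_nonneg (by linarith [h2 x hx]) (Real.exp_pos _).le
  have p2 : ∀ x ∈ Icc (0:ℝ) 1, l * g x - l * g 0 * Real.exp (-(l * x)) ≤ g1 x := by
    intro x hx
    have := m2 (by simp) hx hx.1
    simp only [h10, mul_zero, Real.exp_zero, mul_one] at this
    have h3 : (0 - l * g 0) * Real.exp (-(l * x)) ≤ (g1 x - l * g x) * Real.exp (l * x) * Real.exp (-(l * x)) := by
      gcongr
    rw [mul_assoc, ← Real.exp_add] at h3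
    simp at h3
    linarith
  have m3 : MonotoneOn (fun x => g x * Real.exp (-l * x) - g 0 / 2 * Real.exp (-2 * l * x)) (Icc 0 1) := by
    refine mono_of_deriv01 (fun x => ((dg x).mul (dE (-l) x)).sub ((dE (-2 * l) x).const_mul (g 0 / 2))) fun x hx => ?_
    have := mul_le_mul_of_nonneg_right (p2 x hx) (Real.exp_pos (-l * x)).le
    have e : Real.exp (-2 * l * x) = Real.exp (-(l * x)) * Real.exp (-l * x) := by
      rw [← Real.exp_add]; ring_nf
    rw [e]
    nlinarith
  have h4 := m3 hx (by simp) hx.2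
  simp only [mul_one] at h4
  have e2 : Real.exp (-2 * l * x) = Real.exp (-l * x) * Real.exp (-l * x) := by
      rw [← Real.exp_add]; ring_nf
  have e3 : Real.exp (-l) = Real.exp (-l * x) * Real.exp (-(l * (1 - x))) := by
      rw [← Real.exp_add]; ring_nf
  have h5 : g 0 ≤ g x := m0 (by simp) hx hx.1
  have h6 : Real.exp (-l * x) ≤ 1 := Real.exp_le_one_iff.2 (by nlinarith [hx.1])
  have h7 : 0 ≤ g 0 / 2 * Real.exp (-2 * l) := mul_nonneg (by linarith [h0 0]) (Real.exp_pos _).le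
  have h8 : g x * Real.exp (-l * x) - g 0 / 2 * Real.exp (-2 * l * x) ≤ g 1 * Real.exp (-l) := by linarith
  rw [e2, e3] at h8
  have hp := Real.exp_pos (-l * x)
  have h9 : (g x - g 0 / 2 * Real.exp (-l * x)) ≤ g 1 * Real.exp (-(l * (1 - x))) := by
    refine le_of_mul_le_mul_right ?_ hp
    linarith
  have h10 : g 0 / 2 * Real.exp (-l * x) ≤ g x / 2 := by
    calc _ ≤ g 0 / 2 * 1 := mul_le_mul_of_nonneg_left h6 (by linarith [h0 0])
      _ ≤ _ := by linarith
  linarith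

/-- The decaying wall solution, with pointwise bounds. -/
structure WallSol (P : Prof) (ν α2 l : ℝ) (c : ℂ) (S S1 S2 qS : ℝ → ℂ) : Prop where
  dS : ∀ x, HasDerivAt S (S1 x) x
  dS1 : ∀ x, HasDerivAt S1 (S2 x) x
  cS2 : Continuous S2
  eq : ∀ x ∈ Icc (0:ℝ) 1, P.d c x * S x + Complex.I * ν * (S2 x - α2 * S x) = 0
  S10 : S1 0 = 0
  S01 : S 1 = 1
  dq : ∀ x, HasDerivAt qS (P.d c x * S x) x
  q0 : qS 0 = 0
  mono : MonotoneOn (fun x => ‖S x‖) (Icc 0 1)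
  dec : ∀ x ∈ Icc (0:ℝ) 1, ‖S x‖ ≤ 2 * Real.exp (-(l * (1 - x)))

lemma re_deriv {f : ℝ → ℂ} {f' : ℂ} {x : ℝ} (h : HasDerivAt f f' x) : HasDerivAt (fun x => (f x).re) f'.re x :=
  (Complex.reCLM.hasFDerivAt (x := f x)).comp_hasDerivAt x h
lemma im_deriv {f : ℝ → ℂ} {f' : ℂ} {x : ℝ} (h : HasDerivAt f f' x) : HasDerivAt (fun x => (f x).im) f'.im x :=
  (Complex.imCLM.hasFDerivAt (x := f x)).comp_hasDerivAt x h

theorem wall_exists (P : Prof) {ν α2 l : ℝ} {c : ℂ} (hν : 0 < ν) (hα : 0 ≤ α2) (hl : 0 < l)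
    (hlc : 2 * l ^ 2 * ν ≤ c.im) : ∃ S S1 S2 qS : ℝ → ℂ, WallSol P ν α2 l c S S1 S2 qS := by
  obtain ⟨φ, φ1, ψ, ψ1, h, hs, -, -⟩ := ode_solve (fun x => α2 + Complex.I / ν * P.d c x) (fun _ => 0) (fun _ => 0) (fun _ => 0)
    (by fun_prop) (by fun_prop) (by fun_prop) (by fun_prop) 1 0 1
  obtain ⟨hE, -, h1⟩ := hs 0 (by simp)
  set T := ψ 0
  set T1 := ψ1 0
  set T2 := h 0
  have heq : ∀ x ∈ Icc (0:ℝ) 1, P.d c x * T x + Complex.I * ν * (T2 x - α2 * T x) = 0 := by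
    intro x hx
    have := hE.eq x hx
    have hν' : (ν:ℂ) ≠ 0 := by exact_mod_cast hν.ne'
    rw [this]
    field_simp
    simp
    ring_nf
    simp
  let g : ℝ → ℝ := fun x => (T x).re ^ 2 + (T x).im ^ 2
  have hg : ∀ x, g x = ‖T x‖ ^ 2 := fun x => by
    rw [Complex.sq_norm, Complex.normSq_apply]; simp only [g]; ring
  let g1 : ℝ → ℝ := fun x => 2 * ((T x).re * (T1 x).re + (T x).im * (T1 x).im)
  let g2 : ℝ → ℝ := fun x => 2 * ((T1 x).re ^ 2 + (T1 x).im ^ 2 + (T x).re * (T2 x).re + (T x).im * (T2 x).im)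
  have dg : ∀ x, HasDerivAt g (g1 x) x := fun x => by
    refine (((re_deriv (hE.d2 x)).pow 2).add ((im_deriv (hE.d2 x)).pow 2)).congr_deriv ?_
    simp [g1]; ring
  have dg1 : ∀ x, HasDerivAt g1 (g2 x) x := fun x => by
    refine ((((re_deriv (hE.d2 x)).mul (re_deriv (hE.d3 x))).add ((im_deriv (hE.d2 x)).mul (im_deriv (hE.d3 x)))).const_mul 2).congr_deriv ?_
    simp [g2]; ring
  have key : ∀ x ∈ Icc (0:ℝ) 1, (2 * l) ^ 2 * g x ≤ g2 x := by
    intro x hx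
    have e := heq x hx
    have er := congrArg Complex.re e
    have ei := congrArg Complex.im e
    simp [Prof.d] at er ei
    have k1 : ν * ((T x).re * (T2 x).re + (T x).im * (T2 x).im) = (c.im + ν * α2) * g x := by
      simp only [g]
      linear_combination (T x).re * ei - (T x).im * er
    have k2 : 2 * l ^ 2 * g x * ν ≤ ((T x).re * (T2 x).re + (T x).im * (T2 x).im) * ν := by
      have : 0 ≤ g x := by rw [hg]; positivity
      have : 2 * l ^ 2 * ν * g x ≤ c.im * g x := by gcongr
      have : 0 ≤ ν * α2 * g x := by positivity
      linarith
    have k3 := le_of_mul_le_mul_right k2 hν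
    simp only [g2]
    nlinarith [sq_nonneg (T1 x).re, sq_nonneg (T1 x).im]
  obtain ⟨mono, dec⟩ := compar (l := 2 * l) (by positivity) dg dg1 (fun x => by rw [hg]; positivity) key
    (by simp [g1, T1, hE.z3])
  have m' : MonotoneOn (fun x => ‖T x‖) (Icc 0 1) := by
    intro x hx y hy hxy
    have := mono hx hy hxy
    rw [hg, hg] at this
    exact le_of_sq_le_sq this (norm_nonneg _)
  have hT1 : 1 ≤ ‖T 1‖ := by
    have := m' (by simp : (0:ℝ) ∈ Icc (0:ℝ) 1) (by simp : (1:ℝ) ∈ Icc (0:ℝ) 1) zero_le_one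
    simpa [T, h1] using this
  have hT1p : 0 < ‖T 1‖ := by linarith
  have hT1' : T 1 ≠ 0 := norm_pos_iff.1 hT1p
  have cT : Continuous T := cont_of_deriv hE.d2
  refine ⟨fun x => T x / T 1, fun x => T1 x / T 1, fun x => T2 x / T 1,
    fun x => ∫ t in (0:ℝ)..x, P.d c t * (T t / T 1), ?_⟩
  refine ⟨fun x => (hE.d2 x).div_const _, fun x => (hE.d3 x).div_const _, hE.hc.div_const _, fun x hx => ?_, ?_, ?_,
    fun x => int_hasDeriv (by fun_prop) x, by simp, fun x hx y hy hxy => ?_, fun x hx => ?_⟩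
  · have := heq x hx
    linear_combination this / T 1
  · simp [T1, hE.z3]
  · exact div_self hT1'
  · simp only [norm_div]
    have := m' hx hy hxy
    gcongr
  · have := dec x hx
    rw [hg, hg] at this
    have e : Real.exp (-(2 * l * (1 - x))) = Real.exp (-(l * (1 - x))) ^ 2 := by
      rw [sq, ← Real.exp_add]; ring_nf
    rw [norm_div, div_le_iff₀ hT1p]
    refine le_of_sq_le_sq (this.trans ?_) (by positivity)
    rw [e]
    have : 0 ≤ Real.exp (-(l * (1 - x))) ^ 2 * ‖T 1‖ ^ 2 := by positivity
    nlinarith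

end OS

end

noncomputable section
open Filter Topology MeasureTheory Set ComplexConjugate
namespace OS

lemma exp_moment {r : ℝ} (hr : 0 < r) (j : ℕ) :
    ∫ x in (0:ℝ)..1, (1 - x) ^ j * Real.exp (-(r * (1 - x))) ≤ j.factorial * (2 / r) ^ (j + 1) := by
  have h1 : ∫ x in (0:ℝ)..1, (1 - x) ^ j * Real.exp (-(r * (1 - x))) ≤
      ∫ x in (0:ℝ)..1, (j.factorial * (2 / r) ^ j) * Real.exp (-(r / 2 * (1 - x))) := by
    refine int_mono' (by fun_prop) (by fun_prop) (by simp) fun x hx => ?_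
    have hy : 0 ≤ r / 2 * (1 - x) := mul_nonneg (by positivity) (by linarith [hx.2])
    have := Real.pow_div_factorial_le_exp _ hy j
    rw [div_le_iff₀ (by positivity)] at this
    have e1 : Real.exp (-(r * (1 - x))) = Real.exp (-(r / 2 * (1 - x))) * Real.exp (-(r / 2 * (1 - x))) := by
      rw [← Real.exp_add]; ring_nf
    have e2 : Real.exp (r / 2 * (1 - x)) * Real.exp (-(r / 2 * (1 - x))) = 1 := by
      rw [← Real.exp_add]; simp
    have e3 : (1 - x) ^ j = (2 / r) ^ j * (r / 2 * (1 - x)) ^ j := by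
      rw [← mul_pow]; congr 1; field_simp
    rw [e1, e3, ← mul_assoc]
    refine mul_le_mul_of_nonneg_right ?_ (Real.exp_pos _).le
    calc (2 / r) ^ j * (r / 2 * (1 - x)) ^ j * Real.exp (-(r / 2 * (1 - x))) ≤
        (2 / r) ^ j * (Real.exp (r / 2 * (1 - x)) * j.factorial) * Real.exp (-(r / 2 * (1 - x))) := by gcongr
      _ = (2 / r) ^ j * j.factorial * (Real.exp (r / 2 * (1 - x)) * Real.exp (-(r / 2 * (1 - x)))) := by ring
      _ = _ := by rw [e2]; ring
  refine h1.trans ?_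
  rw [intervalIntegral.integral_const_mul]
  have h2 : ∫ x in (0:ℝ)..1, Real.exp (-(r / 2 * (1 - x))) ≤ 2 / r := by
    have d : ∀ x ∈ uIcc (0:ℝ) 1, HasDerivAt (fun x => 2 / r * Real.exp (-(r / 2 * (1 - x)))) (Real.exp (-(r / 2 * (1 - x)))) x := by
      intro x _
      have h3 : HasDerivAt (fun x : ℝ => -(r / 2 * (1 - x))) (r / 2) x := by
        refine ((((hasDerivAt_id x).const_sub 1).const_mul (r / 2)).neg).congr_deriv ?_
        simp
      refine (h3.exp.const_mul (2 / r)).congr_deriv ?_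
      field_simp
    rw [intervalIntegral.integral_eq_sub_of_hasDerivAt d ((by fun_prop : Continuous _).intervalIntegrable _ _)]
    have := Real.exp_pos (-(r / 2 * (1 - 0)))
    have : 0 ≤ 2 / r * Real.exp (-(r / 2 * (1 - 0))) := by positivity
    simp only [sub_self, mul_zero, neg_zero, Real.exp_zero, mul_one]
    linarith
  calc _ ≤ (j.factorial * (2 / r) ^ j) * (2 / r) := by gcongr
    _ = _ := by ring

/-- a square root with positive real part -/
lemma exists_root (w : ℂ) (hw : 0 < w.re) : ∃ γ : ℂ, γ ^ 2 = w ∧ 0 < γ.re ∧ ‖γ‖ ^ 2 ≤ 2 * γ.re ^ 2 := by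
  obtain ⟨g, hg⟩ := IsAlgClosed.exists_pow_nat_eq w (n := 2) (by norm_num)
  have h1 : g.re ^ 2 - g.im ^ 2 = w.re := by
    rw [← hg]; simp [sq]
  have h2 : ‖g‖ ^ 2 = g.re ^ 2 + g.im ^ 2 := by
    rw [Complex.sq_norm, Complex.normSq_apply]; ring
  have h3 : g.re ≠ 0 := by
    intro h; rw [h] at h1; nlinarith [sq_nonneg g.im]
  rcases lt_or_gt_of_ne h3 with h | h
  · exact ⟨-g, by simpa using hg, by simpa using h, by simp [h2]; linarith⟩
  · exact ⟨g, hg, h, by rw [h2]; linarith⟩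

namespace WallSol
variable {P : Prof} {ν α2 l : ℝ} {c : ℂ} {S S1 S2 qS : ℝ → ℂ} (h : WallSol P ν α2 l c S S1 S2 qS)
include h

lemma cS : Continuous S := cont_of_deriv h.dS
lemma cS1 : Continuous S1 := cont_of_deriv h.dS1

lemma le_one {x : ℝ} (hx : x ∈ Icc (0:ℝ) 1) : ‖S x‖ ≤ 1 := by
  have := h.mono hx (by simp : (1:ℝ) ∈ Icc (0:ℝ) 1) hx.2
  simpa [h.S01] using this

lemma moment (hl : 0 < l) (j : ℕ) : ∫ x in (0:ℝ)..1, (1 - x) ^ j * ‖S x‖ ≤ 2 * j.factorial * (2 / l) ^ (j + 1) := by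
  have cS := h.cS
  have h1 : ∫ x in (0:ℝ)..1, (1 - x) ^ j * ‖S x‖ ≤ ∫ x in (0:ℝ)..1, 2 * ((1 - x) ^ j * Real.exp (-(l * (1 - x)))) := by
    refine int_mono' (by fun_prop) (by fun_prop) (by simp) fun x hx => ?_
    have := h.dec x hx
    have h0 : 0 ≤ 1 - x := by linarith [hx.2]
    calc _ ≤ (1 - x) ^ j * (2 * Real.exp (-(l * (1 - x)))) := by gcongr
      _ = _ := by ring
  refine h1.trans ?_
  rw [intervalIntegral.integral_const_mul, mul_assoc]
  gcongr
  exact exp_moment hl j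

lemma S0_le (j : ℕ) : ‖S 0‖ ≤ (j + 1) * ∫ x in (0:ℝ)..1, (1 - x) ^ j * ‖S x‖ := by
  have cS := h.cS
  have h1 : ∫ x in (0:ℝ)..1, (1 - x) ^ j * ‖S 0‖ ≤ ∫ x in (0:ℝ)..1, (1 - x) ^ j * ‖S x‖ := by
    refine int_mono' (by fun_prop) (by fun_prop) (by simp) fun x hx => ?_
    have h0 : 0 ≤ 1 - x := by linarith [hx.2]
    have := h.mono (by simp : (0:ℝ) ∈ Icc (0:ℝ) 1) hx hx.1
    simp only at this
    gcongr
  rw [intervalIntegral.integral_mul_const] at h1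
  have h2 : ∫ x in (0:ℝ)..1, (1 - x) ^ j = 1 / ((j:ℝ) + 1) := by
    rw [intervalIntegral.integral_comp_sub_left (fun x => x ^ j) 1]
    simp
  rw [h2, div_mul_eq_mul_div, one_mul, div_le_iff₀ (by positivity)] at h1
  linarith

/-- test-function identity -/
lemma test {ψ ψ1 ψ2 : ℝ → ℂ} (d0 : ∀ x, HasDerivAt ψ (ψ1 x) x) (d1 : ∀ x, HasDerivAt ψ1 (ψ2 x) x) (c2 : Continuous ψ2) :
    ∫ x in (0:ℝ)..1, ψ x * (P.d c x * S x) = -(Complex.I * ν * (ψ 1 * S1 1 - ψ1 1 + ψ1 0 * S 0 +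
      ∫ x in (0:ℝ)..1, (ψ2 x - α2 * ψ x) * S x)) := by
  have cS := h.cS
  have cS1 := h.cS1
  have cS2 := h.cS2
  have cp := cont_of_deriv d0
  have cp1 := cont_of_deriv d1
  have e1 : ∫ x in (0:ℝ)..1, ψ x * (P.d c x * S x) = ∫ x in (0:ℝ)..1, -(Complex.I * ν) * ((ψ x * S2 x - ψ2 x * S x) + (ψ2 x - α2 * ψ x) * S x) := by
    refine intervalIntegral.integral_congr fun x hx => ?_
    rw [uIcc_of_le zero_le_one] at hx
    have := h.eq x hx
    linear_combination ψ x * this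
  rw [e1, intervalIntegral.integral_const_mul, intervalIntegral.integral_add ((by fun_prop : Continuous _).intervalIntegrable _ _)
    ((by fun_prop : Continuous _).intervalIntegrable _ _)]
  have e2 := intervalIntegral.integral_eq_sub_of_hasDerivAt (a := 0) (b := 1) (f := fun x => ψ x * S1 x - ψ1 x * S x)
    (f' := fun x => ψ x * S2 x - ψ2 x * S x) (fun x _ => by
      refine (((d0 x).mul (h.dS1 x)).sub ((d1 x).mul (h.dS x))).congr_deriv ?_
      ring) ((by fun_prop : Continuous _).intervalIntegrable _ _)
  rw [e2, h.S10, h.S01]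
  ring

lemma qS_int (x : ℝ) : qS x = ∫ t in (0:ℝ)..x, P.d c t * S t := by
  have cS := h.cS
  have := intervalIntegral.integral_eq_sub_of_hasDerivAt (a := 0) (b := x) (fun y _ => h.dq y)
    ((by fun_prop : Continuous _).intervalIntegrable _ _)
  rw [this, h.q0, sub_zero]

lemma qS_one : qS 1 = -(Complex.I * ν * (S1 1 - α2 * ∫ x in (0:ℝ)..1, S x)) := by
  have := h.test (ψ := fun _ => 1) (ψ1 := fun _ => 0) (ψ2 := fun _ => 0) (fun x => hasDerivAt_const _ _) (fun x => hasDerivAt_const _ _) (by fun_prop)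
  rw [h.qS_int]
  simp only [one_mul] at this
  rw [this]
  have e : ∫ x in (0:ℝ)..1, ((0:ℂ) - α2 * 1) * S x = -(α2 * ∫ x in (0:ℝ)..1, S x) := by
    rw [intervalIntegral.integral_const_mul]; ring
  rw [e]; ring

lemma S1_close {γ : ℂ} {K : ℝ} (hK : 1 ≤ K) (hν : 0 < ν) (hV : ∀ x ∈ Icc (0:ℝ) 1, |P.V x| ≤ K * (1 - x))
    (hγ : γ ^ 2 = α2 - Complex.I * c / ν) (hre : 0 < γ.re) (h2 : ‖γ‖ ^ 2 ≤ 2 * γ.re ^ 2) (hγc : ‖c‖ ≤ ν * ‖γ‖ ^ 2) (hc : 0 < ‖c‖) :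
    ‖S1 1 - γ‖ ≤ 2 + 8 * K / ‖c‖ := by
  have cS := h.cS
  have hν' : (ν:ℂ) ≠ 0 := by exact_mod_cast hν.ne'
  let E : ℝ → ℂ := fun x => Complex.exp (-(γ * (1 - x)))
  have dE : ∀ x, HasDerivAt E (γ * E x) x := by
    intro x
    have h3 : HasDerivAt (fun x : ℝ => -(γ * (1 - (x:ℂ)))) γ x := by
      refine ((((hasDerivAt_id x).ofReal_comp.const_sub 1).const_mul γ).neg).congr_deriv ?_
      simp
    refine h3.cexp.congr_deriv ?_
    simp only [E]; ring
  have t := h.test dE (fun x => (dE x).const_mul γ) (by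
    have : Continuous E := cont_of_deriv dE
    fun_prop)
  have cE : Continuous E := cont_of_deriv dE
  have E1 : E 1 = 1 := by simp [E]
  have nE : ∀ x, ‖E x‖ = Real.exp (-(γ.re * (1 - x))) := fun x => by
    simp only [E, Complex.norm_exp]
    congr 1
    simp
  have e1 : ∫ x in (0:ℝ)..1, (γ * (γ * E x) - α2 * E x) * S x = ∫ x in (0:ℝ)..1, -(Complex.I * c / ν) * (E x * S x) := by
    refine intervalIntegral.integral_congr fun x _ => ?_
    linear_combination E x * S x * hγ
  have e2 : ∫ x in (0:ℝ)..1, E x * (P.d c x * S x) = (∫ x in (0:ℝ)..1, E x * (P.V x * S x)) - c * ∫ x in (0:ℝ)..1, E x * S x := by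
    rw [← intervalIntegral.integral_const_mul, ← intervalIntegral.integral_sub ((by fun_prop : Continuous _).intervalIntegrable _ _)
      ((by fun_prop : Continuous _).intervalIntegrable _ _)]
    refine intervalIntegral.integral_congr fun x _ => ?_
    simp only [Prof.d]; ring
  rw [e1, e2, intervalIntegral.integral_const_mul, E1] at t
  have t2 : S1 1 - γ = -(γ * E 0 * S 0) + Complex.I / ν * ∫ x in (0:ℝ)..1, E x * (P.V x * S x) := by
    have hI := Complex.I_sq
    have hn : (ν:ℂ) * (ν:ℂ)⁻¹ = 1 := mul_inv_cancel₀ hν'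
    rw [div_eq_mul_inv] at t ⊢
    generalize (∫ x in (0:ℝ)..1, E x * S x) = Y at t ⊢
    generalize (∫ x in (0:ℝ)..1, E x * (P.V x * S x)) = X at t ⊢
    have t3 : X = -(Complex.I * ν * (S1 1 - γ + γ * E 0 * S 0)) := by
      linear_combination t + c * Y * (ν:ℂ) * (ν:ℂ)⁻¹ * hI - c * Y * hn
    rw [t3]
    linear_combination (-(S1 1 - γ + γ * E 0 * S 0)) * hn + (ν:ℂ) * (ν:ℂ)⁻¹ * (S1 1 - γ + γ * E 0 * S 0) * hI
  have b1 : ‖γ * E 0 * S 0‖ ≤ 2 := by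
    rw [norm_mul, norm_mul, nE]
    have s0 := h.le_one (x := 0) (by simp)
    have r1 : ‖γ‖ ≤ 2 * γ.re := by nlinarith [norm_nonneg γ]
    have r2 : γ.re * Real.exp (-(γ.re * (1 - 0))) ≤ 1 := by
      rw [sub_zero, mul_one, Real.exp_neg, ← div_eq_mul_inv, div_le_one (Real.exp_pos _)]
      linarith [Real.add_one_le_exp γ.re]
    have := (Real.exp_pos (-(γ.re * (1 - 0)))).le
    calc _ ≤ (2 * γ.re) * Real.exp (-(γ.re * (1 - 0))) * 1 := by gcongr
      _ ≤ 2 := by linarith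
  have b2 : ‖∫ x in (0:ℝ)..1, E x * (P.V x * S x)‖ ≤ K * (4 / γ.re ^ 2) := by
    refine (intervalIntegral.norm_integral_le_integral_norm zero_le_one).trans ?_
    have : ∫ x in (0:ℝ)..1, ‖E x * (P.V x * S x)‖ ≤ ∫ x in (0:ℝ)..1, K * ((1 - x) ^ 1 * Real.exp (-(γ.re * (1 - x)))) := by
      refine int_mono' (by fun_prop) (by fun_prop) (by simp) fun x hx => ?_
      rw [norm_mul, norm_mul, nE, Complex.norm_real, Real.norm_eq_abs, pow_one]
      have s0 := h.le_one hx
      have := hV x hx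
      have h0 : 0 ≤ 1 - x := by linarith [hx.2]
      calc _ ≤ Real.exp (-(γ.re * (1 - x))) * ((K * (1 - x)) * 1) := by gcongr
        _ = _ := by ring
    refine this.trans ?_
    rw [intervalIntegral.integral_const_mul]
    gcongr
    refine (exp_moment hre 1).trans (le_of_eq ?_)
    simp; ring
  have b3 : ‖Complex.I / ν * ∫ x in (0:ℝ)..1, E x * (P.V x * S x)‖ ≤ 8 * K / ‖c‖ := by
    rw [norm_mul, norm_div, Complex.norm_I, Complex.norm_real, Real.norm_of_nonneg hν.le]
    calc _ ≤ 1 / ν * (K * (4 / γ.re ^ 2)) := by gcongr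
      _ = 4 * K / (ν * γ.re ^ 2) := by field_simp
      _ ≤ 4 * K / (‖c‖ / 2) := by
        gcongr
        nlinarith
      _ = _ := by field_simp; ring
  rw [t2]
  refine (norm_add_le _ _).trans ?_
  rw [norm_neg]
  linarith

lemma int_S_le : ‖∫ x in (0:ℝ)..1, S x‖ ≤ 1 := by
  have := intervalIntegral.norm_integral_le_of_norm_le_const (a := 0) (b := 1) (f := S) (C := 1) (fun x hx => by
    rw [uIoc_of_le zero_le_one] at hx
    exact h.le_one ⟨hx.1.le, hx.2⟩)
  simpa using this

set_option maxHeartbeats 1600000 in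
lemma toSH {K M μ : ℝ} (hK : 1 ≤ K) (hM : 1 ≤ M) (hμ : 0 < μ) (hν : 0 < ν) (hV : ∀ x ∈ Icc (0:ℝ) 1, |P.V x| ≤ K * (1 - x))
    (hα : 0 ≤ α2) (hα1 : α2 ≤ 1) (hl : 0 < l) (hlc : 2 * l ^ 2 * ν = c.im) (hcM : ‖c‖ ≤ M * μ) (hci : μ ≤ M * c.im)
    (hνμ : ν ≤ M * μ ^ 3) (hc1 : ‖c‖ ≤ 1) (hνc : (128 * K) ^ 2 * ν ≤ ‖c‖ ^ 3) :
    SH P (7000 * K * M ^ 4) μ ν α2 c S S1 S2 qS := by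
  have cS := h.cS
  have him : 0 < c.im := by
    by_contra h'
    push Not at h'
    nlinarith
  have hc0 : 0 < ‖c‖ := lt_of_lt_of_le him ((le_abs_self _).trans (Complex.abs_im_le_norm c))
  have hν' : (ν:ℂ) ≠ 0 := by exact_mod_cast hν.ne'
  have wre : ((α2:ℂ) - Complex.I * c / ν).re = α2 + c.im / ν := by
    rw [Complex.sub_re, Complex.div_ofReal_re]; simp; ring
  have wim : ((α2:ℂ) - Complex.I * c / ν).im = -(c.re / ν) := by
    rw [Complex.sub_im, Complex.div_ofReal_im]; simp
  obtain ⟨γ, hγ, hre, h2⟩ := exists_root ((α2:ℂ) - Complex.I * c / ν) (by rw [wre]; positivity)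
  have hγc : ‖c‖ ≤ ν * ‖γ‖ ^ 2 := by
    rw [← norm_pow, hγ]
    have : ‖c / ν‖ ^ 2 ≤ ‖(α2:ℂ) - Complex.I * c / ν‖ ^ 2 := by
      rw [Complex.sq_norm, Complex.sq_norm, Complex.normSq_apply, Complex.normSq_apply, wre, wim, Complex.div_ofReal_re, Complex.div_ofReal_im]
      have : 0 ≤ c.im / ν := by positivity
      nlinarith
    have := le_of_sq_le_sq this (norm_nonneg _)
    rw [norm_div, Complex.norm_real, Real.norm_of_nonneg hν.le, div_le_iff₀ hν] at this
    linarith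
  have close := h.S1_close hK hν hV hγ hre h2 hγc hc0
  have g0 := norm_nonneg γ
  have g1 : 128 * K / ‖c‖ ≤ ‖γ‖ := by
    refine le_of_sq_le_sq ?_ g0
    rw [div_pow, div_le_iff₀ (by positivity)]
    refine le_of_mul_le_mul_left ?_ hν
    calc ν * (128 * K) ^ 2 ≤ ‖c‖ ^ 3 := by linarith
      _ = ‖c‖ * ‖c‖ ^ 2 := by ring
      _ ≤ (ν * ‖γ‖ ^ 2) * ‖c‖ ^ 2 := by gcongr
      _ = _ := by ring
  have g2 : 128 ≤ ‖γ‖ := by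
    refine le_trans ?_ g1
    rw [le_div_iff₀ hc0]; nlinarith
  have q1 : ν * ‖γ‖ / 2 ≤ ‖qS 1‖ := by
    rw [h.qS_one, norm_neg, norm_mul, norm_mul, Complex.norm_I, one_mul, Complex.norm_real, Real.norm_of_nonneg hν.le, mul_div_assoc]
    gcongr
    have i1 : ‖(α2:ℂ) * ∫ x in (0:ℝ)..1, S x‖ ≤ 1 := by
      rw [norm_mul, Complex.norm_real, Real.norm_of_nonneg hα]
      have := h.int_S_le
      nlinarith [norm_nonneg (∫ x in (0:ℝ)..1, S x)]
    have i2 : ‖γ‖ ≤ ‖S1 1 - α2 * ∫ x in (0:ℝ)..1, S x‖ + ‖S1 1 - γ‖ + ‖(α2:ℂ) * ∫ x in (0:ℝ)..1, S x‖ := by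
      have := norm_add₃_le (a := S1 1 - α2 * ∫ x in (0:ℝ)..1, S x) (b := -(S1 1 - γ)) (c := (α2:ℂ) * ∫ x in (0:ℝ)..1, S x)
      rw [norm_neg] at this
      refine le_trans (le_of_eq ?_) this
      congr 1; ring
    have i3 : 8 * K / ‖c‖ = (128 * K / ‖c‖) / 16 := by ring
    linarith
  set L := 1 / l with hL
  have hL0 : 0 < L := by positivity
  have hLl : L * l = 1 := by rw [hL]; field_simp
  have hLν : 2 * ν = c.im * L ^ 2 := by
    rw [← hlc, hL]; field_simp
  have L2 : L ≤ 2 * M * μ := by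
    refine le_of_sq_le_sq ?_ (by positivity)
    refine le_of_mul_le_mul_left ?_ him
    calc c.im * L ^ 2 = 2 * ν := hLν.symm
      _ ≤ 2 * (M * μ ^ 2 * μ) := by nlinarith
      _ ≤ 2 * (M * μ ^ 2 * (M * c.im)) := by gcongr
      _ = 2 * (c.im * (M * μ) ^ 2) := by ring
      _ ≤ 4 * (c.im * (M * μ) ^ 2) := by gcongr; norm_num
      _ = _ := by ring
  have L3 : μ * L ≤ 4 * M * ‖qS 1‖ := by
    have : μ * L ≤ 2 * M * (ν * ‖γ‖) := by
      refine le_of_sq_le_sq ?_ (by positivity)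
      have u1 : c.im ≤ ‖c‖ := (le_abs_self _).trans (Complex.abs_im_le_norm c)
      have u2 : c.im * ν ≤ (ν * ‖γ‖) ^ 2 := by
        calc c.im * ν ≤ ‖c‖ * ν := by gcongr
          _ ≤ (ν * ‖γ‖ ^ 2) * ν := by gcongr
          _ = _ := by ring
      calc (μ * L) ^ 2 = μ ^ 2 * L ^ 2 := by ring
        _ ≤ (M * c.im) ^ 2 * L ^ 2 := by gcongr
        _ = M ^ 2 * c.im * (c.im * L ^ 2) := by ring
        _ = 2 * M ^ 2 * (c.im * ν) := by rw [← hLν]; ring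
        _ ≤ 2 * M ^ 2 * (ν * ‖γ‖) ^ 2 := by gcongr
        _ ≤ _ := by nlinarith [sq_nonneg (M * (ν * ‖γ‖))]
    nlinarith
  refine ⟨h.dS, h.dS1, h.cS2, h.eq, h.S10, h.S01, h.dq, h.q0, fun x hx => ?_⟩
  have y0 : 0 ≤ 1 - x := by linarith [hx.2]
  have main : ((1 - x) ^ 2 + μ ^ 2) * ‖qS x‖ ≤ ∫ t in (0:ℝ)..1, (K * ((1 - t) ^ 3 * ‖S t‖) + K * μ ^ 2 * ((1 - t) ^ 1 * ‖S t‖) +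
      (M * μ) * ((1 - t) ^ 2 * ‖S t‖) + (M * μ ^ 3) * ((1 - t) ^ 0 * ‖S t‖)) := by
    rw [h.qS_int]
    have k1 := intervalIntegral.norm_integral_le_integral_norm (f := fun t => P.d c t * S t) (μ := volume) hx.1
    calc _ ≤ ((1 - x) ^ 2 + μ ^ 2) * ∫ t in (0:ℝ)..x, ‖P.d c t * S t‖ := by gcongr
      _ = ∫ t in (0:ℝ)..x, ((1 - x) ^ 2 + μ ^ 2) * ‖P.d c t * S t‖ := by rw [intervalIntegral.integral_const_mul]
      _ ≤ ∫ t in (0:ℝ)..x, (K * ((1 - t) ^ 3 * ‖S t‖) + K * μ ^ 2 * ((1 - t) ^ 1 * ‖S t‖) +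
      (M * μ) * ((1 - t) ^ 2 * ‖S t‖) + (M * μ ^ 3) * ((1 - t) ^ 0 * ‖S t‖)) := by
        refine int_mono' (by fun_prop) (by fun_prop) hx fun t ht => ?_
        have ht' : t ∈ Icc (0:ℝ) 1 := ⟨ht.1, ht.2.trans hx.2⟩
        have dn : ‖P.d c t‖ ≤ K * (1 - t) + M * μ := by
          have := norm_sub_le (P.V t : ℂ) c
          rw [Complex.norm_real, Real.norm_eq_abs] at this
          have := hV t ht'
          unfold Prof.d; linarith
        have t0 : 0 ≤ 1 - t := by linarith [ht'.2]
        have t1 : 1 - x ≤ 1 - t := by linarith [ht.2]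
        rw [norm_mul]
        calc _ ≤ ((1 - t) ^ 2 + μ ^ 2) * ((K * (1 - t) + M * μ) * ‖S t‖) := by gcongr
          _ = _ := by ring
      _ ≤ _ := by
        refine int_mono_right (by fun_prop) (fun t ht => ?_) hx.1 hx.2 le_rfl
        have t0 : 0 ≤ 1 - t := by linarith [ht.2]
        positivity
  have sp : ∫ t in (0:ℝ)..1, (K * ((1 - t) ^ 3 * ‖S t‖) + K * μ ^ 2 * ((1 - t) ^ 1 * ‖S t‖) +
      (M * μ) * ((1 - t) ^ 2 * ‖S t‖) + (M * μ ^ 3) * ((1 - t) ^ 0 * ‖S t‖)) =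
      K * (∫ t in (0:ℝ)..1, (1 - t) ^ 3 * ‖S t‖) + K * μ ^ 2 * (∫ t in (0:ℝ)..1, (1 - t) ^ 1 * ‖S t‖) +
      M * μ * (∫ t in (0:ℝ)..1, (1 - t) ^ 2 * ‖S t‖) + M * μ ^ 3 * (∫ t in (0:ℝ)..1, (1 - t) ^ 0 * ‖S t‖) := by
    rw [intervalIntegral.integral_add, intervalIntegral.integral_add, intervalIntegral.integral_add,
      intervalIntegral.integral_const_mul, intervalIntegral.integral_const_mul, intervalIntegral.integral_const_mul, intervalIntegral.integral_const_mul]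
    all_goals exact (by fun_prop : Continuous _).intervalIntegrable _ _
  rw [sp] at main
  have m0 := h.moment hl 0
  have m1 := h.moment hl 1
  have m2 := h.moment hl 2
  have m3 := h.moment hl 3
  have eL : 2 / l = 2 * L := by rw [hL]; ring
  rw [eL] at m0 m1 m2 m3
  norm_num [Nat.factorial] at m0 m1 m2 m3
  have fin : ((1 - x) ^ 2 + μ ^ 2) * ‖qS x‖ ≤ 1684 * K * M ^ 3 * μ ^ 2 * (μ * L) := by
    have M3 : M ≤ M ^ 3 := by simpa using pow_le_pow_right₀ hM (by norm_num : 1 ≤ 3)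
    have p2 : L ^ 2 ≤ 2 * M * μ * L := by nlinarith
    have p3 : L ^ 3 ≤ 4 * M ^ 2 * μ ^ 2 * L := by
      calc L ^ 3 = L ^ 2 * L := by ring
        _ ≤ (2 * M * μ) ^ 2 * L := by gcongr
        _ = _ := by ring
    have p4 : L ^ 4 ≤ 8 * M ^ 3 * μ ^ 3 * L := by
      calc L ^ 4 = L ^ 3 * L := by ring
        _ ≤ (2 * M * μ) ^ 3 * L := by gcongr
        _ = _ := by ring
    calc _ ≤ K * (192 * (8 * M ^ 3 * μ ^ 3 * L)) + K * μ ^ 2 * (8 * (2 * M ^ 3 * μ * L)) +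
          M * μ * (32 * (4 * M ^ 2 * μ ^ 2 * L)) + M ^ 3 * μ ^ 3 * (4 * L) := by
          refine main.trans ?_
          simp only [pow_one, pow_zero, one_mul]
          gcongr
          · refine m3.trans ?_; nlinarith
          · refine m1.trans ?_
            have : M * (μ * L) ≤ M ^ 3 * (μ * L) := by gcongr
            nlinarith
          · refine m2.trans ?_; nlinarith
          · exact intervalIntegral.integral_nonneg zero_le_one fun t _ => norm_nonneg _
          · linarith
      _ = K * (1552 * M ^ 3 * μ ^ 3 * L) + 1 * (132 * M ^ 3 * μ ^ 3 * L) := by ring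
      _ ≤ K * (1552 * M ^ 3 * μ ^ 3 * L) + K * (132 * M ^ 3 * μ ^ 3 * L) := by gcongr
      _ = _ := by ring
  unfold ps
  rw [mul_div_assoc', div_mul_eq_mul_div, le_div_iff₀ (by positivity)]
  calc _ = ((1 - x) ^ 2 + μ ^ 2) * ‖qS x‖ := by ring
    _ ≤ 1684 * K * M ^ 3 * μ ^ 2 * (4 * M * ‖qS 1‖) := fin.trans (by gcongr)
    _ = 6736 * (K * M ^ 4 * μ ^ 2 * ‖qS 1‖) := by ring
    _ ≤ 7000 * (K * M ^ 4 * μ ^ 2 * ‖qS 1‖) := by gcongr; norm_num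
    _ = _ := by ring

end WallSol
end OS

end

noncomputable section
open Filter Topology MeasureTheory Set ComplexConjugate
namespace OS

structure ZD (P : Prof) (T : Finset ℝ) (ord : ℝ → ℕ) (b : ℝ → ℝ) (c0 : ℝ) : Prop where
  Tsub : ∀ t ∈ T, t ∈ Icc (0:ℝ) 1
  ord1 : ord 1 = 1
  bne : ∀ x ∈ Icc (0:ℝ) 1, b x ≠ 0
  lim : ∀ x ∈ Icc (0:ℝ) 1, Tendsto (fun y => P.V y / (y - x) ^ ord x) (𝓝[≠] x) (𝓝 (b x))
  c0pos : 0 < c0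
  c1 : c0 ≤ 1
  cover : ∀ x ∈ Icc (0:ℝ) 1, ∃ t ∈ T, c0 * |x - t| ^ ord t ≤ |P.V x|

lemma loc_order (P : Prof) : ∀ x : ℝ, ∃ k : ℕ, ∃ b : ℝ, x ∈ Icc (0:ℝ) 1 → b ≠ 0 ∧
    Tendsto (fun y => P.V y / (y - x) ^ k) (𝓝[≠] x) (𝓝 b) ∧ (x = 1 → k = 1) := by
  have hd1 : Tendsto (fun y => P.V y / (y - 1) ^ 1) (𝓝[≠] 1) (𝓝 (-P.a)) := by
    have := (P.dV 1).tendsto_slope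
    rw [P.V11] at this
    refine this.congr fun y => ?_
    rw [slope_def_field, P.V01, sub_zero, pow_one]
  intro x
  by_cases hx1 : x = 1
  · refine ⟨1, -P.a, fun _ => ⟨by linarith [P.a_pos] |> fun h : (-P.a) < 0 => h.ne, ?_, fun _ => rfl⟩⟩
    rw [hx1]; exact hd1
  by_cases hx : x ∈ Icc (0:ℝ) 1
  swap
  · exact ⟨0, 0, fun h => absurd h hx⟩
  have an := P.an x hx
  have nz : ¬ ∀ᶠ y in 𝓝 x, P.V y = 0 := by
    intro h
    have h0 := P.an.eqOn_zero_of_preconnected_of_eventuallyEq_zero (isPreconnected_Icc) hx h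
    have h1 : Tendsto (fun y => P.V y / (y - 1) ^ 1) (𝓝[<] 1) (𝓝 (-P.a)) :=
      hd1.mono_left (nhdsWithin_mono _ fun y hy => ne_of_lt hy)
    have h2 : Tendsto (fun y => P.V y / (y - 1) ^ 1) (𝓝[<] 1) (𝓝 0) := by
      refine tendsto_const_nhds.congr' ?_
      have : Ioo (0:ℝ) 1 ∈ 𝓝[<] (1:ℝ) := Ioo_mem_nhdsLT zero_lt_one
      filter_upwards [this] with y hy
      rw [h0 (Ioo_subset_Icc_self hy)]; simp
    have := tendsto_nhds_unique h1 h2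
    linarith [P.a_pos]
  obtain ⟨n, g, hg, hg0, he⟩ := (an.exists_eventuallyEq_pow_smul_nonzero_iff).2 nz
  refine ⟨n, g x, fun _ => ⟨hg0, ?_, fun h => absurd h hx1⟩⟩
  have : Tendsto g (𝓝[≠] x) (𝓝 (g x)) := hg.continuousAt.tendsto.mono_left nhdsWithin_le_nhds
  refine this.congr' ?_
  filter_upwards [nhdsWithin_le_nhds he, self_mem_nhdsWithin] with y hy hyx
  have : y - x ≠ 0 := sub_ne_zero.2 hyx
  rw [hy, smul_eq_mul]; field_simp

lemma exists_ZD (P : Prof) : ∃ T ord b c0, ZD P T ord b c0 := by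
  choose ord b h using loc_order P
  have loc : ∀ x ∈ Icc (0:ℝ) 1, ∃ c > 0, ∀ᶠ y in 𝓝 x, c * |y - x| ^ ord x ≤ |P.V y| := by
    intro x hx
    obtain ⟨hb, hl, _⟩ := h x hx
    have hb' := abs_pos.2 hb
    refine ⟨|b x| / 2, by positivity, ?_⟩
    have e1 : ∀ᶠ y in 𝓝[≠] x, |b x| / 2 * |y - x| ^ ord x ≤ |P.V y| := by
      have := (hl.abs).eventually_const_lt (by linarith : |b x| / 2 < |b x|)
      filter_upwards [this, self_mem_nhdsWithin] with y hy hyx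
      have : 0 < |y - x| := abs_pos.2 (sub_ne_zero.2 hyx)
      rw [abs_div, abs_pow, lt_div_iff₀ (by positivity)] at hy
      exact hy.le
    rw [eventually_nhdsWithin_iff] at e1
    have cc : ContinuousWithinAt (fun y => |P.V y| - |b x| / 2 * |y - x| ^ ord x) {x}ᶜ x := by
      have : Continuous P.V := cont_of_deriv P.dV
      exact (by fun_prop : Continuous fun y => |P.V y| - |b x| / 2 * |y - x| ^ ord x).continuousWithinAt
    have ex : |b x| / 2 * |x - x| ^ ord x ≤ |P.V x| := by
      have := ge_of_tendsto cc.tendsto (b := 0) (by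
        rw [eventually_nhdsWithin_iff]
        filter_upwards [e1] with y hy hyx
        linarith [hy hyx])
      linarith
    filter_upwards [e1] with y hy
    by_cases hyx : y = x
    · rw [hyx]; exact ex
    · exact hy hyx
  choose! c hc he using loc
  obtain ⟨T, hT, hcov⟩ := isCompact_Icc.elim_nhds_subcover (s := Icc (0:ℝ) 1) (fun x => {y | c x * |y - x| ^ ord x ≤ |P.V y|}) (fun x hx => he x hx)
  have hmin : ∃ c0 > 0, c0 ≤ 1 ∧ ∀ t ∈ T, c0 ≤ c t := by
    clear hcov
    induction T using Finset.induction_on with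
    | empty => exact ⟨1, by norm_num, le_rfl, by simp⟩
    | insert t T _ ih =>
      obtain ⟨c0, h0, h1, h2⟩ := ih fun x hx => hT x (Finset.mem_insert_of_mem hx)
      refine ⟨min c0 (c t), lt_min h0 (hc t (hT t (Finset.mem_insert_self _ _))), (min_le_left _ _).trans h1, fun s hs => ?_⟩
      rcases Finset.mem_insert.1 hs with rfl | hs
      · exact min_le_right _ _
      · exact (min_le_left _ _).trans (h2 s hs)
  obtain ⟨c0, h0, h1, h2⟩ := hmin
  refine ⟨T, ord, b, c0, hT, (h 1 (by simp)).2.2 rfl, fun x hx => (h x hx).1, fun x hx => (h x hx).2.1, h0, h1, fun x hx => ?_⟩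
  obtain ⟨t, ht, hxt⟩ := mem_iUnion₂.1 (hcov hx)
  refine ⟨t, ht, le_trans ?_ hxt⟩
  gcongr
  exact h2 t ht

/-- integrability of the basic bump -/
lemma bump_integrable {k : ℕ} (hk : 1 ≤ k) : Integrable (fun r : ℝ => 1 / (r ^ (2 * k) + 1)) := by
  refine Integrable.mono' (g := fun r => 2 * (1 + r ^ 2)⁻¹) (integrable_inv_one_add_sq.const_mul 2) ?_ (ae_of_all _ fun r => ?_)
  · refine Continuous.aestronglyMeasurable (Continuous.div (by fun_prop) (by fun_prop) fun r => ?_)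
    have : 0 ≤ r ^ (2 * k) := by rw [pow_mul]; positivity
    positivity
  have h0 : 0 ≤ r ^ (2 * k) := by rw [pow_mul]; positivity
  rw [Real.norm_of_nonneg (by positivity), ← div_eq_mul_inv, div_le_div_iff₀ (by positivity) (by positivity)]
  have h1 : r ^ 2 ≤ r ^ (2 * k) + 1 := by
    rw [pow_mul]
    rcases le_total (r ^ 2) 1 with h | h
    · have : 0 ≤ (r ^ 2) ^ k := by positivity
      linarith
    · have := le_self_pow₀ h (by omega : k ≠ 0)
      linarith
  linarith

lemma bump_scale {k : ℕ} (hk : 1 ≤ k) {μ : ℝ} (hμ : 0 < μ) (t : ℝ) :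
    ∫ x : ℝ, 1 / ((x - t) ^ (2 * k) + μ ^ 2) = (∫ r : ℝ, 1 / (r ^ (2 * k) + 1)) * μ ^ ((1:ℝ) / k - 2) ∧
    Integrable (fun x : ℝ => 1 / ((x - t) ^ (2 * k) + μ ^ 2)) := by
  set e := μ ^ ((1:ℝ) / k) with he
  have e0 : 0 < e := by positivity
  have ek : e ^ k = μ := by
    rw [he, ← Real.rpow_natCast, ← Real.rpow_mul hμ.le, one_div_mul_cancel (by positivity), Real.rpow_one]
  have key : (fun x : ℝ => 1 / ((x - t) ^ (2 * k) + μ ^ 2)) = fun x => (fun y => (fun r => (1 / μ ^ 2) * (1 / (r ^ (2 * k) + 1))) (e⁻¹ * y)) (x - t) := by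
    ext x
    simp only
    rw [mul_pow, inv_pow, pow_mul' e 2 k, ek]
    have : 0 ≤ (x - t) ^ (2 * k) := by rw [pow_mul]; positivity
    field_simp
  constructor
  · rw [key, integral_sub_right_eq_self (fun y => (fun r => (1 / μ ^ 2) * (1 / (r ^ (2 * k) + 1))) (e⁻¹ * y)) t,
      Measure.integral_comp_mul_left (fun r : ℝ => (1 / μ ^ 2) * (1 / (r ^ (2 * k) + 1))) e⁻¹, integral_const_mul, inv_inv, abs_of_pos e0, smul_eq_mul,
      Real.rpow_sub hμ, Real.rpow_two, ← he]
    field_simp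
  · rw [key]
    exact (((bump_integrable hk).const_mul _).comp_mul_left' (by positivity)).comp_sub_right t

lemma bump_le {k : ℕ} (hk : 1 ≤ k) {μ : ℝ} (hμ : 0 < μ) (t : ℝ) :
    ∫ x in (0:ℝ)..1, 1 / ((x - t) ^ (2 * k) + μ ^ 2) ≤ (∫ r : ℝ, 1 / (r ^ (2 * k) + 1)) * μ ^ ((1:ℝ) / k - 2) := by
  obtain ⟨h1, h2⟩ := bump_scale hk hμ t
  rw [← h1, intervalIntegral.integral_of_le zero_le_one]
  refine setIntegral_le_integral h2 (ae_of_all _ fun x => ?_)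
  have : 0 ≤ (x - t) ^ (2 * k) := by rw [pow_mul]; positivity
  simp only [Pi.zero_apply]
  positivity

end OS

end

noncomputable section
open Filter Topology MeasureTheory Set ComplexConjugate
namespace OS

namespace ZD
variable {P : Prof} {T : Finset ℝ} {ord : ℝ → ℕ} {b : ℝ → ℝ} {c0 : ℝ} (z : ZD P T ord b c0)
include z

lemma w2_ge {μ x : ℝ} (hx : x ∈ Icc (0:ℝ) 1) : ∃ t ∈ T, c0 ^ 2 * ((x - t) ^ (2 * ord t) + μ ^ 2) ≤ w2 P μ x := by
  obtain ⟨t, ht, h⟩ := z.cover x hx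
  refine ⟨t, ht, ?_⟩
  unfold w2
  have h0 := z.c0pos
  have h1 := z.c1
  have e : (x - t) ^ (2 * ord t) = (|x - t| ^ ord t) ^ 2 := by
    rw [← pow_mul, mul_comm (ord t), pow_mul, pow_mul, sq_abs]
  have : (c0 * |x - t| ^ ord t) ^ 2 ≤ P.V x ^ 2 := by
    rw [← sq_abs (P.V x)]; gcongr
  rw [e]
  have : c0 ^ 2 * μ ^ 2 ≤ 1 * μ ^ 2 := by gcongr; nlinarith
  nlinarith

omit z in
lemma pow_anti {x t : ℝ} (hx : x ∈ Icc (0:ℝ) 1) (ht : t ∈ Icc (0:ℝ) 1) {i j : ℕ} (h : i ≤ j) :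
    (x - t) ^ (2 * j) ≤ (x - t) ^ (2 * i) := by
  rw [pow_mul, pow_mul]
  refine pow_le_pow_of_le_one (by positivity) ?_ h
  rw [sq_le_one_iff_abs_le_one, abs_le]
  constructor <;> linarith [hx.1, hx.2, ht.1, ht.2]

omit z in
lemma even_pos {x t μ : ℝ} (hμ : 0 < μ) (j : ℕ) : 0 < (x - t) ^ (2 * j) + μ ^ 2 := by
  have : 0 ≤ (x - t) ^ (2 * j) := by rw [pow_mul]; positivity
  positivity

lemma inv_w2_le {k : ℕ} (hk : ∀ t ∈ T, ord t ≤ k) {μ x : ℝ} (hμ : 0 < μ) (hx : x ∈ Icc (0:ℝ) 1) :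
    1 / w2 P μ x ≤ ∑ t ∈ T, (c0 ^ 2)⁻¹ * (1 / ((x - t) ^ (2 * k) + μ ^ 2)) := by
  obtain ⟨t, ht, h⟩ := z.w2_ge (μ := μ) hx
  have h0 := z.c0pos
  have h1 := pow_anti hx (z.Tsub t ht) (hk t ht)
  have p := even_pos (x := x) (t := t) hμ k
  calc 1 / w2 P μ x ≤ 1 / (c0 ^ 2 * ((x - t) ^ (2 * k) + μ ^ 2)) := by
        refine one_div_le_one_div_of_le (by positivity) (le_trans ?_ h)
        gcongr
    _ = (c0 ^ 2)⁻¹ * (1 / ((x - t) ^ (2 * k) + μ ^ 2)) := by field_simp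
    _ ≤ _ := Finset.single_le_sum (f := fun t => (c0 ^ 2)⁻¹ * (1 / ((x - t) ^ (2 * k) + μ ^ 2))) (fun s _ => by
        have := even_pos (x := x) (t := s) hμ k
        positivity) ht

lemma ee_w2_le {k : ℕ} (hk : ∀ t ∈ T, t ≠ 0 → ord t ≤ k) {μ x : ℝ} (hμ : 0 < μ) (hμ1 : μ ≤ 1) (hx : x ∈ Icc (0:ℝ) 1) :
    ee (ord 0) μ x / w2 P μ x ≤ (c0 ^ 2)⁻¹ + ∑ t ∈ T, (2 * (c0 ^ 2)⁻¹) * (1 / ((x - t) ^ (2 * k) + μ ^ 2)) := by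
  obtain ⟨t, ht, h⟩ := z.w2_ge (μ := μ) hx
  have h0 := z.c0pos
  have hw := w2_pos (P := P) hμ x
  have sn : 0 ≤ ∑ t ∈ T, (2 * (c0 ^ 2)⁻¹) * (1 / ((x - t) ^ (2 * k) + μ ^ 2)) := Finset.sum_nonneg fun s _ => by
    have := even_pos (x := x) (t := s) hμ k
    positivity
  by_cases t0 : t = 0
  · subst t0
    have : ee (ord 0) μ x / w2 P μ x ≤ (c0 ^ 2)⁻¹ := by
      rw [div_le_iff₀ hw, inv_mul_eq_div, le_div_iff₀ (by positivity)]
      unfold ee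
      rw [sub_zero] at h
      linarith
    linarith
  · have h1 := pow_anti hx (z.Tsub t ht) (hk t ht t0)
    have p := even_pos (x := x) (t := t) hμ k
    have e2 : ee (ord 0) μ x ≤ 2 := by
      unfold ee
      have := pow_le_one₀ hx.1 hx.2 (n := 2 * ord 0)
      nlinarith
    have : 1 / w2 P μ x ≤ 1 / (c0 ^ 2 * ((x - t) ^ (2 * k) + μ ^ 2)) := by
        refine one_div_le_one_div_of_le (by positivity) (le_trans ?_ h)
        gcongr
    calc ee (ord 0) μ x / w2 P μ x = ee (ord 0) μ x * (1 / w2 P μ x) := by ring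
      _ ≤ 2 * (1 / (c0 ^ 2 * ((x - t) ^ (2 * k) + μ ^ 2))) := by gcongr
      _ = (2 * (c0 ^ 2)⁻¹) * (1 / ((x - t) ^ (2 * k) + μ ^ 2)) := by field_simp
      _ ≤ _ := Finset.single_le_sum (f := fun t => (2 * (c0 ^ 2)⁻¹) * (1 / ((x - t) ^ (2 * k) + μ ^ 2))) (fun s _ => by
        have := even_pos (x := x) (t := s) hμ k
        positivity) ht
      _ ≤ _ := by linarith [inv_pos.2 (pow_pos h0 2)]

lemma ps_w2_le : ∃ C, 0 ≤ C ∧ ∀ μ x, 0 < μ → μ ≤ 1 → x ∈ Icc (0:ℝ) 1 →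
    ps μ x / w2 P μ x ≤ C + (c0 ^ 2)⁻¹ * (μ ^ 2 / ((1 - x) ^ 2 + μ ^ 2) ^ 2) := by
  have h0 := z.c0pos
  let D : ℝ → ℝ := fun t => 4 / (1 - t) ^ 2 + 1 / (c0 ^ 2 * ((1 - t) / 2) ^ (2 * ord t))
  have D0 : ∀ t, 0 ≤ D t := fun t => by
    have : 0 ≤ ((1 - t) / 2) ^ (2 * ord t) := by rw [pow_mul]; positivity
    positivity
  refine ⟨∑ t ∈ T, D t, Finset.sum_nonneg fun t _ => D0 t, fun μ x hμ hμ1 hx => ?_⟩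
  obtain ⟨t, ht, h⟩ := z.w2_ge (μ := μ) hx
  have hw := w2_pos (P := P) hμ x
  by_cases t1 : t = 1
  · have s0 : 0 ≤ ∑ t ∈ T, D t := Finset.sum_nonneg fun t _ => D0 t
    subst t1
    rw [z.ord1] at h
    have : ps μ x / w2 P μ x ≤ (c0 ^ 2)⁻¹ * (μ ^ 2 / ((1 - x) ^ 2 + μ ^ 2) ^ 2) := by
      unfold ps
      calc μ ^ 2 / ((1 - x) ^ 2 + μ ^ 2) / w2 P μ x ≤ μ ^ 2 / ((1 - x) ^ 2 + μ ^ 2) / (c0 ^ 2 * ((1 - x) ^ 2 + μ ^ 2)) := by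
            gcongr
            refine le_trans (le_of_eq ?_) h
            ring
        _ = _ := by field_simp
    linarith
  · have tI := z.Tsub t ht
    have tl : 0 < 1 - t := by
      have := lt_of_le_of_ne tI.2 t1; linarith
    have : ps μ x / w2 P μ x ≤ D t := by
      rcases le_total ((1 - t) / 2) (1 - x) with hh | hh
      · have : ps μ x / w2 P μ x ≤ 4 / (1 - t) ^ 2 := by
          have a1 : ps μ x ≤ μ ^ 2 * (4 / (1 - t) ^ 2) := by
            unfold ps
            rw [mul_div_assoc', div_le_div_iff₀ (by positivity) (by positivity)]
            have : ((1 - t) / 2) ^ 2 ≤ (1 - x) ^ 2 := by gcongr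
            have q : (1 - t) ^ 2 ≤ 4 * ((1 - x) ^ 2 + μ ^ 2) := by nlinarith
            calc μ ^ 2 * (1 - t) ^ 2 ≤ μ ^ 2 * (4 * ((1 - x) ^ 2 + μ ^ 2)) := by gcongr
              _ = _ := by ring
          have a2 : μ ^ 2 ≤ w2 P μ x := by unfold w2; nlinarith [sq_nonneg (P.V x)]
          rw [div_le_iff₀ hw]
          refine a1.trans ?_
          rw [mul_comm]
          gcongr
        have : 0 ≤ 1 / (c0 ^ 2 * ((1 - t) / 2) ^ (2 * ord t)) := by positivity
        simp only [D]; linarith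
      · have q1 : ((1 - t) / 2) ^ (2 * ord t) ≤ (x - t) ^ (2 * ord t) := by
          refine pow_le_pow_left₀ (by positivity) ?_ _
          linarith
        have a1 : ps μ x ≤ 1 := by
          unfold ps
          rw [div_le_one (by positivity)]
          nlinarith [sq_nonneg (1 - x)]
        have : ps μ x / w2 P μ x ≤ 1 / (c0 ^ 2 * ((1 - t) / 2) ^ (2 * ord t)) := by
          have : c0 ^ 2 * ((1 - t) / 2) ^ (2 * ord t) ≤ w2 P μ x := by
            refine le_trans ?_ h
            gcongr
            nlinarith [sq_nonneg μ]
          gcongr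
        have : 0 ≤ 4 / (1 - t) ^ 2 := by positivity
        simp only [D]; linarith
    have s1 := Finset.single_le_sum (f := D) (fun s _ => D0 s) ht
    have : 0 ≤ (c0 ^ 2)⁻¹ * (μ ^ 2 / ((1 - x) ^ 2 + μ ^ 2) ^ 2) := by positivity
    linarith

lemma V_le_pow : ∃ C, 0 ≤ C ∧ ∀ x ∈ Icc (0:ℝ) 1, |P.V x| ≤ C * x ^ ord 0 := by
  have cV : Continuous P.V := cont_of_deriv P.dV
  obtain ⟨K, hK⟩ := isCompact_Icc.exists_bound_of_continuousOn (s := Icc (0:ℝ) 1) cV.continuousOn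
  have K0 : 0 ≤ K := (norm_nonneg _).trans (hK 0 (by simp))
  have := (z.lim 0 (by simp)).abs.eventually_lt_const (lt_add_one |b 0|)
  rw [eventually_nhdsWithin_iff, Metric.eventually_nhds_iff] at this
  obtain ⟨δ, hδ, hd⟩ := this
  refine ⟨|b 0| + 1 + K / δ ^ ord 0 , by positivity, ?_⟩
  have p0 : ∀ x ∈ Ioc (0:ℝ) 1, |P.V x| ≤ (|b 0| + 1 + K / δ ^ ord 0) * x ^ ord 0 := by
    intro x hx
    have hx0 := hx.1
    rcases lt_or_ge x δ with h | h
    · have := hd (y := x) (by simpa [abs_of_pos hx0] using h) (by simpa using hx0.ne')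
      rw [sub_zero, abs_div, abs_of_pos (pow_pos hx0 _), div_lt_iff₀ (pow_pos hx0 _)] at this
      have : 0 ≤ K / δ ^ ord 0 * x ^ ord 0 := by positivity
      linarith
    · have h1 := hK x ⟨hx0.le, hx.2⟩
      rw [Real.norm_eq_abs] at h1
      have h2 : K ≤ K / δ ^ ord 0 * x ^ ord 0 := by
        rw [div_mul_eq_mul_div, le_div_iff₀ (by positivity)]
        gcongr
      have : 0 ≤ (|b 0| + 1) * x ^ ord 0 := by positivity
      linarith
  intro x hx
  rcases eq_or_lt_of_le hx.1 with h | h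
  · have cc : ContinuousWithinAt (fun y => (|b 0| + 1 + K / δ ^ ord 0) * y ^ ord 0 - |P.V y|) (Ioi 0) 0 := by
      exact (by fun_prop : Continuous _).continuousWithinAt
    have := ge_of_tendsto cc.tendsto (b := 0) (by
      filter_upwards [Ioc_mem_nhdsGT (zero_lt_one)] with y hy
      linarith [p0 y hy])
    rw [← h]; linarith
  · exact p0 x ⟨h, hx.2⟩

lemma int_bump {k : ℕ} (hk : 1 ≤ k) {μ : ℝ} (hμ : 0 < μ) (A : ℝ) (hA : 0 ≤ A) :
    ∫ x in (0:ℝ)..1, ∑ t ∈ T, A * (1 / ((x - t) ^ (2 * k) + μ ^ 2)) ≤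
      (T.card * A * ∫ r : ℝ, 1 / (r ^ (2 * k) + 1)) * μ ^ ((1:ℝ) / k - 2) := by
  rw [intervalIntegral.integral_finsetSum]
  · calc _ ≤ ∑ t ∈ T, A * ((∫ r : ℝ, 1 / (r ^ (2 * k) + 1)) * μ ^ ((1:ℝ) / k - 2)) := by
          refine Finset.sum_le_sum fun t _ => ?_
          rw [intervalIntegral.integral_const_mul]
          gcongr
          exact bump_le hk hμ t
      _ = _ := by rw [Finset.sum_const, nsmul_eq_mul]; ring
  · intro t _
    exact (Continuous.mul (by fun_prop) (Continuous.div (by fun_prop) (by fun_prop) fun x => (even_pos hμ k).ne')).intervalIntegrable _ _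

end ZD
end OS

end

noncomputable section
open Filter Topology MeasureTheory Set ComplexConjugate
namespace OS

lemma mvt_le {f f1 : ℝ → ℝ} (d : ∀ x, HasDerivAt f (f1 x) x) {x C : ℝ} (hx : x ≤ 1)
    (hC : ∀ y ∈ Icc x 1, |f1 y| ≤ C) : |f x - f 1| ≤ C * (1 - x) := by
  have := Convex.norm_image_sub_le_of_norm_hasDerivWithin_le (f := f) (f' := f1) (s := Icc x 1) (C := C) (x := 1) (y := x)
    (fun y _ => (d y).hasDerivWithinAt) (fun y hy => hC y hy) (convex_Icc _ _) (by simp [hx]) (by simp [hx])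
  rw [Real.norm_eq_abs, Real.norm_eq_abs, abs_sub_comm x 1, abs_of_nonneg (by linarith : 0 ≤ 1 - x)] at this
  exact this

lemma wall_int {μ : ℝ} (hμ : 0 < μ) : ∫ x in (0:ℝ)..1, (1 - x) * (μ ^ 2 / ((1 - x) ^ 2 + μ ^ 2) ^ 2) ≤ 1 / 2 := by
  have d : ∀ x ∈ uIcc (0:ℝ) 1, HasDerivAt (fun x => μ ^ 2 / (2 * ((1 - x) ^ 2 + μ ^ 2))) ((1 - x) * (μ ^ 2 / ((1 - x) ^ 2 + μ ^ 2) ^ 2)) x := by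
    intro x _
    have h1 : HasDerivAt (fun x : ℝ => 2 * ((1 - x) ^ 2 + μ ^ 2)) (-4 * (1 - x)) x := by
      refine (((((hasDerivAt_id x).const_sub 1).pow 2).add_const (μ ^ 2)).const_mul 2).congr_deriv ?_
      simp; ring
    refine ((hasDerivAt_const x (μ ^ 2)).div h1 (by positivity)).congr_deriv ?_
    field_simp
    ring
  rw [intervalIntegral.integral_eq_sub_of_hasDerivAt d]
  · have : 0 ≤ μ ^ 2 / (2 * ((1 - 0) ^ 2 + μ ^ 2)) := by positivity
    have e : μ ^ 2 / (2 * ((1 - 1) ^ 2 + μ ^ 2)) = 1 / 2 := by field_simp; ring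
    rw [e]; linarith
  · exact (Continuous.mul (by fun_prop) (Continuous.div (by fun_prop) (by fun_prop) fun x => by positivity)).intervalIntegrable _ _

lemma bdd01 {f : ℝ → ℝ} (hf : Continuous f) : ∃ K, 0 ≤ K ∧ ∀ x ∈ Icc (0:ℝ) 1, |f x| ≤ K := by
  obtain ⟨K, hK⟩ := isCompact_Icc.exists_bound_of_continuousOn (s := Icc (0:ℝ) 1) hf.continuousOn
  exact ⟨K, (norm_nonneg _).trans (hK 0 (by simp)), fun x hx => hK x hx⟩

namespace ZD
variable {P : Prof} {T : Finset ℝ} {ord : ℝ → ℕ} {b : ℝ → ℝ} {c0 : ℝ}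

set_option maxHeartbeats 1600000 in
lemma exists_VH (z : ZD P T ord b c0) {k kx : ℕ} (hk : 1 ≤ k) (hkT : ∀ t ∈ T, t ≠ 0 → ord t ≤ k) (hkx : 1 ≤ kx) (hkxT : ∀ t ∈ T, ord t ≤ kx) :
    ∃ K, 1 ≤ K ∧ (∀ μ, 0 < μ → μ ≤ 1 → VH P (ord 0) K μ (μ ^ (2 - (1:ℝ) / k)) (μ ^ ((1:ℝ) / (2 * kx)))) ∧
      (∀ x ∈ Icc (0:ℝ) 1, |P.V x| ≤ K * (1 - x)) ∧ (∀ x ∈ Icc (0:ℝ) 1, |P.V x - P.a * (1 - x)| ≤ K * (1 - x) ^ 2) := by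
  have cV : Continuous P.V := cont_of_deriv P.dV
  have cV1 : Continuous P.V1 := cont_of_deriv P.dV1
  have cV2 : Continuous P.V2 := cont_of_deriv P.dV2
  have cV3 : Continuous P.V3 := cont_of_deriv P.dV3
  obtain ⟨K0, p0, h0⟩ := bdd01 cV
  obtain ⟨K1, p1, h1⟩ := bdd01 cV1
  obtain ⟨K2, p2, h2⟩ := bdd01 cV2
  obtain ⟨K3, p3, h3⟩ := bdd01 cV3
  obtain ⟨K4, p4, h4⟩ := bdd01 P.cV4
  obtain ⟨C, pC, hC⟩ := z.ps_w2_le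
  obtain ⟨D, pD, hD⟩ := z.V_le_pow
  have hc0 := z.c0pos
  set J : ℕ → ℝ := fun k => ∫ r : ℝ, 1 / (r ^ (2 * k) + 1) with hJ
  have J0 : ∀ k, 0 ≤ J k := fun k => integral_nonneg fun r => by
    have : 0 ≤ r ^ (2 * k) := by rw [pow_mul]; positivity
    simp only [Pi.zero_apply]; positivity
  set B := (c0 ^ 2)⁻¹ with hB
  have B0 : 0 < B := by positivity
  have pkx : 0 ≤ T.card * B * J kx := by have := J0 kx; positivity
  have pk : 0 ≤ T.card * (2 * B) * J k := by have := J0 k; positivity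
  have pj1 : 0 ≤ B * J 1 := by have := J0 1; positivity
  set K := 1 + K0 + K1 + K2 + K3 + K4 + C + B + D ^ 2 + 4 + 4 ^ ord 0 + T.card * B * J kx + T.card * (2 * B) * J k + B * J 1 with hKd
  have pD2 : 0 ≤ D ^ 2 := by positivity
  have p4k : 0 < (4:ℝ) ^ ord 0 := by positivity
  refine ⟨K, by linarith, fun μ hμ hμ1 => ?_, fun x hx => ?_, fun x hx => ?_⟩
  · have hk' : (1:ℝ) ≤ k := by exact_mod_cast hk
    have hkx' : (1:ℝ) ≤ kx := by exact_mod_cast hkx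
    have ik : (1:ℝ) / k ≤ 1 := by rw [div_le_one (by linarith)]; exact hk'
    have mμ : μ ^ (2 - (1:ℝ) / k) ≤ μ := by
      conv_rhs => rw [← Real.rpow_one μ]
      exact Real.rpow_le_rpow_of_exponent_ge hμ hμ1 (by linarith)
    have minv : μ ^ ((1:ℝ) / k - 2) = 1 / μ ^ (2 - (1:ℝ) / k) := by
      rw [show (1:ℝ) / k - 2 = -(2 - (1:ℝ) / k) by ring, Real.rpow_neg hμ.le, one_div (μ ^ _)]
    have cw : Continuous fun x => w2 P μ x := cont_w2
    have wne : ∀ x, w2 P μ x ≠ 0 := fun x => (w2_pos hμ x).ne'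
    have cps := cont_ps hμ
    have csum : ∀ (A : ℝ) (j : ℕ), Continuous fun x : ℝ => ∑ t ∈ T, A * (1 / ((x - t) ^ (2 * j) + μ ^ 2)) := fun A j =>
      continuous_finsetSum _ fun t _ => Continuous.mul (by fun_prop) (Continuous.div (by fun_prop) (by fun_prop) fun x => (even_pos hμ j).ne')
    have cb : Continuous fun x : ℝ => B * (1 / ((x - 1) ^ (2 * 1) + μ ^ 2)) :=
      Continuous.mul (by fun_prop) (Continuous.div (by fun_prop) (by fun_prop) fun x => (even_pos hμ 1).ne')
    have cpw : Continuous fun x => (1 - x) * ps μ x / w2 P μ x := Continuous.div (by fun_prop) cw wne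
    have cpw' : Continuous fun x => ps μ x / w2 P μ x := Continuous.div (by fun_prop) cw wne
    have cq : Continuous fun x : ℝ => μ ^ 2 / ((1 - x) ^ 2 + μ ^ 2) ^ 2 := Continuous.div (by fun_prop) (by fun_prop) fun x => by positivity
    constructor
    · linarith
    · exact hμ
    · exact hμ1
    · positivity
    · exact mμ
    · positivity
    · intro x hx; linarith [h0 x hx]
    · intro x hx; linarith [h1 x hx]
    · intro x hx; linarith [h2 x hx]
    · intro x hx; linarith [h3 x hx]
    · intro x hx; linarith [h4 x hx]
    · calc _ ≤ ∫ x in (0:ℝ)..1, ∑ t ∈ T, B * (1 / ((x - t) ^ (2 * kx) + μ ^ 2)) :=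
            int_mono' (continuous_const.div cw wne) (csum _ _) (by simp) fun x hx => z.inv_w2_le hkxT hμ hx
        _ ≤ (T.card * B * J kx) * μ ^ ((1:ℝ) / kx - 2) := z.int_bump hkx hμ B B0.le
        _ ≤ K * μ ^ ((1:ℝ) / kx - 2) := by gcongr; linarith
        _ = _ := by
          rw [Real.rpow_sub hμ, Real.rpow_two, ← Real.rpow_natCast (μ ^ ((1:ℝ) / (2 * kx))) 2, ← Real.rpow_mul hμ.le, mul_div_assoc]
          congr 3
          push_cast; field_simp
    · calc _ ≤ ∫ x in (0:ℝ)..1, (B + ∑ t ∈ T, (2 * B) * (1 / ((x - t) ^ (2 * k) + μ ^ 2))) :=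
            int_mono' (Continuous.div cont_ee cw wne) (continuous_const.add (csum _ _)) (by simp) fun x hx => z.ee_w2_le hkT hμ hμ1 hx
        _ = B + ∫ x in (0:ℝ)..1, (∑ t ∈ T, (2 * B) * (1 / ((x - t) ^ (2 * k) + μ ^ 2))) := by
          rw [intervalIntegral.integral_add (by simp) ((csum _ _).intervalIntegrable _ _)]
          simp
        _ ≤ B * (1 / μ ^ (2 - (1:ℝ) / k)) + (T.card * (2 * B) * J k) * μ ^ ((1:ℝ) / k - 2) := by
          have i1 := z.int_bump hk hμ (2 * B) (by positivity)
          have i2 : 1 ≤ 1 / μ ^ (2 - (1:ℝ) / k) := by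
            rw [le_div_iff₀ (by positivity)]; linarith
          have : B * 1 ≤ B * (1 / μ ^ (2 - (1:ℝ) / k)) := by gcongr
          linarith
        _ = (B + T.card * (2 * B) * J k) * (1 / μ ^ (2 - (1:ℝ) / k)) := by rw [minv]; ring
        _ ≤ K * (1 / μ ^ (2 - (1:ℝ) / k)) := by gcongr; linarith
        _ = _ := by ring
    · have bl := bump_le (k := 1) le_rfl hμ 1
      calc _ ≤ ∫ x in (0:ℝ)..1, (C + B * (1 / ((x - 1) ^ (2 * 1) + μ ^ 2))) := by
            refine int_mono' cpw' (continuous_const.add cb) (by simp) fun x hx => ?_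
            refine (hC μ x hμ hμ1 hx).trans ?_
            refine add_le_add le_rfl (mul_le_mul_of_nonneg_left ?_ B0.le)
            rw [show (x - 1) ^ (2 * 1) = (1 - x) ^ 2 by ring, div_le_div_iff₀ (by positivity) (by positivity)]
            nlinarith [mul_nonneg (sq_nonneg (1 - x)) (add_nonneg (sq_nonneg (1 - x)) (sq_nonneg μ))]
        _ = C + B * ∫ x in (0:ℝ)..1, 1 / ((x - 1) ^ (2 * 1) + μ ^ 2) := by
          rw [intervalIntegral.integral_add (by simp) (cb.intervalIntegrable _ _),
            intervalIntegral.integral_const_mul]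
          simp
        _ ≤ C * (1 / μ) + B * (J 1 * (1 / μ)) := by
          have i2 : 1 ≤ 1 / μ := by rw [le_div_iff₀ hμ]; linarith
          have e : μ ^ ((1:ℝ) / (1:ℕ) - 2) = 1 / μ := by
            rw [show (1:ℝ) / (1:ℕ) - 2 = -1 by norm_num, Real.rpow_neg_one, one_div]
          rw [e] at bl
          have : C * 1 ≤ C * (1 / μ) := by gcongr
          have : B * ∫ x in (0:ℝ)..1, 1 / ((x - 1) ^ (2 * 1) + μ ^ 2) ≤ B * (J 1 * (1 / μ)) := by gcongr
          linarith
        _ = (C + B * J 1) * (1 / μ) := by ring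
        _ ≤ K * (1 / μ) := by gcongr; linarith
        _ = _ := by ring
    · calc _ ≤ ∫ x in (0:ℝ)..1, (C + B * ((1 - x) * (μ ^ 2 / ((1 - x) ^ 2 + μ ^ 2) ^ 2))) := by
            refine int_mono' cpw (by fun_prop) (by simp) fun x hx => ?_
            have y0 : 0 ≤ 1 - x := by linarith [hx.2]
            have y1 : 1 - x ≤ 1 := by linarith [hx.1]
            calc _ = (1 - x) * (ps μ x / w2 P μ x) := by ring
              _ ≤ (1 - x) * (C + B * (μ ^ 2 / ((1 - x) ^ 2 + μ ^ 2) ^ 2)) := by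
                gcongr; exact hC μ x hμ hμ1 hx
              _ = (1 - x) * C + B * ((1 - x) * (μ ^ 2 / ((1 - x) ^ 2 + μ ^ 2) ^ 2)) := by ring
              _ ≤ 1 * C + B * ((1 - x) * (μ ^ 2 / ((1 - x) ^ 2 + μ ^ 2) ^ 2)) := by gcongr
              _ = _ := by ring
        _ = C + B * ∫ x in (0:ℝ)..1, (1 - x) * (μ ^ 2 / ((1 - x) ^ 2 + μ ^ 2) ^ 2) := by
          rw [intervalIntegral.integral_add (by simp) ((by fun_prop : Continuous _).intervalIntegrable _ _), intervalIntegral.integral_const_mul]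
          simp
        _ ≤ C + B * (1 / 2) := by gcongr; exact wall_int hμ
        _ ≤ K := by linarith
    · intro x hx
      unfold w2 ee
      have : P.V x ^ 2 ≤ (D * x ^ ord 0) ^ 2 := by
        rw [← sq_abs]; have := hD x hx; gcongr
      have x0 : 0 ≤ x ^ (2 * ord 0) := by rw [pow_mul]; positivity
      calc _ ≤ D ^ 2 * x ^ (2 * ord 0) + 1 * μ ^ 2 := by
            have e : (D * x ^ ord 0) ^ 2 = D ^ 2 * x ^ (2 * ord 0) := by ring
            linarith
        _ ≤ K * x ^ (2 * ord 0) + K * μ ^ 2 := by gcongr <;> linarith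
        _ = _ := by ring
    · intro x hx
      unfold ps ee
      have x0 : 0 ≤ x ^ (2 * ord 0) := by rw [pow_mul]; positivity
      rcases le_total x (1 / 2) with h | h
      · calc μ ^ 2 / ((1 - x) ^ 2 + μ ^ 2) ≤ 4 * μ ^ 2 := by
              rw [div_le_iff₀ (by positivity)]
              have : (1:ℝ) / 4 ≤ (1 - x) ^ 2 := by nlinarith
              nlinarith [mul_nonneg (sq_nonneg μ) (sq_nonneg μ), mul_le_mul_of_nonneg_left this (sq_nonneg μ)]
          _ ≤ K * (x ^ (2 * ord 0) + μ ^ 2) := by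
            have : 4 * μ ^ 2 ≤ K * μ ^ 2 := by gcongr; linarith
            have : 0 ≤ K * x ^ (2 * ord 0) := by
              have : 0 ≤ K := by linarith
              positivity
            linarith
      · calc μ ^ 2 / ((1 - x) ^ 2 + μ ^ 2) ≤ 1 := by
              rw [div_le_one (by positivity)]; nlinarith [sq_nonneg (1 - x)]
          _ = 4 ^ ord 0 * ((1 / 2) ^ (2 * ord 0)) := by
              rw [pow_mul, ← mul_pow]; norm_num
          _ ≤ K * x ^ (2 * ord 0) := by
            gcongr
            linarith
          _ ≤ _ := by
            have : 0 ≤ K := by linarith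
            gcongr
            nlinarith
  · have := mvt_le P.dV hx.2 (fun y hy => h1 y ⟨hx.1.trans hy.1, hy.2⟩)
    rw [P.V01, sub_zero] at this
    refine this.trans ?_
    have : 0 ≤ 1 - x := by linarith [hx.2]
    gcongr
    linarith
  · have y0 : 0 ≤ 1 - x := by linarith [hx.2]
    have dg : ∀ x, HasDerivAt (fun x => P.V x - P.a * (1 - x)) (P.V1 x + P.a) x := fun x => by
      refine ((P.dV x).sub (((hasDerivAt_id x).const_sub 1).const_mul P.a)).congr_deriv ?_
      simp
    have := mvt_le dg (C := K2 * (1 - x)) hx.2 (fun y hy => by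
      have := mvt_le P.dV1 hy.2 (fun w hw => h2 w ⟨(hx.1.trans hy.1).trans hw.1, hw.2⟩)
      rw [P.V11, sub_neg_eq_add] at this
      refine this.trans ?_
      gcongr
      exact hy.1)
    simp only [P.V01, sub_self, mul_zero, sub_zero] at this
    refine this.trans ?_
    rw [mul_assoc, ← sq]
    gcongr
    linarith

end ZD
end OS

end

noncomputable section
open Filter Topology MeasureTheory Set ComplexConjugate
namespace OS

def Ik (k : ℕ) (b : ℝ) (C : ℂ) : ℂ := ∫ r : ℝ, 1 / ((b * r ^ k : ℝ) - C) ^ 2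

lemma d_lower {v μ η M : ℝ} {C : ℂ} (hη : 0 < η) (hC : η ≤ C.im) (hM : ‖C‖ ≤ M) :
    v ^ 2 + μ ^ 2 ≤ (2 + (2 * M ^ 2 + 1) / η ^ 2) * ‖(v:ℂ) - μ * C‖ ^ 2 := by
  have h1 : ((v:ℂ) - μ * C).im = -(μ * C.im) := by simp
  have h2 : (μ * C.im) ^ 2 ≤ ‖(v:ℂ) - μ * C‖ ^ 2 := by
    have := Complex.abs_im_le_norm ((v:ℂ) - μ * C)
    rw [h1, abs_neg] at this
    rw [← sq_abs (μ * C.im)]; gcongr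
  have h3 : μ ^ 2 ≤ ‖(v:ℂ) - μ * C‖ ^ 2 / η ^ 2 := by
    rw [le_div_iff₀ (by positivity)]
    calc μ ^ 2 * η ^ 2 ≤ μ ^ 2 * C.im ^ 2 := by gcongr
      _ = _ := by ring
      _ ≤ _ := h2
  have h4 : |v| ≤ ‖(v:ℂ) - μ * C‖ + |μ| * ‖C‖ := by
    have := norm_add_le ((v:ℂ) - μ * C) (μ * C)
    rwa [sub_add_cancel, norm_mul, Complex.norm_real, Complex.norm_real, Real.norm_eq_abs, Real.norm_eq_abs] at this
  have hC0 := norm_nonneg C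
  have h5 : v ^ 2 ≤ 2 * ‖(v:ℂ) - μ * C‖ ^ 2 + 2 * (μ ^ 2 * M ^ 2) := by
    have : v ^ 2 ≤ (‖(v:ℂ) - μ * C‖ + |μ| * ‖C‖) ^ 2 := by rw [← sq_abs v]; gcongr
    have e : (|μ| * ‖C‖) ^ 2 ≤ μ ^ 2 * M ^ 2 := by rw [mul_pow, sq_abs]; gcongr
    nlinarith [sq_nonneg (‖(v:ℂ) - μ * C‖ - |μ| * ‖C‖)]
  have h6 : μ ^ 2 * (2 * M ^ 2 + 1) ≤ ‖(v:ℂ) - μ * C‖ ^ 2 / η ^ 2 * (2 * M ^ 2 + 1) := by gcongr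
  calc _ ≤ 2 * ‖(v:ℂ) - μ * C‖ ^ 2 + ‖(v:ℂ) - μ * C‖ ^ 2 / η ^ 2 * (2 * M ^ 2 + 1) := by nlinarith
    _ = _ := by ring

/-- Sequence hypotheses. -/
structure SeqH (μ : ℕ → ℝ) (C : ℕ → ℂ) (Cs : ℂ) (η M : ℝ) : Prop where
  pos : ∀ n, 0 < μ n
  le1 : ∀ n, μ n ≤ 1
  lim : Tendsto μ atTop (𝓝 0)
  limC : Tendsto C atTop (𝓝 Cs)
  hη : 0 < η
  im : ∀ n, η ≤ (C n).im
  nm : ∀ n, ‖C n‖ ≤ M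

lemma SeqH.im' {μ C Cs η M} (s : SeqH μ C Cs η M) : η ≤ Cs.im :=
  ge_of_tendsto ((Complex.continuous_im.tendsto Cs).comp s.limC) (Eventually.of_forall s.im)

lemma SeqH.nm' {μ C Cs η M} (s : SeqH μ C Cs η M) : ‖Cs‖ ≤ M :=
  le_of_tendsto ((continuous_norm.tendsto Cs).comp s.limC) (Eventually.of_forall s.nm)

namespace ZD
variable {P : Prof} {T : Finset ℝ} {ord : ℝ → ℕ} {b : ℝ → ℝ} {c0 : ℝ}

/-- scaled pointwise limit -/
lemma scaled_lim (z : ZD P T ord b c0) {k : ℕ} (hk : 1 ≤ k) {w : ℝ} (hw : w ∈ Icc (0:ℝ) 1) (hj : ord w ≤ k)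
    {μ C Cs η M} (s : SeqH μ C Cs η M) {r : ℝ} (hr : r ≠ 0) :
    Tendsto (fun n => 1 / (((P.V (w + μ n ^ ((1:ℝ) / k) * r) / μ n : ℝ) : ℂ) - C n) ^ 2) atTop
      (𝓝 (if ord w = k then 1 / (((b w * r ^ k : ℝ) : ℂ) - Cs) ^ 2 else 0)) := by
  have hk' : (0:ℝ) < k := by exact_mod_cast hk
  set e : ℕ → ℝ := fun n => μ n ^ ((1:ℝ) / k) with he
  have e0 : ∀ n, 0 < e n := fun n => Real.rpow_pos_of_pos (s.pos n) _
  have ek : ∀ n, e n ^ k = μ n := fun n => by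
    rw [he]; simp only
    rw [← Real.rpow_natCast, ← Real.rpow_mul (s.pos n).le, one_div_mul_cancel (by positivity), Real.rpow_one]
  have el : Tendsto e atTop (𝓝 0) := by
    have := s.lim.rpow_const (p := (1:ℝ) / k) (Or.inr (by positivity))
    rwa [Real.zero_rpow (by positivity)] at this
  have wl : Tendsto (fun n => w + e n * r) atTop (𝓝[≠] w) := by
    refine tendsto_nhdsWithin_iff.2 ⟨?_, Eventually.of_forall fun n => ?_⟩
    · have := (el.mul_const r).const_add w
      simpa using this
    · have := mul_ne_zero (e0 n).ne' hr
      simpa using this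
  have g := (z.lim w hw).comp wl
  simp only [Function.comp_def, add_sub_cancel_left] at g
  set G : ℕ → ℝ := fun n => P.V (w + e n * r) / (e n * r) ^ ord w with hG
  have Gv : ∀ n, P.V (w + e n * r) = G n * (e n * r) ^ ord w := fun n => by
    rw [hG]; simp only
    have := mul_ne_zero (e0 n).ne' hr
    field_simp
  split_ifs with hjk
  · have l1 : Tendsto (fun n => ((P.V (w + e n * r) / μ n : ℝ) : ℂ) - C n) atTop (𝓝 (((b w * r ^ k : ℝ) : ℂ) - Cs)) := by
      refine Tendsto.sub ?_ s.limC
      refine (Complex.continuous_ofReal.tendsto _).comp ?_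
      refine (g.mul_const (r ^ k)).congr fun n => ?_
      have hp := s.pos n
      rw [Gv, hjk, mul_pow, ek]
      field_simp
    refine tendsto_const_nhds.div (l1.pow 2) (pow_ne_zero 2 ?_)
    intro h
    have := congrArg Complex.im h
    simp only [Complex.sub_im, Complex.ofReal_im, Complex.zero_im] at this
    linarith [s.im', s.hη]
  · have bw := z.bne w hw
    have hlt : ord w < k := lt_of_le_of_ne hj hjk
    have l1 : Tendsto (fun n => e n ^ (k - ord w) / (r ^ ord w * G n)) atTop (𝓝 0) := by
      have := (el.pow (k - ord w)).div (g.const_mul (r ^ ord w)) (mul_ne_zero (pow_ne_zero _ hr) bw)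
      rwa [zero_pow (by omega), zero_div] at this
    have l1c : Tendsto (fun n => ((e n ^ (k - ord w) / (r ^ ord w * G n) : ℝ) : ℂ)) atTop (𝓝 0) := by
      have h0 := (Complex.continuous_ofReal.tendsto _).comp l1
      rw [Complex.ofReal_zero] at h0
      exact h0
    have l2 := (l1c.pow 2).div ((tendsto_const_nhds (x := (1:ℂ))).sub (s.limC.mul l1c) |>.pow 2) (by simp)
    have : (0:ℂ) ^ 2 / (1 - Cs * 0) ^ 2 = 0 := by simp
    rw [this] at l2
    refine l2.congr' ?_
    filter_upwards [g.eventually_ne bw] with n hn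
    have hp := s.pos n
    have hV : P.V (w + e n * r) / μ n = (e n ^ (k - ord w) / (r ^ ord w * G n))⁻¹ := by
      rw [Gv, ← ek n]
      have : e n ^ k = e n ^ (k - ord w) * e n ^ ord w := by rw [← pow_add]; congr 1; omega
      rw [this, mul_pow]
      have := (e0 n).ne'
      field_simp
    rw [hV]
    have hne : e n ^ (k - ord w) / (r ^ ord w * G n) ≠ 0 :=
      div_ne_zero (pow_ne_zero _ (e0 n).ne') (mul_ne_zero (pow_ne_zero _ hr) hn)
    simp only [Pi.div_apply]
    generalize e n ^ (k - ord w) / (r ^ ord w * G n) = y at hne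
    have hy : (y:ℂ) ≠ 0 := by exact_mod_cast hne
    rw [Complex.ofReal_inv, show ((y:ℂ)⁻¹ - C n) = (1 - C n * y) / y by field_simp, div_pow, one_div_div]

open Classical in
/-- weights -/
def wt (P : Prof) (T : Finset ℝ) (ord : ℝ → ℕ) (c0 : ℝ) (w s : ℝ) : ℝ :=
  Set.indicator {s | c0 * |s - w| ^ ord w ≤ |P.V s|} 1 s /
    ∑ v ∈ T, Set.indicator {s | c0 * |s - v| ^ ord v ≤ |P.V s|} 1 s

lemma wt_meas (P : Prof) (T : Finset ℝ) (ord : ℝ → ℕ) (c0 w : ℝ) : Measurable (wt P T ord c0 w) := by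
  have hm : ∀ v, MeasurableSet {s | c0 * |s - v| ^ ord v ≤ |P.V s|} := fun v => by
    have := P.cV
    exact (isClosed_le (by fun_prop) (by fun_prop)).measurableSet
  unfold wt
  exact (measurable_one.indicator (hm w)).div (Finset.measurable_fun_sum T fun v _ => measurable_one.indicator (hm v))

lemma ind_nonneg (A : Set ℝ) (s : ℝ) : 0 ≤ Set.indicator A (1 : ℝ → ℝ) s := Set.indicator_nonneg (fun _ _ => zero_le_one) s

lemma wt_nonneg (w s : ℝ) : 0 ≤ wt P T ord c0 w s :=
  div_nonneg (ind_nonneg _ _) (Finset.sum_nonneg fun _ _ => ind_nonneg _ _)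

lemma wt_le {w : ℝ} (hw : w ∈ T) (s : ℝ) : wt P T ord c0 w s ≤ 1 :=
  div_le_one_of_le₀ (Finset.single_le_sum (f := fun v => Set.indicator {s | c0 * |s - v| ^ ord v ≤ |P.V s|} (1 : ℝ → ℝ) s)
    (fun _ _ => ind_nonneg _ _) hw) (Finset.sum_nonneg fun _ _ => ind_nonneg _ _)

lemma wt_zero {w s : ℝ} (h : ¬ c0 * |s - w| ^ ord w ≤ |P.V s|) : wt P T ord c0 w s = 0 := by
  unfold wt
  rw [Set.indicator_of_notMem (by simpa using h), zero_div]

lemma wt_sum (z : ZD P T ord b c0) {s : ℝ} (hs : s ∈ Icc (0:ℝ) 1) : ∑ w ∈ T, wt P T ord c0 w s = 1 := by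
  unfold wt
  rw [← Finset.sum_div]
  refine div_self (ne_of_gt ?_)
  obtain ⟨t, ht, h⟩ := z.cover s hs
  refine Finset.sum_pos' (fun _ _ => ind_nonneg _ _) ⟨t, ht, ?_⟩
  rw [Set.indicator_of_mem (by simpa using h)]
  simp

lemma V_zero_of_ord (z : ZD P T ord b c0) {w : ℝ} (hw : w ∈ Icc (0:ℝ) 1) (h : 1 ≤ ord w) : P.V w = 0 := by
  have l1 : Tendsto (fun y => P.V y / (y - w) ^ ord w * (y - w) ^ ord w) (𝓝[≠] w) (𝓝 (b w * 0)) := by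
    refine (z.lim w hw).mul ?_
    have : Continuous fun y : ℝ => (y - w) ^ ord w := by fun_prop
    have := (this.tendsto w).mono_left (nhdsWithin_le_nhds (s := {w}ᶜ))
    simpa [zero_pow (by omega : ord w ≠ 0)] using this
  have l2 : Tendsto P.V (𝓝[≠] w) (𝓝 (P.V w)) := (P.cV.tendsto w).mono_left nhdsWithin_le_nhds
  have l3 : Tendsto P.V (𝓝[≠] w) (𝓝 (b w * 0)) := by
    refine l1.congr' ?_
    filter_upwards [self_mem_nhdsWithin] with y hy
    have : y - w ≠ 0 := sub_ne_zero.2 hy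
    field_simp
  simpa using tendsto_nhds_unique l2 l3

lemma ord_pos_of_zero (z : ZD P T ord b c0) {w : ℝ} (hw : w ∈ Icc (0:ℝ) 1) (h : P.V w = 0) : 1 ≤ ord w := by
  by_contra h0
  have h0 : ord w = 0 := by omega
  have l1 := z.lim w hw
  rw [h0] at l1
  have l2 : Tendsto P.V (𝓝[≠] w) (𝓝 (P.V w)) := (P.cV.tendsto w).mono_left nhdsWithin_le_nhds
  have := tendsto_nhds_unique l2 (l1.congr fun y => by simp)
  exact z.bne w hw (by rw [← this, h])

lemma mem_T_of_zero (z : ZD P T ord b c0) {w : ℝ} (hw : w ∈ Icc (0:ℝ) 1) (h : P.V w = 0) : w ∈ T := by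
  obtain ⟨t, ht, h'⟩ := z.cover w hw
  have c := z.c0pos
  rw [h, abs_zero] at h'
  have h2 : |w - t| ^ ord t = 0 := by
    have : 0 ≤ |w - t| ^ ord t := by positivity
    nlinarith
  have : |w - t| = 0 := eq_zero_of_pow_eq_zero h2
  have : w = t := by linarith [abs_eq_zero.1 this]
  rw [this]; exact ht

lemma wt_one (z : ZD P T ord b c0) {w : ℝ} (hw : w ∈ T) (h : 1 ≤ ord w) :
    ∀ᶠ s in 𝓝 w, s ∈ Icc (0:ℝ) 1 → wt P T ord c0 w s = 1 := by
  have c := z.c0pos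
  have V0 := z.V_zero_of_ord (z.Tsub w hw) h
  have e1 : ∀ᶠ s in 𝓝 w, ∀ v ∈ T, v ≠ w → ¬ c0 * |s - v| ^ ord v ≤ |P.V s| := by
    rw [Filter.eventually_all_finset]
    intro v hv
    by_cases hvw : v = w
    · exact Eventually.of_forall fun s h => absurd hvw h
    have cc : ContinuousAt (fun s => c0 * |s - v| ^ ord v - |P.V s|) w := by
      have := P.cV
      exact (by fun_prop : Continuous _).continuousAt
    have : 0 < c0 * |w - v| ^ ord v - |P.V w| := by
      rw [V0, abs_zero, sub_zero]
      have : 0 < |w - v| := abs_pos.2 (sub_ne_zero.2 (Ne.symm hvw))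
      positivity
    filter_upwards [cc.eventually_const_lt this] with s hs _
    linarith
  filter_upwards [e1] with s hs hsI
  have := z.wt_sum hsI
  rw [Finset.sum_eq_single w (fun v hv hvw => wt_zero (hs v hv hvw)) (fun h => absurd hw h)] at this
  exact this

end ZD
end OS

end

noncomputable section
open Filter Topology MeasureTheory Set ComplexConjugate
namespace OS

lemma SeqH.dne {μ C Cs η M} (s : SeqH μ C Cs η M) (n : ℕ) (v : ℝ) : (v : ℂ) - μ n * C n ≠ 0 := by
  intro h
  have := congrArg Complex.im h
  simp at this
  rcases this with h | h
  · exact (s.pos n).ne' h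
  · linarith [s.im n, s.hη]

namespace ZD
variable {P : Prof} {T : Finset ℝ} {ord : ℝ → ℕ} {b : ℝ → ℝ} {c0 : ℝ}

lemma subst_int (g : ℝ → ℂ) (w : ℝ) {e : ℝ} (he : 0 < e) : ∫ s, g s = (e:ℂ) * ∫ r, g (w + e * r) := by
  have h1 := Measure.integral_comp_mul_left (fun y => g (w + y)) e
  rw [integral_add_left_eq_self g w] at h1
  rw [h1, abs_of_pos (inv_pos.2 he)]
  rw [Complex.real_smul, ← mul_assoc, ← Complex.ofReal_mul, mul_inv_cancel₀ he.ne']; simp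

/-- piece integrand -/
def pc (P : Prof) (T : Finset ℝ) (ord : ℝ → ℕ) (c0 : ℝ) (t x w : ℝ) (D : ℂ) (s : ℝ) : ℂ :=
  (Ioc t x).indicator (fun s => (wt P T ord c0 w s : ℂ) * (1 / ((P.V s : ℂ) - D) ^ 2)) s

lemma piece_lim (z : ZD P T ord b c0) {k : ℕ} (hk : 1 ≤ k) (hkT : ∀ w ∈ T, w ≠ 0 → ord w ≤ k)
    {μ C Cs η M} (s : SeqH μ C Cs η M) {t x : ℝ} (ht0 : 0 < t) (hx1 : x ≤ 1) (htx : t < x)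
    (hVt : P.V t ≠ 0) (hVx : P.V x ≠ 0 ∨ (x = 1 ∧ 2 ≤ k)) {w : ℝ} (hw : w ∈ T) (hw0 : w ≠ 0) :
    Tendsto (fun n => ((μ n ^ (2 - (1:ℝ) / k) : ℝ) : ℂ) * ∫ y, pc P T ord c0 t x w (μ n * C n) y) atTop
      (𝓝 (if t < w ∧ w < x ∧ ord w = k then Ik k (b w) Cs else 0)) := by
  have hk' : (0:ℝ) < k := by exact_mod_cast hk
  have hwI := z.Tsub w hw
  have hj := hkT w hw hw0
  have c := z.c0pos
  set e : ℕ → ℝ := fun n => μ n ^ ((1:ℝ) / k) with he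
  have e0 : ∀ n, 0 < e n := fun n => Real.rpow_pos_of_pos (s.pos n) _
  have ek : ∀ n, e n ^ k = μ n := fun n => by
    rw [he]; simp only
    rw [← Real.rpow_natCast, ← Real.rpow_mul (s.pos n).le, one_div_mul_cancel (by positivity), Real.rpow_one]
  have el : Tendsto e atTop (𝓝 0) := by
    have := s.lim.rpow_const (p := (1:ℝ) / k) (Or.inr (by positivity))
    rwa [Real.zero_rpow (by positivity)] at this
  have pe : ∀ n, μ n ^ (2 - (1:ℝ) / k) * e n = μ n ^ 2 := fun n => by
    rw [he]; simp only
    rw [← Real.rpow_add (s.pos n), sub_add_cancel]; exact_mod_cast Real.rpow_natCast (μ n) 2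
  set g : ℕ → ℝ → ℂ := fun n r => ((Ioc t x).indicator (fun s => wt P T ord c0 w s) (w + e n * r) : ℝ) *
    (1 / (((P.V (w + e n * r) / μ n : ℝ) : ℂ) - C n) ^ 2) with hg
  have key : ∀ n, ((μ n ^ (2 - (1:ℝ) / k) : ℝ) : ℂ) * ∫ y, pc P T ord c0 t x w (μ n * C n) y = ∫ r, g n r := fun n => by
    rw [subst_int _ w (e0 n), ← mul_assoc, ← Complex.ofReal_mul, pe, ← integral_const_mul]
    congr 1; funext r
    simp only [hg, pc]
    have hp : (μ n : ℂ) ≠ 0 := by exact_mod_cast (s.pos n).ne'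
    have hd := s.dne n (P.V (w + e n * r))
    by_cases hm : w + e n * r ∈ Ioc t x
    · rw [indicator_of_mem hm, indicator_of_mem hm]
      rw [show (((P.V (w + e n * r) / μ n : ℝ) : ℂ) - C n) = ((P.V (w + e n * r) : ℂ) - μ n * C n) / μ n by
        push_cast; field_simp]
      push_cast
      rw [div_pow, one_div_div]; ring
    · rw [indicator_of_notMem hm, indicator_of_notMem hm]; simp
  simp_rw [key]
  set A := (2 + (2 * M ^ 2 + 1) / η ^ 2) with hA
  have hη := s.hη
  have A0 : 0 < A := by positivity
  have w0 : ∀ y, 0 ≤ (Ioc t x).indicator (fun s => wt P T ord c0 w s) y :=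
    fun y => indicator_nonneg (fun s _ => wt_nonneg w s) y
  have w1 : ∀ y, (Ioc t x).indicator (fun s => wt P T ord c0 w s) y ≤ 1 := fun y => by
    by_cases hm : y ∈ Ioc t x
    · rw [indicator_of_mem hm]; exact wt_le hw y
    · rw [indicator_of_notMem hm]; exact zero_le_one
  have hbound : ∀ n r, ‖g n r‖ ≤ A / c0 ^ 2 * (1 / (r ^ (2 * k) + 1)) := fun n r => by
    have hr : 0 ≤ r ^ (2 * k) := by rw [pow_mul]; positivity
    by_cases hm : w + e n * r ∈ Ioc t x ∧ c0 * |w + e n * r - w| ^ ord w ≤ |P.V (w + e n * r)|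
    · obtain ⟨hm, hv⟩ := hm
      rw [add_sub_cancel_left] at hv
      have h1 : |e n * r| ≤ 1 := by
        rw [abs_le]; constructor
        · linarith [hm.1, hwI.2]
        · linarith [hm.2, hwI.1]
      have h2 : c0 * |e n * r| ^ k ≤ |P.V (w + e n * r)| := by
        refine le_trans ?_ hv
        exact mul_le_mul_of_nonneg_left (pow_le_pow_of_le_one (abs_nonneg _) h1 hj) c.le
      have h3 : c0 ^ 2 * (μ n ^ 2 * r ^ (2 * k)) ≤ P.V (w + e n * r) ^ 2 := by
        rw [← sq_abs (P.V _)]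
        calc _ = (c0 * |e n * r| ^ k) ^ 2 := by
              rw [mul_pow, ← pow_mul, mul_comm k 2, pow_mul |_|, sq_abs, ← pow_mul, mul_pow, mul_comm 2 k, pow_mul (e n), ek]
          _ ≤ _ := by gcongr
      have h4 := d_lower (v := P.V (w + e n * r)) (μ := μ n) s.hη (s.im n) (s.nm n)
      have hp := s.pos n
      have hd := s.dne n (P.V (w + e n * r))
      have hdn : 0 < ‖(P.V (w + e n * r) : ℂ) - μ n * C n‖ := norm_pos_iff.2 hd
      have e1 : ‖(1 / (((P.V (w + e n * r) / μ n : ℝ) : ℂ) - C n) ^ 2)‖ = μ n ^ 2 / ‖(P.V (w + e n * r) : ℂ) - μ n * C n‖ ^ 2 := by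
        have hp' : (μ n : ℂ) ≠ 0 := by exact_mod_cast (s.pos n).ne'
        rw [show (((P.V (w + e n * r) / μ n : ℝ) : ℂ) - C n) = ((P.V (w + e n * r) : ℂ) - μ n * C n) / μ n by
          push_cast; field_simp]
        rw [div_pow, one_div_div, norm_div, norm_pow, norm_pow, Complex.norm_real, Real.norm_eq_abs, sq_abs]
      simp only [hg]
      rw [norm_mul, Complex.norm_real, Real.norm_eq_abs, abs_of_nonneg (w0 _), e1]
      calc _ ≤ 1 * (μ n ^ 2 / ‖(P.V (w + e n * r) : ℂ) - μ n * C n‖ ^ 2) := by gcongr; exact w1 _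
        _ = μ n ^ 2 / ‖(P.V (w + e n * r) : ℂ) - μ n * C n‖ ^ 2 := one_mul _
        _ ≤ _ := by
          rw [div_mul_div_comm, mul_one, div_le_div_iff₀ (by positivity) (by positivity)]
          have : c0 ^ 2 ≤ 1 := pow_le_one₀ c.le z.c1
          have : μ n ^ 2 * c0 ^ 2 ≤ μ n ^ 2 := by nlinarith [sq_nonneg (μ n)]
          nlinarith
    · have : (Ioc t x).indicator (fun s => wt P T ord c0 w s) (w + e n * r) = 0 := by
        by_cases h1 : w + e n * r ∈ Ioc t x
        · rw [indicator_of_mem h1]; exact wt_zero fun h => hm ⟨h1, h⟩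
        · exact indicator_of_notMem h1 _
      simp only [hg, this, Complex.ofReal_zero, zero_mul, norm_zero]
      positivity
  have main : ∀ r : ℝ, r ≠ 0 → Tendsto (fun n => g n r) atTop
      (𝓝 (if t < w ∧ w < x ∧ ord w = k then 1 / (((b w * r ^ k : ℝ) : ℂ) - Cs) ^ 2 else 0)) := by
    intro r hr
    have sl := z.scaled_lim hk hwI hj s hr
    have wl : Tendsto (fun n => w + e n * r) atTop (𝓝 w) := by
      have := (el.mul_const r).const_add w
      simpa using this
    by_cases hjk : ord w = k
    · rw [if_pos hjk] at sl
      have V0 := z.V_zero_of_ord hwI (by omega)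
      have hwt : w ≠ t := fun h => hVt (h ▸ V0)
      have hwx : w ≠ x := fun h => by
        rcases hVx with h' | ⟨h', h2⟩
        · exact h' (h ▸ V0)
        · have : ord w = 1 := by rw [h, h', z.ord1]
          omega
      by_cases hin : t < w ∧ w < x
      · rw [if_pos ⟨hin.1, hin.2, hjk⟩]
        refine sl.congr' ?_
        filter_upwards [wl.eventually (z.wt_one hw (by omega)), wl.eventually (Ioo_mem_nhds hin.1 hin.2)] with n h1 h2
        simp only [hg]
        rw [indicator_of_mem (Ioo_subset_Ioc_self h2), h1 ⟨by linarith [h2.1], by linarith [h2.2]⟩, Complex.ofReal_one, one_mul]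
      · rw [if_neg (fun h => hin ⟨h.1, h.2.1⟩)]
        refine tendsto_const_nhds.congr' ?_
        have : ∀ᶠ y in 𝓝 w, y ∉ Ioc t x := by
          rcases lt_or_gt_of_ne hwt with h | h
          · filter_upwards [Iio_mem_nhds h] with y hy hy'
            exact absurd hy'.1 (not_lt.2 (le_of_lt hy))
          · have : x < w := lt_of_le_of_ne (not_lt.1 fun h' => hin ⟨h, h'⟩) (Ne.symm hwx)
            filter_upwards [Ioi_mem_nhds this] with y hy hy'
            exact absurd hy'.2 (not_le.2 hy)
        filter_upwards [wl.eventually this] with n hn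
        simp only [hg]
        rw [indicator_of_notMem hn]; simp
    · rw [if_neg hjk] at sl
      rw [if_neg (fun h => hjk h.2.2)]
      refine squeeze_zero_norm (fun n => ?_) (tendsto_norm_zero.comp sl)
      simp only [hg, Function.comp]
      rw [norm_mul, Complex.norm_real, Real.norm_eq_abs, abs_of_nonneg (w0 _)]
      exact mul_le_of_le_one_left (norm_nonneg _) (w1 _)
  have hI : (if t < w ∧ w < x ∧ ord w = k then Ik k (b w) Cs else 0) =
      ∫ r : ℝ, (if t < w ∧ w < x ∧ ord w = k then 1 / (((b w * r ^ k : ℝ) : ℂ) - Cs) ^ 2 else 0) := by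
    split_ifs
    · rfl
    · simp
  rw [hI]
  refine tendsto_integral_of_dominated_convergence (fun r => A / c0 ^ 2 * (1 / (r ^ (2 * k) + 1))) ?_ ?_ ?_ ?_
  · intro n
    have hV := P.cV
    have m1 : Measurable ((Ioc t x).indicator (fun s => wt P T ord c0 w s)) := (wt_meas P T ord c0 w).indicator measurableSet_Ioc
    have m2 : Measurable fun r : ℝ => w + e n * r := by fun_prop
    have m3 : Measurable fun r : ℝ => P.V (w + e n * r) := hV.measurable.comp m2
    have : Measurable (g n) := by
      refine (Complex.measurable_ofReal.comp (m1.comp m2)).mul ?_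
      refine Measurable.const_div ?_ _
      exact ((Complex.measurable_ofReal.comp (m3.div_const _)).sub_const _).pow_const 2
    exact this.aestronglyMeasurable
  · exact (bump_integrable hk).const_mul _
  · exact fun n => Eventually.of_forall (hbound n)
  · have : ∀ᵐ r : ℝ, r ≠ 0 := by simp [ae_iff, measure_singleton]
    filter_upwards [this] with r hr using main r hr

lemma pc_integrable (z : ZD P T ord b c0) {t x w : ℝ} (hw : w ∈ T) {D : ℂ} (hD : ∀ v : ℝ, (v:ℂ) - D ≠ 0) :
    IntegrableOn (fun s => (wt P T ord c0 w s : ℂ) * (1 / ((P.V s : ℂ) - D) ^ 2)) (Ioc t x) := by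
  have hV := P.cV
  have hc : Continuous fun s => 1 / ((P.V s : ℂ) - D) ^ 2 :=
    continuous_const.div (by fun_prop) fun s => pow_ne_zero 2 (hD _)
  have hi : IntegrableOn (fun s => 1 / ((P.V s : ℂ) - D) ^ 2) (Ioc t x) :=
    (hc.integrableOn_Icc (a := t) (b := x)).mono_set Ioc_subset_Icc_self
  refine Integrable.bdd_mul (c := 1) hi ?_ ?_
  · exact (Complex.measurable_ofReal.comp (wt_meas P T ord c0 w)).aestronglyMeasurable
  · refine Eventually.of_forall fun s => ?_
    rw [Complex.norm_real, Real.norm_eq_abs, abs_of_nonneg (wt_nonneg w s)]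
    exact wt_le hw s

lemma piece_zero (z : ZD P T ord b c0) {k : ℕ} (hk : 1 ≤ k)
    {μ C Cs η M} (s : SeqH μ C Cs η M) {t x : ℝ} (ht0 : 0 < t) (hx1 : x ≤ 1) (htx : t < x) (hw : (0:ℝ) ∈ T) :
    Tendsto (fun n => ((μ n ^ (2 - (1:ℝ) / k) : ℝ) : ℂ) * ∫ y, pc P T ord c0 t x 0 (μ n * C n) y) atTop (𝓝 0) := by
  have hk' : (1:ℝ) ≤ k := by exact_mod_cast hk
  have c := z.c0pos
  have hη := s.hη
  set A := (2 + (2 * M ^ 2 + 1) / η ^ 2) with hA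
  have A0 : 0 < A := by positivity
  set v0 := c0 * t ^ ord 0 with hv0
  have v0p : 0 < v0 := by positivity
  have hp : 0 < 2 - (1:ℝ) / k := by
    have : (1:ℝ) / k ≤ 1 := by rw [div_le_one (by linarith)]; exact hk'
    linarith
  have bd : ∀ n, ‖∫ y, pc P T ord c0 t x 0 (μ n * C n) y‖ ≤ A / v0 ^ 2 * (x - t) := fun n => by
    simp only [pc]
    rw [integral_indicator measurableSet_Ioc]
    have : (x - t) = (volume.real (Ioc t x)) := by
      rw [Real.volume_real_Ioc_of_le htx.le]
    rw [this]
    refine norm_setIntegral_le_of_norm_le_const (by simp) fun y hy => ?_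
    by_cases hm : c0 * |y - 0| ^ ord 0 ≤ |P.V y|
    · rw [norm_mul, Complex.norm_real, Real.norm_eq_abs, abs_of_nonneg (wt_nonneg _ _)]
      refine (mul_le_of_le_one_left (norm_nonneg _) (wt_le hw _)).trans ?_
      have h1 : v0 ≤ |P.V y| := by
        refine le_trans ?_ hm
        rw [sub_zero, abs_of_pos (by linarith [hy.1]), hv0]
        have := hy.1.le
        gcongr
      have h4 := d_lower (v := P.V y) (μ := μ n) s.hη (s.im n) (s.nm n)
      have hdn : 0 < ‖(P.V y : ℂ) - μ n * C n‖ := norm_pos_iff.2 (s.dne n _)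
      rw [norm_div, norm_one, norm_pow, div_le_div_iff₀ (by positivity) (by positivity)]
      have : v0 ^ 2 ≤ P.V y ^ 2 := by rw [← sq_abs (P.V y)]; gcongr
      nlinarith [sq_nonneg (μ n)]
    · rw [wt_zero hm]; simp; positivity
  have l := s.lim.rpow_const (p := 2 - (1:ℝ) / k) (Or.inr hp.le)
  rw [Real.zero_rpow hp.ne'] at l
  refine squeeze_zero_norm (a := fun n => μ n ^ (2 - (1:ℝ) / k) * (A / v0 ^ 2 * (x - t))) (fun n => ?_) (by simpa using l.mul_const (A / v0 ^ 2 * (x - t)))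
  rw [norm_mul, Complex.norm_real, Real.norm_eq_abs, abs_of_nonneg (Real.rpow_nonneg (s.pos n).le _)]
  exact mul_le_mul_of_nonneg_left (bd n) (Real.rpow_nonneg (s.pos n).le _)

/-- kernel limit -/
lemma kernel_lim (z : ZD P T ord b c0) {k : ℕ} (hk : 1 ≤ k) (hkT : ∀ w ∈ T, w ≠ 0 → ord w ≤ k)
    {μ C Cs η M} (s : SeqH μ C Cs η M) {t x : ℝ} (ht0 : 0 < t) (hx1 : x ≤ 1) (htx : t < x)
    (hVt : P.V t ≠ 0) (hVx : P.V x ≠ 0 ∨ (x = 1 ∧ 2 ≤ k)) :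
    Tendsto (fun n => ((μ n ^ (2 - (1:ℝ) / k) : ℝ) : ℂ) * ∫ y in t..x, 1 / ((P.V y : ℂ) - μ n * C n) ^ 2) atTop
      (𝓝 (∑ w ∈ T, if t < w ∧ w < x ∧ ord w = k then Ik k (b w) Cs else 0)) := by
  have key : ∀ n, (((μ n ^ (2 - (1:ℝ) / k) : ℝ) : ℂ) * ∫ y in t..x, 1 / ((P.V y : ℂ) - μ n * C n) ^ 2) =
      ∑ w ∈ T, ((μ n ^ (2 - (1:ℝ) / k) : ℝ) : ℂ) * ∫ y, pc P T ord c0 t x w (μ n * C n) y := fun n => by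
    rw [← Finset.mul_sum]
    congr 1
    have : ∀ w ∈ T, ∫ y, pc P T ord c0 t x w (μ n * C n) y = ∫ y in Ioc t x, (wt P T ord c0 w y : ℂ) * (1 / ((P.V y : ℂ) - μ n * C n) ^ 2) :=
      fun w _ => by simp only [pc]; rw [integral_indicator measurableSet_Ioc]
    rw [Finset.sum_congr rfl this, ← integral_finset_sum T fun w hw => z.pc_integrable hw (s.dne n), intervalIntegral.integral_of_le htx.le]
    refine setIntegral_congr_fun measurableSet_Ioc fun y hy => ?_
    rw [← Finset.sum_mul, ← Complex.ofReal_sum, z.wt_sum ⟨by linarith [hy.1], by linarith [hy.2]⟩]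
    simp
  simp_rw [key]
  refine tendsto_finsetSum T fun w hw => ?_
  by_cases hw0 : w = 0
  · subst hw0
    rw [if_neg (fun h => absurd h.1 (not_lt.2 ht0.le))]
    exact z.piece_zero hk s ht0 hx1 htx hw
  · exact z.piece_lim hk hkT s ht0 hx1 htx hVt hVx hw hw0

end ZD
end OS

end

noncomputable section
open Filter Topology MeasureTheory Set ComplexConjugate
namespace OS

lemma den_ne {v : ℝ} {C : ℂ} (hC : 0 < C.im) : (v:ℂ) - C ≠ 0 := by
  intro h
  have := congrArg Complex.im h
  simp at this; linarith

lemma Ik_bound {k : ℕ} {b η M : ℝ} (hb : b ≠ 0) (hη : 0 < η) : ∃ B, 0 < B ∧ ∀ C : ℂ, η ≤ C.im → ‖C‖ ≤ M → ∀ r : ℝ,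
    1 / ‖((b * r ^ k : ℝ) : ℂ) - C‖ ^ 2 ≤ B * (1 / (r ^ (2 * k) + 1)) := by
  set A := (2 + (2 * M ^ 2 + 1) / η ^ 2) with hA
  have A0 : 0 < A := by positivity
  have hb2 : 0 < b ^ 2 := by positivity
  refine ⟨A * (1 + 1 / b ^ 2), by positivity, fun C h1 h2 r => ?_⟩
  have hr : 0 ≤ r ^ (2 * k) := by rw [pow_mul]; positivity
  have hd : 0 < ‖((b * r ^ k : ℝ) : ℂ) - C‖ := norm_pos_iff.2 (den_ne (hη.trans_le h1))
  have h := d_lower (v := b * r ^ k) (μ := 1) hη h1 h2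
  rw [Complex.ofReal_one, one_mul, one_pow] at h
  rw [mul_one_div, div_le_div_iff₀ (by positivity) (by positivity), one_mul]
  have e : (b * r ^ k) ^ 2 = b ^ 2 * r ^ (2 * k) := by ring
  rw [e] at h
  set N := ‖((b * r ^ k : ℝ) : ℂ) - C‖ ^ 2
  calc r ^ (2 * k) + 1 ≤ (1 + 1 / b ^ 2) * (b ^ 2 * r ^ (2 * k) + 1) := by
        have : (1 + 1 / b ^ 2) * (b ^ 2 * r ^ (2 * k) + 1) = b ^ 2 * r ^ (2 * k) + 1 + r ^ (2 * k) + 1 / b ^ 2 := by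
          field_simp; ring
        rw [this]
        have : 0 ≤ b ^ 2 * r ^ (2 * k) := by positivity
        have : 0 < 1 / b ^ 2 := by positivity
        linarith
    _ ≤ (1 + 1 / b ^ 2) * (A * N) := by gcongr
    _ = _ := by ring

lemma tail_top {k : ℕ} (hk : 1 ≤ k) : Tendsto (fun r : ℝ => |r| * (1 / (r ^ (2 * k) + 1))) atTop (𝓝 0) := by
  refine squeeze_zero' (Eventually.of_forall fun r => ?_) ?_ tendsto_inv_atTop_zero
  · have hr : 0 ≤ r ^ (2 * k) := by rw [pow_mul]; positivity
    positivity
  · filter_upwards [eventually_ge_atTop 1] with r hr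
    have h0 : 0 < r := by linarith
    rw [abs_of_pos h0, mul_one_div, ← one_div, div_le_div_iff₀ (by positivity) h0]
    have : r ^ 2 ≤ r ^ (2 * k) := pow_le_pow_right₀ hr (by omega)
    nlinarith

lemma tail_bot {k : ℕ} (hk : 1 ≤ k) : Tendsto (fun r : ℝ => |r| * (1 / (r ^ (2 * k) + 1))) atBot (𝓝 0) := by
  have := (tail_top hk).comp tendsto_neg_atBot_atTop
  refine this.congr fun r => ?_
  simp only [Function.comp, abs_neg]
  rw [Even.neg_pow ⟨k, by ring⟩]

lemma cont_den {k : ℕ} {b : ℝ} {C : ℂ} (hC : 0 < C.im) (j : ℕ) :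
    Continuous fun r : ℝ => 1 / (((b * r ^ k : ℝ) : ℂ) - C) ^ j :=
  continuous_const.div (by fun_prop) fun r => pow_ne_zero _ (den_ne hC)

lemma Ik_int2 {k : ℕ} (hk : 1 ≤ k) {b : ℝ} (hb : b ≠ 0) {C : ℂ} (hC : 0 < C.im) :
    Integrable fun r : ℝ => 1 / (((b * r ^ k : ℝ) : ℂ) - C) ^ 2 := by
  obtain ⟨B, hB, h⟩ := Ik_bound (k := k) (M := ‖C‖) hb hC
  refine Integrable.mono' ((bump_integrable hk).const_mul B) (cont_den hC 2).aestronglyMeasurable (Eventually.of_forall fun r => ?_)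
  have := h C le_rfl le_rfl r
  rwa [norm_div, norm_one, norm_pow]

lemma im_le_den (v : ℝ) (C : ℂ) (hC : 0 < C.im) : C.im ≤ ‖(v:ℂ) - C‖ := by
  have := Complex.abs_im_le_norm ((v:ℂ) - C)
  simp at this
  rwa [abs_of_pos hC] at this

lemma Ik_b3 {k : ℕ} {b η M : ℝ} (hb : b ≠ 0) (hη : 0 < η) : ∃ B, 0 < B ∧ ∀ C : ℂ, η ≤ C.im → ‖C‖ ≤ M → ∀ r : ℝ,
    ‖1 / (((b * r ^ k : ℝ) : ℂ) - C) ^ 3‖ ≤ B * (1 / (r ^ (2 * k) + 1)) := by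
  obtain ⟨B, hB, h⟩ := Ik_bound (k := k) (M := M) hb hη
  refine ⟨1 / η * B, by positivity, fun C h1 h2 r => ?_⟩
  have hd : 0 < ‖((b * r ^ k : ℝ) : ℂ) - C‖ := norm_pos_iff.2 (den_ne (hη.trans_le h1))
  have h4 := im_le_den (b * r ^ k) C (hη.trans_le h1)
  rw [norm_div, norm_one, norm_pow]
  calc _ = 1 / ‖((b * r ^ k : ℝ) : ℂ) - C‖ * (1 / ‖((b * r ^ k : ℝ) : ℂ) - C‖ ^ 2) := by field_simp
    _ ≤ 1 / η * (B * (1 / (r ^ (2 * k) + 1))) := by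
      gcongr
      · linarith
      · exact h C h1 h2 r
    _ = _ := by ring

lemma Ik_int3 {k : ℕ} (hk : 1 ≤ k) {b : ℝ} (hb : b ≠ 0) {C : ℂ} (hC : 0 < C.im) :
    Integrable fun r : ℝ => 1 / (((b * r ^ k : ℝ) : ℂ) - C) ^ 3 := by
  obtain ⟨B, hB, h⟩ := Ik_b3 (k := k) (M := ‖C‖) hb hC
  exact Integrable.mono' ((bump_integrable hk).const_mul B) (cont_den hC 3).aestronglyMeasurable
    (Eventually.of_forall fun r => h C le_rfl le_rfl r)

lemma Ik_deriv {k : ℕ} (hk : 1 ≤ k) {b : ℝ} (hb : b ≠ 0) {C : ℂ} (hC : 0 < C.im) :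
    HasDerivAt (Ik k b) (2 * ∫ r : ℝ, 1 / (((b * r ^ k : ℝ) : ℂ) - C) ^ 3) C := by
  obtain ⟨B, hB, h⟩ := Ik_b3 (k := k) (M := ‖C‖ + C.im / 2) hb (half_pos hC)
  have hball : ∀ C' ∈ Metric.ball C (C.im / 2), C.im / 2 ≤ C'.im ∧ ‖C'‖ ≤ ‖C‖ + C.im / 2 := fun C' hC' => by
    rw [Metric.mem_ball, dist_eq_norm] at hC'
    have h1 := Complex.abs_im_le_norm (C' - C)
    have h2 := norm_add_le (C' - C) C
    rw [sub_add_cancel] at h2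
    rw [Complex.sub_im, abs_le] at h1
    constructor <;> linarith [h1.1]
  rw [← integral_const_mul]
  refine (hasDerivAt_integral_of_dominated_loc_of_deriv_le
    (F := fun C (r:ℝ) => 1 / (((b * r ^ k : ℝ) : ℂ) - C) ^ 2)
    (F' := fun C (r:ℝ) => 2 * (1 / (((b * r ^ k : ℝ) : ℂ) - C) ^ 3))
    (bound := fun r => 2 * (B * (1 / (r ^ (2 * k) + 1))))
    (Metric.ball_mem_nhds C (half_pos hC)) ?_ (Ik_int2 hk hb hC) ?_ ?_ ?_ ?_).2
  · filter_upwards [Metric.ball_mem_nhds C (half_pos hC)] with C' hC'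
    exact (cont_den (by linarith [(hball C' hC').1]) 2).aestronglyMeasurable
  · exact (continuous_const.mul (cont_den hC 3)).aestronglyMeasurable
  · refine Eventually.of_forall fun r C' hC' => ?_
    rw [norm_mul, Complex.norm_ofNat]
    exact mul_le_mul_of_nonneg_left (h C' (hball C' hC').1 (hball C' hC').2 r) zero_le_two
  · exact ((bump_integrable hk).const_mul B).const_mul 2
  · refine Eventually.of_forall fun r C' hC' => ?_
    have hne : ((b * r ^ k : ℝ) : ℂ) - C' ≠ 0 := den_ne (by linarith [(hball C' hC').1])
    have h1 : HasDerivAt (fun C' : ℂ => (((b * r ^ k : ℝ) : ℂ) - C') ^ 2) (2 * (((b * r ^ k : ℝ) : ℂ) - C') * (-1)) C' := by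
      refine (((hasDerivAt_id C').const_sub ((b * r ^ k : ℝ) : ℂ)).fun_pow 2).congr_deriv ?_
      simp
    have h2 := (hasDerivAt_const C' (1:ℂ)).div h1 (pow_ne_zero 2 hne)
    refine h2.congr_deriv ?_
    field_simp
    ring

/-- Euler identity -/
lemma Ik_euler {k : ℕ} (hk : 1 ≤ k) {b : ℝ} (hb : b ≠ 0) {C : ℂ} (hC : 0 < C.im) :
    C * (2 * ∫ r : ℝ, 1 / (((b * r ^ k : ℝ) : ℂ) - C) ^ 3) = -(2 - 1 / k) * Ik k b C := by
  have hk' : (k:ℂ) ≠ 0 := by exact_mod_cast (by omega : k ≠ 0)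
  have i2 := Ik_int2 hk hb hC
  have i3 := Ik_int3 hk hb hC
  obtain ⟨B, hB, h⟩ := Ik_bound (k := k) (M := ‖C‖) hb hC
  have hd : ∀ r : ℝ, HasDerivAt (fun r : ℝ => (r:ℂ) / (((b * r ^ k : ℝ) : ℂ) - C) ^ 2)
      ((1 - 2 * k) * (1 / (((b * r ^ k : ℝ) : ℂ) - C) ^ 2) + (-(2 * k * C)) * (1 / (((b * r ^ k : ℝ) : ℂ) - C) ^ 3)) r := fun r => by
    have hne : ((b * r ^ k : ℝ) : ℂ) - C ≠ 0 := den_ne hC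
    have h1 : HasDerivAt (fun r : ℝ => b * r ^ k) (b * (k * r ^ (k - 1))) r := (hasDerivAt_pow k r).const_mul b
    have h2 : HasDerivAt (fun r : ℝ => (((b * r ^ k : ℝ) : ℂ) - C) ^ 2) (2 * (((b * r ^ k : ℝ) : ℂ) - C) * ((b * (k * r ^ (k - 1)) : ℝ) : ℂ)) r := by
      refine ((h1.ofReal_comp.sub_const C).fun_pow 2).congr_deriv ?_
      simp
    have h3 := ((hasDerivAt_id r).ofReal_comp).div h2 (pow_ne_zero 2 hne)
    refine h3.congr_deriv ?_
    have e : (r:ℂ) * ((b * (k * r ^ (k - 1)) : ℝ) : ℂ) = k * ((((b * r ^ k : ℝ) : ℂ) - C) + C) := by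
      have : r ^ k = r ^ (k - 1) * r := by rw [← pow_succ]; congr 1; omega
      rw [this]; push_cast; ring
    simp only [id]
    rw [show (r:ℂ) * (2 * (((b * r ^ k : ℝ) : ℂ) - C) * ((b * (k * r ^ (k - 1)) : ℝ) : ℂ)) = 2 * (((b * r ^ k : ℝ) : ℂ) - C) * ((r:ℂ) * ((b * (k * r ^ (k - 1)) : ℝ) : ℂ)) by ring, e]
    generalize ((b * r ^ k : ℝ) : ℂ) - C = y at hne
    field_simp
    push_cast
    ring
  have hn : ∀ r : ℝ, ‖(r:ℂ) / (((b * r ^ k : ℝ) : ℂ) - C) ^ 2‖ ≤ B * (|r| * (1 / (r ^ (2 * k) + 1))) := fun r => by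
    have := h C le_rfl le_rfl r
    rw [norm_div, norm_pow, Complex.norm_real, Real.norm_eq_abs, div_eq_mul_one_div]
    calc _ ≤ |r| * (B * (1 / (r ^ (2 * k) + 1))) := by gcongr
      _ = _ := by ring
  have lt : Tendsto (fun r : ℝ => (r:ℂ) / (((b * r ^ k : ℝ) : ℂ) - C) ^ 2) atTop (𝓝 0) :=
    squeeze_zero_norm hn (by simpa using (tail_top hk).const_mul B)
  have lb : Tendsto (fun r : ℝ => (r:ℂ) / (((b * r ^ k : ℝ) : ℂ) - C) ^ 2) atBot (𝓝 0) :=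
    squeeze_zero_norm hn (by simpa using (tail_bot hk).const_mul B)
  have := integral_of_hasDerivAt_of_tendsto hd ((i2.const_mul _).add (i3.const_mul _)) lb lt
  rw [integral_add (i2.const_mul _) (i3.const_mul _), integral_const_mul, integral_const_mul] at this
  change (1 - 2 * (k:ℂ)) * Ik k b C + _ = _ at this
  set J := ∫ r : ℝ, 1 / (((b * r ^ k : ℝ) : ℂ) - C) ^ 3
  have e : k * (C * (2 * J)) = k * (-(2 - 1 / k) * Ik k b C) := by
    rw [show (k:ℂ) * (-(2 - 1 / k) * Ik k b C) = (1 - 2 * k) * Ik k b C by field_simp; ring]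
    linear_combination -this
  exact mul_left_cancel₀ hk' e

lemma ndI_slit {C : ℂ} (hC : 0 < C.im) : C / Complex.I ∈ Complex.slitPlane := by
  left
  rw [Complex.div_I]; simpa using hC

/-- scaling -/
lemma Ik_scale {k : ℕ} (hk : 1 ≤ k) {b : ℝ} (hb : b ≠ 0) {C : ℂ} (hC : 0 < C.im) :
    Ik k b C = (C / Complex.I) ^ (-(2 - 1 / k : ℂ)) * Ik k b Complex.I := by
  set p : ℂ := 2 - 1 / k with hp
  let S : Set ℂ := {C | 0 < C.im}
  have So : IsOpen S := isOpen_lt continuous_const Complex.continuous_im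
  have Sc : Convex ℝ S := convex_halfSpace_im_gt 0
  have hd : ∀ C ∈ S, HasDerivAt (fun C => (C / Complex.I) ^ p * Ik k b C) 0 C := fun C hC => by
    have h1 : HasDerivAt (fun C : ℂ => (C / Complex.I) ^ p) (p * (C / Complex.I) ^ (p - 1) * (1 / Complex.I)) C :=
      HasDerivAt.cpow_const ((hasDerivAt_id C).div_const _) (ndI_slit hC)
    refine (h1.mul (Ik_deriv hk hb hC)).congr_deriv ?_
    have hC0 : C ≠ 0 := fun h => by
      have hC : 0 < C.im := hC
      rw [h] at hC; simp at hC
    have hCI : C / Complex.I ≠ 0 := div_ne_zero hC0 Complex.I_ne_zero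
    have h2 := Ik_euler hk hb hC
    rw [Complex.cpow_sub _ _ hCI, Complex.cpow_one]
    have : (2 * ∫ r : ℝ, 1 / (((b * r ^ k : ℝ) : ℂ) - C) ^ 3) = -p * Ik k b C / C := by
      rw [eq_div_iff hC0, ← h2]; ring
    rw [this]
    have := Complex.I_ne_zero
    field_simp
    ring
  have hI : Complex.I ∈ S := by simp [S]
  have hcon := Sc.is_const_of_fderivWithin_eq_zero (𝕜 := ℂ) (f := fun C => (C / Complex.I) ^ p * Ik k b C)
    (fun C hC => (hd C hC).differentiableAt.differentiableWithinAt)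
    (fun C hC => by
      rw [fderivWithin_of_isOpen So hC]
      rw [(hd C hC).hasFDerivAt.fderiv]
      ext
      simp) hC hI
  rw [div_self Complex.I_ne_zero, Complex.one_cpow, one_mul] at hcon
  rw [← hcon, Complex.cpow_neg]
  have : (C / Complex.I) ^ p ≠ 0 := by
    rw [Complex.cpow_def_of_ne_zero (Complex.slitPlane_ne_zero (ndI_slit hC))]
    exact Complex.exp_ne_zero _
  field_simp

lemma Ik_one {b : ℝ} (hb : b ≠ 0) {C : ℂ} (hC : 0 < C.im) : Ik 1 b C = 0 := by
  have hb' : (b:ℂ) ≠ 0 := by exact_mod_cast hb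
  have i2 := Ik_int2 le_rfl hb hC
  have hd : ∀ r : ℝ, HasDerivAt (fun r : ℝ => -(1 / b) * (1 / (((b * r ^ 1 : ℝ) : ℂ) - C))) (1 / (((b * r ^ 1 : ℝ) : ℂ) - C) ^ 2) r := fun r => by
    have hne : ((b * r ^ 1 : ℝ) : ℂ) - C ≠ 0 := den_ne hC
    have h1 : HasDerivAt (fun r : ℝ => b * r ^ 1) b r := by simpa using (hasDerivAt_id r).const_mul b
    have h2 := ((hasDerivAt_const r (1:ℂ)).div (h1.ofReal_comp.sub_const C) hne).const_mul (-(1 / (b:ℂ)))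
    refine h2.congr_deriv ?_
    field_simp
    ring
  have nt : Tendsto (fun r : ℝ => |b| * |r| - ‖C‖) (cocompact ℝ) atTop := by
    refine tendsto_atTop_add_const_right _ _ (Tendsto.const_mul_atTop (abs_pos.2 hb) ?_)
    exact tendsto_norm_cocompact_atTop
  have nt2 : Tendsto (fun r : ℝ => ‖((b * r ^ 1 : ℝ) : ℂ) - C‖) (cocompact ℝ) atTop := by
    refine tendsto_atTop_mono (fun r => ?_) nt
    have := norm_sub_norm_le (((b * r ^ 1 : ℝ) : ℂ)) C
    rwa [Complex.norm_real, Real.norm_eq_abs, abs_mul, abs_pow, pow_one] at this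
  have l : Tendsto (fun r : ℝ => -(1 / b) * (1 / (((b * r ^ 1 : ℝ) : ℂ) - C))) (cocompact ℝ) (𝓝 0) := by
    have : Tendsto (fun r : ℝ => (1 / (((b * r ^ 1 : ℝ) : ℂ) - C))) (cocompact ℝ) (𝓝 0) := by
      rw [tendsto_zero_iff_norm_tendsto_zero]
      refine (tendsto_inv_atTop_zero.comp nt2).congr fun r => ?_
      simp [Function.comp]
    simpa using this.const_mul (-(1 / (b:ℂ)))
  rw [cocompact_eq_atBot_atTop, tendsto_sup] at l
  have := integral_of_hasDerivAt_of_tendsto hd i2 l.1 l.2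
  rw [sub_zero] at this
  exact this

lemma Ik_neg {k : ℕ} (hk : 2 ≤ k) {b : ℝ} (hb : b ≠ 0) : (Ik k b Complex.I).re < 0 := by
  have hk1 : 1 ≤ k := by omega
  have hI : 0 < Complex.I.im := by simp
  have hb2 : 0 < b ^ 2 := by positivity
  have i2 := Ik_int2 hk1 hb hI
  have e1 : (Ik k b Complex.I).re = ∫ r : ℝ, ((b * r ^ k) ^ 2 - 1) / (1 + (b * r ^ k) ^ 2) ^ 2 := by
    unfold Ik
    have := (integral_re i2).symm
    simp only [RCLike.re_to_complex] at this
    rw [this]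
    congr 1; funext r
    have hne : ((b * r ^ k : ℝ) : ℂ) - Complex.I ≠ 0 := den_ne hI
    generalize b * r ^ k = v at hne
    have : 1 / ((v:ℂ) - Complex.I) ^ 2 = ((v + Complex.I) ^ 2) * (((1 / (1 + v ^ 2) ^ 2 : ℝ)) : ℂ) := by
      have h1 : (1 + (v:ℂ) ^ 2) = (v - Complex.I) * (v + Complex.I) := by ring_nf; simp; ring
      have h2 : (v:ℂ) + Complex.I ≠ 0 := by
        intro h; have := congrArg Complex.im h; simp at this
      push_cast
      rw [h1]; field_simp
    rw [this, Complex.re_mul_ofReal, pow_two]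
    simp
    ring
  have ib : ∀ g : ℝ → ℝ, Continuous g → (∀ v, |g v| ≤ 1 + v ^ 2) → Integrable fun r : ℝ => g (b * r ^ k) / (1 + (b * r ^ k) ^ 2) ^ 2 := by
    intro g hg hb'
    obtain ⟨B, hB, h⟩ := Ik_bound (k := k) (M := ‖Complex.I‖) hb hI
    refine Integrable.mono' ((bump_integrable hk1).const_mul B) ?_ (Eventually.of_forall fun r => ?_)
    · refine Continuous.aestronglyMeasurable (Continuous.div (by fun_prop) (by fun_prop) fun r => by positivity)
    · have := h Complex.I le_rfl le_rfl r
      refine le_trans ?_ this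
      have e : ‖((b * r ^ k : ℝ) : ℂ) - Complex.I‖ ^ 2 = 1 + (b * r ^ k) ^ 2 := by
        generalize b * r ^ k = v
        rw [← Complex.normSq_eq_norm_sq, Complex.normSq_apply]; simp; ring
      rw [e, norm_div, Real.norm_eq_abs, Real.norm_eq_abs, abs_of_nonneg (by positivity : 0 ≤ (1 + (b * r ^ k) ^ 2) ^ 2),
        div_le_div_iff₀ (by positivity) (by positivity)]
      have := hb' (b * r ^ k)
      have h0 : 0 < 1 + (b * r ^ k) ^ 2 := by positivity
      nlinarith
  have iA := ib (fun v => v ^ 2 - 1) (by fun_prop) (fun v => by rw [abs_le]; constructor <;> nlinarith [sq_nonneg v])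
  have i1 := ib (fun v => 1) (by fun_prop) (fun v => by rw [abs_one]; nlinarith [sq_nonneg v])
  have iv := ib (fun v => v ^ 2) (by fun_prop) (fun v => by rw [abs_of_nonneg (sq_nonneg v)]; linarith)
  have hd : ∀ r : ℝ, HasDerivAt (fun r : ℝ => r / (1 + (b * r ^ k) ^ 2))
      (1 / (1 + (b * r ^ k) ^ 2) ^ 2 + (-(2 * k - 1)) * ((b * r ^ k) ^ 2 / (1 + (b * r ^ k) ^ 2) ^ 2)) r := fun r => by
    have h0 : (1 + (b * r ^ k) ^ 2) ≠ 0 := by positivity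
    have h1 : HasDerivAt (fun r : ℝ => b * r ^ k) (b * (k * r ^ (k - 1))) r := (hasDerivAt_pow k r).const_mul b
    have h2 : HasDerivAt (fun r : ℝ => 1 + (b * r ^ k) ^ 2) (2 * (b * r ^ k) * (b * (k * r ^ (k - 1)))) r := by
      refine ((h1.fun_pow 2).const_add 1).congr_deriv ?_
      simp
    refine ((hasDerivAt_id r).div h2 h0).congr_deriv ?_
    have e : r * (2 * (b * r ^ k) * (b * (k * r ^ (k - 1)))) = 2 * k * (b * r ^ k) ^ 2 := by
      have : r ^ k = r ^ (k - 1) * r := by rw [← pow_succ]; congr 1; omega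
      rw [this]; ring
    simp only [id]
    rw [e]
    generalize b * r ^ k = v at h0
    field_simp
    ring
  obtain ⟨B, hB, h⟩ := Ik_bound (k := k) (M := ‖Complex.I‖) hb hI
  have hn : ∀ r : ℝ, ‖r / (1 + (b * r ^ k) ^ 2)‖ ≤ B * (|r| * (1 / (r ^ (2 * k) + 1))) := fun r => by
    have := h Complex.I le_rfl le_rfl r
    have e : ‖((b * r ^ k : ℝ) : ℂ) - Complex.I‖ ^ 2 = 1 + (b * r ^ k) ^ 2 := by
      generalize b * r ^ k = v
      rw [← Complex.normSq_eq_norm_sq, Complex.normSq_apply]; simp; ring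
    rw [e] at this
    rw [norm_div, Real.norm_eq_abs, Real.norm_eq_abs, abs_of_nonneg (by positivity : 0 ≤ (1 + (b * r ^ k) ^ 2)), div_eq_mul_one_div]
    calc _ ≤ |r| * (B * (1 / (r ^ (2 * k) + 1))) := by gcongr
      _ = _ := by ring
  have lt : Tendsto (fun r : ℝ => r / (1 + (b * r ^ k) ^ 2)) atTop (𝓝 0) :=
    squeeze_zero_norm hn (by simpa using (tail_top hk1).const_mul B)
  have lb : Tendsto (fun r : ℝ => r / (1 + (b * r ^ k) ^ 2)) atBot (𝓝 0) :=
    squeeze_zero_norm hn (by simpa using (tail_bot hk1).const_mul B)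
  have h0 := integral_of_hasDerivAt_of_tendsto hd (i1.add (iv.const_mul _)) lb lt
  rw [integral_add i1 (iv.const_mul _), integral_const_mul, sub_zero] at h0
  have e2 : (∫ r : ℝ, ((b * r ^ k) ^ 2 - 1) / (1 + (b * r ^ k) ^ 2) ^ 2) =
      (∫ r : ℝ, (b * r ^ k) ^ 2 / (1 + (b * r ^ k) ^ 2) ^ 2) - ∫ r : ℝ, 1 / (1 + (b * r ^ k) ^ 2) ^ 2 := by
    rw [← integral_sub iv i1]
    congr 1; funext r; ring
  have hpos : 0 < ∫ r : ℝ, (b * r ^ k) ^ 2 / (1 + (b * r ^ k) ^ 2) ^ 2 := by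
    rw [integral_pos_iff_support_of_nonneg (fun r => by positivity) iv]
    have : Ioo (0:ℝ) 1 ⊆ Function.support fun r : ℝ => (b * r ^ k) ^ 2 / (1 + (b * r ^ k) ^ 2) ^ 2 := fun r hr => by
      have := hr.1
      have : (b * r ^ k) ^ 2 / (1 + (b * r ^ k) ^ 2) ^ 2 ≠ 0 := by positivity
      exact this
    refine lt_of_lt_of_le ?_ (measure_mono this)
    simp
  rw [e1, e2]
  have hk2 : (2:ℝ) ≤ k := by exact_mod_cast hk
  nlinarith

end OS

end

noncomputable section
open Filter Topology MeasureTheory Set ComplexConjugate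
namespace OS

lemma ii_bdd {E : Type*} [NormedAddCommGroup E] {h : ℝ → E} {B : ℝ} (hm : AEStronglyMeasurable h (volume.restrict (Ioc (0:ℝ) 1))) (hB : ∀ x ∈ Icc (0:ℝ) 1, ‖h x‖ ≤ B)
    {x y : ℝ} (hx : x ∈ Icc (0:ℝ) 1) (hy : y ∈ Icc (0:ℝ) 1) : IntervalIntegrable h volume x y := by
  have : IntegrableOn h (Ioc 0 1) := by
    refine Integrable.of_bound hm B ?_
    refine (ae_restrict_iff' measurableSet_Ioc).2 (Eventually.of_forall fun t ht => hB t (Ioc_subset_Icc_self ht))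
  refine (intervalIntegrable_iff_integrableOn_Ioc_of_le zero_le_one).2 this |>.mono_set ?_
  rw [uIcc_of_le zero_le_one]
  exact uIcc_subset_Icc hx hy

lemma lim_abs {g : ℕ → ℝ → ℂ} {kap : ℕ → ℝ → ℝ → ℂ} {kinf : ℝ → ℝ → ℂ} {F : ℝ → ℂ} {ε : ℕ → ℝ} {L B : ℝ} {X : Set ℝ}
    (hg : ∀ n, Continuous (g n)) (hkc : ∀ n x, Continuous (kap n x)) (hF : Measurable F)
    (hki : ∀ x, Measurable (kinf x))
    (hL0 : 0 ≤ L)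
    (hB : ∀ n, ∀ x ∈ Icc (0:ℝ) 1, ‖g n x‖ ≤ B) (hFB : ∀ x ∈ Icc (0:ℝ) 1, ‖F x‖ ≤ B)
    (hε : Tendsto ε atTop (𝓝 0))
    (h1 : ∀ n, ∀ x ∈ Icc (0:ℝ) 1, ‖g n x - (1 + ∫ t in (0:ℝ)..x, kap n x t * g n t)‖ ≤ ε n)
    (hL : ∀ n, ∀ x ∈ Icc (0:ℝ) 1, ∀ t ∈ Icc 0 x, ‖kap n x t‖ ≤ L)
    (hFe : ∀ x ∈ Icc (0:ℝ) 1, F x = 1 + ∫ t in (0:ℝ)..x, kinf x t * F t)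
    (hX : X ⊆ Icc 0 1) (hXae : ∀ᵐ x ∂(volume.restrict (Ioc (0:ℝ) 1)), x ∈ X)
    (hlim : ∀ x ∈ X, ∀ᵐ t ∂(volume.restrict (Ioc 0 x)), Tendsto (fun n => kap n x t) atTop (𝓝 (kinf x t))) :
    Tendsto (fun n => ∫ x in (0:ℝ)..1, ‖g n x - F x‖) atTop (𝓝 0) ∧ ∀ x ∈ X, Tendsto (fun n => g n x) atTop (𝓝 (F x)) := by
  have I0 : (0:ℝ) ∈ Icc (0:ℝ) 1 := by simp
  have I1 : (1:ℝ) ∈ Icc (0:ℝ) 1 := by simp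
  have hB0 : 0 ≤ B := (norm_nonneg _).trans (hFB 0 I0)
  set e : ℕ → ℝ → ℝ := fun n x => ‖g n x - F x‖ with he
  have em : ∀ n, Measurable (e n) := fun n => ((hg n).measurable.sub hF).norm
  have eB : ∀ n, ∀ x ∈ Icc (0:ℝ) 1, e n x ≤ 2 * B := fun n x hx =>
    (norm_sub_le _ _).trans (by linarith [hB n x hx, hFB x hx])
  have e0 : ∀ n x, 0 ≤ e n x := fun n x => norm_nonneg _
  have ei : ∀ n, ∀ x ∈ Icc (0:ℝ) 1, IntervalIntegrable (e n) volume 0 x := fun n x hx =>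
    ii_bdd (B := 2 * B) (em n).aestronglyMeasurable (fun y hy => by rw [Real.norm_eq_abs, abs_of_nonneg (e0 n y)]; exact eB n y hy) I0 hx
  -- pointwise bound
  set δ : ℕ → ℝ → ℝ := fun n x => ∫ t in (0:ℝ)..x, ‖kap n x t - kinf x t‖ * ‖F t‖ with hδ
  have kiL : ∀ x ∈ X, ∀ᵐ t ∂(volume.restrict (Ioc 0 x)), ‖kinf x t‖ ≤ L := fun x hx => by
    filter_upwards [hlim x hx, self_mem_ae_restrict measurableSet_Ioc] with t ht hti
    exact le_of_tendsto ((continuous_norm.tendsto _).comp ht)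
      (Eventually.of_forall fun n => hL n x (hX hx) t (Ioc_subset_Icc_self hti))
  have hle : ∀ x ∈ X, Ioc (0:ℝ) x ⊆ Icc 0 1 := fun x hx t ht => ⟨ht.1.le, ht.2.trans (hX hx).2⟩
  have kFi : ∀ x ∈ X, IntervalIntegrable (fun t => kinf x t * F t) volume 0 x := fun x hx => by
    refine (intervalIntegrable_iff_integrableOn_Ioc_of_le (hX hx).1).2 ?_
    refine Measure.integrableOn_of_bounded (M := L * B) (by simp) ((hki x).mul hF).aestronglyMeasurable ?_
    filter_upwards [kiL x hx, self_mem_ae_restrict measurableSet_Ioc] with t ht hti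
    rw [norm_mul]
    exact mul_le_mul ht (hFB t (hle x hx hti)) (norm_nonneg _) hL0
  have dFi : ∀ n, ∀ x ∈ X, IntervalIntegrable (fun t => ‖kap n x t - kinf x t‖ * ‖F t‖) volume 0 x := fun n x hx => by
    refine (intervalIntegrable_iff_integrableOn_Ioc_of_le (hX hx).1).2 ?_
    refine Measure.integrableOn_of_bounded (M := (L + L) * B) (by simp) ?_ ?_
    · exact ((((hkc n x).measurable.sub (hki x)).norm).mul hF.norm).aestronglyMeasurable
    filter_upwards [kiL x hx, self_mem_ae_restrict measurableSet_Ioc] with t ht hti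
    rw [norm_mul, norm_norm, norm_norm]
    have := hL n x (hX hx) t (Ioc_subset_Icc_self hti)
    exact mul_le_mul ((norm_sub_le _ _).trans (add_le_add this ht)) (hFB t (hle x hx hti)) (norm_nonneg _) (by positivity)
  have main : ∀ n, ∀ x ∈ X, e n x ≤ ε n + δ n x + L * ∫ t in (0:ℝ)..x, e n t := fun n x hx => by
    have hxI := hX hx
    have i1 : IntervalIntegrable (fun t => kap n x t * g n t) volume 0 x := ((hkc n x).mul (hg n)).intervalIntegrable _ _
    have a1 : g n x - F x = (g n x - (1 + ∫ t in (0:ℝ)..x, kap n x t * g n t)) +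
        ∫ t in (0:ℝ)..x, (kap n x t * g n t - kinf x t * F t) := by
      rw [intervalIntegral.integral_sub i1 (kFi x hx)]
      nth_rewrite 1 [hFe x hxI]; ring
    have a2 : ‖∫ t in (0:ℝ)..x, (kap n x t * g n t - kinf x t * F t)‖ ≤
        ∫ t in (0:ℝ)..x, (‖kap n x t - kinf x t‖ * ‖F t‖ + L * e n t) := by
      refine intervalIntegral.norm_integral_le_of_norm_le hxI.1 ?_ ((dFi n x hx).add ((ei n x hxI).const_mul L))
      refine Eventually.of_forall fun t ht => ?_
      rw [show kap n x t * g n t - kinf x t * F t = (kap n x t - kinf x t) * F t + kap n x t * (g n t - F t) by ring]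
      refine (norm_add_le _ _).trans ?_
      rw [norm_mul, norm_mul]
      have := hL n x hxI t (Ioc_subset_Icc_self ht)
      exact add_le_add le_rfl (mul_le_mul_of_nonneg_right this (norm_nonneg _))
    rw [intervalIntegral.integral_add (dFi n x hx) ((ei n x hxI).const_mul L), intervalIntegral.integral_const_mul] at a2
    simp only [he]
    rw [a1]
    refine (norm_add_le _ _).trans ?_
    have := h1 n x hxI
    simp only [hδ]
    linarith
  have δlim : ∀ x ∈ X, Tendsto (fun n => δ n x) atTop (𝓝 0) := fun x hx => by
    have hxI := hX hx
    have : Tendsto (fun n => ∫ t in Ioc 0 x, ‖kap n x t - kinf x t‖ * ‖F t‖) atTop (𝓝 (∫ t in Ioc 0 x, (0:ℝ))) := by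
      refine tendsto_integral_of_dominated_convergence (fun _ => (L + L) * B) ?_ ?_ ?_ ?_
      · exact fun n => ((((hkc n x).measurable.sub (hki x)).norm).mul hF.norm).aestronglyMeasurable
      · exact integrable_const _
      · intro n
        filter_upwards [kiL x hx, self_mem_ae_restrict measurableSet_Ioc] with t ht hti
        rw [norm_mul, norm_norm, norm_norm]
        have := hL n x (hX hx) t (Ioc_subset_Icc_self hti)
        exact mul_le_mul ((norm_sub_le _ _).trans (add_le_add this ht)) (hFB t (hle x hx hti)) (norm_nonneg _) (by positivity)
      · filter_upwards [hlim x hx] with t ht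
        have := ((ht.sub_const (kinf x t)).norm).mul_const ‖F t‖
        simpa using this
    simp only [integral_zero] at this
    refine this.congr fun n => ?_
    simp only [hδ]
    rw [intervalIntegral.integral_of_le hxI.1]
  -- o_n
  set G : ℕ → ℝ → ℝ := fun n x => ∫ t in (0:ℝ)..x, e n t with hG
  have Gc : ∀ n, ContinuousOn (G n) (Icc 0 1) := fun n => by
    have := intervalIntegral.continuousOn_primitive_interval (μ := volume) (f := e n) (a := 0) (b := 1)
      ((intervalIntegrable_iff' (by simp)).1 (ei n 1 I1))
    rwa [uIcc_of_le zero_le_one] at this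
  have G0 : ∀ n, ∀ x ∈ Icc (0:ℝ) 1, 0 ≤ G n x := fun n x hx => intervalIntegral.integral_nonneg hx.1 fun t _ => e0 n t
  set o : ℕ → ℝ → ℝ := fun n x => max 0 (e n x - L * G n x) with ho
  have om : ∀ n, AEStronglyMeasurable (o n) (volume.restrict (Ioc (0:ℝ) 1)) := fun n => by
    have c1 : AEStronglyMeasurable (G n) (volume.restrict (Ioc (0:ℝ) 1)) :=
      ((Gc n).mono Ioc_subset_Icc_self).aestronglyMeasurable measurableSet_Ioc
    exact (aemeasurable_const.max ((em n).aemeasurable.sub (c1.aemeasurable.const_mul L))).aestronglyMeasurable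
  have o0 : ∀ n x, 0 ≤ o n x := fun n x => le_max_left _ _
  have oB : ∀ n, ∀ x ∈ Icc (0:ℝ) 1, ‖o n x‖ ≤ 2 * B := fun n x hx => by
    rw [Real.norm_eq_abs, abs_of_nonneg (o0 n x)]
    refine max_le (by positivity) ?_
    have := mul_nonneg hL0 (G0 n x hx)
    linarith [eB n x hx]
  have oi : ∀ n, ∀ x ∈ Icc (0:ℝ) 1, IntervalIntegrable (o n) volume 0 x := fun n x hx => ii_bdd (om n) (oB n) I0 hx
  have olim : Tendsto (fun n => ∫ x in (0:ℝ)..1, o n x) atTop (𝓝 0) := by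
    have : Tendsto (fun n => ∫ t in Ioc (0:ℝ) 1, o n t) atTop (𝓝 (∫ t in Ioc (0:ℝ) 1, (0:ℝ))) := by
      refine tendsto_integral_of_dominated_convergence (fun _ => 2 * B) om (integrable_const _) ?_ ?_
      · intro n
        filter_upwards [self_mem_ae_restrict measurableSet_Ioc] with t hti using oB n t (Ioc_subset_Icc_self hti)
      · filter_upwards [hXae] with x hx
        have l := (hε.abs).add (δlim x hx).abs
        simp only [abs_zero, add_zero] at l
        refine squeeze_zero (fun n => o0 n x) (fun n => ?_) l
        refine max_le (by positivity) ?_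
        have := main n x hx
        have := le_abs_self (ε n)
        have := le_abs_self (δ n x)
        simp only [hG]
        linarith
    simp only [integral_zero] at this
    refine this.congr fun n => ?_
    rw [intervalIntegral.integral_of_le zero_le_one]
  have GB : ∀ n, ∀ x ∈ Icc (0:ℝ) 1, G n x ≤ (∫ x in (0:ℝ)..1, o n x) * Real.exp L := fun n => by
    -- extend G continuously
    set Gt : ℝ → ℝ := fun x => G n (max 0 (min x 1)) with hGt
    have cl : ∀ x : ℝ, max 0 (min x 1) ∈ Icc (0:ℝ) 1 := fun x => ⟨le_max_left _ _, max_le zero_le_one (min_le_right _ _)⟩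
    have clx : ∀ x ∈ Icc (0:ℝ) 1, max 0 (min x 1) = x := fun x hx => by rw [min_eq_left hx.2, max_eq_right hx.1]
    have Gtc : Continuous Gt := by
      have := (Gc n).comp_continuous (f := fun x : ℝ => max 0 (min x 1)) (by fun_prop) cl
      exact this
    have := gron Gtc hL0 (intervalIntegral.integral_nonneg zero_le_one fun t _ => o0 n t) (a0 := ∫ x in (0:ℝ)..1, o n x) ?_
    · intro x hx
      have := this x hx
      simp only [hGt, clx x hx] at this
      exact this
    · intro x hx
      simp only [hGt, clx x hx]
      have c2 : ∫ t in (0:ℝ)..x, Gt t = ∫ t in (0:ℝ)..x, G n t := by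
        refine intervalIntegral.integral_congr fun t ht => ?_
        rw [uIcc_of_le hx.1] at ht
        simp only [hGt, clx t ⟨ht.1, ht.2.trans hx.2⟩]
      have c3 : IntervalIntegrable (G n) volume 0 x := by
        refine ContinuousOn.intervalIntegrable ((Gc n).mono ?_)
        exact uIcc_subset_Icc I0 hx
      calc G n x = ∫ t in (0:ℝ)..x, e n t := rfl
        _ ≤ ∫ t in (0:ℝ)..x, (o n t + L * G n t) := by
          refine intervalIntegral.integral_mono_on hx.1 (ei n x hx) ((oi n x hx).add (c3.const_mul L)) fun t ht => ?_
          have : e n t - L * G n t ≤ o n t := le_max_right _ _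
          linarith
        _ = (∫ t in (0:ℝ)..x, o n t) + L * ∫ t in (0:ℝ)..x, G n t := by
          rw [intervalIntegral.integral_add (oi n x hx) (c3.const_mul L), intervalIntegral.integral_const_mul]
        _ ≤ _ := by
          rw [← c2]
          refine add_le_add ?_ le_rfl
          exact intervalIntegral.integral_mono_interval le_rfl hx.1 hx.2 (Eventually.of_forall fun t => o0 n t) (oi n 1 I1)
  have Glim : Tendsto (fun n => G n 1) atTop (𝓝 0) := by
    refine squeeze_zero (fun n => G0 n 1 I1) (fun n => GB n 1 I1) ?_
    simpa using olim.mul_const (Real.exp L)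
  refine ⟨Glim, fun x hx => ?_⟩
  rw [tendsto_iff_norm_sub_tendsto_zero]
  have l := (hε.add (δlim x hx)).add (Glim.const_mul L)
  simp only [add_zero, mul_zero] at l
  refine squeeze_zero (fun n => e0 n x) (fun n => (main n x hx).trans ?_) l
  have : (∫ t in (0:ℝ)..x, e n t) ≤ G n 1 :=
    intervalIntegral.integral_mono_interval le_rfl (hX hx).1 (hX hx).2 (Eventually.of_forall fun t => e0 n t) (ei n 1 I1)
  have := mul_le_mul_of_nonneg_left this hL0
  linarith

end OS

end

noncomputable section
open Filter Topology MeasureTheory Set ComplexConjugate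
namespace OS

/-- the Volterra kernel -/
def kapf (P : Prof) (α2 : ℝ) (c : ℂ) (x t : ℝ) : ℂ := α2 * P.d c t ^ 2 * ∫ y in t..x, 1 / P.d c y ^ 2

section
variable {P : Prof} {k : ℕ} {K M μ m σ ν α2 : ℝ} {c : ℂ} {S S1 S2 qS f f1 f2 q rh rh1 rh2 : ℝ → ℂ}
namespace Setup
variable (h : Setup P k K M μ m σ ν α2 c S S1 S2 qS f f1 f2 q rh rh1 rh2)
include h

lemma cid : Continuous fun y => 1 / P.d c y ^ 2 :=
  Continuous.div (by fun_prop) (by fun_prop) fun x => pow_ne_zero 2 (h.dne x)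

lemma kapf_eq (x t : ℝ) : kapf P α2 c x t = α2 * P.d c t ^ 2 *
    ((∫ y in (0:ℝ)..x, 1 / P.d c y ^ 2) - ∫ y in (0:ℝ)..t, 1 / P.d c y ^ 2) := by
  unfold kapf
  rw [intervalIntegral.integral_interval_sub_left (h.cid.intervalIntegrable _ _) (h.cid.intervalIntegrable _ _)]

lemma ckap (x : ℝ) : Continuous (kapf P α2 c x) := by
  have : kapf P α2 c x = fun t => α2 * P.d c t ^ 2 *
    ((∫ y in (0:ℝ)..x, 1 / P.d c y ^ 2) - ∫ y in (0:ℝ)..t, 1 / P.d c y ^ 2) := funext (h.kapf_eq x)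
  rw [this]
  have := int_cont h.cid
  fun_prop

lemma d2_ee {t s : ℝ} (ht : t ∈ Icc (0:ℝ) s) (hs : s ≤ 1) : ‖P.d c t‖ ^ 2 ≤ 5 * M ^ 4 * K * ee k μ s := by
  have hM := h.ph.hM
  have hK := h.vh.hK
  calc _ ≤ 5 * M ^ 4 * w2 P μ t := d_le h.vh h.ph t
    _ ≤ 5 * M ^ 4 * (K * ee k μ t) := by gcongr; exact h.vh.H5 t ⟨ht.1, ht.2.trans hs⟩
    _ ≤ 5 * M ^ 4 * (K * ee k μ s) := by gcongr; exact ee_mono ht.1 ht.2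
    _ = _ := by ring

lemma cew : Continuous fun y => ee k μ y / w2 P μ y :=
  Continuous.div (by fun_prop) (by fun_prop) fun x => (w2_pos h.vh.μ0 x).ne'

lemma ew_nonneg (x : ℝ) : 0 ≤ ee k μ x / w2 P μ x := div_nonneg (ee_pos h.vh.μ0 x).le (w2_pos h.vh.μ0 x).le

lemma ew_int {x : ℝ} (hx : x ∈ Icc (0:ℝ) 1) : ∫ y in (0:ℝ)..x, ee k μ y / w2 P μ y ≤ K / m :=
  (int_mono_right h.cew (fun x _ => h.ew_nonneg x) hx.1 hx.2 le_rfl).trans h.vh.H2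

lemma kap_le {x t : ℝ} (hx : x ∈ Icc (0:ℝ) 1) (ht : t ∈ Icc 0 x) : ‖kapf P α2 c x t‖ ≤ 25 * M ^ 9 * K ^ 2 := by
  have hM := h.ph.hM
  have hK := h.vh.hK
  have hm := h.vh.m0
  have e0 := ee_pos (k := k) h.vh.μ0 t
  have key : ee k μ t * ‖∫ y in t..x, 1 / P.d c y ^ 2‖ ≤ 5 * M ^ 4 * (K / m) := by
    calc _ ≤ ee k μ t * ∫ y in t..x, ‖1 / P.d c y ^ 2‖ := by
          gcongr; exact intervalIntegral.norm_integral_le_integral_norm ht.2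
      _ = ∫ y in t..x, ee k μ t * ‖1 / P.d c y ^ 2‖ := by rw [intervalIntegral.integral_const_mul]
      _ ≤ ∫ y in t..x, 5 * M ^ 4 * (ee k μ y / w2 P μ y) := by
          have := h.cid; have := h.cew
          refine intervalIntegral.integral_mono_on ht.2 ((continuous_const.mul h.cid.norm).intervalIntegrable _ _)
            ((continuous_const.mul this).intervalIntegrable _ _) fun y hy => ?_
          rw [norm_div, norm_pow, norm_one]
          calc _ ≤ ee k μ y * (5 * M ^ 4 / w2 P μ y) := by
                exact mul_le_mul (ee_mono ht.1 hy.1) (h.inv_d y) (by positivity) (ee_pos h.vh.μ0 _).le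
            _ = _ := by ring
      _ = 5 * M ^ 4 * ∫ y in t..x, ee k μ y / w2 P μ y := by rw [intervalIntegral.integral_const_mul]
      _ ≤ 5 * M ^ 4 * (K / m) := by
          gcongr
          refine le_trans ?_ (h.ew_int hx)
          rw [← intervalIntegral.integral_interval_sub_left (h.cew.intervalIntegrable 0 x) (h.cew.intervalIntegrable 0 t)]
          have := int_nonneg' (fun x _ => h.ew_nonneg x) (x := t) ⟨ht.1, ht.2.trans hx.2⟩
          linarith
  unfold kapf
  rw [norm_mul, norm_mul, norm_pow, Complex.norm_real, Real.norm_eq_abs, abs_of_nonneg h.ph.α0]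
  calc _ ≤ (M * m) * (5 * M ^ 4 * K * ee k μ t) * ‖∫ y in t..x, 1 / P.d c y ^ 2‖ := by
        gcongr
        · exact h.ph.αM
        · exact h.d2_ee ⟨ht.1, le_rfl⟩ (ht.2.trans hx.2)
    _ = (M * m) * (5 * M ^ 4 * K) * (ee k μ t * ‖∫ y in t..x, 1 / P.d c y ^ 2‖) := by ring
    _ ≤ (M * m) * (5 * M ^ 4 * K) * (5 * M ^ 4 * (K / m)) := by gcongr
    _ = _ := by field_simp; ring

lemma f0_kernel {x : ℝ} (hx : x ∈ Icc (0:ℝ) 1) :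
    ‖(f x - fSf P c (rh 1) qS x) - (f 0 + ∫ t in (0:ℝ)..x, kapf P α2 c x t * (f t - fSf P c (rh 1) qS t))‖ ≤
      25 * M ^ 8 * K * (√(∫ t in (0:ℝ)..1, omg P k μ t * ‖rh t - rh 1 * S t‖ ^ 2) / m + M * K * ∫ t in (0:ℝ)..1, ‖fSf P c (rh 1) qS t‖) := by
  have hM := h.ph.hM
  have hK := h.vh.hK
  have hm := h.vh.m0
  have hα := h.ph.α0
  have cr := h.cr
  have cfS := h.cfS
  have cf := h.cf
  set fS := fSf P c (rh 1) qS with hfS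
  set Qr := √(∫ t in (0:ℝ)..1, omg P k μ t * ‖rh t - rh 1 * S t‖ ^ 2) with hQr
  set N := ∫ t in (0:ℝ)..1, ‖fS t‖ with hN
  set G : ℝ → ℂ := fun s => ∫ t in (0:ℝ)..s, (P.d c t * (rh t - rh 1 * S t) + α2 * P.d c t ^ 2 * fS t) with hG
  set H : ℝ → ℂ := fun s => ∫ t in (0:ℝ)..s, α2 * P.d c t ^ 2 * (f t - fS t) with hH
  set J : ℝ → ℂ := fun s => ∫ t in (0:ℝ)..s, 1 / P.d c t ^ 2 with hJ
  have cg : Continuous fun t => P.d c t * (rh t - rh 1 * S t) + α2 * P.d c t ^ 2 * fS t := by fun_prop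
  have ch : Continuous fun t => α2 * P.d c t ^ 2 * (f t - fS t) := by fun_prop
  have q0e : ∀ s, q s - rh 1 * qS s = G s + H s := fun s => by
    rw [h.q0_int, hG, hH]
    simp only []
    rw [← intervalIntegral.integral_add (cg.intervalIntegrable _ _) (ch.intervalIntegrable _ _)]
    congr 1; ext t; ring
  have cid := h.cid
  have cG : Continuous G := int_cont cg
  have cH : Continuous H := int_cont ch
  have cJ : Continuous J := int_cont cid
  have parts : ∫ s in (0:ℝ)..x, H s * (1 / P.d c s ^ 2) = ∫ t in (0:ℝ)..x, kapf P α2 c x t * (f t - fS t) := by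
    rw [intervalIntegral.integral_mul_deriv_eq_deriv_mul (u := H) (v := J) (fun s _ => int_hasDeriv ch s) (fun s _ => int_hasDeriv cid s)
      (ch.intervalIntegrable _ _) (cid.intervalIntegrable _ _)]
    have H0 : H 0 = 0 := by simp [hH]
    rw [H0, zero_mul, sub_zero, show H x * J x = ∫ t in (0:ℝ)..x, α2 * P.d c t ^ 2 * (f t - fS t) * J x by
      rw [intervalIntegral.integral_mul_const], ← intervalIntegral.integral_sub ((by fun_prop : Continuous fun t => α2 * P.d c t ^ 2 * (f t - fS t) * J x).intervalIntegrable _ _) ((by fun_prop : Continuous fun t => α2 * P.d c t ^ 2 * (f t - fS t) * J t).intervalIntegrable _ _)]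
    congr 1; ext t; rw [h.kapf_eq]; ring
  have e1 : (f x - fS x) - (f 0 + ∫ t in (0:ℝ)..x, kapf P α2 c x t * (f t - fS t)) = ∫ s in (0:ℝ)..x, G s * (1 / P.d c s ^ 2) := by
    rw [h.f0_int x, ← parts]
    have : ∫ t in (0:ℝ)..x, (q t - rh 1 * qS t) / P.d c t ^ 2 = (∫ s in (0:ℝ)..x, G s * (1 / P.d c s ^ 2)) + ∫ s in (0:ℝ)..x, H s * (1 / P.d c s ^ 2) := by
      rw [← intervalIntegral.integral_add ((cG.fun_mul cid).intervalIntegrable _ _) ((cH.fun_mul cid).intervalIntegrable _ _)]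
      congr 1; ext t; rw [q0e]; ring
    rw [this]; ring
  have Gle : ∀ s ∈ Icc (0:ℝ) 1, ‖G s‖ ≤ ee k μ s * (5 * M ^ 4 * Qr + 5 * M ^ 5 * K * m * N) := fun s hs => by
    have e0 := (ee_pos (k := k) h.vh.μ0 s).le
    calc ‖G s‖ ≤ ∫ t in (0:ℝ)..s, ‖P.d c t * (rh t - rh 1 * S t) + α2 * P.d c t ^ 2 * fS t‖ := intervalIntegral.norm_integral_le_integral_norm hs.1
      _ ≤ ∫ t in (0:ℝ)..s, (‖P.d c t‖ * ‖rh t - rh 1 * S t‖ + (M * m) * (5 * M ^ 4 * K * ee k μ s) * ‖fS t‖) := by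
          refine int_mono' cg.norm (by fun_prop) hs fun t ht => (norm_add_le _ _).trans ?_
          rw [norm_mul, norm_mul, norm_mul, norm_pow, Complex.norm_real, Real.norm_eq_abs, abs_of_nonneg hα]
          gcongr
          · exact h.ph.αM
          · exact h.d2_ee ht hs.2
      _ = (∫ t in (0:ℝ)..s, ‖P.d c t‖ * ‖rh t - rh 1 * S t‖) + (M * m) * (5 * M ^ 4 * K * ee k μ s) * ∫ t in (0:ℝ)..s, ‖fS t‖ := by
          rw [intervalIntegral.integral_add ((by fun_prop : Continuous _).intervalIntegrable _ _) ((by fun_prop : Continuous _).intervalIntegrable _ _), intervalIntegral.integral_const_mul]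
      _ ≤ 5 * M ^ 4 * ee k μ s * Qr + (M * m) * (5 * M ^ 4 * K * ee k μ s) * N := by
          gcongr
          · exact h.Ir_le hs
          · exact int_mono_right cfS.norm (fun _ _ => norm_nonneg _) hs.1 hs.2 le_rfl
      _ = _ := by ring
  rw [e1]
  have N0 : 0 ≤ N := int_nonneg' (fun _ _ => norm_nonneg _) (by simp)
  calc _ ≤ ∫ s in (0:ℝ)..x, ‖G s * (1 / P.d c s ^ 2)‖ := intervalIntegral.norm_integral_le_integral_norm hx.1
    _ ≤ ∫ s in (0:ℝ)..x, (5 * M ^ 4 * Qr + 5 * M ^ 5 * K * m * N) * (5 * M ^ 4) * (ee k μ s / w2 P μ s) := by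
        have := h.cew
        refine int_mono' (cG.fun_mul cid).norm (by fun_prop) hx fun s hs => ?_
        have hs1 : s ∈ Icc (0:ℝ) 1 := ⟨hs.1, hs.2.trans hx.2⟩
        have := (ee_pos (k := k) h.vh.μ0 s).le
        rw [norm_mul, norm_div, norm_pow, norm_one]
        calc _ ≤ (ee k μ s * (5 * M ^ 4 * Qr + 5 * M ^ 5 * K * m * N)) * (5 * M ^ 4 / w2 P μ s) := by
              exact mul_le_mul (Gle s hs1) (h.inv_d s) (by positivity) (by positivity)
          _ = _ := by ring
    _ = (5 * M ^ 4 * Qr + 5 * M ^ 5 * K * m * N) * (5 * M ^ 4) * ∫ s in (0:ℝ)..x, ee k μ s / w2 P μ s := by rw [intervalIntegral.integral_const_mul]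
    _ ≤ (5 * M ^ 4 * Qr + 5 * M ^ 5 * K * m * N) * (5 * M ^ 4) * (K / m) := by gcongr; exact h.ew_int hx
    _ = _ := by field_simp; ring

end Setup
end

/-- limit kernel -/
def kinf (P : Prof) (T : Finset ℝ) (ord : ℝ → ℕ) (b : ℝ → ℝ) (k : ℕ) (κ : ℝ) (Cs : ℂ) (x t : ℝ) : ℂ :=
  κ * (P.V t : ℂ) ^ 2 * ∑ w ∈ T, if t < w ∧ w < x ∧ ord w = k then Ik k (b w) Cs else 0

lemma kinf_meas {P : Prof} {T : Finset ℝ} {ord : ℝ → ℕ} {b : ℝ → ℝ} {k : ℕ} {κ : ℝ} {Cs : ℂ} (x : ℝ) :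
    Measurable (kinf P T ord b k κ Cs x) := by
  unfold kinf
  refine Measurable.mul (Continuous.measurable (by fun_prop)) ?_
  refine Finset.measurable_sum _ fun w _ => Measurable.ite ?_ measurable_const measurable_const
  by_cases h : w < x ∧ ord w = k
  · have : {t : ℝ | t < w ∧ w < x ∧ ord w = k} = Iio w := by ext t; simp [h.1, h.2]
    rw [this]; exact measurableSet_Iio
  · have : {t : ℝ | t < w ∧ w < x ∧ ord w = k} = ∅ := by ext t; simp only [mem_setOf_eq, mem_empty_iff_false, iff_false]; tauto
    rw [this]; exact MeasurableSet.empty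

lemma seq_lim {P : Prof} {T : Finset ℝ} {ord : ℝ → ℕ} {b : ℝ → ℝ} {c0 : ℝ} (z : ZD P T ord b c0) {k : ℕ} (hk : 1 ≤ k)
    (hkT : ∀ w ∈ T, w ≠ 0 → ord w ≤ k) {μ C Cs η Mc} (s : SeqH μ C Cs η Mc) {K M κ σ' Cc B : ℝ} (hσ : 0 < σ') {ν : ℕ → ℝ}
    {S S1 S2 qS f f1 f2 q rh rh1 rh2 : ℕ → ℝ → ℂ}
    (hs : ∀ n, Setup P (ord 0) K M (μ n) (μ n ^ (2 - (1:ℝ) / k)) (μ n ^ σ') (ν n) (κ * μ n ^ (2 - (1:ℝ) / k)) (μ n * C n)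
      (S n) (S1 n) (S2 n) (qS n) (f n) (f1 n) (f2 n) (q n) (rh n) (rh1 n) (rh2 n))
    (f0 : ∀ n, f n 0 = 1)
    (cl1 : ∀ n, ∀ x ∈ Icc (0:ℝ) 1, ‖f n x - fSf P (μ n * C n) (rh n 1) (qS n) x‖ ≤ Cc)
    (cl2 : ∀ n, ‖rh n 1‖ * ‖qS n 1‖ ≤ Cc * μ n ^ (2 - (1:ℝ) / k))
    (cl3 : ∀ n, (∫ t in (0:ℝ)..1, ‖fSf P (μ n * C n) (rh n 1) (qS n) t‖) ≤ Cc * μ n ^ (2 - (1:ℝ) / k))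
    (cl4 : ∀ n, √(∫ t in (0:ℝ)..1, omg P (ord 0) (μ n) t * ‖rh n t - rh n 1 * S n t‖ ^ 2) ≤ Cc * (μ n ^ (2 - (1:ℝ) / k) * μ n ^ σ'))
    {F : ℝ → ℂ} (hF : Measurable F) (hFB : ∀ x ∈ Icc (0:ℝ) 1, ‖F x‖ ≤ B)
    (hFe : ∀ x ∈ Icc (0:ℝ) 1, F x = 1 + ∫ t in (0:ℝ)..x, kinf P T ord b k κ Cs x t * F t) :
    Tendsto (fun n => ∫ x in (0:ℝ)..1, ‖f n x - fSf P (μ n * C n) (rh n 1) (qS n) x - F x‖) atTop (𝓝 0) ∧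
    (2 ≤ k → Tendsto (fun n => f n 1) atTop (𝓝 (F 1))) := by
  have hM := (hs 0).ph.hM
  have hK := (hs 0).vh.hK
  have hk1 : (1:ℝ) ≤ k := by exact_mod_cast hk
  have hk2 : (1:ℝ) / k ≤ 1 := by rw [div_le_one (by linarith)]; exact hk1
  have rl : ∀ {r : ℝ}, 0 < r → Tendsto (fun n => μ n ^ r) atTop (𝓝 0) := fun {r} hr => by
    have := (Real.continuousAt_rpow_const 0 r (Or.inr hr.le)).tendsto.comp s.lim
    rwa [Real.zero_rpow hr.ne'] at this
  set p : ℝ := 2 - (1:ℝ) / k with hp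
  have pp : 0 < p := by linarith
  have mpos : ∀ n, 0 < μ n ^ p := fun n => Real.rpow_pos_of_pos (s.pos n) p
  set g : ℕ → ℝ → ℂ := fun n x => f n x - fSf P (μ n * C n) (rh n 1) (qS n) x with hg
  set X : Set ℝ := {x | x ∈ Icc (0:ℝ) 1 ∧ (P.V x ≠ 0 ∨ (x = 1 ∧ 2 ≤ k))} with hX
  have zfin : ∀ᵐ x : ℝ, x ∉ (T : Set ℝ) := compl_mem_ae_iff.2 (T.finite_toSet.measure_zero volume)
  have main := lim_abs (g := g) (kap := fun n x t => kapf P (κ * μ n ^ p) (μ n * C n) x t) (kinf := kinf P T ord b k κ Cs) (F := F)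
    (ε := fun n => 25 * M ^ 8 * K * (Cc * μ n ^ σ' + M * K * (Cc * μ n ^ p))) (L := 25 * M ^ 9 * K ^ 2) (B := max Cc B) (X := X)
    (fun n => (hs n).cf.sub (hs n).cfS) (fun n x => (hs n).ckap x) hF kinf_meas (by positivity)
    (fun n x hx => (cl1 n x hx).trans (le_max_left _ _)) (fun x hx => (hFB x hx).trans (le_max_right _ _))
    (by
      have := ((((rl hσ).const_mul Cc).add (((rl pp).const_mul Cc).const_mul (M * K))).const_mul (25 * M ^ 8 * K))
      simpa using this)
    (fun n x hx => by
      have h := (hs n).f0_kernel hx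
      rw [f0 n] at h
      refine h.trans ?_
      gcongr
      · rw [div_le_iff₀ (mpos n)]
        refine (cl4 n).trans (le_of_eq (by ring))
      · exact cl3 n)
    (fun n x hx t ht => (hs n).kap_le hx ht) hFe (fun x hx => hx.1)
    (by
      filter_upwards [ae_restrict_of_ae zfin, self_mem_ae_restrict measurableSet_Ioc] with x hx hx2
      exact ⟨Ioc_subset_Icc_self hx2, Or.inl fun h0 => hx (z.mem_T_of_zero (Ioc_subset_Icc_self hx2) h0)⟩)
    (fun x hx => by
      have : ∀ᵐ t ∂(volume.restrict (Ioc 0 x)), t ≠ x := ae_restrict_of_ae (by simp [ae_iff])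
      filter_upwards [ae_restrict_of_ae zfin, self_mem_ae_restrict measurableSet_Ioc, this] with t ht ht2 htx
      have hVt : P.V t ≠ 0 := fun h0 => ht (z.mem_T_of_zero ⟨ht2.1.le, ht2.2.trans hx.1.2⟩ h0)
      have kl := z.kernel_lim hk hkT s ht2.1 hx.1.2 (lt_of_le_of_ne ht2.2 htx) hVt hx.2
      have dl : Tendsto (fun n => P.d (μ n * C n) t) atTop (𝓝 (P.V t : ℂ)) := by
        unfold Prof.d
        have h1 : Tendsto (fun n => (μ n : ℂ)) atTop (𝓝 ((0:ℝ):ℂ)) := (Complex.continuous_ofReal.tendsto _).comp s.lim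
        have := (tendsto_const_nhds (x := (P.V t : ℂ))).sub (h1.mul s.limC)
        simpa using this
      have := ((dl.pow 2).const_mul (κ : ℂ)).mul kl
      refine this.congr fun n => ?_
      simp only [kapf, Prof.d]
      push_cast
      ring)
  refine ⟨main.1, fun hk2' => ?_⟩
  have h1 := main.2 1 ⟨by simp, Or.inr ⟨rfl, hk2'⟩⟩
  have hp1 : 0 < p - 1 := by
    have : (1:ℝ) / k ≤ 1 / 2 := by
      apply one_div_le_one_div_of_le (by norm_num); exact_mod_cast hk2'
    linarith
  have h2 : Tendsto (fun n => fSf P (μ n * C n) (rh n 1) (qS n) 1) atTop (𝓝 0) := by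
    refine squeeze_zero_norm (a := fun n => 5 * M ^ 5 * Cc * K * μ n ^ (p - 1)) (fun n => ?_) ?_
    · have hμ := s.pos n
      refine ((hs n).fS_sup (x := 1) (by simp)).trans ?_
      have e : μ n ^ (p - 1) = μ n ^ p / μ n := by
        rw [Real.rpow_sub_one hμ.ne']
      calc _ ≤ 5 * M ^ 5 * (Cc * μ n ^ p) * (K / μ n) := mul_le_mul_of_nonneg_right (mul_le_mul_of_nonneg_left (cl2 n) (by positivity)) (by positivity)
        _ = _ := by rw [e]; ring
    · simpa using (rl hp1).const_mul (5 * M ^ 5 * Cc * K)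
  have := h1.add h2
  simpa [hg] using this

end OS

end

noncomputable section
open Filter Topology MeasureTheory Set ComplexConjugate
namespace OS

/-- iterates of the limit Volterra operator -/
def gs (P : Prof) (T : Finset ℝ) (ord : ℝ → ℕ) (b : ℝ → ℝ) (k : ℕ) : ℕ → ℝ → ℂ
  | 0, _ => 1
  | n + 1, x => ∑ w ∈ T, if w < x ∧ ord w = k then Ik k (b w) Complex.I * ∫ t in (0:ℝ)..w, (P.V t : ℂ) ^ 2 * gs P T ord b k n t else 0

section
variable {P : Prof} {T : Finset ℝ} {ord : ℝ → ℕ} {b : ℝ → ℝ} {k : ℕ}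

lemma gs_succ (n : ℕ) (x : ℝ) : gs P T ord b k (n + 1) x = ∑ w ∈ T, if w < x ∧ ord w = k then Ik k (b w) Complex.I * ∫ t in (0:ℝ)..w, (P.V t : ℂ) ^ 2 * gs P T ord b k n t else 0 := rfl

lemma gs_meas (n : ℕ) : Measurable (gs P T ord b k n) := by
  cases n with
  | zero => exact measurable_const
  | succ n =>
    rw [show gs P T ord b k (n + 1) = fun x => _ from funext (gs_succ n)]
    refine Finset.measurable_sum _ fun w _ => Measurable.ite ?_ measurable_const measurable_const
    by_cases h : ord w = k
    · have : {x : ℝ | w < x ∧ ord w = k} = Ioi w := by ext t; simp [h]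
      rw [this]; exact measurableSet_Ioi
    · have : {x : ℝ | w < x ∧ ord w = k} = ∅ := by ext t; simp [h]
      rw [this]; exact MeasurableSet.empty

lemma gs_bdd (n : ℕ) : ∃ B, ∀ x, ‖gs P T ord b k n x‖ ≤ B := by
  cases n with
  | zero => exact ⟨1, fun x => by simp [gs]⟩
  | succ n =>
    refine ⟨∑ w ∈ T, ‖Ik k (b w) Complex.I * ∫ t in (0:ℝ)..w, (P.V t : ℂ) ^ 2 * gs P T ord b k n t‖, fun x => ?_⟩
    rw [gs_succ]
    refine (norm_sum_le _ _).trans (Finset.sum_le_sum fun w _ => ?_)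
    split_ifs
    · exact le_rfl
    · rw [norm_zero]; exact norm_nonneg _

lemma gs_zero (hT : ∀ w ∈ T, w ∈ Icc (0:ℝ) 1) (n : ℕ) : ∀ x, (T.filter (· < x)).card < n → gs P T ord b k n x = 0 := by
  induction n with
  | zero => intro x h; omega
  | succ n ih =>
    intro x h
    unfold gs
    refine Finset.sum_eq_zero fun w hw => ?_
    split_ifs with hx
    · rw [intervalIntegral.integral_congr (g := fun _ => (0:ℂ))]
      · simp
      · intro t ht
        rw [uIcc_of_le (hT w hw).1] at ht
        simp only []
        rw [ih t, mul_zero]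
        have : (T.filter (· < t)).card < (T.filter (· < x)).card := by
          apply Finset.card_lt_card
          rw [Finset.ssubset_iff_of_subset]
          · exact ⟨w, by simp [hw, hx.1], by simp [ht.2]⟩
          · intro y hy
            simp only [Finset.mem_filter] at hy ⊢
            exact ⟨hy.1, by linarith [hy.2, ht.2, hx.1]⟩
        omega
    · rfl

lemma gs_ii (n : ℕ) (x y : ℝ) : IntervalIntegrable (fun t => (P.V t : ℂ) ^ 2 * gs P T ord b k n t) volume x y := by
  obtain ⟨B, hB⟩ := gs_bdd (P := P) (T := T) (ord := ord) (b := b) (k := k) n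
  have : IntervalIntegrable (gs P T ord b k n) volume x y := by
    rw [intervalIntegrable_iff]
    exact Measure.integrableOn_of_bounded (M := B) (by simp) (gs_meas n).aestronglyMeasurable (Eventually.of_forall hB)
  exact this.continuousOn_mul (Continuous.continuousOn (by fun_prop))

/-- the limit of `f` -/
def Fl (P : Prof) (T : Finset ℝ) (ord : ℝ → ℕ) (b : ℝ → ℝ) (k : ℕ) (Y : ℂ) (x : ℝ) : ℂ :=
  ∑ n ∈ Finset.range (T.card + 1), Y ^ n * gs P T ord b k n x

lemma Fl_meas (Y : ℂ) : Measurable (Fl P T ord b k Y) := by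
  unfold Fl
  exact Finset.measurable_sum _ fun n _ => (gs_meas n).const_mul _

lemma Fl_bdd (Y : ℂ) : ∃ B, ∀ x, ‖Fl P T ord b k Y x‖ ≤ B := by
  choose B hB using fun n => gs_bdd (P := P) (T := T) (ord := ord) (b := b) (k := k) n
  refine ⟨∑ n ∈ Finset.range (T.card + 1), ‖Y ^ n‖ * B n, fun x => ?_⟩
  unfold Fl
  refine (norm_sum_le _ _).trans (Finset.sum_le_sum fun n _ => ?_)
  rw [norm_mul]
  gcongr
  exact hB n x

lemma gs_step (hT : ∀ w ∈ T, w ∈ Icc (0:ℝ) 1) (n : ℕ) (x : ℝ) :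
    ∫ t in (0:ℝ)..x, (P.V t : ℂ) ^ 2 * (∑ w ∈ T, if t < w ∧ w < x ∧ ord w = k then Ik k (b w) Complex.I else 0) * gs P T ord b k n t =
      gs P T ord b k (n + 1) x ∧
    IntervalIntegrable (fun t => (P.V t : ℂ) ^ 2 * (∑ w ∈ T, if t < w ∧ w < x ∧ ord w = k then Ik k (b w) Complex.I else 0) * gs P T ord b k n t) volume 0 x := by
  have e : (fun t => (P.V t : ℂ) ^ 2 * (∑ w ∈ T, if t < w ∧ w < x ∧ ord w = k then Ik k (b w) Complex.I else 0) * gs P T ord b k n t) =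
      fun t => ∑ w ∈ T, if t < w ∧ w < x ∧ ord w = k then Ik k (b w) Complex.I * ((P.V t : ℂ) ^ 2 * gs P T ord b k n t) else 0 := by
    ext t
    rw [Finset.mul_sum, Finset.sum_mul]
    refine Finset.sum_congr rfl fun w _ => ?_
    split_ifs
    · ring
    · simp
  have key : ∀ w ∈ T, IntervalIntegrable (fun t => if t < w ∧ w < x ∧ ord w = k then Ik k (b w) Complex.I * ((P.V t : ℂ) ^ 2 * gs P T ord b k n t) else 0) volume 0 x ∧
      ∫ t in (0:ℝ)..x, (if t < w ∧ w < x ∧ ord w = k then Ik k (b w) Complex.I * ((P.V t : ℂ) ^ 2 * gs P T ord b k n t) else 0) =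
      if w < x ∧ ord w = k then Ik k (b w) Complex.I * ∫ t in (0:ℝ)..w, (P.V t : ℂ) ^ 2 * gs P T ord b k n t else 0 := fun w hw => by
    by_cases h : w < x ∧ ord w = k
    · have hi := (gs_ii (P := P) (T := T) (ord := ord) (b := b) (k := k) n 0 x).const_mul (Ik k (b w) Complex.I)
      have e2 : (fun t => if t < w ∧ w < x ∧ ord w = k then Ik k (b w) Complex.I * ((P.V t : ℂ) ^ 2 * gs P T ord b k n t) else 0) =
          (Iio w).indicator fun t => Ik k (b w) Complex.I * ((P.V t : ℂ) ^ 2 * gs P T ord b k n t) := by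
        ext t; simp [indicator_apply, h.1, h.2]
      have w0 := (hT w hw).1
      rw [e2, if_pos h, ← intervalIntegral.integral_const_mul]
      rw [intervalIntegrable_iff_integrableOn_Ioc_of_le (w0.trans h.1.le)] at hi ⊢
      refine ⟨hi.indicator measurableSet_Iio, ?_⟩
      rw [intervalIntegral.integral_of_le (w0.trans h.1.le), intervalIntegral.integral_of_le w0, setIntegral_indicator measurableSet_Iio]
      have : Ioc 0 x ∩ Iio w = Ioo 0 w := by
        ext t; simp only [mem_inter_iff, mem_Ioc, mem_Iio, mem_Ioo]
        constructor
        · rintro ⟨⟨a, _⟩, c⟩; exact ⟨a, c⟩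
        · rintro ⟨a, c⟩; exact ⟨⟨a, by linarith [h.1]⟩, c⟩
      rw [this, integral_Ioc_eq_integral_Ioo]
    · have : ∀ t, ¬ (t < w ∧ w < x ∧ ord w = k) := fun t ht => h ht.2
      simp [this, h]
  rw [e]
  constructor
  · rw [intervalIntegral.integral_finsetSum fun w hw => (key w hw).1]
    conv_rhs => unfold gs
    exact Finset.sum_congr rfl fun w hw => (key w hw).2
  · have := IntervalIntegrable.sum T fun w hw => (key w hw).1
    rw [show (∑ w ∈ T, fun t => if t < w ∧ w < x ∧ ord w = k then Ik k (b w) Complex.I * ((P.V t : ℂ) ^ 2 * gs P T ord b k n t) else 0) = _ from by funext t; exact Finset.sum_apply t T _] at this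
    exact this

lemma Fl_eq (hT : ∀ w ∈ T, w ∈ Icc (0:ℝ) 1) (hk : 1 ≤ k) (hb : ∀ w ∈ T, b w ≠ 0) {Cs : ℂ} (hC : 0 < Cs.im) (x : ℝ) :
    Fl P T ord b k ((Cs / Complex.I) ^ (-(2 - 1 / k : ℂ))) x =
      1 + ∫ t in (0:ℝ)..x, kinf P T ord b k 1 Cs x t * Fl P T ord b k ((Cs / Complex.I) ^ (-(2 - 1 / k : ℂ))) t := by
  set Y := (Cs / Complex.I) ^ (-(2 - 1 / k : ℂ)) with hY
  have e : ∀ t, kinf P T ord b k 1 Cs x t * Fl P T ord b k Y t = ∑ n ∈ Finset.range (T.card + 1), Y ^ (n + 1) *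
      ((P.V t : ℂ) ^ 2 * (∑ w ∈ T, if t < w ∧ w < x ∧ ord w = k then Ik k (b w) Complex.I else 0) * gs P T ord b k n t) := fun t => by
    have : (∑ w ∈ T, if t < w ∧ w < x ∧ ord w = k then Ik k (b w) Cs else 0) = Y * ∑ w ∈ T, if t < w ∧ w < x ∧ ord w = k then Ik k (b w) Complex.I else 0 := by
      rw [Finset.mul_sum]
      refine Finset.sum_congr rfl fun w hw => ?_
      split_ifs
      · exact Ik_scale hk (hb w hw) hC
      · simp
    unfold kinf Fl
    rw [this, Finset.mul_sum]
    refine Finset.sum_congr rfl fun n _ => ?_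
    push_cast; ring
  simp_rw [e]
  rw [intervalIntegral.integral_finsetSum fun n _ => ((gs_step hT n x).2.const_mul _)]
  simp_rw [intervalIntegral.integral_const_mul, (gs_step (P := P) (ord := ord) (b := b) (k := k) hT _ x).1]
  have h1 := Finset.sum_range_succ (fun n => Y ^ n * gs P T ord b k n x) (T.card + 1)
  have h2 := Finset.sum_range_succ' (fun n => Y ^ n * gs P T ord b k n x) (T.card + 1)
  have h3 : gs P T ord b k (T.card + 1) x = 0 := gs_zero hT _ x (Nat.lt_succ_of_le (Finset.card_filter_le _ _))
  rw [h3, mul_zero, add_zero] at h1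
  unfold Fl
  rw [← h1, h2]
  simp only [pow_zero, one_mul]
  rw [add_comm]
  simp [gs]

open Polynomial in
lemma poly_root {E : ℂ[X]} (h0 : E.eval 0 = 1) (h1 : (E.derivative.eval 0).re < 0) : ∃ Y, E.eval Y = 0 ∧ 0 < Y.re := by
  by_contra hn
  push Not at hn
  have hE : E ≠ 0 := by rintro rfl; simp at h0
  have := (IsAlgClosed.splits E).eval_derivative_div_eval_of_ne_zero (x := 0) (by rw [h0]; norm_num)
  rw [h0, div_one] at this
  rw [this, ← Complex.coe_reAddGroupHom, map_multiset_sum, Multiset.map_map] at h1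
  refine absurd h1 (not_lt.2 (Multiset.sum_nonneg fun r hr => ?_))
  obtain ⟨y, hy, rfl⟩ := Multiset.mem_map.1 hr
  have := hn y ((mem_roots hE).1 hy)
  simp only [Function.comp, Complex.coe_reAddGroupHom, zero_sub, one_div, Complex.inv_re, Complex.neg_re]
  exact div_nonneg (by linarith) (Complex.normSq_nonneg _)

open Polynomial in
/-- polynomial in `Y` -/
def Ep (P : Prof) (T : Finset ℝ) (ord : ℝ → ℕ) (b : ℝ → ℝ) (k : ℕ) : ℂ[X] := ∑ n ∈ Finset.range (T.card + 1), C (gs P T ord b k n 1) * X ^ n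

open Polynomial in
lemma Ep_eval (Y : ℂ) : (Ep P T ord b k).eval Y = Fl P T ord b k Y 1 := by
  simp only [Ep, Fl, eval_finset_sum, eval_mul, eval_C, eval_pow, eval_X]
  exact Finset.sum_congr rfl fun n _ => mul_comm _ _

open Polynomial in
lemma Ep_zero : (Ep P T ord b k).eval 0 = 1 := by
  simp only [Ep, eval_finset_sum, eval_mul, eval_C, eval_pow, eval_X]
  rw [Finset.sum_eq_single 0]
  · simp [gs]
  · intro n _ hn; simp [hn]
  · simp

open Polynomial in
lemma caseB_root (hT : ∀ w ∈ T, w ∈ Icc (0:ℝ) 1) (hk : 2 ≤ k) (hb : ∀ w ∈ T, b w ≠ 0) {w0 : ℝ} (hw0 : w0 ∈ T) (hw1 : w0 < 1) (hwp : 0 < w0)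
    (hord : ord w0 = k) (hV : ∃ y ∈ Ioo 0 w0, P.V y ≠ 0) : ∃ Y, Fl P T ord b k Y 1 = 0 ∧ 0 < Y.re := by
  obtain ⟨Y, h1, h2⟩ := poly_root (E := Ep P T ord b k) Ep_zero (by
    have hc : 0 < T.card := Finset.card_pos.2 ⟨w0, hw0⟩
    have : (Ep P T ord b k).derivative.eval 0 = gs P T ord b k 1 1 := by
      simp only [Ep, derivative_sum, derivative_C_mul, derivative_X_pow, eval_finset_sum, eval_mul, eval_C, eval_pow, eval_X]
      rw [Finset.sum_eq_single 1]
      · simp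
      · intro n _ hn
        rcases Nat.lt_or_gt_of_ne hn with h | h
        · obtain rfl : n = 0 := by omega
          simp
        · rw [zero_pow (by omega)]; simp
      · intro h; exact absurd (Finset.mem_range.2 (by omega)) h
    rw [this]
    have re : ∀ w ∈ T, (Ik k (b w) Complex.I * ∫ t in (0:ℝ)..w, (P.V t : ℂ) ^ 2 * gs P T ord b k 0 t).re = (Ik k (b w) Complex.I).re * ∫ t in (0:ℝ)..w, P.V t ^ 2 := fun w _ => by
      have : ∫ t in (0:ℝ)..w, (P.V t : ℂ) ^ 2 * gs P T ord b k 0 t = ((∫ t in (0:ℝ)..w, P.V t ^ 2 : ℝ) : ℂ) := by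
        rw [← intervalIntegral.integral_ofReal]; congr 1; ext t; simp [gs]
      rw [this, Complex.re_mul_ofReal]
    have nn : ∀ w ∈ T, 0 ≤ ∫ t in (0:ℝ)..w, P.V t ^ 2 := fun w hw => intervalIntegral.integral_nonneg (hT w hw).1 fun _ _ => sq_nonneg _
    unfold gs
    rw [Complex.re_sum]
    refine Finset.sum_neg' (fun w hw => ?_) ⟨w0, hw0, ?_⟩
    · split_ifs
      · rw [re w hw]; exact mul_nonpos_of_nonpos_of_nonneg (Ik_neg hk (hb w hw)).le (nn w hw)
      · simp
    · rw [if_pos ⟨hw1, hord⟩, re w0 hw0]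
      refine mul_neg_of_neg_of_pos (Ik_neg hk (hb w0 hw0)) ?_
      obtain ⟨y, hy, hVy⟩ := hV
      exact intervalIntegral.integral_pos hwp (Continuous.continuousOn (by fun_prop)) (fun _ _ => sq_nonneg _) ⟨y, Ioo_subset_Icc_self hy, by positivity⟩)
  exact ⟨Y, (Ep_eval Y).symm.trans h1, h2⟩

lemma slit_arg {w : ℂ} (hw : 0 < w.re) : |w.arg| < Real.pi / 2 := Complex.abs_arg_lt_pi_div_two_iff.2 (Or.inl hw)

lemma cpow_back {w : ℂ} (hw : 0 < w.re) {p : ℝ} (hp : 0 < p) (hp2 : p ≤ 2) : (w ^ (-(p:ℂ))) ^ (-(1 / p : ℂ)) = w := by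
  have ha := slit_arg hw
  rw [abs_lt] at ha
  have him : (Complex.log w * (-(p:ℂ))).im = - (w.arg * p) := by
    rw [← Complex.ofReal_neg, Complex.im_mul_ofReal, Complex.log_im]; ring
  have hpc : (p:ℂ) ≠ 0 := by exact_mod_cast hp.ne'
  have := Real.pi_pos
  rw [← Complex.cpow_mul _ (by rw [him]; nlinarith) (by rw [him]; nlinarith), neg_mul_neg, mul_one_div_cancel hpc, Complex.cpow_one]

lemma cpow_forw {Y : ℂ} (hY : 0 < Y.re) {p : ℝ} (hp : 1 ≤ p) : (Y ^ (-(1 / p : ℂ))) ^ (-(p : ℂ)) = Y ∧ 0 < (Y ^ (-(1 / p : ℂ))).re := by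
  have ha := slit_arg hY
  rw [abs_lt] at ha
  have hpc : (p:ℂ) ≠ 0 := by exact_mod_cast (by linarith : p ≠ 0)
  have e : -(1 / p : ℂ) = ((-(1 / p) : ℝ) : ℂ) := by push_cast; ring
  have him : (Complex.log Y * (-(1 / p : ℂ))).im = - (Y.arg / p) := by
    rw [e, Complex.im_mul_ofReal, Complex.log_im]; ring
  have hpi := Real.pi_pos
  have p0 : 0 < p := by linarith
  have b1 : Y.arg / p < Real.pi / 2 := by rw [div_lt_iff₀ p0]; nlinarith
  have b2 : -(Real.pi / 2) < Y.arg / p := by rw [lt_div_iff₀ p0]; nlinarith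
  constructor
  · rw [← Complex.cpow_mul _ (by rw [him]; linarith) (by rw [him]; linarith), neg_mul_neg, one_div_mul_cancel hpc, Complex.cpow_one]
  · have Y0 : Y ≠ 0 := by rintro rfl; simp at hY
    rw [Complex.cpow_def_of_ne_zero Y0, Complex.exp_re, him]
    exact mul_pos (Real.exp_pos _) (Real.cos_pos_of_mem_Ioo ⟨by linarith, by linarith⟩)

lemma div_I_re (C : ℂ) : (C / Complex.I).re = C.im := by simp [Complex.div_I]

lemma caseB_circle (hk : 1 ≤ k) {Y0 : ℂ} (hY : Fl P T ord b k Y0 1 = 0) (hre : 0 < Y0.re) :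
    ∃ C0 : ℂ, ∃ r η δ : ℝ, 0 < r ∧ 0 < η ∧ 0 < δ ∧ (∀ C ∈ Metric.closedBall C0 r, η ≤ C.im) ∧
      ContinuousOn (fun C : ℂ => Fl P T ord b k ((C / Complex.I) ^ (-(2 - 1 / k : ℂ))) 1) (Metric.closedBall C0 r) ∧
      Fl P T ord b k ((C0 / Complex.I) ^ (-(2 - 1 / k : ℂ))) 1 = 0 ∧
      ∀ C ∈ Metric.sphere C0 r, δ ≤ ‖Fl P T ord b k ((C / Complex.I) ^ (-(2 - 1 / k : ℂ))) 1‖ := by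
  have hk1 : (1:ℝ) ≤ k := by exact_mod_cast hk
  have hk2 : (1:ℝ) / k ≤ 1 := by rw [div_le_one (by linarith)]; exact hk1
  have hk3 : 0 < (1:ℝ) / k := by positivity
  have ep : (2 - 1 / k : ℂ) = ((2 - 1 / k : ℝ) : ℂ) := by push_cast; ring
  rw [ep]
  set p : ℝ := 2 - 1 / k with hp
  have p1 : 1 ≤ p := by linarith
  have p2 : p ≤ 2 := by linarith
  obtain ⟨f1, f2⟩ := cpow_forw hre p1
  set C0 : ℂ := Complex.I * Y0 ^ (-(1 / p : ℂ)) with hC0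
  have C0d : C0 / Complex.I = Y0 ^ (-(1 / p : ℂ)) := by rw [hC0]; field_simp
  have im0 : 0 < C0.im := by rw [← div_I_re, C0d]; exact f2
  have E0 : Ep P T ord b k ≠ 0 := by intro h; have := Ep_zero (P := P) (T := T) (ord := ord) (b := b) (k := k); rw [h] at this; simp at this
  let Z : Finset ℂ := (Ep P T ord b k).roots.toFinset.image fun Y => Complex.I * Y ^ (-(1 / p : ℂ))
  have hZ : ∀ C : ℂ, 0 < C.im → Fl P T ord b k ((C / Complex.I) ^ (-(p : ℂ))) 1 = 0 → C ∈ Z := fun C hC h => by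
    refine Finset.mem_image.2 ⟨(C / Complex.I) ^ (-(p : ℂ)), ?_, ?_⟩
    · rw [Multiset.mem_toFinset, Polynomial.mem_roots E0, Polynomial.IsRoot.def, Ep_eval, h]
    · rw [cpow_back (by rw [div_I_re]; exact hC) (by linarith) p2]; field_simp
  have hev : ∀ᶠ C in 𝓝[≠] C0, C ∉ Z := by
    have : (↑(Z.erase C0) : Set ℂ)ᶜ ∈ 𝓝 C0 := (Z.erase C0).finite_toSet.isClosed.isOpen_compl.mem_nhds (by simp)
    filter_upwards [mem_nhdsWithin_of_mem_nhds this, self_mem_nhdsWithin] with C h1 h2 h3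
    exact h1 (by simp only [Finset.coe_erase, mem_diff, Finset.mem_coe]; exact ⟨h3, h2⟩)
  rw [eventually_nhdsWithin_iff, Metric.eventually_nhds_iff] at hev
  obtain ⟨ε, hε, hev⟩ := hev
  set r := min (ε / 2) (C0.im / 2) with hr
  have r0 : 0 < r := by positivity
  have him : ∀ C ∈ Metric.closedBall C0 r, C0.im / 2 ≤ C.im := fun C hC => by
    rw [Metric.mem_closedBall, dist_eq_norm] at hC
    have h1 := (Complex.abs_im_le_norm (C - C0)).trans hC
    rw [Complex.sub_im, abs_le] at h1
    have := min_le_right (ε / 2) (C0.im / 2)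
    linarith
  have hcont : ContinuousOn (fun C : ℂ => Fl P T ord b k ((C / Complex.I) ^ (-(p : ℂ))) 1) (Metric.closedBall C0 r) := by
    have : ∀ C ∈ Metric.closedBall C0 r, C / Complex.I ∈ Complex.slitPlane := fun C hC =>
      Or.inl (by rw [div_I_re]; linarith [him C hC])
    unfold Fl
    refine continuousOn_finset_sum _ fun n _ => (ContinuousOn.pow ?_ n).mul continuousOn_const
    exact ContinuousOn.cpow (by fun_prop) continuousOn_const this
  have hne : ∀ C ∈ Metric.sphere C0 r, Fl P T ord b k ((C / Complex.I) ^ (-(p : ℂ))) 1 ≠ 0 := fun C hC h => by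
    refine hev (y := C) ?_ ?_ (hZ C ?_ h)
    · rw [Metric.mem_sphere.1 hC]; have := min_le_left (ε / 2) (C0.im / 2); linarith
    · intro h'; rw [Set.mem_singleton_iff.1 h', Metric.mem_sphere, dist_self] at hC; linarith
    · linarith [him C (Metric.sphere_subset_closedBall hC)]
  obtain ⟨Cm, hCm, hmin⟩ := (isCompact_sphere C0 r).exists_isMinOn (NormedSpace.sphere_nonempty.2 r0.le)
    ((hcont.mono Metric.sphere_subset_closedBall).norm)
  refine ⟨C0, r, C0.im / 2, _, r0, by positivity, norm_pos_iff.2 (hne Cm hCm), him, hcont, ?_, fun C hC => hmin hC⟩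
  rw [C0d, f1, hY]
end
end OS

end

noncomputable section
open Filter Topology MeasureTheory Set ComplexConjugate
namespace OS

lemma EvenSol.comb {A B φ φ1 ψ ψ1 h φ' φ1' ψ' ψ1' h' : ℝ → ℂ} (s : EvenSol A B φ φ1 ψ ψ1 h) (s' : EvenSol A B φ' φ1' ψ' ψ1' h') (u v : ℂ) :
    EvenSol A B (fun x => u * φ x + v * φ' x) (fun x => u * φ1 x + v * φ1' x) (fun x => u * ψ x + v * ψ' x)
      (fun x => u * ψ1 x + v * ψ1' x) (fun x => u * h x + v * h' x) where
  d0 x := ((s.d0 x).const_mul u).fun_add ((s'.d0 x).const_mul v)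
  d1 x := ((s.d1 x).const_mul u).fun_add ((s'.d1 x).const_mul v)
  d2 x := ((s.d2 x).const_mul u).fun_add ((s'.d2 x).const_mul v)
  d3 x := ((s.d3 x).const_mul u).fun_add ((s'.d3 x).const_mul v)
  hc := (continuous_const.mul s.hc).add (continuous_const.mul s'.hc)
  eq x hx := by rw [s.eq x hx, s'.eq x hx]; ring
  z1 := by rw [s.z1, s'.z1]; ring
  z3 := by rw [s.z3, s'.z3]; ring
  ev x := by rw [s.ev, s'.ev]
  ev2 x := by rw [s.ev2, s'.ev2]
  ev4 x := by rw [s.ev4, s'.ev4]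

lemma EvenSol.psi_zero {A B φ φ1 ψ ψ1 h : ℝ → ℂ} (s : EvenSol A B φ φ1 ψ ψ1 h) (h0 : ∀ x ∈ Icc (0:ℝ) 1, φ x = 0) : ψ 0 = 0 := by
  have h1 : ∀ x ∈ Ioo (0:ℝ) 1, φ1 x = 0 := fun x hx => by
    refine (s.d0 x).unique ((hasDerivAt_const x (0:ℂ)).congr_of_eventuallyEq ?_)
    filter_upwards [Ioo_mem_nhds hx.1 hx.2] with y hy using h0 y (Ioo_subset_Icc_self hy)
  have h2 : ∀ x ∈ Ioo (0:ℝ) 1, ψ x = 0 := fun x hx => by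
    refine (s.d1 x).unique ((hasDerivAt_const x (0:ℂ)).congr_of_eventuallyEq ?_)
    filter_upwards [Ioo_mem_nhds hx.1 hx.2] with y hy using h1 y hy
  have c : Tendsto ψ (𝓝[>] 0) (𝓝 (ψ 0)) := ((s.d2 0).continuousAt.tendsto).mono_left nhdsWithin_le_nhds
  refine tendsto_nhds_unique c (tendsto_const_nhds.congr' ?_)
  filter_upwards [Ioo_mem_nhdsGT (zero_lt_one (α := ℝ))] with y hy using (h2 y hy).symm

lemma find_root (P : Prof) {ν α2 μ : ℝ} (hν : 0 < ν) (hμ : 0 < μ) {C0 : ℂ} {r δ e : ℝ} {Φ : ℂ → ℂ} (hr : 0 < r)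
    (him : ∀ C ∈ Metric.closedBall C0 r, 0 < C.im)
    (H0 : ∀ C ∈ Metric.closedBall C0 r, ∀ f f1 f2 q rh rh1 rh2 : ℝ → ℂ, Mode P ν α2 (μ * C) f f1 f2 q rh rh1 rh2 → q 1 = 0 → f 0 = 0 →
      ∀ x ∈ Icc (0:ℝ) 1, f x = 0)
    (H1 : ∀ C ∈ Metric.closedBall C0 r, ∀ f f1 f2 q rh rh1 rh2 : ℝ → ℂ, Mode P ν α2 (μ * C) f f1 f2 q rh rh1 rh2 → q 1 = 0 → f 0 = 1 →
      ‖f 1 - Φ C‖ ≤ e)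
    (hΦ0 : Φ C0 = 0) (hΦ : ∀ C ∈ Metric.sphere C0 r, δ ≤ ‖Φ C‖) (he : 2 * e < δ) :
    ∃ C ∈ Metric.closedBall C0 r, ∃ φ φ1 ψ ψ1 h : ℝ → ℂ, EvenSol (P.cA ν α2 (μ * C)) (P.cB ν α2 (μ * C)) φ φ1 ψ ψ1 h ∧
      φ 1 = 0 ∧ φ1 1 = 0 ∧ φ 0 ≠ 0 := by
  set ρ : ℝ := μ * (‖C0‖ + r) + 1 with hρ
  have hmem : ∀ C ∈ Metric.closedBall C0 r, (μ * C : ℂ) ∈ Metric.ball (0:ℂ) ρ := fun C hC => by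
    rw [mem_ball_zero_iff, norm_mul, Complex.norm_real, Real.norm_eq_abs, abs_of_pos hμ, hρ]
    rw [Metric.mem_closedBall, dist_eq_norm] at hC
    have : ‖C‖ ≤ ‖C0‖ + r := by
      calc ‖C‖ = ‖C0 + (C - C0)‖ := by congr 1; ring
        _ ≤ _ := (norm_add_le _ _).trans (by linarith)
    nlinarith
  have solve := fun p0 s0 : ℂ => ode_solve (fun x => 2 * α2 + Complex.I / ν * P.V x) (fun _ => -(Complex.I / ν))
    (fun x => -(α2:ℂ) ^ 2 - Complex.I / ν * (α2 * P.V x + P.V2 x)) (fun _ => Complex.I / ν * α2)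
    (by fun_prop) (by fun_prop) (by have := P.cV2; fun_prop) (by fun_prop) ρ p0 s0
  have eA : ∀ c : ℂ, (fun x => (2 * α2 + Complex.I / ν * P.V x) + c * (-(Complex.I / ν))) = P.cA ν α2 c := fun c => by
    ext x; simp only [Prof.cA, Prof.d]; ring
  have eB : ∀ c : ℂ, (fun x => (-(α2:ℂ) ^ 2 - Complex.I / ν * (α2 * P.V x + P.V2 x)) + c * (Complex.I / ν * α2)) = P.cB ν α2 c := fun c => by
    ext x; simp only [Prof.cB, Prof.d]; ring
  obtain ⟨φa, φa1, ψa, ψa1, ha, sa, da, da1⟩ := solve 1 0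
  obtain ⟨φb, φb1, ψb, ψb1, hb, sb, db, db1⟩ := solve 0 1
  simp only [eA, eB] at sa sb
  have cim : ∀ C ∈ Metric.closedBall C0 r, 0 < (μ * C : ℂ).im := fun C hC => by
    rw [Complex.im_ofReal_mul]; exact mul_pos hμ (him C hC)
  have d1 : ∀ c, P.d c 1 = -c := fun c => by simp [Prof.d, P.V01]
  let qa : ℂ → ℂ := fun c => -c * φa1 c 1 + P.a * φa c 1
  let qb : ℂ → ℂ := fun c => -c * φb1 c 1 + P.a * φb c 1
  have qb0 : ∀ C ∈ Metric.closedBall C0 r, qb (μ * C) ≠ 0 := fun C hC h0 => by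
    obtain ⟨s1, s2, s3⟩ := sb _ (hmem C hC)
    obtain ⟨f, f1, f2, q, rh, rh1, rh2, mo, hf, hq⟩ := mode_of_sol P hν (cim C hC) s1
    have dn := P.d_ne (cim C hC)
    have hf0 : f 0 = 0 := by
      have := hf 0
      rw [s2] at this
      exact (mul_eq_zero.1 this.symm).resolve_left (dn 0)
    have hq1 : q 1 = 0 := by rw [hq, d1, P.V11, ← h0]; simp only [qb]; push_cast; ring
    have := H0 C hC f f1 f2 q rh rh1 rh2 mo hq1 hf0
    have := s1.psi_zero fun x hx => by rw [hf, this x hx, mul_zero]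
    rw [s3] at this
    exact one_ne_zero this
  let D : ℂ → ℂ := fun C => P.d (μ * C) 0 / (-(μ * C)) * (φa (μ * C) 1 - qa (μ * C) / qb (μ * C) * φb (μ * C) 1)
  have sol : ∀ C ∈ Metric.closedBall C0 r, ∃ φ φ1 ψ ψ1 h : ℝ → ℂ, EvenSol (P.cA ν α2 (μ * C)) (P.cB ν α2 (μ * C)) φ φ1 ψ ψ1 h ∧
      φ 1 = -(μ * C) * D C ∧ -(μ * C) * φ1 1 + P.a * φ 1 = 0 ∧ φ 0 = P.d (μ * C) 0 := fun C hC => by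
    obtain ⟨a1, a2, a3⟩ := sa _ (hmem C hC)
    obtain ⟨b1, b2, b3⟩ := sb _ (hmem C hC)
    have c0 : (μ * C : ℂ) ≠ 0 := fun h => by have := cim C hC; rw [h] at this; simp at this
    refine ⟨_, _, _, _, _, a1.comb b1 (P.d (μ * C) 0) (-(P.d (μ * C) 0 * (qa (μ * C) / qb (μ * C)))), ?_, ?_, ?_⟩
    · simp only [D]
      rw [← mul_assoc, mul_div_cancel₀ _ (neg_ne_zero.2 c0)]; ring
    · have := qb0 C hC
      have e1 : -(μ * C) * φa1 (μ * C) 1 + P.a * φa (μ * C) 1 = qa (μ * C) := rfl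
      have e2 : -(μ * C) * φb1 (μ * C) 1 + P.a * φb (μ * C) 1 = qb (μ * C) := rfl
      have : -(μ * C) * (P.d (μ * C) 0 * φa1 (μ * C) 1 + -(P.d (μ * C) 0 * (qa (μ * C) / qb (μ * C))) * φb1 (μ * C) 1) +
        P.a * (P.d (μ * C) 0 * φa (μ * C) 1 + -(P.d (μ * C) 0 * (qa (μ * C) / qb (μ * C))) * φb (μ * C) 1) =
        P.d (μ * C) 0 * ((-(μ * C) * φa1 (μ * C) 1 + P.a * φa (μ * C) 1) - qa (μ * C) / qb (μ * C) * (-(μ * C) * φb1 (μ * C) 1 + P.a * φb (μ * C) 1)) := by ring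
      rw [this, e1, e2, div_mul_cancel₀ _ (qb0 C hC), sub_self, mul_zero]
    · rw [a2, b2]; ring
  have hD : ∀ C ∈ Metric.closedBall C0 r, ‖D C - Φ C‖ ≤ e := fun C hC => by
    obtain ⟨φ, φ1, ψ, ψ1, h, s, p1, p2, p3⟩ := sol C hC
    obtain ⟨f, f1, f2, q, rh, rh1, rh2, mo, hf, hq⟩ := mode_of_sol P hν (cim C hC) s
    have dn := P.d_ne (cim C hC)
    have c0 : (-(μ * C) : ℂ) ≠ 0 := by rw [← d1]; exact dn 1
    have : f 1 = D C := by
      have h1 := hf 1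
      rw [p1, d1] at h1
      exact (mul_left_cancel₀ c0 h1).symm
    rw [← this]
    refine H1 C hC f f1 f2 q rh rh1 rh2 mo ?_ ?_
    · rw [hq, d1, P.V11, ← p2]; push_cast; ring
    · have h1 := hf 0
      rw [p3] at h1
      exact (mul_left_cancel₀ (dn 0) (by rw [mul_one]; exact h1)).symm
  have hdiff : DifferentiableOn ℂ D (Metric.closedBall C0 r) := by
    have hm : DifferentiableOn ℂ (fun C : ℂ => (μ * C : ℂ)) (Metric.closedBall C0 r) := by fun_prop
    have cmp : ∀ {g : ℂ → ℂ}, DifferentiableOn ℂ g (Metric.ball 0 ρ) → DifferentiableOn ℂ (fun C => g (μ * C)) (Metric.closedBall C0 r) :=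
      fun hg => hg.comp hm hmem
    have ka := cmp da; have ka1 := cmp da1; have kb := cmp db; have kb1 := cmp db1
    have k0 : ∀ C ∈ Metric.closedBall C0 r, (-(μ * C) : ℂ) ≠ 0 := fun C hC => by rw [← d1]; exact P.d_ne (cim C hC) 1
    refine DifferentiableOn.mul (DifferentiableOn.div ?_ hm.neg k0) (ka.sub (DifferentiableOn.mul (DifferentiableOn.div ?_ ?_ qb0) kb))
    · simp only [Prof.d]; fun_prop
    · exact (hm.neg.mul ka1).add (ka.const_mul _)
    · exact (hm.neg.mul kb1).add (kb.const_mul _)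
  have hzero : ∃ C ∈ Metric.closedBall C0 r, D C = 0 := by
    by_contra hn
    push Not at hn
    have hd : DiffContOnCl ℂ (fun C => (D C)⁻¹) (Metric.ball C0 r) := by
      refine DifferentiableOn.diffContOnCl ?_
      rw [closure_ball C0 hr.ne']
      exact hdiff.inv hn
    have h0 : C0 ∈ Metric.closedBall C0 r := Metric.mem_closedBall_self hr.le
    have hde : 0 < δ - e := by
      have := (norm_nonneg _).trans (hD C0 h0)
      linarith
    have := Complex.norm_le_of_forall_mem_frontier_norm_le Metric.isBounded_ball hd (C := 1 / (δ - e)) (fun C hC => by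
      rw [frontier_ball C0 hr.ne'] at hC
      have hC' := Metric.sphere_subset_closedBall hC
      rw [norm_inv, ← one_div]
      apply one_div_le_one_div_of_le hde
      have h1 := hΦ C hC
      have h2 := hD C hC'
      have h3 := norm_sub_norm_le (Φ C) (D C)
      rw [norm_sub_rev] at h3
      linarith) (subset_closure (Metric.mem_ball_self hr))
    have h4 := hD C0 h0
    rw [hΦ0, sub_zero] at h4
    rw [norm_inv, ← one_div, one_div_le_one_div (norm_pos_iff.2 (hn C0 h0)) hde] at this
    linarith
  obtain ⟨C, hC, hDC⟩ := hzero
  obtain ⟨φ, φ1, ψ, ψ1, h, s, p1, p2, p3⟩ := sol C hC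
  rw [hDC, mul_zero] at p1
  refine ⟨C, hC, φ, φ1, ψ, ψ1, h, s, p1, ?_, by rw [p3]; exact P.d_ne (cim C hC) 0⟩
  rw [p1, mul_zero, add_zero] at p2
  refine (mul_eq_zero.1 p2).resolve_left ?_
  rw [← d1]; exact P.d_ne (cim C hC) 1

end OS

end

noncomputable section
open Filter Topology MeasureTheory Set ComplexConjugate
namespace OS

lemma seq_unif {Kc : Set ℂ} (hKc : IsCompact Kc) {Bad : ℝ → ℂ → Prop}
    (h : ∀ (μ : ℕ → ℝ) (C : ℕ → ℂ) (Cs : ℂ), (∀ n, 0 < μ n) → (∀ n, μ n ≤ 1) → Tendsto μ atTop (𝓝 0) → (∀ n, C n ∈ Kc) → Cs ∈ Kc →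
      Tendsto C atTop (𝓝 Cs) → (∀ n, Bad (μ n) (C n)) → False) :
    ∃ μ0 : ℝ, 0 < μ0 ∧ ∀ μ, 0 < μ → μ < μ0 → ∀ C ∈ Kc, ¬ Bad μ C := by
  by_contra hn
  push Not at hn
  have hpos : ∀ n : ℕ, (0:ℝ) < 1 / (n + 1) := fun n => by positivity
  choose μ h1 h2 C h3 h4 using fun n : ℕ => hn (1 / (n + 1)) (hpos n)
  obtain ⟨Cs, hCs, g, hg, hl⟩ := hKc.tendsto_subseq h3
  have lim : Tendsto μ atTop (𝓝 0) :=
    squeeze_zero (fun n => (h1 n).le) (fun n => (h2 n).le) tendsto_one_div_add_atTop_nhds_zero_nat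
  refine h (μ ∘ g) (C ∘ g) Cs (fun n => h1 _) (fun n => ?_) (lim.comp hg.tendsto_atTop) (fun n => h3 _) hCs hl fun n => h4 _
  refine (h2 (g n)).le.trans ?_
  rw [div_le_one (by positivity)]
  have : (0:ℝ) ≤ (g n : ℕ) := by positivity
  linarith

lemma small_rpow {r s0 : ℝ} (hr : 0 < r) (hs : 0 < s0) : ∃ μ0 : ℝ, 0 < μ0 ∧ ∀ μ, 0 < μ → μ < μ0 → μ ^ r ≤ s0 := by
  refine ⟨s0 ^ (1 / r), by positivity, fun μ h0 h1 => ?_⟩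
  calc μ ^ r ≤ (s0 ^ (1 / r)) ^ r := by gcongr
    _ = s0 := by rw [← Real.rpow_mul hs.le]; field_simp; simp

/-- the fixed environment attached to a profile -/
structure Env (P : Prof) (T : Finset ℝ) (ord : ℝ → ℕ) (b : ℝ → ℝ) (c0 : ℝ) (k : ℕ) (K σ' : ℝ) : Prop where
  z : ZD P T ord b c0
  hk : 1 ≤ k
  hkT : ∀ w ∈ T, w ≠ 0 → ord w ≤ k
  hK : 1 ≤ K
  hσ : 0 < σ'
  vh : ∀ μ, 0 < μ → μ ≤ 1 → VH P (ord 0) K μ (μ ^ (2 - (1:ℝ) / k)) (μ ^ σ')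
  hV : ∀ x ∈ Icc (0:ℝ) 1, |P.V x| ≤ K * (1 - x)
  hV2 : ∀ x ∈ Icc (0:ℝ) 1, |P.V x - P.a * (1 - x)| ≤ K * (1 - x) ^ 2

section
variable {P : Prof} {T : Finset ℝ} {ord : ℝ → ℕ} {b : ℝ → ℝ} {c0 : ℝ} {k : ℕ} {K σ' : ℝ}
variable (E : Env P T ord b c0 k K σ')
include E

lemma Env.p1 : 1 ≤ 2 - (1:ℝ) / k := by
  have hk1 : (1:ℝ) ≤ k := by exact_mod_cast E.hk
  have hk2 : (1:ℝ) / k ≤ 1 := by rw [div_le_one (by linarith)]; exact hk1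
  linarith

lemma Env.mμ {μ : ℝ} (h0 : 0 < μ) (h1 : μ ≤ 1) : μ ^ (2 - (1:ℝ) / k) ≤ μ := by
  simpa using Real.rpow_le_rpow_of_exponent_ge h0 h1 E.p1

lemma Env.mk_wall {M μ τ κ : ℝ} {C : ℂ} (hM : 1 ≤ M) (hμ : 0 < μ) (hC : ‖C‖ ≤ M) (hCi : 1 ≤ M * C.im) (hτ : 0 < τ) (hτM : τ ≤ M)
    (hκ : 0 < κ) (hκM : κ ≤ M) (hMμ : M * μ ≤ 1)
    (hLa : τ * μ ^ (2 - (1:ℝ) / k) * (K + 2 * ord 0) ^ 2 ≤ μ * C.im / 4)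
    (hwall : (128 * K) ^ 2 * (τ * μ ^ (2 - (1:ℝ) / k)) ≤ μ * ‖C‖ ^ 3) :
    ∃ l : ℝ, ∃ S S1 S2 qS : ℝ → ℂ, 0 < l ∧ 2 * l ^ 2 * (τ * μ ^ (2 - (1:ℝ) / k) * μ ^ 2) = (μ * C : ℂ).im ∧
      WallSol P (τ * μ ^ (2 - (1:ℝ) / k) * μ ^ 2) (κ * μ ^ (2 - (1:ℝ) / k)) l (μ * C) S S1 S2 qS ∧
      ∀ f f1 f2 q rh rh1 rh2 : ℝ → ℂ, Mode P (τ * μ ^ (2 - (1:ℝ) / k) * μ ^ 2) (κ * μ ^ (2 - (1:ℝ) / k)) (μ * C) f f1 f2 q rh rh1 rh2 → q 1 = 0 →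
        Setup P (ord 0) K (7000 * K * M ^ 4) μ (μ ^ (2 - (1:ℝ) / k)) (μ ^ σ') (τ * μ ^ (2 - (1:ℝ) / k) * μ ^ 2) (κ * μ ^ (2 - (1:ℝ) / k)) (μ * C)
          S S1 S2 qS f f1 f2 q rh rh1 rh2 := by
  have hμ1 : μ ≤ 1 := by nlinarith
  have mμ := E.mμ hμ hμ1
  set m := μ ^ (2 - (1:ℝ) / k) with hm
  have m0 : 0 < m := Real.rpow_pos_of_pos hμ _
  have Ci : 0 < C.im := by by_contra h; push Not at h; nlinarith
  have hK := E.hK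
  have cim : (μ * C : ℂ).im = μ * C.im := Complex.im_ofReal_mul _ _
  have cn : ‖(μ * C : ℂ)‖ = μ * ‖C‖ := by rw [norm_mul, Complex.norm_real, Real.norm_eq_abs, abs_of_pos hμ]
  have CiC : C.im ≤ ‖C‖ := (le_abs_self _).trans (Complex.abs_im_le_norm C)
  set ν := τ * m * μ ^ 2 with hν
  have ν0 : 0 < ν := by positivity
  set l := √(μ * C.im / (2 * ν)) with hl
  have l0 : 0 < l := Real.sqrt_pos.2 (by positivity)
  have hlc : 2 * l ^ 2 * ν = (μ * C : ℂ).im := by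
    rw [cim, hl, Real.sq_sqrt (by positivity)]; field_simp
  have α0 : 0 ≤ κ * m := by positivity
  obtain ⟨S, S1, S2, qS, W⟩ := wall_exists P ν0 α0 l0 hlc.le
  refine ⟨l, S, S1, S2, qS, l0, hlc, W, fun f f1 f2 q rh rh1 rh2 mo hq => ?_⟩
  have MM : M ≤ 7000 * K * M ^ 4 := by
    have : M ≤ M ^ 4 := by simpa using pow_le_pow_right₀ hM (by norm_num : 1 ≤ 4)
    nlinarith
  have sh := W.toSH (K := K) (M := M) (μ := μ) hK hM hμ ν0 E.hV α0 (by nlinarith) l0 hlc (by rw [cn]; nlinarith) (by rw [cim]; nlinarith)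
    (by
      calc ν ≤ M * μ * μ ^ 2 := by rw [hν]; gcongr
        _ = _ := by ring)
    (by rw [cn]; nlinarith)
    (by
      rw [cn]
      calc (128 * K) ^ 2 * ν = ((128 * K) ^ 2 * (τ * m)) * μ ^ 2 := by rw [hν]; ring
        _ ≤ (μ * ‖C‖ ^ 3) * μ ^ 2 := by gcongr
        _ = (μ * ‖C‖) ^ 3 := by ring)
  refine ⟨E.vh μ hμ hμ1, ⟨hM.trans MM, ?_, ?_, ν0, ?_, α0, ?_, ?_⟩, sh, mo, hq⟩
  · rw [cn]; nlinarith
  · rw [cim]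
    calc μ ≤ μ * (M * C.im) := by nlinarith
      _ = M * (μ * C.im) := by ring
      _ ≤ _ := by gcongr
  · rw [hν]; gcongr; exact hτM.trans MM
  · gcongr; exact hκM.trans MM
  · rw [cim]
    calc ν * ((K + 2 * ord 0) / μ) ^ 2 = τ * m * (K + 2 * ord 0) ^ 2 := by rw [hν]; field_simp
      _ ≤ _ := hLa
end

/-- conclusion of the construction, in the scaled variables -/
def Core (P : Prof) : Prop := ∃ p κ τ1 τ2 μ0 k1 k2 : ℝ, 1 ≤ p ∧ 0 < κ ∧ 0 < τ1 ∧ τ1 < τ2 ∧ 0 < μ0 ∧ 0 < k1 ∧ k1 ≤ k2 ∧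
  ∀ μ τ : ℝ, 0 < μ → μ < μ0 → τ1 < τ → τ < τ2 → ∃ c : ℂ, ∃ φ φ1 ψ ψ1 h : ℝ → ℂ,
    EvenSol (P.cA (τ * μ ^ p * μ ^ 2) (κ * μ ^ p) c) (P.cB (τ * μ ^ p * μ ^ 2) (κ * μ ^ p) c) φ φ1 ψ ψ1 h ∧ φ 1 = 0 ∧ φ1 1 = 0 ∧ φ 0 ≠ 0 ∧
    k1 * μ ≤ c.im ∧ c.im ≤ k2 * μ

lemma caseB {P : Prof} {T : Finset ℝ} {ord : ℝ → ℕ} {b : ℝ → ℝ} {c0 : ℝ} {k : ℕ} {K σ' : ℝ}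
    (E : Env P T ord b c0 k K σ') (hk2 : 2 ≤ k) {Y0 : ℂ} (hY : Fl P T ord b k Y0 1 = 0) (hre : 0 < Y0.re) : Core P := by
  obtain ⟨C0, r, η, δ, r0, η0, δ0, him, hcont, hC0, hsph⟩ := caseB_circle (k := k) E.hk hY hre
  set Φ : ℂ → ℂ := fun C => Fl P T ord b k ((C / Complex.I) ^ (-(2 - 1 / k : ℂ))) 1 with hΦ
  have hK := E.hK
  have hp1 : 1 < 2 - (1:ℝ) / k := by
    have : (1:ℝ) / k ≤ 1 / 2 := by
      apply one_div_le_one_div_of_le (by norm_num); exact_mod_cast hk2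
    linarith
  set p : ℝ := 2 - (1:ℝ) / k with hp
  have Cn : ∀ C ∈ Metric.closedBall C0 r, ‖C‖ ≤ ‖C0‖ + r := fun C hC => by
    rw [Metric.mem_closedBall, dist_eq_norm] at hC
    calc ‖C‖ = ‖C0 + (C - C0)‖ := by congr 1; ring
      _ ≤ _ := (norm_add_le _ _).trans (by linarith)
  set M : ℝ := ‖C0‖ + r + 1 / η + 2 with hM
  have η1 : 0 < 1 / η := by positivity
  have hM1 : 1 ≤ M := by have := norm_nonneg C0; linarith
  have hM2 : 2 ≤ M := by have := norm_nonneg C0; linarith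
  have hMη : 1 ≤ M * η := by
    have : 1 / η * η = 1 := by field_simp
    have := norm_nonneg C0
    nlinarith
  set M' := 7000 * K * M ^ 4 with hM'
  have hM'1 : 1 ≤ M' := by have := one_le_pow₀ hM1 (n := 4); nlinarith
  obtain ⟨Cc, s0, hCc, hs0, cl⟩ := closing K M' hK hM'1
  obtain ⟨μa, μa0, ha⟩ := small_rpow (r := p) (by linarith) hs0
  obtain ⟨μb, μb0, hb⟩ := small_rpow E.hσ hs0
  obtain ⟨μc, μc0, hc⟩ := small_rpow (r := p - 1) (s0 := min (η / (8 * (K + 2 * ord 0) ^ 2)) (η ^ 3 / (2 * (128 * K) ^ 2))) (by linarith) (by positivity)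
  -- uniform convergence
  obtain ⟨μd, μd0, hd⟩ := seq_unif (isCompact_closedBall C0 r) (Bad := fun μ C => μ < min μa μb ∧ ∃ (ν : ℝ) (S S1 S2 qS f f1 f2 q rh rh1 rh2 : ℝ → ℂ),
      Setup P (ord 0) K M' μ (μ ^ p) (μ ^ σ') ν (1 * μ ^ p) (μ * C) S S1 S2 qS f f1 f2 q rh rh1 rh2 ∧ f 0 = 1 ∧ δ / 3 < ‖f 1 - Φ C‖) (by
    intro μ C Cs hμ hμ1 hμl hC hCs hCl hbad
    choose hlt ν S S1 S2 qS f f1 f2 q rh rh1 rh2 hs hf0 hbad using hbad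
    have seq : SeqH μ C Cs η (‖C0‖ + r) := ⟨hμ, hμ1, hμl, hCl, η0, fun n => him _ (hC n), fun n => Cn _ (hC n)⟩
    have clo := fun n => cl (hs n) (ha (μ n) (hμ n) ((hlt n).trans_le (min_le_left _ _))) (hb (μ n) (hμ n) ((hlt n).trans_le (min_le_right _ _)))
    simp only [hf0, norm_one, mul_one] at clo
    obtain ⟨B, hB⟩ := Fl_bdd (P := P) (T := T) (ord := ord) (b := b) (k := k) ((Cs / Complex.I) ^ (-(2 - 1 / k : ℂ)))
    have lim := (seq_lim E.z E.hk E.hkT seq E.hσ hs hf0 (fun n => (clo n).1) (fun n => (clo n).2.1) (fun n => (clo n).2.2.1) (fun n => (clo n).2.2.2)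
      (Fl_meas _) (fun x _ => hB x) (fun x _ => Fl_eq E.z.Tsub E.hk (fun w hw => E.z.bne w (E.z.Tsub w hw)) (η0.trans_le (him Cs hCs)) x)).2 hk2
    have lim2 : Tendsto (fun n => Φ (C n)) atTop (𝓝 (Φ Cs)) :=
      (hcont Cs hCs).tendsto.comp (tendsto_nhdsWithin_iff.2 ⟨hCl, Eventually.of_forall hC⟩)
    have lim3 := (lim.sub lim2).norm
    rw [sub_self, norm_zero] at lim3
    have := ge_of_tendsto lim3 (Eventually.of_forall fun n => (hbad n).le)
    linarith)
  refine ⟨p, 1, 1, 2, min (min (min μa μb) (min μc μd)) (1 / M), η, ‖C0‖ + r, hp1.le, one_pos, one_pos, by norm_num, by positivity, η0, ?_, ?_⟩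
  · have h0 : C0 ∈ Metric.closedBall C0 r := Metric.mem_closedBall_self r0.le
    exact (him C0 h0).trans ((le_abs_self _).trans ((Complex.abs_im_le_norm _).trans (by linarith)))
  intro μ τ hμ hμ0 hτ1 hτ2
  have l1 : μ < μa := hμ0.trans_le ((min_le_left _ _).trans ((min_le_left _ _).trans (min_le_left _ _)))
  have l2 : μ < μb := hμ0.trans_le ((min_le_left _ _).trans ((min_le_left _ _).trans (min_le_right _ _)))
  have l3 : μ < μc := hμ0.trans_le ((min_le_left _ _).trans ((min_le_right _ _).trans (min_le_left _ _)))
  have l4 : μ < μd := hμ0.trans_le ((min_le_left _ _).trans ((min_le_right _ _).trans (min_le_right _ _)))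
  have l5 : M * μ ≤ 1 := by
    have : μ < 1 / M := hμ0.trans_le (min_le_right _ _)
    rw [lt_div_iff₀ (by linarith)] at this; linarith
  have τ0 : 0 < τ := by linarith
  have mm : μ ^ p = μ * μ ^ (p - 1) := by rw [Real.rpow_sub_one hμ.ne']; field_simp
  have e0 := Real.rpow_pos_of_pos hμ (p - 1)
  have e1 := (hc μ hμ l3).trans (min_le_left _ _)
  have e2 := (hc μ hμ l3).trans (min_le_right _ _)
  rw [le_div_iff₀ (by positivity)] at e1 e2
  have wall : ∀ C ∈ Metric.closedBall C0 r, ∃ S S1 S2 qS : ℝ → ℂ, ∀ f f1 f2 q rh rh1 rh2 : ℝ → ℂ,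
      Mode P (τ * μ ^ p * μ ^ 2) (1 * μ ^ p) (μ * C) f f1 f2 q rh rh1 rh2 → q 1 = 0 →
        Setup P (ord 0) K M' μ (μ ^ p) (μ ^ σ') (τ * μ ^ p * μ ^ 2) (1 * μ ^ p) (μ * C)
          S S1 S2 qS f f1 f2 q rh rh1 rh2 := fun C hC => by
    have hCi := him C hC
    obtain ⟨l, S, S1, S2, qS, -, -, -, h⟩ := E.mk_wall (M := M) (μ := μ) (τ := τ) (κ := 1) (C := C) hM1 hμ ((Cn C hC).trans (by linarith))
      (by nlinarith) τ0 (by linarith) one_pos hM1 l5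
      (by
        rw [← hp, mm]
        calc τ * (μ * μ ^ (p - 1)) * (K + 2 * ord 0) ^ 2 = μ * (τ * (μ ^ (p - 1) * (K + 2 * ord 0) ^ 2)) := by ring
          _ ≤ μ * (2 * (μ ^ (p - 1) * (K + 2 * ord 0) ^ 2)) := by gcongr
          _ ≤ μ * (η / 4) := by gcongr; linarith
          _ ≤ μ * (C.im / 4) := by gcongr
          _ = _ := by ring)
      (by
        rw [← hp, mm]
        calc (128 * K) ^ 2 * (τ * (μ * μ ^ (p - 1))) = μ * (τ * (μ ^ (p - 1) * (128 * K) ^ 2)) := by ring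
          _ ≤ μ * (2 * (μ ^ (p - 1) * (128 * K) ^ 2)) := by gcongr
          _ ≤ μ * η ^ 3 := by gcongr; linarith
          _ ≤ μ * ‖C‖ ^ 3 := by
            gcongr
            exact hCi.trans ((le_abs_self _).trans (Complex.abs_im_le_norm C)))
    exact ⟨S, S1, S2, qS, h⟩
  obtain ⟨C, hC, φ, φ1, ψ, ψ1, h, s, h1, h2, h3⟩ := find_root P (ν := τ * μ ^ p * μ ^ 2) (α2 := 1 * μ ^ p) (μ := μ) (C0 := C0) (r := r) (δ := δ) (e := δ / 3) (Φ := Φ)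
    (by positivity) hμ r0 (fun C hC => η0.trans_le (him C hC))
    (fun C hC f f1 f2 q rh rh1 rh2 mo hq hf0 x hx => by
      obtain ⟨S, S1, S2, qS, hS⟩ := wall C hC
      have st := hS f f1 f2 q rh rh1 rh2 mo hq
      have c := cl st (ha μ hμ l1) (hb μ hμ l2)
      rw [hf0] at c
      have n1 := c.1 x hx
      have n2 := c.2.1
      have n3 := st.fS_sup hx
      simp only [norm_zero, mul_zero] at n1 n2
      have n4 : ‖rh 1‖ * ‖qS 1‖ = 0 := le_antisymm n2 (by positivity)
      rw [n4] at n3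
      simp only [mul_zero, zero_mul] at n3
      rw [norm_le_zero_iff] at n1 n3
      rw [n3, sub_zero] at n1
      exact n1)
    (fun C hC f f1 f2 q rh rh1 rh2 mo hq hf0 => by
      obtain ⟨S, S1, S2, qS, hS⟩ := wall C hC
      have st := hS f f1 f2 q rh rh1 rh2 mo hq
      by_contra hcon
      push Not at hcon
      exact hd μ hμ l4 C hC ⟨lt_min l1 l2, _, S, S1, S2, qS, f, f1, f2, q, rh, rh1, rh2, st, hf0, hcon⟩)
    hC0 hsph (by linarith)
  refine ⟨μ * C, φ, φ1, ψ, ψ1, h, s, h1, h2, h3, ?_, ?_⟩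
  · rw [Complex.im_ofReal_mul, mul_comm]
    exact mul_le_mul_of_nonneg_left (him C hC) hμ.le
  · rw [Complex.im_ofReal_mul, mul_comm (‖C0‖ + r)]
    exact mul_le_mul_of_nonneg_left ((le_abs_self _).trans ((Complex.abs_im_le_norm C).trans (Cn C hC))) hμ.le

end OS

end

noncomputable section
open Filter Topology MeasureTheory Set ComplexConjugate
namespace OS

namespace WallSol
variable {P : Prof} {ν α2 l : ℝ} {c : ℂ} {S S1 S2 qS : ℝ → ℂ} (h : WallSol P ν α2 l c S S1 S2 qS)
include h

lemma test2 {γ : ℂ} (hν : 0 < ν) (hγ0 : γ ≠ 0) (hγ : γ ^ 2 = α2 - Complex.I * c / ν)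
    {ψ ψ1 ψ2 : ℝ → ℂ} (d0 : ∀ x, HasDerivAt ψ (ψ1 x) x) (d1 : ∀ x, HasDerivAt ψ1 (ψ2 x) x) (c2 : Continuous ψ2) :
    ∫ x in (0:ℝ)..1, ψ x * S x = γ⁻¹ ^ 2 * (ψ 1 * S1 1 - ψ1 1 + ψ1 0 * S 0 + ∫ x in (0:ℝ)..1, ψ2 x * S x) +
      (Complex.I * ν * γ ^ 2)⁻¹ * ∫ x in (0:ℝ)..1, ψ x * (P.V x * S x) := by
  have cS := h.cS
  have cψ : Continuous ψ := cont_of_deriv d0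
  have ht := h.test d0 d1 c2
  have hν' : (ν:ℂ) ≠ 0 := by exact_mod_cast hν.ne'
  have hc : Complex.I * ν * γ ^ 2 = c + Complex.I * ν * α2 := by
    rw [hγ]; field_simp; ring_nf; simp
  have e1 : ∫ x in (0:ℝ)..1, ψ x * (P.d c x * S x) = (∫ x in (0:ℝ)..1, ψ x * (P.V x * S x)) - c * ∫ x in (0:ℝ)..1, ψ x * S x := by
    rw [← intervalIntegral.integral_const_mul, ← intervalIntegral.integral_sub]
    · refine intervalIntegral.integral_congr fun x _ => ?_
      simp only [Prof.d]; ring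
    · exact (by fun_prop : Continuous _).intervalIntegrable _ _
    · exact (by fun_prop : Continuous _).intervalIntegrable _ _
  have e2 : ∫ x in (0:ℝ)..1, (ψ2 x - α2 * ψ x) * S x = (∫ x in (0:ℝ)..1, ψ2 x * S x) - α2 * ∫ x in (0:ℝ)..1, ψ x * S x := by
    rw [← intervalIntegral.integral_const_mul, ← intervalIntegral.integral_sub]
    · refine intervalIntegral.integral_congr fun x _ => ?_
      ring
    · exact (by fun_prop : Continuous _).intervalIntegrable _ _
    · exact (by fun_prop : Continuous _).intervalIntegrable _ _
  rw [e1, e2] at ht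
  set X := ∫ x in (0:ℝ)..1, ψ x * S x
  set Y := ∫ x in (0:ℝ)..1, ψ x * (P.V x * S x)
  set Z := ∫ x in (0:ℝ)..1, ψ2 x * S x
  have hne : Complex.I * ν * γ ^ 2 ≠ 0 := mul_ne_zero (mul_ne_zero Complex.I_ne_zero hν') (pow_ne_zero 2 hγ0)
  have key : (Complex.I * ν * γ ^ 2) * X = Complex.I * ν * (ψ 1 * S1 1 - ψ1 1 + ψ1 0 * S 0 + Z) + Y := by
    rw [hc]; linear_combination -ht
  apply mul_left_cancel₀ hne
  rw [key, mul_add (Complex.I * ν * γ ^ 2), mul_inv_cancel_left₀ hne]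
  congr 1
  field_simp

lemma mom_le (j : ℕ) : ‖∫ x in (0:ℝ)..1, ((1 - x : ℝ) : ℂ) ^ j * S x‖ ≤ ∫ x in (0:ℝ)..1, (1 - x) ^ j * ‖S x‖ := by
  have cS := h.cS
  refine (intervalIntegral.norm_integral_le_integral_norm zero_le_one).trans ?_
  refine int_mono' (by fun_prop) (by fun_prop) (by simp) fun x hx => ?_
  rw [norm_mul, norm_pow, Complex.norm_real, Real.norm_eq_abs, abs_of_nonneg (by linarith [hx.2])]

lemma momV_le {K : ℝ} (hV : ∀ x ∈ Icc (0:ℝ) 1, |P.V x| ≤ K * (1 - x)) (j : ℕ) :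
    ‖∫ x in (0:ℝ)..1, ((1 - x : ℝ) : ℂ) ^ j * (P.V x * S x)‖ ≤ K * ∫ x in (0:ℝ)..1, (1 - x) ^ (j + 1) * ‖S x‖ := by
  have cS := h.cS
  refine (intervalIntegral.norm_integral_le_integral_norm zero_le_one).trans ?_
  rw [← intervalIntegral.integral_const_mul]
  refine int_mono' (by fun_prop) (by fun_prop) (by simp) fun x hx => ?_
  have h0 : 0 ≤ 1 - x := by linarith [hx.2]
  rw [norm_mul, norm_mul, norm_pow, Complex.norm_real, Complex.norm_real, Real.norm_eq_abs, Real.norm_eq_abs, abs_of_nonneg h0]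
  calc (1 - x) ^ j * (|P.V x| * ‖S x‖) ≤ (1 - x) ^ j * (K * (1 - x) * ‖S x‖) := by gcongr; exact hV x hx
    _ = _ := by ring

lemma momV_sub {K : ℝ} (hV2 : ∀ x ∈ Icc (0:ℝ) 1, |P.V x - P.a * (1 - x)| ≤ K * (1 - x) ^ 2) (j : ℕ) :
    ‖(∫ x in (0:ℝ)..1, ((1 - x : ℝ) : ℂ) ^ j * (P.V x * S x)) - P.a * ∫ x in (0:ℝ)..1, ((1 - x : ℝ) : ℂ) ^ (j + 1) * S x‖ ≤
      K * ∫ x in (0:ℝ)..1, (1 - x) ^ (j + 2) * ‖S x‖ := by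
  have cS := h.cS
  have e : (∫ x in (0:ℝ)..1, ((1 - x : ℝ) : ℂ) ^ j * (P.V x * S x)) - P.a * ∫ x in (0:ℝ)..1, ((1 - x : ℝ) : ℂ) ^ (j + 1) * S x =
      ∫ x in (0:ℝ)..1, ((1 - x : ℝ) : ℂ) ^ j * (((P.V x - P.a * (1 - x) : ℝ) : ℂ) * S x) := by
    rw [← intervalIntegral.integral_const_mul, ← intervalIntegral.integral_sub]
    · refine intervalIntegral.integral_congr fun x _ => ?_
      push_cast; ring
    · exact (by fun_prop : Continuous _).intervalIntegrable _ _
    · exact (by fun_prop : Continuous _).intervalIntegrable _ _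
  rw [e]
  refine (intervalIntegral.norm_integral_le_integral_norm zero_le_one).trans ?_
  rw [← intervalIntegral.integral_const_mul]
  refine int_mono' (by fun_prop) (by fun_prop) (by simp) fun x hx => ?_
  have h0 : 0 ≤ 1 - x := by linarith [hx.2]
  rw [norm_mul, norm_mul, norm_pow, Complex.norm_real, Complex.norm_real, Real.norm_eq_abs, Real.norm_eq_abs, abs_of_nonneg h0]
  calc (1 - x) ^ j * (|P.V x - P.a * (1 - x)| * ‖S x‖) ≤ (1 - x) ^ j * (K * (1 - x) ^ 2 * ‖S x‖) := by gcongr; exact hV2 x hx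
    _ = _ := by ring

lemma mom_rec {γ : ℂ} (hν : 0 < ν) (hγ0 : γ ≠ 0) (hγ : γ ^ 2 = α2 - Complex.I * c / ν) {N W : ℕ → ℂ}
    (hN : ∀ j, N j = ∫ x in (0:ℝ)..1, ((1 - x : ℝ) : ℂ) ^ j * S x) (hW : ∀ j, W j = ∫ x in (0:ℝ)..1, ((1 - x : ℝ) : ℂ) ^ j * (P.V x * S x)) :
    N 0 = γ⁻¹ ^ 2 * S1 1 + (Complex.I * ν * γ ^ 2)⁻¹ * W 0 ∧
    N 1 = γ⁻¹ ^ 2 * (1 - S 0) + (Complex.I * ν * γ ^ 2)⁻¹ * W 1 ∧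
    N 2 = γ⁻¹ ^ 2 * (2 * N 0 - 2 * S 0) + (Complex.I * ν * γ ^ 2)⁻¹ * W 2 ∧
    N 3 = γ⁻¹ ^ 2 * (6 * N 1 - 3 * S 0) + (Complex.I * ν * γ ^ 2)⁻¹ * W 3 := by
  have dy : ∀ x : ℝ, HasDerivAt (fun x : ℝ => ((1 - x : ℝ) : ℂ)) (-1 : ℂ) x := fun x => by
    simpa using ((hasDerivAt_id x).const_sub (1:ℝ)).ofReal_comp
  refine ⟨?_, ?_, ?_, ?_⟩
  · rw [hN, hW, h.test2 hν hγ0 hγ (ψ := fun x => ((1 - x : ℝ) : ℂ) ^ 0) (ψ1 := fun _ => 0) (ψ2 := fun _ => 0) (fun x => by simpa using hasDerivAt_const x (1:ℂ))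
      (fun x => hasDerivAt_const _ _) (by fun_prop)]
    simp
  · rw [hN, hW, h.test2 hν hγ0 hγ (ψ := fun x => ((1 - x : ℝ) : ℂ) ^ 1) (ψ1 := fun _ => -1) (ψ2 := fun _ => 0) (fun x => by simpa using dy x)
      (fun x => hasDerivAt_const _ _) (by fun_prop)]
    simp; ring_nf; simp
  · rw [hN, hN, hW, h.test2 hν hγ0 hγ (ψ := fun x => ((1 - x : ℝ) : ℂ) ^ 2) (ψ1 := fun x => -2 * ((1 - x : ℝ) : ℂ)) (ψ2 := fun _ => 2)
      (fun x => ((dy x).fun_pow 2).congr_deriv (by push_cast; ring)) (fun x => ((dy x).const_mul (-2)).congr_deriv (by ring)) (by fun_prop)]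
    rw [intervalIntegral.integral_const_mul]
    simp; ring_nf; simp
  · rw [hN, hN, hW, h.test2 hν hγ0 hγ (ψ := fun x => ((1 - x : ℝ) : ℂ) ^ 3) (ψ1 := fun x => -3 * ((1 - x : ℝ) : ℂ) ^ 2) (ψ2 := fun x => 6 * ((1 - x : ℝ) : ℂ))
      (fun x => ((dy x).fun_pow 3).congr_deriv (by push_cast; ring)) (fun x => (((dy x).fun_pow 2).const_mul (-3)).congr_deriv (by push_cast; ring)) (by fun_prop)]
    simp only [mul_assoc, pow_one]
    rw [intervalIntegral.integral_const_mul]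
    simp; ring_nf; simp

end WallSol

set_option maxHeartbeats 2000000 in
lemma wall_arith {K B t μ a : ℝ} {g D γ S0 s1 : ℂ} {N W : ℕ → ℂ} (hK : 1 ≤ K) (hB : 1 ≤ B) (ha : 0 < a) (haK : a ≤ K) (t0 : 0 < t) (t1 : t ≤ 1) (μ0 : 0 < μ)
    (μt : μ ≤ t ^ 2) (hg : ‖g‖ ≤ 2 * (t ^ 2 * μ)) (hg2 : t ^ 2 * μ / 2 ≤ ‖g‖) (hD : ‖D‖ ≤ 2 / μ) (hgγ : g * γ = 1) (hs : ‖s1 - γ‖ ≤ 2 + 16 * K / μ)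
    (r0 : N 0 = g ^ 2 * s1 + D * W 0) (r1 : N 1 = g ^ 2 * (1 - S0) + D * W 1) (r2 : N 2 = g ^ 2 * (2 * N 0 - 2 * S0) + D * W 2)
    (r3 : N 3 = g ^ 2 * (6 * N 1 - 3 * S0) + D * W 3)
    (n0 : ‖N 0‖ ≤ B * (t * μ)) (n1 : ‖N 1‖ ≤ B * (t * μ) ^ 2)
    (z0 : ‖S0‖ ≤ B * (t * μ)) (z1 : ‖S0‖ ≤ 2 * B * (t * μ) ^ 2) (z2 : ‖S0‖ ≤ 3 * B * (t * μ) ^ 3)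
    (w0 : ‖W 0 - a * N 1‖ ≤ K * (B * (t * μ) ^ 3)) (w1 : ‖W 1 - a * N 2‖ ≤ K * (B * (t * μ) ^ 4)) (w2 : ‖W 2 - a * N 3‖ ≤ K * (B * (t * μ) ^ 5))
    (w3 : ‖W 3‖ ≤ K * (B * (t * μ) ^ 5)) (ht : 2776 * (K ^ 4 * B * t ^ 2) ≤ 1) :
    ‖W 0 - a * g * N 0‖ ≤ 6780 * (K ^ 5 * B * t ^ 3) * μ * ‖N 0‖ ∧ N 0 ≠ 0 := by
  have tt : t ^ 2 ≤ t := by nlinarith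
  have μ1 : μ ≤ 1 := by nlinarith
  have μt1 : μ ≤ t := μt.trans tt
  have na : ‖(a:ℂ)‖ = a := by rw [Complex.norm_real, Real.norm_eq_abs, abs_of_pos ha]
  have g2 : ‖g ^ 2‖ ≤ 4 * (t ^ 4 * μ ^ 2) := by
    rw [norm_pow]
    calc ‖g‖ ^ 2 ≤ (2 * (t ^ 2 * μ)) ^ 2 := by gcongr
      _ = _ := by ring
  have K2 : K ≤ K ^ 2 := by nlinarith
  have K3 : K ^ 2 ≤ K ^ 3 := by nlinarith
  have K4 : K ^ 3 ≤ K ^ 4 := by nlinarith [sq_nonneg K]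
  have K5 : K ^ 4 ≤ K ^ 5 := by nlinarith [sq_nonneg (K ^ 2)]
  -- N 3
  have b3 : ‖N 3‖ ≤ 62 * (K * B * t ^ 5 * μ ^ 4) := by
    have e : ‖N 3‖ ≤ 4 * (t ^ 4 * μ ^ 2) * (6 * (B * (t * μ) ^ 2) + 3 * (3 * B * (t * μ) ^ 3)) + 2 / μ * (K * (B * (t * μ) ^ 5)) := by
      rw [r3]
      refine (norm_add_le _ _).trans ?_
      rw [norm_mul, norm_mul D]
      gcongr
      refine (norm_sub_le _ _).trans ?_
      rw [norm_mul, norm_mul]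
      simp only [Complex.norm_ofNat]
      gcongr
    have e2 : 2 / μ * (K * (B * (t * μ) ^ 5)) = 2 * (K * B * t ^ 5 * μ ^ 4) := by field_simp
    rw [e2] at e
    have e3 : 24 * (B * t ^ 4 * μ ^ 4 * t ^ 2) ≤ 24 * (K * B * t ^ 5 * μ ^ 4) := by
      calc 24 * (B * t ^ 4 * μ ^ 4 * t ^ 2) ≤ 24 * (B * t ^ 4 * μ ^ 4 * t) := by gcongr
        _ = 24 * (1 * (B * t ^ 5 * μ ^ 4)) := by ring
        _ ≤ 24 * (K * (B * t ^ 5 * μ ^ 4)) := by gcongr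
        _ = _ := by ring
    have e4 : 36 * (B * t ^ 5 * μ ^ 4 * (t ^ 2 * μ)) ≤ 36 * (K * B * t ^ 5 * μ ^ 4) := by
      have : t ^ 2 * μ ≤ K := by nlinarith
      calc 36 * (B * t ^ 5 * μ ^ 4 * (t ^ 2 * μ)) ≤ 36 * (B * t ^ 5 * μ ^ 4 * K) := by gcongr
        _ = _ := by ring
    calc ‖N 3‖ ≤ _ := e
      _ = 24 * (B * t ^ 4 * μ ^ 4 * t ^ 2) + 36 * (B * t ^ 5 * μ ^ 4 * (t ^ 2 * μ)) + 2 * (K * B * t ^ 5 * μ ^ 4) := by ring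
      _ ≤ _ := by linarith
  have c2 : ‖W 2‖ ≤ 63 * (K ^ 2 * B * t ^ 5 * μ ^ 4) := by
    calc ‖W 2‖ = ‖(W 2 - a * N 3) + a * N 3‖ := by ring_nf
      _ ≤ K * (B * (t * μ) ^ 5) + K * (62 * (K * B * t ^ 5 * μ ^ 4)) := by
          refine (norm_add_le _ _).trans (add_le_add w2 ?_)
          rw [norm_mul, na]; gcongr
      _ = K * (B * t ^ 5 * μ ^ 4 * μ) + 62 * (K ^ 2 * B * t ^ 5 * μ ^ 4) := by ring
      _ ≤ K ^ 2 * (B * t ^ 5 * μ ^ 4 * 1) + 62 * (K ^ 2 * B * t ^ 5 * μ ^ 4) := by gcongr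
      _ = _ := by ring
  have b2 : ‖N 2‖ ≤ 150 * (K ^ 2 * B * t ^ 5 * μ ^ 3) := by
    have e : ‖N 2‖ ≤ 4 * (t ^ 4 * μ ^ 2) * (2 * (B * (t * μ)) + 2 * (2 * B * (t * μ) ^ 2)) + 2 / μ * (63 * (K ^ 2 * B * t ^ 5 * μ ^ 4)) := by
      rw [r2]
      refine (norm_add_le _ _).trans ?_
      rw [norm_mul, norm_mul D]
      gcongr
      refine (norm_sub_le _ _).trans ?_
      rw [norm_mul, norm_mul]
      simp only [Complex.norm_ofNat]
      gcongr
    have e2 : 2 / μ * (63 * (K ^ 2 * B * t ^ 5 * μ ^ 4)) = 126 * (K ^ 2 * B * t ^ 5 * μ ^ 3) := by field_simp; norm_num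
    rw [e2] at e
    have e3 : B * t ^ 5 * μ ^ 3 * (8 + 16 * (t * μ)) ≤ B * t ^ 5 * μ ^ 3 * (24 * K ^ 2) := by
      have : t * μ ≤ 1 := by nlinarith
      gcongr; nlinarith
    calc ‖N 2‖ ≤ _ := e
      _ = B * t ^ 5 * μ ^ 3 * (8 + 16 * (t * μ)) + 126 * (K ^ 2 * B * t ^ 5 * μ ^ 3) := by ring
      _ ≤ B * t ^ 5 * μ ^ 3 * (24 * K ^ 2) + 126 * (K ^ 2 * B * t ^ 5 * μ ^ 3) := by linarith
      _ = _ := by ring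
  have c1 : ‖W 1‖ ≤ 151 * (K ^ 3 * B * t ^ 5 * μ ^ 3) := by
    calc ‖W 1‖ = ‖(W 1 - a * N 2) + a * N 2‖ := by ring_nf
      _ ≤ K * (B * (t * μ) ^ 4) + K * (150 * (K ^ 2 * B * t ^ 5 * μ ^ 3)) := by
          refine (norm_add_le _ _).trans (add_le_add w1 ?_)
          rw [norm_mul, na]; gcongr
      _ = K * (B * t ^ 4 * μ ^ 3 * μ) + 150 * (K ^ 3 * B * t ^ 5 * μ ^ 3) := by ring
      _ ≤ K ^ 3 * (B * t ^ 4 * μ ^ 3 * t) + 150 * (K ^ 3 * B * t ^ 5 * μ ^ 3) := by gcongr; linarith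
      _ = _ := by ring
  have b1 : ‖N 1 - g ^ 2‖ ≤ 306 * (K ^ 3 * B * t ^ 5 * μ ^ 2) := by
    have e : ‖N 1 - g ^ 2‖ ≤ 4 * (t ^ 4 * μ ^ 2) * (B * (t * μ)) + 2 / μ * (151 * (K ^ 3 * B * t ^ 5 * μ ^ 3)) := by
      have : N 1 - g ^ 2 = -(g ^ 2 * S0) + D * W 1 := by rw [r1]; ring
      rw [this]
      refine (norm_add_le _ _).trans ?_
      rw [norm_neg, norm_mul, norm_mul D]
      gcongr
    have e2 : 2 / μ * (151 * (K ^ 3 * B * t ^ 5 * μ ^ 3)) = 302 * (K ^ 3 * B * t ^ 5 * μ ^ 2) := by field_simp; norm_num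
    rw [e2] at e
    calc ‖N 1 - g ^ 2‖ ≤ _ := e
      _ = 4 * (B * t ^ 5 * μ ^ 2) * μ + 302 * (K ^ 3 * B * t ^ 5 * μ ^ 2) := by ring
      _ ≤ 4 * (B * t ^ 5 * μ ^ 2) * K ^ 3 + 302 * (K ^ 3 * B * t ^ 5 * μ ^ 2) := by gcongr; linarith
      _ = _ := by ring
  have c0 : ‖W 0 - a * g ^ 2‖ ≤ 307 * (K ^ 4 * B * t ^ 5 * μ ^ 2) := by
    calc ‖W 0 - a * g ^ 2‖ = ‖(W 0 - a * N 1) + a * (N 1 - g ^ 2)‖ := by ring_nf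
      _ ≤ K * (B * (t * μ) ^ 3) + K * (306 * (K ^ 3 * B * t ^ 5 * μ ^ 2)) := by
          refine (norm_add_le _ _).trans (add_le_add w0 ?_)
          rw [norm_mul, na]; gcongr
      _ = K * (B * t ^ 3 * μ ^ 2 * μ) + 306 * (K ^ 4 * B * t ^ 5 * μ ^ 2) := by ring
      _ ≤ K ^ 4 * (B * t ^ 3 * μ ^ 2 * t ^ 2) + 306 * (K ^ 4 * B * t ^ 5 * μ ^ 2) := by gcongr; linarith
      _ = _ := by ring
  have c0' : ‖W 0‖ ≤ 311 * (K ^ 4 * B * t ^ 4 * μ ^ 2) := by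
    calc ‖W 0‖ = ‖(W 0 - a * g ^ 2) + a * g ^ 2‖ := by ring_nf
      _ ≤ 307 * (K ^ 4 * B * t ^ 5 * μ ^ 2) + K * (4 * (t ^ 4 * μ ^ 2)) := by
          refine (norm_add_le _ _).trans (add_le_add c0 ?_)
          rw [norm_mul, na]; gcongr
      _ = 307 * (K ^ 4 * B * t ^ 4 * μ ^ 2) * t + 4 * (t ^ 4 * μ ^ 2) * (K * 1) := by ring
      _ ≤ 307 * (K ^ 4 * B * t ^ 4 * μ ^ 2) * 1 + 4 * (t ^ 4 * μ ^ 2) * (K ^ 4 * B) := by gcongr; linarith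
      _ = _ := by ring
  have b0 : ‖N 0 - g‖ ≤ 694 * (K ^ 4 * B * t ^ 4 * μ) := by
    have e : ‖N 0 - g‖ ≤ 4 * (t ^ 4 * μ ^ 2) * (2 + 16 * K / μ) + 2 / μ * (311 * (K ^ 4 * B * t ^ 4 * μ ^ 2)) := by
      have : N 0 - g = g ^ 2 * (s1 - γ) + D * W 0 := by rw [r0]; linear_combination g * hgγ
      rw [this]
      refine (norm_add_le _ _).trans ?_
      rw [norm_mul, norm_mul D]
      gcongr
    have e2 : 4 * (t ^ 4 * μ ^ 2) * (2 + 16 * K / μ) + 2 / μ * (311 * (K ^ 4 * B * t ^ 4 * μ ^ 2)) =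
        t ^ 4 * μ * (8 * μ + 64 * K) + 622 * (K ^ 4 * B * t ^ 4 * μ) := by field_simp; ring
    rw [e2] at e
    have e3 : 8 * μ + 64 * K ≤ 72 * (K ^ 4 * B) := by
      have : K ^ 4 * 1 ≤ K ^ 4 * B := by gcongr
      linarith
    calc ‖N 0 - g‖ ≤ _ := e
      _ ≤ t ^ 4 * μ * (72 * (K ^ 4 * B)) + 622 * (K ^ 4 * B * t ^ 4 * μ) := by gcongr
      _ = _ := by ring
  have lower : t ^ 2 * μ / 4 ≤ ‖N 0‖ := by
    have e1 : ‖g‖ ≤ ‖N 0‖ + ‖N 0 - g‖ := by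
      have := norm_sub_le (N 0) (N 0 - g); simpa using this
    have e2 : 694 * (K ^ 4 * B * t ^ 4 * μ) ≤ t ^ 2 * μ / 4 := by
      calc 694 * (K ^ 4 * B * t ^ 4 * μ) = t ^ 2 * μ / 4 * (2776 * (K ^ 4 * B * t ^ 2)) := by ring
        _ ≤ t ^ 2 * μ / 4 * 1 := by gcongr
        _ = _ := by ring
    linarith
  refine ⟨?_, ?_⟩
  · have : W 0 - a * g * N 0 = (W 0 - a * g ^ 2) - a * g * (N 0 - g) := by ring
    rw [this]
    calc _ ≤ 307 * (K ^ 4 * B * t ^ 5 * μ ^ 2) + K * (2 * (t ^ 2 * μ)) * (694 * (K ^ 4 * B * t ^ 4 * μ)) := by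
          refine (norm_sub_le _ _).trans (add_le_add c0 ?_)
          rw [norm_mul, norm_mul, na]; gcongr
      _ = 307 * (B * t ^ 5 * μ ^ 2) * K ^ 4 + 1388 * (K ^ 5 * B * t ^ 5 * μ ^ 2) * t := by ring
      _ ≤ 307 * (B * t ^ 5 * μ ^ 2) * K ^ 5 + 1388 * (K ^ 5 * B * t ^ 5 * μ ^ 2) * 1 := by gcongr
      _ = 6780 * (K ^ 5 * B * t ^ 3) * μ * (t ^ 2 * μ / 4) := by ring
      _ ≤ _ := by gcongr
  · intro h0
    rw [h0, norm_zero] at lower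
    have : 0 < t ^ 2 * μ / 4 := by positivity
    linarith

end OS

end

noncomputable section
open Filter Topology MeasureTheory Set ComplexConjugate
namespace OS

/-- size of the wall moments -/
def BB (a : ℝ) : ℝ := 48 * (2 * (1 + 5 / a)) ^ 5

lemma BB_one {a : ℝ} (ha : 0 < a) : 1 ≤ BB a := by
  unfold BB
  have h1 : 1 ≤ 2 * (1 + 5 / a) := by
    have : 0 < 5 / a := by positivity
    linarith
  have := one_le_pow₀ h1 (n := 5)
  linarith

lemma WallSol.mom_BB {P : Prof} {ν α2 l t μ : ℝ} {c : ℂ} {S S1 S2 qS : ℝ → ℂ} (h : WallSol P ν α2 l c S S1 S2 qS) (hl : 0 < l)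
    (ht : 0 < t) (hμ : 0 < μ) (hll : 1 / l ≤ (1 + 5 / P.a) * (t * μ)) {j : ℕ} (hj : j ≤ 4) :
    ∫ x in (0:ℝ)..1, (1 - x) ^ j * ‖S x‖ ≤ BB P.a * (t * μ) ^ (j + 1) := by
  have ha := P.a_pos
  refine (h.moment hl j).trans ?_
  have h1 : 1 ≤ 2 * (1 + 5 / P.a) := by
    have : 0 < 5 / P.a := by positivity
    linarith
  have h2 : (2 * (1 + 5 / P.a)) ^ (j + 1) ≤ (2 * (1 + 5 / P.a)) ^ 5 := pow_le_pow_right₀ h1 (by omega)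
  have h3 : (j.factorial : ℝ) ≤ 24 := by
    have := Nat.factorial_le hj
    have e : Nat.factorial 4 = 24 := rfl
    rw [e] at this
    exact_mod_cast this
  calc 2 * (j.factorial : ℝ) * (2 / l) ^ (j + 1) = 2 * (j.factorial : ℝ) * (2 * (1 / l)) ^ (j + 1) := by ring_nf
    _ ≤ 2 * 24 * (2 * ((1 + 5 / P.a) * (t * μ))) ^ (j + 1) := by gcongr
    _ = 48 * (2 * (1 + 5 / P.a)) ^ (j + 1) * (t * μ) ^ (j + 1) := by rw [← mul_assoc 2 (1 + 5 / P.a), mul_pow]; ring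
    _ ≤ 48 * (2 * (1 + 5 / P.a)) ^ 5 * (t * μ) ^ (j + 1) := by gcongr

/-- algebra of the complex wave number of the wall layer -/
lemma gam_arith {κ t μ ν : ℝ} {C γ ω : ℂ} (hκ : 0 < κ) (t0 : 0 < t) (t1 : t ≤ 1) (μ0 : 0 < μ) (μ1 : μ ≤ 1) (hν : ν = t ^ 4 * μ ^ 3)
    (hγ : γ ^ 2 = (κ * μ : ℝ) - Complex.I * (μ * C) / ν) (hre : 0 < γ.re) (hCi : 0 ≤ C.im) {s : ℝ} (hC : ‖C - 1‖ ≤ s) (hs : s ≤ 1 / 4) (hs2 : 4 * (κ * t ^ 2) ≤ 1)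
    (hω : ω ^ 2 = Complex.I) (hωr : 7 / 10 ≤ ω.re) :
    γ ≠ 0 ∧ ‖γ⁻¹‖ ≤ 2 * (t ^ 2 * μ) ∧ t ^ 2 * μ / 2 ≤ ‖γ⁻¹‖ ∧ ‖(Complex.I * ν * γ ^ 2)⁻¹‖ ≤ 2 / μ ∧
    μ * ‖C‖ ≤ ν * ‖γ‖ ^ 2 ∧ ‖γ⁻¹ / μ - t ^ 2 * ω‖ ≤ 3 * (s + κ * t ^ 2) * t ^ 2 := by
  have hμ' : (μ:ℂ) ≠ 0 := by exact_mod_cast μ0.ne'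
  have ht' : (t:ℂ) ≠ 0 := by exact_mod_cast t0.ne'
  have ν0 : 0 < ν := by rw [hν]; positivity
  have hν' : (ν:ℂ) ≠ 0 := by exact_mod_cast ν0.ne'
  have hγ0 : γ ≠ 0 := by rintro rfl; simp at hre
  set x : ℝ := κ * μ ^ 3 * t ^ 4 with hx
  have x0 : 0 < x := by positivity
  have xle : x ≤ κ * t ^ 2 := by
    have e1 : μ ^ 3 ≤ 1 := pow_le_one₀ μ0.le μ1
    have e2 : t ^ 2 ≤ 1 := pow_le_one₀ t0.le t1
    calc x = κ * t ^ 2 * (μ ^ 3 * t ^ 2) := by rw [hx]; ring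
      _ ≤ κ * t ^ 2 * (1 * 1) := by gcongr
      _ = _ := by ring
  set Z : ℂ := C + Complex.I * x with hZ
  have key : γ ^ 2 * (μ ^ 2 * t ^ 4) = -Complex.I * Z := by
    have : (ν:ℂ) = t ^ 4 * μ ^ 3 := by rw [hν]; push_cast; ring
    rw [hγ, this, hZ, hx]
    push_cast
    field_simp
    ring_nf
    simp
  have hZ1 : ‖Z - 1‖ ≤ s + κ * t ^ 2 := by
    calc ‖Z - 1‖ = ‖(C - 1) + Complex.I * x‖ := by rw [hZ]; ring_nf
      _ ≤ s + x := by
        refine (norm_add_le _ _).trans (add_le_add hC ?_)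
        rw [norm_mul, Complex.norm_I, one_mul, Complex.norm_real, Real.norm_eq_abs, abs_of_pos x0]
      _ ≤ _ := by linarith
  have hZ2 : ‖Z - 1‖ ≤ 1 / 2 := by linarith
  have hZl : 1 / 2 ≤ ‖Z‖ := by
    have := norm_sub_le Z (Z - 1)
    simp only [sub_sub_cancel, norm_one] at this
    linarith
  have hZu : ‖Z‖ ≤ 3 / 2 := by
    have := norm_add_le (Z - 1) 1
    simp only [sub_add_cancel, norm_one] at this
    linarith
  have kn : ‖γ‖ ^ 2 * (μ ^ 2 * t ^ 4) = ‖Z‖ := by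
    have := congrArg norm key
    simpa [norm_mul, norm_pow, abs_of_pos μ0, abs_of_pos t0] using this
  have g0 : 0 < ‖γ‖ := norm_pos_iff.2 hγ0
  have q1 : 1 / 2 ≤ (‖γ‖ * (t ^ 2 * μ)) ^ 2 := by
    calc (1:ℝ) / 2 ≤ ‖Z‖ := hZl
      _ = _ := by rw [← kn]; ring
  have q2 : (‖γ‖ * (t ^ 2 * μ)) ^ 2 ≤ 3 / 2 := by
    calc _ = ‖Z‖ := by rw [← kn]; ring
      _ ≤ _ := hZu
  have y0 : 0 < ‖γ‖ * (t ^ 2 * μ) := by positivity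
  refine ⟨hγ0, ?_, ?_, ?_, ?_, ?_⟩
  · rw [norm_inv, inv_le_iff_one_le_mul₀ g0]
    nlinarith
  · rw [norm_inv, inv_eq_one_div, le_div_iff₀ g0]
    nlinarith
  · rw [norm_inv, norm_mul, norm_mul, Complex.norm_I, one_mul, Complex.norm_real, Real.norm_eq_abs, abs_of_pos ν0, norm_pow]
    have : ν * ‖γ‖ ^ 2 = μ * ‖Z‖ := by rw [← kn, hν]; ring
    rw [this, inv_eq_one_div, div_le_div_iff₀ (by positivity) μ0]
    nlinarith
  · have : ν * ‖γ‖ ^ 2 = μ * ‖Z‖ := by rw [← kn, hν]; ring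
    rw [this]
    gcongr
    rw [← sq_le_sq₀ (norm_nonneg _) (norm_nonneg _), Complex.sq_norm, Complex.sq_norm, Complex.normSq_apply, Complex.normSq_apply, hZ]
    simp
    nlinarith
  · set G : ℂ := γ⁻¹ / μ with hG
    have Z0 : Z ≠ 0 := by rw [← norm_pos_iff]; linarith
    have G2 : G ^ 2 = Complex.I * t ^ 4 / Z := by
      rw [hG, eq_div_iff Z0]
      field_simp
      linear_combination -Complex.I * key + Z * Complex.I_sq
    have Gre : 0 < G.re := by
      rw [hG, Complex.div_ofReal_re, Complex.inv_re]
      have := Complex.normSq_pos.2 hγ0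
      positivity
    have prod : (G - t ^ 2 * ω) * (G + t ^ 2 * ω) = Complex.I * t ^ 4 * (1 - Z) / Z := by
      have : (G - t ^ 2 * ω) * (G + t ^ 2 * ω) = G ^ 2 - t ^ 4 * ω ^ 2 := by ring
      rw [this, G2, hω]; field_simp
    have hsum : 7 / 10 * t ^ 2 ≤ ‖G + t ^ 2 * ω‖ := by
      refine le_trans ?_ ((le_abs_self _).trans (Complex.abs_re_le_norm _))
      have : (G + t ^ 2 * ω).re = G.re + t ^ 2 * ω.re := by
        rw [Complex.add_re]; congr 1
        rw [← Complex.ofReal_pow, Complex.re_ofReal_mul]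
      rw [this]
      have := mul_le_mul_of_nonneg_left hωr (sq_nonneg t)
      linarith
    have hn := congrArg norm prod
    rw [norm_mul, norm_div, norm_mul, norm_mul, Complex.norm_I, one_mul, norm_pow, Complex.norm_real, Real.norm_eq_abs, abs_of_pos t0] at hn
    have hup : t ^ 4 * ‖1 - Z‖ / ‖Z‖ ≤ 2 * (t ^ 4 * (s + κ * t ^ 2)) := by
      rw [div_le_iff₀ (by linarith), norm_sub_rev]
      have s0 : 0 ≤ s + κ * t ^ 2 := (norm_nonneg _).trans hZ1
      calc t ^ 4 * ‖Z - 1‖ ≤ t ^ 4 * (s + κ * t ^ 2) := by gcongr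
        _ = 2 * (t ^ 4 * (s + κ * t ^ 2)) * (1 / 2) := by ring
        _ ≤ _ := by gcongr
    rw [← hn] at hup
    have s0 : 0 ≤ s + κ * t ^ 2 := (norm_nonneg _).trans hZ1
    have t2 : 0 < t ^ 2 := by positivity
    have : ‖G - t ^ 2 * ω‖ * (7 / 10 * t ^ 2) ≤ 3 * (s + κ * t ^ 2) * t ^ 2 * (7 / 10 * t ^ 2) := by
      calc _ ≤ ‖G - t ^ 2 * ω‖ * ‖G + t ^ 2 * ω‖ := by gcongr
        _ ≤ 2 * (t ^ 4 * (s + κ * t ^ 2)) := hup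
        _ ≤ 2.1 * (t ^ 4 * (s + κ * t ^ 2)) := by gcongr; norm_num
        _ = _ := by ring
    exact le_of_mul_le_mul_right this (by positivity)

set_option maxHeartbeats 2000000 in
lemma WallSol.X_close {P : Prof} {K κ t μ l ν α2 : ℝ} {C ω : ℂ} {S S1 S2 qS : ℝ → ℂ} (W : WallSol P ν α2 l (μ * C) S S1 S2 qS)
    (hK : 1 ≤ K) (haK : P.a ≤ K) (hV : ∀ x ∈ Icc (0:ℝ) 1, |P.V x| ≤ K * (1 - x))
    (hV2 : ∀ x ∈ Icc (0:ℝ) 1, |P.V x - P.a * (1 - x)| ≤ K * (1 - x) ^ 2)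
    (hκ : 0 < κ) (t0 : 0 < t) (t1 : t ≤ 1) (μ0 : 0 < μ) (μt : μ ≤ t ^ 2) (hν : ν = t ^ 4 * μ ^ 3) (hα : α2 = κ * μ) (hl : 0 < l)
    (hlc : 2 * l ^ 2 * ν = μ * C.im) (hω : ω ^ 2 = Complex.I) (hωn : ‖ω‖ = 1) (hωr : 7 / 10 ≤ ω.re) (hωi : 7 / 10 ≤ ω.im)
    (hC : ‖C - (1 + P.a * t ^ 2 * ω)‖ ≤ P.a * t ^ 2 / 4)
    (hs1 : 8 * (P.a * t ^ 2) ≤ 1) (hs2 : 4 * (κ * t ^ 2) ≤ 1) (hs3 : 2776 * (K ^ 4 * BB P.a * t ^ 2) ≤ 1)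
    (hs4 : (6780 * (K ^ 5 * BB P.a) + 3 * P.a * (2 * P.a + κ)) * t ≤ P.a / 100) :
    qS 1 ≠ 0 ∧ ‖μ * (∫ x in (0:ℝ)..1, S x) / qS 1‖ ≤ 2 ∧
      ‖μ * (∫ x in (0:ℝ)..1, S x) / qS 1 + 1 / (C - P.a * t ^ 2 * ω)‖ ≤ P.a * t ^ 2 / 50 := by
  have ha := P.a_pos
  have hμ' : (μ:ℂ) ≠ 0 := by exact_mod_cast μ0.ne'
  set A : ℂ := P.a * t ^ 2 * ω with hA
  have At : 0 < P.a * t ^ 2 := by positivity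
  have An : ‖A‖ = P.a * t ^ 2 := by
    rw [hA, norm_mul, hωn, mul_one, norm_mul, norm_pow, Complex.norm_real, Complex.norm_real, Real.norm_eq_abs, Real.norm_eq_abs, abs_of_pos ha, abs_of_pos t0]
  have Ai : 7 / 10 * (P.a * t ^ 2) ≤ A.im := by
    have : A = ((P.a * t ^ 2 : ℝ) : ℂ) * ω := by rw [hA]; push_cast; ring
    rw [this, Complex.im_ofReal_mul]; nlinarith
  have hC1 : ‖C - 1‖ ≤ 2 * (P.a * t ^ 2) := by
    calc ‖C - 1‖ = ‖(C - (1 + A)) + A‖ := by ring_nf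
      _ ≤ _ := (norm_add_le _ _).trans (by linarith)
  have Ci : 2 / 5 * (P.a * t ^ 2) ≤ C.im := by
    have h1 := (Complex.abs_im_le_norm _).trans hC
    rw [abs_le] at h1
    simp only [Complex.sub_im, Complex.add_im, Complex.one_im] at h1
    linarith [h1.1]
  have μ1 : μ ≤ 1 := μt.trans (pow_le_one₀ t0.le t1)
  have ν0 : 0 < ν := by rw [hν]; positivity
  have Ci0 : 0 < C.im := by linarith
  obtain ⟨γ, hγ, hre, h2⟩ := exists_root ((α2:ℂ) - Complex.I * (μ * C) / ν) (by
    have : ((α2:ℂ) - Complex.I * (μ * C) / ν).re = α2 + μ * C.im / ν := by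
      rw [Complex.sub_re, Complex.div_ofReal_re]; simp; ring
    rw [this, hα]; positivity)
  obtain ⟨hγ0, gu, gl, hD, hγc, hG⟩ := gam_arith (C := C) (γ := γ) (ω := ω) (s := 2 * (P.a * t ^ 2)) hκ t0 t1 μ0 μ1 hν (by rw [hγ, hα]) hre Ci0.le hC1 (by linarith) hs2 hω hωr
  have Cn : 1 / 2 ≤ ‖C‖ := by
    have := norm_sub_le C (C - 1)
    simp only [sub_sub_cancel, norm_one] at this
    linarith
  have cn : ‖(μ * C : ℂ)‖ = μ * ‖C‖ := by rw [norm_mul, Complex.norm_real, Real.norm_eq_abs, abs_of_pos μ0]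
  have hS := W.S1_close hK ν0 hV hγ hre h2 (by rw [cn]; exact hγc) (by rw [cn]; positivity)
  have hS' : ‖S1 1 - γ‖ ≤ 2 + 16 * K / μ := by
    refine hS.trans ?_
    rw [cn]
    have : 8 * K / (μ * ‖C‖) ≤ 16 * K / μ := by
      rw [div_le_div_iff₀ (by positivity) μ0]
      nlinarith [mul_pos (by linarith : 0 < K) μ0]
    linarith
  have hll : 1 / l ≤ (1 + 5 / P.a) * (t * μ) := by
    have e1 : (1 / l) ^ 2 = 2 * (t ^ 4 * μ ^ 2) / C.im := by
      rw [hν] at hlc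
      field_simp
      have := mul_left_cancel₀ μ0.ne' (show μ * C.im = μ * (l ^ 2 * 2 * t ^ 4 * μ ^ 2) by rw [← hlc]; ring)
      linarith
    have e2 : 2 * (t ^ 4 * μ ^ 2) / C.im ≤ 5 / P.a * (t * μ) ^ 2 := by
      rw [div_le_iff₀ Ci0]
      calc 2 * (t ^ 4 * μ ^ 2) = 5 / P.a * (t * μ) ^ 2 * (2 / 5 * (P.a * t ^ 2)) := by field_simp
        _ ≤ _ := by gcongr
    have e3 : 5 / P.a ≤ (1 + 5 / P.a) ^ 2 := by
      have h5 : 0 < 5 / P.a := by positivity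
      generalize 5 / P.a = y at h5
      nlinarith only [h5, sq_nonneg y]
    rw [← sq_le_sq₀ (by positivity) (by positivity), e1, mul_pow]
    exact e2.trans (by gcongr)
  have B1 := BB_one ha
  set N : ℕ → ℂ := fun j => ∫ x in (0:ℝ)..1, ((1 - x : ℝ) : ℂ) ^ j * S x with hN
  set Wm : ℕ → ℂ := fun j => ∫ x in (0:ℝ)..1, ((1 - x : ℝ) : ℂ) ^ j * (P.V x * S x) with hWm
  obtain ⟨r0, r1, r2, r3⟩ := W.mom_rec ν0 hγ0 hγ (N := N) (W := Wm) (fun j => rfl) (fun j => rfl)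
  have mb := fun (j : ℕ) (hj : j ≤ 4) => W.mom_BB hl t0 μ0 hll hj
  have K0 : 0 ≤ K := by linarith
  obtain ⟨res, N0⟩ := wall_arith hK B1 ha haK t0 t1 μ0 μt gu gl hD (inv_mul_cancel₀ hγ0) hS' r0 r1 r2 r3
    ((W.mom_le 0).trans ((mb 0 (by norm_num)).trans (by simp)))
    ((W.mom_le 1).trans (mb 1 (by norm_num)))
    (by have := W.S0_le 0; have h2 := mb 0 (by norm_num); norm_num at this h2; linarith)
    (by have := W.S0_le 1; have h2 := mb 1 (by norm_num); norm_num at this h2; linarith)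
    (by have := W.S0_le 2; have h2 := mb 2 (by norm_num); norm_num at this h2; linarith)
    ((W.momV_sub hV2 0).trans (mul_le_mul_of_nonneg_left (mb 2 (by norm_num)) K0))
    ((W.momV_sub hV2 1).trans (mul_le_mul_of_nonneg_left (mb 3 (by norm_num)) K0))
    ((W.momV_sub hV2 2).trans (mul_le_mul_of_nonneg_left (mb 4 (by norm_num)) K0))
    ((W.momV_le hV 3).trans (mul_le_mul_of_nonneg_left (mb 4 (by norm_num)) K0)) hs3
  have N0eq : ∫ x in (0:ℝ)..1, S x = N 0 := by simp [hN]
  have cS := W.cS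
  have hq : qS 1 = Wm 0 - μ * C * N 0 := by
    rw [W.qS_int, ← N0eq, ← intervalIntegral.integral_const_mul, hWm, ← intervalIntegral.integral_sub]
    · refine intervalIntegral.integral_congr fun x _ => ?_
      simp only [Prof.d, pow_zero]; ring
    · exact (by fun_prop : Continuous _).intervalIntegrable _ _
    · exact (by fun_prop : Continuous _).intervalIntegrable _ _
  set m : ℂ := Wm 0 / N 0 / μ with hm
  have mA : ‖m - A‖ ≤ P.a * t ^ 2 / 100 := by
    have e1 : m - A = (Wm 0 - P.a * γ⁻¹ * N 0) / (μ * N 0) + P.a * (γ⁻¹ / μ - t ^ 2 * ω) := by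
      rw [hm, hA]; field_simp; ring
    have n0 : 0 < ‖N 0‖ := norm_pos_iff.2 N0
    calc ‖m - A‖ ≤ 6780 * (K ^ 5 * BB P.a * t ^ 3) + P.a * (3 * (2 * (P.a * t ^ 2) + κ * t ^ 2) * t ^ 2) := by
          rw [e1]
          refine (norm_add_le _ _).trans (add_le_add ?_ ?_)
          · rw [norm_div, norm_mul, Complex.norm_real, Real.norm_eq_abs, abs_of_pos μ0, div_le_iff₀ (by positivity)]
            linarith
          · rw [norm_mul, Complex.norm_real, Real.norm_eq_abs, abs_of_pos ha]
            gcongr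
      _ = t ^ 2 * (6780 * (K ^ 5 * BB P.a) * t + 3 * P.a * (2 * P.a + κ) * (t * t)) := by ring
      _ ≤ t ^ 2 * (6780 * (K ^ 5 * BB P.a) * t + 3 * P.a * (2 * P.a + κ) * (t * 1)) := by gcongr
      _ = t ^ 2 * ((6780 * (K ^ 5 * BB P.a) + 3 * P.a * (2 * P.a + κ)) * t) := by ring
      _ ≤ t ^ 2 * (P.a / 100) := by gcongr
      _ = _ := by ring
  have d1 : 3 / 4 ≤ ‖C - A‖ := by
    have := norm_sub_le (C - A) (C - (1 + A))
    rw [show C - A - (C - (1 + A)) = 1 by ring, norm_one] at this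
    linarith
  have d2 : 3 / 4 ≤ ‖C - m‖ := by
    have := norm_sub_le (C - A) (m - A)
    have h3 := norm_sub_le (C - m + (m - A)) (C - (1 + A))
    rw [show C - m + (m - A) - (C - (1 + A)) = 1 by ring, norm_one] at h3
    have h4 := norm_add_le (C - m) (m - A)
    linarith
  have ne1 : C - A ≠ 0 := by rw [← norm_pos_iff]; linarith
  have ne2 : C - m ≠ 0 := by rw [← norm_pos_iff]; linarith
  have hq2 : qS 1 = -(μ * N 0 * (C - m)) := by rw [hq, hm]; field_simp; ring
  have hX : μ * (∫ x in (0:ℝ)..1, S x) / qS 1 = -(1 / (C - m)) := by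
    rw [N0eq, hq2]; field_simp
  refine ⟨?_, ?_, ?_⟩
  · rw [hq2]; exact neg_ne_zero.2 (mul_ne_zero (mul_ne_zero hμ' N0) ne2)
  · rw [hX, norm_neg, norm_div, norm_one, div_le_iff₀ (by linarith)]; linarith
  · have : -(1 / (C - m)) + 1 / (C - A) = -(m - A) / ((C - m) * (C - A)) := by field_simp; ring
    rw [hX, this, norm_div, norm_neg, norm_mul, div_le_iff₀ (by positivity)]
    have : 1 / 2 ≤ ‖C - m‖ * ‖C - A‖ := by nlinarith
    nlinarith

end OS

end

noncomputable section
open Filter Topology MeasureTheory Set ComplexConjugate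
namespace OS

namespace Setup
variable {P : Prof} {k : ℕ} {K M μ m σ ν α2 : ℝ} {c : ℂ} {S S1 S2 qS f f1 f2 q rh rh1 rh2 : ℝ → ℂ}
  (h : Setup P k K M μ m σ ν α2 c S S1 S2 qS f f1 f2 q rh rh1 rh2)
include h

lemma dphi1 (x : ℝ) : HasDerivAt (fun x => P.V1 x * f x + P.d c x * f1 x) (rh x + P.V2 x * f x + α2 * (P.d c x * f x)) x := by
  have h1 := (((P.dV1 x).ofReal_comp).fun_mul (h.mo.df x)).fun_add ((P.dd c x).fun_mul (h.mo.df1 x))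
  have h2 := h.mo.dq x
  have h3 : HasDerivAt q ((2 * P.d c x * P.V1 x) * f1 x + P.d c x ^ 2 * f2 x) x := by
    have e : q = fun x => P.d c x ^ 2 * f1 x := funext h.mo.hq
    rw [e]
    refine ((((P.dd c x).fun_pow 2)).fun_mul (h.mo.df1 x)).congr_deriv ?_
    push_cast; ring
  have e := h2.unique h3
  refine h1.congr_deriv ?_
  apply mul_left_cancel₀ (h.dne x)
  linear_combination -e

lemma f1_formula : -(P.a * f 1) = ∫ x in (0:ℝ)..1, (rh x + P.V2 x * f x + α2 * (P.d c x * f x)) := by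
  have c1 := h.cf
  have c2 := h.crh
  rw [intervalIntegral.integral_eq_sub_of_hasDerivAt (fun y _ => h.dphi1 y) ((by fun_prop : Continuous _).intervalIntegrable _ _)]
  have e : f1 1 = 0 := by
    have := h.mo.hq 1
    rw [h.q1] at this
    exact (mul_eq_zero.1 this.symm).resolve_left (pow_ne_zero 2 (h.dne 1))
  simp [P.V10, P.V11, h.mo.f10, e]

lemma norm_d_le {x : ℝ} (hx : x ∈ Icc (0:ℝ) 1) : ‖P.d c x‖ ≤ K + M * μ := by
  refine (norm_sub_le _ _).trans (add_le_add ?_ h.ph.cM)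
  rw [Complex.norm_real]; exact h.vh.bV x hx

lemma int_r_le {Q : ℝ} (hQ : √(∫ t in (0:ℝ)..1, omg P k μ t * ‖rh t - rh 1 * S t‖ ^ 2) ≤ μ * Q) (hQ0 : 0 ≤ Q) :
    ‖∫ t in (0:ℝ)..1, (rh t - rh 1 * S t)‖ ≤ 2 * Q := by
  have hμ := h.vh.μ0
  have cr := h.cr
  have co := h.comg
  refine (intervalIntegral.norm_integral_le_integral_norm zero_le_one).trans ?_
  have h1 := cs_int (a := 0) (b := 1) zero_le_one (f := fun _ => 1) (g := fun t => ‖rh t - rh 1 * S t‖) continuousOn_const cr.norm.continuousOn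
  simp only [one_mul, one_pow, intervalIntegral.integral_const, sub_zero, smul_eq_mul] at h1
  have h2 : ∫ t in (0:ℝ)..1, ‖rh t - rh 1 * S t‖ ^ 2 ≤ ∫ t in (0:ℝ)..1, 4 / μ ^ 2 * (omg P k μ t * ‖rh t - rh 1 * S t‖ ^ 2) := by
    refine int_mono' (by fun_prop) (by fun_prop) (by simp) fun t ht => ?_
    have e1 : μ ^ 2 / 4 ≤ omg P k μ t := by
      unfold omg
      have ep := ee_pos (k := k) hμ t
      have e2 : ee k μ t ≤ 2 := (ee_mono ht.1 ht.2).trans (ee_one h.vh)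
      have e3 : μ ^ 2 ≤ w2 P μ t := by unfold w2; nlinarith [sq_nonneg (P.V t)]
      have e4 : ee k μ t ^ 2 ≤ 4 := by nlinarith
      have : 0 < w2 P μ t := w2_pos hμ t
      gcongr
    calc ‖rh t - rh 1 * S t‖ ^ 2 = 4 / μ ^ 2 * (μ ^ 2 / 4 * ‖rh t - rh 1 * S t‖ ^ 2) := by field_simp
      _ ≤ _ := by gcongr
  rw [intervalIntegral.integral_const_mul] at h2
  have h0 : 0 ≤ ∫ t in (0:ℝ)..1, omg P k μ t * ‖rh t - rh 1 * S t‖ ^ 2 :=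
    int_nonneg' (fun t _ => mul_nonneg (omg_pos hμ t).le (by positivity)) (by simp)
  have h3 : ∫ t in (0:ℝ)..1, omg P k μ t * ‖rh t - rh 1 * S t‖ ^ 2 ≤ (μ * Q) ^ 2 := by
    rw [← Real.sq_sqrt h0]; gcongr
  have h4 : (∫ t in (0:ℝ)..1, ‖rh t - rh 1 * S t‖) ^ 2 ≤ (2 * Q) ^ 2 := by
    calc _ ≤ _ := h1
      _ ≤ 4 / μ ^ 2 * ((μ * Q) ^ 2) := h2.trans (by gcongr)
      _ = _ := by field_simp; ring
  exact abs_le_of_sq_le_sq' h4 (by positivity) |>.2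

lemma norm_int_mul_le {g u : ℝ → ℂ} {Kg : ℝ} (cg : Continuous g) (cu : Continuous u) (hg : ∀ x ∈ Icc (0:ℝ) 1, ‖g x‖ ≤ Kg) :
    ‖∫ x in (0:ℝ)..1, g x * u x‖ ≤ Kg * ∫ x in (0:ℝ)..1, ‖u x‖ := by
  refine (intervalIntegral.norm_integral_le_integral_norm zero_le_one).trans ?_
  rw [← intervalIntegral.integral_const_mul]
  refine int_mono' (by fun_prop) (by fun_prop) (by simp) fun x hx => ?_
  rw [norm_mul]
  gcongr
  exact hg x hx

set_option maxHeartbeats 1000000 in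
lemma f1_close {κ Q e : ℝ} (hm : α2 = κ * μ) (hκ : 0 < κ) (hκa : κ * ∫ x in (0:ℝ)..1, P.V x ^ 2 = P.a)
    (hQ : √(∫ t in (0:ℝ)..1, omg P k μ t * ‖rh t - rh 1 * S t‖ ^ 2) ≤ μ * Q) (hQ0 : 0 ≤ Q)
    (he : ∫ x in (0:ℝ)..1, ‖f x - 1‖ ≤ e) (hq : qS 1 ≠ 0) (hX : ‖μ * (∫ x in (0:ℝ)..1, S x) / qS 1‖ ≤ 2) :
    P.a * ‖f 1 - 1 - μ * (∫ x in (0:ℝ)..1, S x) / qS 1‖ ≤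
      2 * (10 * M ^ 4 * Q + κ * ((2 * K * M + M ^ 2) * μ + (K + M) ^ 2 * e)) + 2 * Q + K * e + κ * μ * (K + M) * (1 + e) := by
  have hμ := h.vh.μ0
  have hμ1 := h.vh.μ1
  have hμ' : (μ:ℂ) ≠ 0 := by exact_mod_cast hμ.ne'
  have hM := h.ph.hM
  have hK := h.vh.hK
  have c1 := h.cf
  have c2 := h.crh
  have c3 := h.cS
  have cr := h.cr
  have nd : ∀ x ∈ Icc (0:ℝ) 1, ‖P.d c x‖ ≤ K + M := fun x hx => (h.norm_d_le hx).trans (by nlinarith)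
  have he0 : 0 ≤ e := (int_nonneg' (fun t _ => norm_nonneg _) (by simp)).trans he
  set N0 := ∫ x in (0:ℝ)..1, S x with hN0
  set X : ℂ := μ * N0 / qS 1 with hXd
  set R := ∫ t in (0:ℝ)..1, (rh t - rh 1 * S t) with hR
  set I2 := ∫ x in (0:ℝ)..1, (P.V2 x : ℂ) * (f x - 1) with hI2
  set I3 := ∫ x in (0:ℝ)..1, P.d c x * f x with hI3
  have eV2 : ∫ x in (0:ℝ)..1, (P.V2 x : ℂ) = -P.a := by
    rw [intervalIntegral.integral_eq_sub_of_hasDerivAt (fun y _ => (P.dV1 y).ofReal_comp) ((by fun_prop : Continuous _).intervalIntegrable _ _)]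
    simp [P.V10, P.V11]
  -- the formula
  have F : -(P.a * f 1) = rh 1 * N0 + R + (I2 + -P.a) + α2 * I3 := by
    rw [h.f1_formula, ← eV2, hI2, hI3, hR, hN0, ← intervalIntegral.integral_const_mul, ← intervalIntegral.integral_const_mul, ← intervalIntegral.integral_add,
      ← intervalIntegral.integral_add, ← intervalIntegral.integral_add, ← intervalIntegral.integral_add]
    · refine intervalIntegral.integral_congr fun x _ => ?_
      ring
    all_goals exact (by fun_prop : Continuous _).intervalIntegrable _ _
  -- q0(1)
  set J1 := ∫ t in (0:ℝ)..1, P.d c t * (rh t - rh 1 * S t) with hJ1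
  set J2 := ∫ t in (0:ℝ)..1, P.d c t ^ 2 * (f t - 1) with hJ2
  set J3 := ∫ t in (0:ℝ)..1, (-2 * P.V t * c + c ^ 2) * (1:ℂ) with hJ3
  have eV : ∫ t in (0:ℝ)..1, ((P.V t : ℂ)) ^ 2 = ((∫ x in (0:ℝ)..1, P.V x ^ 2 : ℝ) : ℂ) := by
    rw [← intervalIntegral.integral_ofReal]; simp
  have G : -(rh 1 * qS 1) = μ * P.a + (J1 + α2 * (J2 + J3)) := by
    have := h.q0_int 1
    rw [h.q1, zero_sub] at this
    have e2 : (μ:ℂ) * P.a = α2 * ∫ t in (0:ℝ)..1, ((P.V t : ℂ)) ^ 2 := by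
      rw [eV, ← hκa, hm]; push_cast; ring
    rw [this, e2, hJ1, hJ2, hJ3, ← intervalIntegral.integral_add, ← intervalIntegral.integral_const_mul, ← intervalIntegral.integral_const_mul, ← intervalIntegral.integral_add,
      ← intervalIntegral.integral_add]
    · refine intervalIntegral.integral_congr fun x _ => ?_
      simp only [Prof.d]; ring
    all_goals exact (by fun_prop : Continuous _).intervalIntegrable _ _
  set E : ℂ := (J1 + α2 * (J2 + J3)) / μ with hE
  have bN : rh 1 * N0 = -(P.a + E) * X := by
    rw [hXd, hE]
    have : rh 1 = -(μ * P.a + (J1 + α2 * (J2 + J3))) / qS 1 := by rw [← G]; field_simp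
    rw [this]; field_simp
  have key : P.a * (f 1 - 1 - X) = E * X - R - I2 - α2 * I3 := by
    linear_combination -F - bN
  have nI2 : ‖I2‖ ≤ K * e := by
    refine (h.norm_int_mul_le (by fun_prop) (by fun_prop) (Kg := K) fun x hx => ?_).trans (by gcongr)
    rw [Complex.norm_real]; exact h.vh.bV2 x hx
  have nf : ∫ x in (0:ℝ)..1, ‖f x‖ ≤ 1 + e := by
    have : ∫ x in (0:ℝ)..1, ‖f x‖ ≤ ∫ x in (0:ℝ)..1, (1 + ‖f x - 1‖) := by
      refine int_mono' (by fun_prop) (by fun_prop) (by simp) fun x _ => ?_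
      have := norm_add_le 1 (f x - 1)
      rw [norm_one] at this
      simpa using this
    rw [intervalIntegral.integral_add (by simp) ((by fun_prop : Continuous fun x => ‖f x - 1‖).intervalIntegrable _ _)] at this
    simp only [intervalIntegral.integral_const, sub_zero, smul_eq_mul, mul_one] at this
    linarith
  have nα : ‖(α2:ℂ)‖ = κ * μ := by rw [hm, Complex.norm_real, Real.norm_eq_abs, abs_of_pos (by positivity)]
  have nI3 : ‖(α2:ℂ) * I3‖ ≤ κ * μ * (K + M) * (1 + e) := by
    rw [norm_mul, nα, mul_assoc (κ * μ)]
    refine mul_le_mul_of_nonneg_left ?_ (by positivity)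
    exact (h.norm_int_mul_le (g := fun x => P.d c x) (u := f) (by fun_prop) c1 nd).trans (by gcongr)
  have nR : ‖R‖ ≤ 2 * Q := h.int_r_le hQ hQ0
  have nJ1 : ‖J1‖ ≤ 10 * M ^ 4 * (μ * Q) := by
    refine (intervalIntegral.norm_integral_le_integral_norm zero_le_one).trans ?_
    simp only [norm_mul]
    refine (h.Ir_le (by simp)).trans ?_
    have := ee_one h.vh
    have ep := ee_pos (k := k) hμ 1
    calc 5 * M ^ 4 * ee k μ 1 * _ ≤ 5 * M ^ 4 * 2 * (μ * Q) := by gcongr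
      _ = _ := by ring
  have nJ2 : ‖J2‖ ≤ (K + M) ^ 2 * e := by
    refine (h.norm_int_mul_le (by fun_prop) (by fun_prop) (Kg := (K + M) ^ 2) fun x hx => ?_).trans (by gcongr)
    rw [norm_pow]
    have := nd x hx
    gcongr
  have nJ3 : ‖J3‖ ≤ (2 * K * M + M ^ 2) * μ := by
    refine (h.norm_int_mul_le (by fun_prop) (by fun_prop) (Kg := (2 * K * M + M ^ 2) * μ) fun x hx => ?_).trans (by simp)
    have cM := h.ph.cM
    have bV := h.vh.bV x hx
    calc ‖-2 * (P.V x : ℂ) * c + c ^ 2‖ ≤ 2 * |P.V x| * ‖c‖ + ‖c‖ ^ 2 := by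
          refine (norm_add_le _ _).trans ?_
          rw [norm_mul, norm_mul, norm_neg, norm_pow, Complex.norm_real]
          simp
      _ ≤ 2 * K * (M * μ) + (M * μ) ^ 2 := by gcongr
      _ = 2 * K * M * μ + M ^ 2 * μ * μ := by ring
      _ ≤ 2 * K * M * μ + M ^ 2 * μ * 1 := by gcongr
      _ = _ := by ring
  have nE : ‖E‖ ≤ 10 * M ^ 4 * Q + κ * ((2 * K * M + M ^ 2) * μ + (K + M) ^ 2 * e) := by
    rw [hE, norm_div, Complex.norm_real, Real.norm_eq_abs, abs_of_pos hμ, div_le_iff₀ hμ]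
    calc ‖J1 + α2 * (J2 + J3)‖ ≤ 10 * M ^ 4 * (μ * Q) + κ * μ * ((K + M) ^ 2 * e + (2 * K * M + M ^ 2) * μ) := by
          refine (norm_add_le _ _).trans (add_le_add nJ1 ?_)
          rw [norm_mul, nα]
          gcongr
          exact (norm_add_le _ _).trans (add_le_add nJ2 nJ3)
      _ = _ := by ring
  have nl : P.a * ‖f 1 - 1 - X‖ = ‖E * X - R - I2 - α2 * I3‖ := by
    rw [← key, norm_mul, Complex.norm_real, Real.norm_eq_abs, abs_of_pos P.a_pos]
  rw [nl]
  have s1 := norm_sub_le (E * X - R - I2) (α2 * I3)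
  have s2 := norm_sub_le (E * X - R) I2
  have s3 := norm_sub_le (E * X) R
  have s4 : ‖E * X‖ ≤ (10 * M ^ 4 * Q + κ * ((2 * K * M + M ^ 2) * μ + (K + M) ^ 2 * e)) * 2 := by
    rw [norm_mul]; exact mul_le_mul nE hX (norm_nonneg _) ((norm_nonneg _).trans nE)
  linarith

end Setup

lemma V2_pos {P : Prof} {K : ℝ} (hK : 1 ≤ K) (haK : P.a ≤ K) (hV2 : ∀ x ∈ Icc (0:ℝ) 1, |P.V x - P.a * (1 - x)| ≤ K * (1 - x) ^ 2) :
    0 < ∫ x in (0:ℝ)..1, P.V x ^ 2 := by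
  have ha := P.a_pos
  refine intervalIntegral.integral_pos zero_lt_one (by fun_prop) (fun x _ => sq_nonneg _) ⟨1 - P.a / (2 * K), ⟨?_, ?_⟩, ?_⟩
  · have : P.a / (2 * K) ≤ 1 := by rw [div_le_one (by linarith)]; linarith
    linarith
  · have : 0 < P.a / (2 * K) := by positivity
    linarith
  · have h1 : P.a / (2 * K) ≤ 1 := by rw [div_le_one (by linarith)]; linarith
    have h0 : 0 < P.a / (2 * K) := by positivity
    have := hV2 (1 - P.a / (2 * K)) ⟨by linarith, by linarith⟩
    have : P.V (1 - P.a / (2 * K)) ≠ 0 := by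
      intro h
      rw [h, abs_le] at this
      have e : K * (P.a / (2 * K)) = P.a / 2 := by field_simp
      have e2 : K * (1 - (1 - P.a / (2 * K))) ^ 2 = P.a / 2 * (P.a / (2 * K)) := by rw [← e]; ring
      rw [e2] at this
      nlinarith [this.1]
    positivity

end OS

end

noncomputable section
open Filter Topology MeasureTheory Set ComplexConjugate
namespace OS

lemma omega_exists : ∃ ω : ℂ, ω ^ 2 = Complex.I ∧ ‖ω‖ = 1 ∧ 7 / 10 ≤ ω.re ∧ 7 / 10 ≤ ω.im := by
  have s : (√2 / 2) ^ 2 = 1 / 2 := by rw [div_pow, Real.sq_sqrt (by norm_num)]; norm_num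
  have s7 : 7 / 10 ≤ √2 / 2 := by
    have : (7 / 5 : ℝ) ≤ √2 := Real.le_sqrt_of_sq_le (by norm_num)
    linarith
  refine ⟨⟨√2 / 2, √2 / 2⟩, ?_, ?_, s7, s7⟩
  · rw [pow_two]
    apply Complex.ext <;> simp
    linarith
  · rw [Complex.norm_def, Complex.normSq_mk, Real.sqrt_eq_one]; linarith

/-- choice of the small parameter -/
lemma t_exists {a κ K L B : ℝ} (ha : 0 < a) (hκ : 0 < κ) (hK : 1 ≤ K) (hB : 1 ≤ B) (hL : 0 ≤ L) : ∃ t1 : ℝ, 0 < t1 ∧ t1 ≤ 1 ∧ ∀ t, 0 < t → t ≤ t1 →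
    8 * (a * t ^ 2) ≤ 1 ∧ 4 * (κ * t ^ 2) ≤ 1 ∧ 2776 * (K ^ 4 * B * t ^ 2) ≤ 1 ∧
    (6780 * (K ^ 5 * B) + 3 * a * (2 * a + κ)) * t ≤ a / 100 ∧ t ^ 4 * L ≤ 2 / 5 * (a * t ^ 2) / 4 ∧ (128 * K) ^ 2 * t ^ 4 ≤ 1 / 4 := by
  set X4 := 6780 * (K ^ 5 * B) + 3 * a * (2 * a + κ) with hX4
  have p4 : 0 < X4 := by positivity
  set D := 1 + 8 * a + 4 * κ + 2776 * (K ^ 4 * B) + X4 * 100 / a + L * 10 / a + 4 * (128 * K) ^ 2 with hD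
  have q1 : 0 < K ^ 4 * B := by positivity
  have q2 : 0 < X4 * 100 / a := by positivity
  have q3 : 0 ≤ L * 10 / a := by positivity
  have q4 : 0 < (128 * K) ^ 2 := by positivity
  have D1 : 1 ≤ D := by linarith
  have D0 : 0 < D := by linarith
  refine ⟨1 / D, by positivity, by rw [div_le_one D0]; exact D1, fun t h0 h1 => ?_⟩
  have hDt : D * t ≤ 1 := by rw [le_div_iff₀ D0] at h1; linarith
  have t1 : t ≤ 1 := h1.trans (by rw [div_le_one D0]; exact D1)
  have key : ∀ x, x ≤ D → x * t ≤ 1 := fun x hx => (mul_le_mul_of_nonneg_right hx h0.le).trans hDt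
  have tt : t ^ 2 ≤ t := by nlinarith
  have t4 : t ^ 4 ≤ t := by
    have : t ^ 4 ≤ t ^ 1 := pow_le_pow_of_le_one h0.le t1 (by norm_num)
    simpa using this
  have k1 := key (8 * a) (by linarith)
  have k2 := key (4 * κ) (by linarith)
  have k3 := key (2776 * (K ^ 4 * B)) (by linarith)
  have k4 := key (X4 * 100 / a) (by linarith)
  have k5 := key (L * 10 / a) (by linarith)
  have k6 := key (4 * (128 * K) ^ 2) (by linarith)
  refine ⟨?_, ?_, ?_, ?_, ?_, ?_⟩
  · nlinarith
  · nlinarith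
  · nlinarith
  · have : X4 * 100 / a * t = X4 * t * 100 / a := by ring
    rw [this, div_le_one ha] at k4
    linarith
  · have : L * 10 / a * t = L * t * 10 / a := by ring
    rw [this, div_le_one ha] at k5
    have e1 : t ^ 2 * L ≤ t * L := by gcongr
    calc t ^ 4 * L = t ^ 2 * (t ^ 2 * L) := by ring
      _ ≤ t ^ 2 * (a / 10) := by gcongr; linarith
      _ = _ := by ring
  · nlinarith

lemma small_bound {A1 A2 A3 Cc g σ' : ℝ} (h1 : 0 ≤ A1) (h2 : 0 ≤ A2) (h3 : 0 ≤ A3) (hC : 1 ≤ Cc) (hg : 0 < g) (hσ : 0 < σ') :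
    ∃ ε μ0 : ℝ, 0 < ε ∧ 0 < μ0 ∧ ∀ μ, 0 < μ → μ < μ0 → ε + Cc * μ ≤ 1 ∧ A1 * μ ^ σ' + A2 * μ + A3 * (ε + Cc * μ) ≤ g := by
  obtain ⟨μ1, p1, q1⟩ := small_rpow hσ (s0 := g / (3 * (A1 + 1))) (by positivity)
  refine ⟨min (1 / 2) (g / (3 * (A3 + 1))), min μ1 (min (1 / (2 * Cc)) (g / (3 * (A2 + A3 * Cc + 1)))), by positivity, by positivity, fun μ m0 m1 => ?_⟩
  have l1 : μ ≤ 1 / (2 * Cc) := m1.le.trans ((min_le_right _ _).trans (min_le_left _ _))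
  have l2 : μ ≤ g / (3 * (A2 + A3 * Cc + 1)) := m1.le.trans ((min_le_right _ _).trans (min_le_right _ _))
  have l3 := q1 μ m0 (m1.trans_le (min_le_left _ _))
  have s0 := Real.rpow_pos_of_pos m0 σ'
  set ε := min (1 / 2) (g / (3 * (A3 + 1)))
  have l4 : ε ≤ 1 / 2 := min_le_left _ _
  have l5 : ε ≤ g / (3 * (A3 + 1)) := min_le_right _ _
  have e0 : 0 < ε := by positivity
  rw [le_div_iff₀ (by positivity)] at l1 l2 l3 l5
  constructor
  · nlinarith
  · nlinarith

lemma seq_lim_one {P : Prof} {T : Finset ℝ} {ord : ℝ → ℕ} {b : ℝ → ℝ} {c0 : ℝ} (z : ZD P T ord b c0) {κ : ℝ} {Cs : ℂ} (hCs : 0 < Cs.im) (x t : ℝ) :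
    kinf P T ord b 1 κ Cs x t = 0 := by
  unfold kinf
  rw [Finset.sum_eq_zero, mul_zero]
  intro w hw
  rw [Ik_one (z.bne w (z.Tsub w hw)) hCs]
  simp

set_option maxHeartbeats 1600000 in
lemma caseA {P : Prof} {T : Finset ℝ} {ord : ℝ → ℕ} {b : ℝ → ℝ} {c0 : ℝ} {K σ' : ℝ}
    (E : Env P T ord b c0 1 K σ') : Core P := by
  have hK := E.hK
  have ha := P.a_pos
  have haK : P.a ≤ K := by
    have := (E.vh 1 one_pos le_rfl).bV1 1 (by simp)
    rwa [P.V11, abs_neg, abs_of_pos ha] at this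
  have hH := V2_pos hK haK E.hV2
  obtain ⟨ω, hω, hωn, hωr, hωi⟩ := omega_exists
  set κ := P.a / ∫ x in (0:ℝ)..1, P.V x ^ 2 with hκd
  have hκ : 0 < κ := by positivity
  have hκa : κ * ∫ x in (0:ℝ)..1, P.V x ^ 2 = P.a := by rw [hκd]; field_simp
  obtain ⟨tm, tm0, tm1, htm⟩ := t_exists (L := (K + 2 * ord 0) ^ 2) (B := BB P.a) ha hκ hK (BB_one ha) (by positivity)
  set t0 := tm / 2 with ht0
  have t00 : 0 < t0 := by positivity
  set η := 2 / 5 * (P.a * t0 ^ 2) with hη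
  have η0 : 0 < η := by positivity
  set M : ℝ := 2 + 1 / η + κ with hM
  have η1 : 0 < 1 / η := by positivity
  have hM1 : 1 ≤ M := by linarith
  have hMη : 1 ≤ M * η := by
    have : 1 / η * η = 1 := by field_simp
    nlinarith
  set M' := 7000 * K * M ^ 4 with hM'
  have hM'1 : 1 ≤ M' := by have := one_le_pow₀ hM1 (n := 4); nlinarith
  obtain ⟨Cc, s0, hCc, hs0, cl⟩ := closing K M' hK hM'1
  set p : ℝ := 2 - (1:ℝ) / ((1:ℕ):ℝ) with hp
  have p1 : p = 1 := by rw [hp]; norm_num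
  have mp : ∀ μ : ℝ, μ ^ p = μ := fun μ => by rw [p1, Real.rpow_one]
  obtain ⟨μb, μb0, hb⟩ := small_rpow E.hσ hs0
  obtain ⟨ε, μe, ε0, μe0, hε⟩ := small_bound (A1 := 20 * M' ^ 4 * Cc + 2 * Cc) (A2 := 2 * κ * (2 * K * M' + M' ^ 2) + 2 * κ * (K + M'))
    (A3 := 2 * κ * (K + M') ^ 2 + K) (Cc := Cc) (g := P.a * (P.a * t0 ^ 2 / 50)) (by positivity) (by positivity) (by positivity) hCc (by positivity) E.hσ
  have hKc : IsCompact (Metric.closedBall (0:ℂ) 2 ∩ {C : ℂ | η ≤ C.im}) :=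
    (isCompact_closedBall 0 2).inter_right (isClosed_le continuous_const Complex.continuous_im)
  -- uniform convergence
  obtain ⟨μd, μd0, hd⟩ := seq_unif hKc (Bad := fun μ C => μ < min s0 μb ∧ ∃ (ν : ℝ) (S S1 S2 qS f f1 f2 q rh rh1 rh2 : ℝ → ℂ),
      Setup P (ord 0) K M' μ (μ ^ p) (μ ^ σ') ν (κ * μ ^ p) (μ * C) S S1 S2 qS f f1 f2 q rh rh1 rh2 ∧ f 0 = 1 ∧
        ε < ∫ x in (0:ℝ)..1, ‖f x - fSf P (μ * C) (rh 1) qS x - 1‖) (by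
    intro μ C Cs hμ hμ1 hμl hC hCs hCl hbad
    choose hlt ν S S1 S2 qS f f1 f2 q rh rh1 rh2 hs hf0 hbad using hbad
    have seq : SeqH μ C Cs η 2 := ⟨hμ, hμ1, hμl, hCl, η0, fun n => (hC n).2, fun n => by simpa using (hC n).1⟩
    have clo := fun n => cl (hs n) (by rw [mp]; exact ((hlt n).trans_le (min_le_left _ _)).le) (hb (μ n) (hμ n) ((hlt n).trans_le (min_le_right _ _)))
    simp only [hf0, norm_one, mul_one] at clo
    have lim := (seq_lim E.z E.hk E.hkT seq E.hσ hs hf0 (fun n => (clo n).1) (fun n => (clo n).2.1) (fun n => (clo n).2.2.1) (fun n => (clo n).2.2.2)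
      (F := fun _ => 1) (B := 1) measurable_const (fun x _ => by simp) (fun x _ => by
        simp [seq_lim_one E.z (η0.trans_le hCs.2)])).1
    have := ge_of_tendsto lim (Eventually.of_forall fun n => (hbad n).le)
    linarith)
  refine ⟨p, κ, t0 ^ 4, 2 * t0 ^ 4, min (min (min s0 μb) (min μe μd)) (min (1 / M) (t0 ^ 2)), η, 2, p1.ge, hκ, by positivity, ?_, by positivity, η0, ?_, ?_⟩
  · have : 0 < t0 ^ 4 := by positivity
    linarith
  · have := (htm tm tm0 le_rfl).1
    have e : t0 ^ 2 = tm ^ 2 / 4 := by rw [ht0]; ring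
    rw [hη, e]; nlinarith
  intro μ τ hμ hμ0 hτ1 hτ2
  have l1 : μ < s0 := hμ0.trans_le ((min_le_left _ _).trans ((min_le_left _ _).trans (min_le_left _ _)))
  have l2 : μ < μb := hμ0.trans_le ((min_le_left _ _).trans ((min_le_left _ _).trans (min_le_right _ _)))
  have l3 : μ < μe := hμ0.trans_le ((min_le_left _ _).trans ((min_le_right _ _).trans (min_le_left _ _)))
  have l4 : μ < μd := hμ0.trans_le ((min_le_left _ _).trans ((min_le_right _ _).trans (min_le_right _ _)))
  have l5 : M * μ ≤ 1 := by
    have : μ < 1 / M := hμ0.trans_le ((min_le_right _ _).trans (min_le_left _ _))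
    rw [lt_div_iff₀ (by linarith)] at this; linarith
  have l6 : μ < t0 ^ 2 := hμ0.trans_le ((min_le_right _ _).trans (min_le_right _ _))
  have τ0 : 0 < τ := lt_trans (by positivity) hτ1
  set t := τ ^ (1 / 4 : ℝ) with ht
  have tp : 0 < t := by positivity
  have tτ : t ^ 4 = τ := by rw [ht, ← Real.rpow_natCast, ← Real.rpow_mul τ0.le]; norm_num
  have tl : t0 ≤ t := by
    by_contra h; push Not at h
    have : t ^ 4 < t0 ^ 4 := by gcongr
    linarith
  have tu : t ≤ tm := by
    by_contra h; push Not at h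
    have : tm ^ 4 < t ^ 4 := by gcongr
    have e : tm ^ 4 = 16 * t0 ^ 4 := by rw [ht0]; ring
    have : 0 < t0 ^ 4 := by positivity
    linarith
  obtain ⟨b1, b2, b3, b4, b5, b6⟩ := htm t tp tu
  have τM : τ ≤ M := by
    have : t ^ 4 ≤ 1 := pow_le_one₀ tp.le (tu.trans tm1)
    linarith
  set s := P.a * t ^ 2 with hs
  have sp : 0 < s := by positivity
  have s0s : P.a * t0 ^ 2 ≤ s := by rw [hs]; gcongr
  set A : ℂ := P.a * t ^ 2 * ω with hA
  have As : A = (s:ℂ) * ω := by rw [hA, hs]; push_cast; ring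
  have An : ‖A‖ = s := by rw [As, norm_mul, hωn, Complex.norm_real, Real.norm_eq_abs, abs_of_pos sp, mul_one]
  have Ai : 7 / 10 * s ≤ A.im := by rw [As, Complex.im_ofReal_mul]; nlinarith
  have inball : ∀ C ∈ Metric.closedBall (1 + A) (s / 4), ‖C - (1 + A)‖ ≤ s / 4 := fun C hC => by
    rwa [Metric.mem_closedBall, dist_eq_norm] at hC
  have Cim : ∀ C ∈ Metric.closedBall (1 + A) (s / 4), 2 / 5 * s ≤ C.im := fun C hC => by
    have h1 := (abs_le.1 ((Complex.abs_im_le_norm _).trans (inball C hC))).1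
    simp at h1
    linarith
  have Cim' : ∀ C ∈ Metric.closedBall (1 + A) (s / 4), η ≤ C.im := fun C hC => (by rw [hη]; linarith : η ≤ 2 / 5 * s).trans (Cim C hC)
  have Cle : ∀ C ∈ Metric.closedBall (1 + A) (s / 4), ‖C‖ ≤ 2 := fun C hC => by
    have h1 := inball C hC
    have h2 := norm_add_le (C - (1 + A)) (1 + A)
    have h3 := norm_add_le 1 A
    rw [norm_one, An] at h3
    rw [sub_add_cancel] at h2
    linarith
  have Cge : ∀ C ∈ Metric.closedBall (1 + A) (s / 4), 3 / 4 ≤ ‖C‖ := fun C hC => by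
    have h1 := inball C hC
    have h2 : ‖(1:ℂ)‖ ≤ ‖C‖ + ‖C - (1 + A)‖ + ‖A‖ := by
      calc ‖(1:ℂ)‖ = ‖C - (C - (1 + A)) - A‖ := by congr 1; ring
        _ ≤ _ := (norm_sub_le _ _).trans (add_le_add (norm_sub_le _ _) le_rfl)
    rw [norm_one, An] at h2
    linarith
  have wall : ∀ C ∈ Metric.closedBall (1 + A) (s / 4), ∃ S S1 S2 qS : ℝ → ℂ,
      (qS 1 ≠ 0 ∧ ‖μ * (∫ x in (0:ℝ)..1, S x) / qS 1‖ ≤ 2 ∧ ‖μ * (∫ x in (0:ℝ)..1, S x) / qS 1 + 1 / (C - A)‖ ≤ s / 50) ∧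
      ∀ f f1 f2 q rh rh1 rh2 : ℝ → ℂ,
      Mode P (τ * μ ^ p * μ ^ 2) (κ * μ ^ p) (μ * C) f f1 f2 q rh rh1 rh2 → q 1 = 0 →
        Setup P (ord 0) K M' μ (μ ^ p) (μ ^ σ') (τ * μ ^ p * μ ^ 2) (κ * μ ^ p) (μ * C)
          S S1 S2 qS f f1 f2 q rh rh1 rh2 := fun C hC => by
    have hCi := Cim C hC
    have hCn := Cge C hC
    obtain ⟨l, S, S1, S2, qS, l0, hl, W, h⟩ := E.mk_wall (M := M) (μ := μ) (τ := τ) (κ := κ) (C := C) hM1 hμ ((Cle C hC).trans (by linarith))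
      (hMη.trans (mul_le_mul_of_nonneg_left (Cim' C hC) (by linarith))) τ0 τM hκ (by linarith) l5
      (by
        rw [← hp, mp, ← tτ]
        calc t ^ 4 * μ * (K + 2 * ord 0) ^ 2 = μ * (t ^ 4 * (K + 2 * ord 0) ^ 2) := by ring
          _ ≤ μ * (2 / 5 * s / 4) := by gcongr
          _ ≤ μ * (C.im / 4) := by gcongr
          _ = _ := by ring)
      (by
        rw [← hp, mp, ← tτ]
        calc (128 * K) ^ 2 * (t ^ 4 * μ) = μ * ((128 * K) ^ 2 * t ^ 4) := by ring
          _ ≤ μ * (1 / 4) := by gcongr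
          _ ≤ μ * (3 / 4) ^ 3 := by gcongr; norm_num
          _ ≤ μ * ‖C‖ ^ 3 := by gcongr)
    rw [← hp] at hl W h
    exact ⟨S, S1, S2, qS, W.X_close hK haK E.hV E.hV2 hκ tp (tu.trans tm1) hμ (l6.le.trans (by gcongr)) (by rw [mp, tτ]; ring) (by rw [mp]) l0
      (by rw [hl, Complex.im_ofReal_mul]) hω hωn hωr hωi (inball C hC) b1 b2 b3 b4, h⟩
  have nonz : ∀ C ∈ Metric.closedBall (1 + A) (s / 4), C - A ≠ 0 := fun C hC h => by
    have := inball C hC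
    rw [← sub_sub, sub_right_comm, h, zero_sub, norm_neg, norm_one] at this
    linarith
  obtain ⟨C, hC, φ, φ1, ψ, ψ1, h, sol, h1, h2, h3⟩ := find_root P (ν := τ * μ ^ p * μ ^ 2) (α2 := κ * μ ^ p) (μ := μ) (C0 := 1 + A) (r := s / 4)
    (δ := s / 8) (e := s / 25) (Φ := fun C => 1 - 1 / (C - A))
    (by positivity) hμ (by positivity) (fun C hC => η0.trans_le (Cim' C hC))
    (fun C hC f f1 f2 q rh rh1 rh2 mo hq hf0 x hx => by
      obtain ⟨S, S1, S2, qS, -, hS⟩ := wall C hC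
      have st := hS f f1 f2 q rh rh1 rh2 mo hq
      have c := cl st (by rw [mp]; exact l1.le) (hb μ hμ l2)
      rw [hf0] at c
      have n1 := c.1 x hx
      have n2 := c.2.1
      have n3 := st.fS_sup hx
      simp only [norm_zero, mul_zero] at n1 n2
      have n4 : ‖rh 1‖ * ‖qS 1‖ = 0 := le_antisymm n2 (by positivity)
      rw [n4] at n3
      simp only [mul_zero, zero_mul] at n3
      rw [norm_le_zero_iff] at n1 n3
      rw [n3, sub_zero] at n1
      exact n1)
    (fun C hC f f1 f2 q rh rh1 rh2 mo hq hf0 => by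
      obtain ⟨S, S1, S2, qS, ⟨hq1, hX, hX2⟩, hS⟩ := wall C hC
      have st := hS f f1 f2 q rh rh1 rh2 mo hq
      have c := cl st (by rw [mp]; exact l1.le) (hb μ hμ l2)
      rw [hf0, norm_one] at c
      have hmem : C ∈ Metric.closedBall (0:ℂ) 2 ∩ {C : ℂ | η ≤ C.im} := ⟨by simpa using Cle C hC, Cim' C hC⟩
      have hn : ∫ x in (0:ℝ)..1, ‖f x - fSf P (μ * C) (rh 1) qS x - 1‖ ≤ ε := by
        by_contra hcon
        push Not at hcon
        exact hd μ hμ l4 C hmem ⟨lt_min l1 l2, _, S, S1, S2, qS, f, f1, f2, q, rh, rh1, rh2, st, hf0, hcon⟩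
      have cf := st.cf
      have cfS := st.cfS
      have he : ∫ x in (0:ℝ)..1, ‖f x - 1‖ ≤ ε + Cc * μ := by
        have : ∫ x in (0:ℝ)..1, ‖f x - 1‖ ≤ ∫ x in (0:ℝ)..1, (‖f x - fSf P (μ * C) (rh 1) qS x - 1‖ + ‖fSf P (μ * C) (rh 1) qS x‖) := by
          refine int_mono' (by fun_prop) (by fun_prop) (by simp) fun x _ => ?_
          calc ‖f x - 1‖ = ‖(f x - fSf P (μ * C) (rh 1) qS x - 1) + fSf P (μ * C) (rh 1) qS x‖ := by congr 1; ring
            _ ≤ _ := norm_add_le _ _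
        rw [intervalIntegral.integral_add ((by fun_prop : Continuous fun x => ‖f x - fSf P (μ * C) (rh 1) qS x - 1‖).intervalIntegrable _ _)
          (cfS.norm.intervalIntegrable _ _)] at this
        have c3 := c.2.2.1
        rw [mp, mul_one] at c3
        linarith
      obtain ⟨e1, e2⟩ := hε μ hμ l3
      set e := ε + Cc * μ with he'
      have σ0 := Real.rpow_pos_of_pos hμ σ'
      have fc := st.f1_close (κ := κ) (Q := Cc * μ ^ σ') (e := e) (by rw [mp]) hκ hκa
        (c.2.2.2.trans (le_of_eq (by rw [mp]; ring))) (by positivity) he hq1 hX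
      have fc2 : P.a * ‖f 1 - 1 - μ * (∫ x in (0:ℝ)..1, S x) / qS 1‖ ≤ P.a * (P.a * t0 ^ 2 / 50) := by
        refine (fc.trans ?_).trans e2
        have : κ * μ * (K + M') * (1 + e) ≤ κ * μ * (K + M') * (1 + 1) := by gcongr
        linarith
      have fc3 := le_of_mul_le_mul_left fc2 ha
      calc ‖f 1 - (1 - 1 / (C - A))‖ = ‖(f 1 - 1 - μ * (∫ x in (0:ℝ)..1, S x) / qS 1) + (μ * (∫ x in (0:ℝ)..1, S x) / qS 1 + 1 / (C - A))‖ := by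
            congr 1; ring
        _ ≤ P.a * t0 ^ 2 / 50 + s / 50 := (norm_add_le _ _).trans (add_le_add fc3 hX2)
        _ ≤ s / 25 := by linarith)
    (by simp)
    (fun C hC => by
      have nz := nonz C (Metric.sphere_subset_closedBall hC)
      rw [Metric.mem_sphere, dist_eq_norm] at hC
      have e : 1 - 1 / (C - A) = (C - (1 + A)) / (C - A) := by field_simp; ring
      have n : ‖C - A‖ ≤ 2 := by
        calc ‖C - A‖ = ‖(C - (1 + A)) + 1‖ := by congr 1; ring
          _ ≤ s / 4 + 1 := (norm_add_le _ _).trans (by rw [hC, norm_one])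
          _ ≤ 2 := by linarith
      simp only [e]
      rw [norm_div, hC, le_div_iff₀ (norm_pos_iff.2 nz)]
      nlinarith) (by linarith)
  refine ⟨μ * C, φ, φ1, ψ, ψ1, h, sol, h1, h2, h3, ?_, ?_⟩
  · rw [Complex.im_ofReal_mul, mul_comm]
    exact mul_le_mul_of_nonneg_left (Cim' C hC) hμ.le
  · rw [Complex.im_ofReal_mul, mul_comm (2:ℝ)]
    exact mul_le_mul_of_nonneg_left ((le_abs_self _).trans ((Complex.abs_im_le_norm C).trans (Cle C hC))) hμ.le

end OS

end

noncomputable section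
open Filter Topology MeasureTheory Set ComplexConjugate
namespace OS

theorem core (P : Prof) : Core P := by
  obtain ⟨T, ord, b, c0, z⟩ := exists_ZD P
  set k := max 1 ((T.erase 0).sup ord) with hk
  set kx := max 1 (T.sup ord) with hkx
  have hk1 : 1 ≤ k := le_max_left _ _
  have hkT : ∀ t ∈ T, t ≠ 0 → ord t ≤ k := fun t ht h0 =>
    (Finset.le_sup (f := ord) (Finset.mem_erase.2 ⟨h0, ht⟩)).trans (le_max_right _ _)
  have hkx1 : 1 ≤ kx := le_max_left _ _
  have hkxT : ∀ t ∈ T, ord t ≤ kx := fun t ht => (Finset.le_sup (f := ord) ht).trans (le_max_right _ _)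
  obtain ⟨K, hK, vh, hV, hV2⟩ := z.exists_VH hk1 hkT hkx1 hkxT
  have kxp : (0:ℝ) < kx := by exact_mod_cast hkx1
  have E : Env P T ord b c0 k K ((1:ℝ) / (2 * kx)) := ⟨z, hk1, hkT, hK, by positivity, vh, hV, hV2⟩
  by_cases h2 : 2 ≤ k
  · have hs : (T.erase 0).sup ord = k := by
      rcases max_choice 1 ((T.erase 0).sup ord) with h | h
      · omega
      · rw [hk, h]
    have hne : (T.erase 0).Nonempty := by
      by_contra h
      rw [Finset.not_nonempty_iff_eq_empty] at h
      rw [h] at hs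
      simp at hs
      omega
    obtain ⟨w0, hw, hwk⟩ := Finset.exists_mem_eq_sup (T.erase 0) hne ord
    rw [hs] at hwk
    obtain ⟨hw0, hwT⟩ := Finset.mem_erase.1 hw
    have hI := z.Tsub w0 hwT
    have wp : 0 < w0 := lt_of_le_of_ne hI.1 (Ne.symm hw0)
    have w1 : w0 < 1 := lt_of_le_of_ne hI.2 (by
      rintro h
      rw [h, z.ord1] at hwk
      omega)
    have hex : ∃ y ∈ Ioo 0 w0, P.V y ≠ 0 := by
      by_contra h
      push Not at h
      have sub : Ioo 0 w0 ⊆ (T : Set ℝ) := fun y hy => z.mem_T_of_zero ⟨hy.1.le, hy.2.le.trans hI.2⟩ (h y hy)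
      exact (Ioo_infinite wp) (T.finite_toSet.subset sub)
    obtain ⟨Y, hY, hre⟩ := caseB_root z.Tsub h2 (fun w hw => z.bne w (z.Tsub w hw)) hwT w1 wp hwk.symm hex
    exact caseB E h2 hY hre
  · have : k = 1 := by omega
    rw [this] at E
    exact caseA E

lemma deriv_par {f : ℝ → ℝ} {s x : ℝ} (h : f =ᶠ[𝓝 x] fun y => s * f (-y)) : deriv f =ᶠ[𝓝 x] fun y => (-s) * deriv f (-y) := by
  refine h.deriv.trans (Eventually.of_forall fun y => ?_)
  simp only [deriv_const_mul_field']
  rw [deriv_comp_neg]; ring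

lemma prof_exists {U : ℝ → ℝ} (hUanalytic : AnalyticOnNhd ℝ U (Set.Icc 0 2)) (hsym : ∀ z ∈ Set.Icc (0:ℝ) 2, U (2 - z) = U z)
    (hU'0 : 0 < deriv U 0) (hU'1 : deriv U 1 = 0) :
    ∃ P : Prof, (∀ y ∈ Ioo (-1:ℝ) 1, P.V y = P.V (-y) ∧ P.V2 y = P.V2 (-y)) ∧
      ∀ z ∈ Ioo (0:ℝ) 2, U z = P.V (z - 1) + U 0 ∧ deriv (deriv U) z = P.V2 (z - 1) := by
  have hIcc : Icc (0:ℝ) 2 = Metric.closedBall 1 1 := by rw [Real.closedBall_eq_Icc]; norm_num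
  have hop : IsOpen {x | AnalyticAt ℝ U x} := isOpen_analyticAt ℝ U
  obtain ⟨δ, δ0, hδ⟩ := (isCompact_closedBall (1:ℝ) 1).exists_cthickening_subset_open hop (by rw [← hIcc]; exact hUanalytic)
  rw [cthickening_closedBall δ0.le zero_le_one] at hδ
  let χ : ContDiffBump (1:ℝ) := ⟨1 + δ / 2, 1 + δ, by positivity, by linarith⟩
  set V : ℝ → ℝ := fun x => χ (1 - x) * U (1 - x) - U 0 with hVd
  have W4 : ContDiff ℝ 4 (fun z => χ z * U z) := by
    refine contDiff_iff_contDiffAt.2 fun x => ?_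
    by_cases hx : x ∈ Metric.closedBall (1:ℝ) (δ + 1)
    · exact χ.contDiff.contDiffAt.mul (AnalyticAt.contDiffAt (hδ hx))
    · have ho : (Metric.closedBall (1:ℝ) (δ + 1))ᶜ ∈ 𝓝 x := Metric.isClosed_closedBall.isOpen_compl.mem_nhds hx
      refine (contDiffAt_const (c := (0:ℝ))).congr_of_eventuallyEq ?_
      filter_upwards [ho] with y hy
      have : χ y = 0 := χ.zero_of_le_dist (by
        rw [mem_compl_iff, Metric.mem_closedBall, not_le] at hy
        change 1 + δ ≤ _
        linarith)
      rw [this, zero_mul]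
  have V4 : ContDiff ℝ 4 V := (W4.comp (contDiff_const.sub contDiff_id)).sub contDiff_const
  have V3 : ContDiff ℝ 3 (deriv V) := ((contDiff_succ_iff_deriv (n := 3)).1 V4).2.2
  have V2 : ContDiff ℝ 2 (deriv (deriv V)) := ((contDiff_succ_iff_deriv (n := 2)).1 V3).2.2
  have V1 : ContDiff ℝ 1 (deriv (deriv (deriv V))) := ((contDiff_succ_iff_deriv (n := 1)).1 V2).2.2
  have V0 : ContDiff ℝ 0 (deriv (deriv (deriv (deriv V)))) := ((contDiff_succ_iff_deriv (n := 0)).1 V1).2.2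
  have loc : ∀ x ∈ Icc (-1:ℝ) 1, V =ᶠ[𝓝 x] fun y => U (1 - y) - U 0 := by
    intro x hx
    have : Ioo (-1 - δ / 2) (1 + δ / 2) ∈ 𝓝 x := Ioo_mem_nhds (by linarith [hx.1]) (by linarith [hx.2])
    filter_upwards [this] with y hy
    have : χ (1 - y) = 1 := χ.one_of_mem_closedBall (by
      rw [Metric.mem_closedBall, Real.dist_eq, abs_le]
      exact ⟨by change -(1 + δ / 2) ≤ _; linarith [hy.2], by change _ ≤ 1 + δ / 2; linarith [hy.1]⟩)
    rw [hVd]; simp only [this, one_mul]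
  have val : ∀ x ∈ Icc (-1:ℝ) 1, V x = U (1 - x) - U 0 := fun x hx => (loc x hx).self_of_nhds
  have derU : ∀ x ∈ Icc (-1:ℝ) 1, deriv V x = -deriv U (1 - x) := fun x hx => by
    rw [(loc x hx).deriv_eq, deriv_sub_const, deriv_comp_const_sub]
  have evV : ∀ x ∈ Ioo (-1:ℝ) 1, V =ᶠ[𝓝 x] fun y => 1 * V (-y) := by
    intro x hx
    filter_upwards [Ioo_mem_nhds hx.1 hx.2] with y hy
    rw [val y ⟨hy.1.le, hy.2.le⟩, val (-y) ⟨by linarith [hy.2], by linarith [hy.1]⟩, ← hsym (1 - y) ⟨by linarith [hy.2], by linarith [hy.1]⟩]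
    ring_nf
  have evV2 : ∀ x ∈ Ioo (-1:ℝ) 1, deriv (deriv V) x = deriv (deriv V) (-x) := fun x hx => by
    have := (deriv_par (deriv_par (evV x hx))).self_of_nhds
    simpa using this
  have V30 : deriv (deriv (deriv V)) 0 = 0 := by
    have := (deriv_par (deriv_par (deriv_par (evV 0 (by norm_num))))).self_of_nhds
    simp only [neg_zero] at this
    linarith
  let P : Prof := ⟨V, deriv V, deriv (deriv V), deriv (deriv (deriv V)), deriv (deriv (deriv (deriv V))), deriv U 0,
    fun x => (V4.differentiable (by norm_num) x).hasDerivAt, fun x => (V3.differentiable (by norm_num) x).hasDerivAt,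
    fun x => (V2.differentiable (by norm_num) x).hasDerivAt, fun x => (V1.differentiable (by norm_num) x).hasDerivAt,
    V0.continuous, hU'0, by rw [derU 0 (by norm_num)]; simp [hU'1], V30, by rw [val 1 (by norm_num)]; simp,
    by rw [derU 1 (by norm_num)]; simp, fun x hx => by
      refine AnalyticAt.congr ?_ (loc x ⟨by linarith [hx.1], hx.2⟩).symm
      have hU := hUanalytic (1 - x) ⟨by linarith [hx.2], by linarith [hx.1]⟩
      have hl : AnalyticAt ℝ (fun y : ℝ => 1 - y) x := by fun_prop
      exact (AnalyticAt.comp (f := fun y : ℝ => 1 - y) hU hl).sub analyticAt_const⟩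
  refine ⟨P, fun y hy => ⟨?_, evV2 y hy⟩, fun z hz => ⟨?_, ?_⟩⟩
  · have := (evV y hy).self_of_nhds
    simpa using this
  · have : P.V (z - 1) = U (1 - (z - 1)) - U 0 := val (z - 1) ⟨by linarith [hz.1], by linarith [hz.2]⟩
    rw [this, ← hsym z ⟨hz.1.le, hz.2.le⟩]
    ring_nf
  · have hz' : z - 1 ∈ Ioo (-1:ℝ) 1 := ⟨by linarith [hz.1], by linarith [hz.2]⟩
    change _ = deriv (deriv V) (z - 1)
    rw [evV2 _ hz']
    have h1 := (loc (-(z - 1)) ⟨by linarith [hz.2], by linarith [hz.1]⟩).deriv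
    rw [h1.deriv_eq]
    have e : deriv (fun y => U (1 - y) - U 0) = fun y => -deriv U (1 - y) := by
      funext y; rw [deriv_sub_const, deriv_comp_const_sub]
    rw [e, deriv.fun_neg, deriv_comp_const_sub]
    ring_nf

end OS

end

noncomputable section
open Filter Topology MeasureTheory Set ComplexConjugate
namespace OS

lemma scaling {p κ τ1 τ2 μ0 : ℝ} (hp : 1 ≤ p) (hκ : 0 < κ) (hτ1 : 0 < τ1) (hτ : τ1 < τ2) (hμ0 : 0 < μ0) :
    ∃ αlow αup : ℝ → ℝ, ∃ Rc : ℝ, 0 < Rc ∧ ∀ R, Rc ≤ R → 0 < αlow R ∧ αlow R < αup R ∧ ∀ α, αlow R < α → α < αup R →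
      ∃ μ τ : ℝ, 0 < μ ∧ μ < μ0 ∧ τ1 < τ ∧ τ < τ2 ∧ κ * μ ^ p = α ^ 2 ∧ τ * μ ^ p * μ ^ 2 = 1 / (α * R) := by
  have hp0 : 0 < p := by linarith
  set N : ℝ := 3 + 4 / p with hN
  have hN0 : 0 < N := by positivity
  set G : ℝ := κ ^ (1 + 2 / p) with hG
  have G0 : 0 < G := by positivity
  have hτ2 : 0 < τ2 := hτ1.trans hτ
  set α0 : ℝ := √(κ * μ0 ^ p) with hα0
  have α00 : 0 < α0 := Real.sqrt_pos.2 (by positivity)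
  refine ⟨fun R => (G / (τ2 * R)) ^ (1 / N), fun R => (G / (τ1 * R)) ^ (1 / N), G / (τ1 * α0 ^ N), by positivity, fun R hR => ?_⟩
  have R0 : 0 < R := lt_of_lt_of_le (by positivity) hR
  refine ⟨by positivity, Real.rpow_lt_rpow (by positivity) (by gcongr) (by positivity), fun α h1 h2 => ?_⟩
  have hα : 0 < α := lt_trans (by positivity) h1
  have pw : ∀ {x : ℝ}, 0 < x → (x ^ (1 / N)) ^ N = x := fun {x} hx => by
    rw [← Real.rpow_mul hx.le, one_div_mul_cancel hN0.ne', Real.rpow_one]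
  have h1' : G / (τ2 * R) < α ^ N := by
    rw [← pw (x := G / (τ2 * R)) (by positivity)]; gcongr
  have h2' : α ^ N < G / (τ1 * R) := by
    rw [← pw (x := G / (τ1 * R)) (by positivity)]; gcongr
  have hαα : α < α0 := by
    by_contra h
    push Not at h
    have e1 : α0 ^ N ≤ α ^ N := by gcongr
    have e2 : G / (τ1 * R) ≤ α0 ^ N := by
      rw [div_le_iff₀ (by positivity)] at hR ⊢
      linarith
    linarith
  set μ : ℝ := (α ^ 2 / κ) ^ (1 / p) with hμ
  have μp : 0 < μ := by positivity
  have μpp : μ ^ p = α ^ 2 / κ := by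
    rw [hμ, ← Real.rpow_mul (by positivity), one_div_mul_cancel hp0.ne', Real.rpow_one]
  set τ : ℝ := 1 / (α * R) / (μ ^ p * μ ^ 2) with hτd
  have τe : τ = G / (R * α ^ N) := by
    have e1 : μ ^ 2 = α ^ (4 / p) / κ ^ (2 / p) := by
      rw [hμ, ← Real.rpow_natCast, ← Real.rpow_mul (by positivity), Real.div_rpow (by positivity) hκ.le, ← Real.rpow_natCast α 2, ← Real.rpow_mul hα.le]
      congr 2 <;> push_cast <;> ring
    rw [hτd, μpp, e1, hG, hN, Real.rpow_add hκ, Real.rpow_add hα, Real.rpow_one, show α ^ (3:ℝ) = α ^ 3 by norm_cast]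
    have := Real.rpow_pos_of_pos hκ (2 / p)
    have := Real.rpow_pos_of_pos hα (4 / p)
    field_simp
  have αN : 0 < α ^ N := by positivity
  refine ⟨μ, τ, μp, ?_, ?_, ?_, by rw [μpp]; field_simp, by rw [hτd]; field_simp⟩
  · by_contra h
    push Not at h
    have e1 : μ0 ^ p ≤ μ ^ p := by gcongr
    rw [μpp, le_div_iff₀ hκ] at e1
    have e2 : α0 ^ 2 = κ * μ0 ^ p := Real.sq_sqrt (by positivity)
    nlinarith
  · rw [τe, lt_div_iff₀ (by positivity)]
    rw [lt_div_iff₀ (by positivity)] at h2'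
    linarith
  · rw [τe, div_lt_iff₀ (by positivity)]
    rw [div_lt_iff₀ (by positivity)] at h1'
    linarith

lemma growth {κ τ τ1 τ2 m μ α R : ℝ} (hκ : 0 < κ) (hτ1 : 0 < τ1) (h1 : τ1 < τ) (h2 : τ < τ2) (hμ : 0 < μ) (hα : 0 < α) (hR : 0 < R)
    (e1 : κ * m = α ^ 2) (e2 : τ * m * μ ^ 2 = 1 / (α * R)) :
    √(κ / τ2) * (α * R) ^ (-(1:ℝ) / 2) ≤ α * μ ∧ α * μ ≤ √(κ / τ1) * (α * R) ^ (-(1:ℝ) / 2) := by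
  have hs : (α * R) ^ (-(1:ℝ) / 2) = √(1 / (α * R)) := by
    rw [Real.sqrt_eq_rpow, neg_div, Real.rpow_neg (by positivity), one_div (α * R), Real.inv_rpow (by positivity)]
  have τ0 : 0 < τ := hτ1.trans h1
  have key : α * μ = √(κ / τ) * √(1 / (α * R)) := by
    rw [← Real.sqrt_mul (by positivity), ← e2]
    rw [show κ / τ * (τ * m * μ ^ 2) = (α * μ) ^ 2 by rw [mul_pow, ← e1]; field_simp]
    rw [Real.sqrt_sq (by positivity)]
  rw [hs, key]
  constructor <;> gcongr

lemma os_eq {P : Prof} {ν α2 α R : ℝ} {c : ℂ} {φ φ1 ψ ψ1 h : ℝ → ℂ} (s : EvenSol (P.cA ν α2 c) (P.cB ν α2 c) φ φ1 ψ ψ1 h)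
    (hP : ∀ y ∈ Ioo (-1:ℝ) 1, P.V y = P.V (-y) ∧ P.V2 y = P.V2 (-y)) (hα : 0 < α) (hR : 0 < R) (hν : ν = 1 / (α * R)) (hα2 : α2 = α ^ 2)
    {y : ℝ} (hy : y ∈ Ioo (-1:ℝ) 1) :
    (1 / (Complex.I * Complex.ofReal α * Complex.ofReal R)) * (h y - 2 * (Complex.ofReal α)^2 * ψ y + (Complex.ofReal α)^4 * φ y)
      = ((P.V y : ℂ) - c) * (ψ y - (Complex.ofReal α)^2 * φ y) - (P.V2 y : ℂ) * φ y := by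
  have main : ∀ x ∈ Icc (0:ℝ) 1, (1 / (Complex.I * Complex.ofReal α * Complex.ofReal R)) * (h x - 2 * (Complex.ofReal α)^2 * ψ x + (Complex.ofReal α)^4 * φ x)
      = ((P.V x : ℂ) - c) * (ψ x - (Complex.ofReal α)^2 * φ x) - (P.V2 x : ℂ) * φ x := by
    intro x hx
    have hα' : (α:ℂ) ≠ 0 := by exact_mod_cast hα.ne'
    have hR' : (R:ℂ) ≠ 0 := by exact_mod_cast hR.ne'
    rw [s.eq x hx, Prof.cA, Prof.cB, hν, hα2, Prof.d]
    push_cast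
    have hI := Complex.I_ne_zero
    field_simp
    ring
  rcases le_total 0 y with h0 | h0
  · exact main y ⟨h0, hy.2.le⟩
  · have := main (-y) ⟨by linarith, by linarith [hy.1]⟩
    rwa [s.ev, s.ev2, s.ev4, ← (hP y hy).1, ← (hP y hy).2] at this

lemma main_thm
    (U : ℝ → ℝ)
    (hUanalytic : AnalyticOnNhd ℝ U (Set.Icc 0 2))
    (hsym : ∀ z ∈ Set.Icc (0:ℝ) 2, U (2 - z) = U z)
    (hU'0 : 0 < deriv U 0)
    (hU'1 : deriv U 1 = 0) :
    ∃ αlow αup : ℝ → ℝ, ∃ Rc : ℝ, 0 < Rc ∧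
    ∃ k₁ k₂ : ℝ, 0 < k₁ ∧ k₁ ≤ k₂ ∧
      ∀ R : ℝ, Rc ≤ R →
        0 < αlow R ∧ αlow R < αup R ∧
        ∀ α : ℝ, αlow R < α → α < αup R →
          ∃ c : ℂ, ∃ φ : ℝ → ℂ,
            0 < c.im ∧
            ContDiff ℝ 4 φ ∧
            (∃ z ∈ Set.Icc (0:ℝ) 2, φ z ≠ 0) ∧
            -- Orr–Sommerfeld equation on (0,2)
            (∀ z ∈ Set.Ioo (0:ℝ) 2,
              (1 / (Complex.I * Complex.ofReal α * Complex.ofReal R))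
                  * (deriv (deriv (deriv (deriv φ))) z
                      - 2 * (Complex.ofReal α)^2 * deriv (deriv φ) z
                      + (Complex.ofReal α)^4 * φ z)
                = (Complex.ofReal (U z) - c) * (deriv (deriv φ) z - (Complex.ofReal α)^2 * φ z)
                    - Complex.ofReal (deriv (deriv U) z) * φ z) ∧
            -- no-slip boundary conditions at both walls
            φ 0 = 0 ∧ deriv φ 0 = 0 ∧ φ 2 = 0 ∧ deriv φ 2 = 0 ∧
            -- growth rate α·Im c ≈ (αR)^{-1/2}
            k₁ * (α * R) ^ (-(1:ℝ)/2) ≤ α * c.im ∧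
            α * c.im ≤ k₂ * (α * R) ^ (-(1:ℝ)/2) ∧
            -- symmetry of the eigenfunction about z = 1
            (∀ z ∈ Set.Icc (0:ℝ) 2, φ (2 - z) = φ z) := by
  obtain ⟨P, hP, hPU⟩ := prof_exists hUanalytic hsym hU'0 hU'1
  obtain ⟨p, κ, τ1, τ2, μ0, k1, k2, hp, hκ, hτ1, hτ, hμ0, hk1, hk, H⟩ := core P
  have hτ2 : 0 < τ2 := hτ1.trans hτ
  obtain ⟨αlow, αup, Rc, hRc, hS⟩ := scaling hp hκ hτ1 hτ hμ0
  refine ⟨αlow, αup, Rc, hRc, k1 * √(κ / τ2), k2 * √(κ / τ1), by positivity, mul_le_mul hk (by gcongr) (by positivity) (hk1.le.trans hk), fun R hR => ?_⟩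
  obtain ⟨al, au, hα⟩ := hS R hR
  refine ⟨al, au, fun α ha1 ha2 => ?_⟩
  have R0 : 0 < R := hRc.trans_le hR
  have α0 : 0 < α := al.trans ha1
  obtain ⟨μ, τ, μp, μl, l1, l2, e1, e2⟩ := hα α ha1 ha2
  obtain ⟨c, φ, φ1, ψ, ψ1, h, s, b0, b1, nz, ci1, ci2⟩ := H μ τ μp μl l1 l2
  have k10 : 0 ≤ k1 := hk1.le
  have hci : 0 < c.im := lt_of_lt_of_le (by positivity) ci1
  obtain ⟨g1, g2⟩ := growth hκ hτ1 l1 l2 μp α0 R0 e1 e2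
  have sh : ∀ {g g' : ℝ → ℂ}, (∀ x, HasDerivAt g (g' x) x) → deriv (fun z => g (z - 1)) = fun z => g' (z - 1) := fun {g g'} hg => by
    funext z
    rw [deriv_comp_sub_const]
    exact (hg _).deriv
  have od : ∀ x, φ1 (-x) = -φ1 x := fun x => by
    have h1 : deriv (fun y => φ (-y)) x = deriv φ x := by congr 1; funext y; exact s.ev y
    rw [deriv_comp_neg, (s.d0 _).deriv, (s.d0 _).deriv] at h1
    rw [← h1, neg_neg]
  have Cd : ∀ {n : ℕ} {g g' : ℝ → ℂ}, (∀ x, HasDerivAt g (g' x) x) → ContDiff ℝ n g' → ContDiff ℝ (n + 1 : ℕ) g := fun {n g g'} hg hc => by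
    have : deriv g = g' := funext fun x => (hg x).deriv
    push_cast
    refine contDiff_succ_iff_deriv.2 ⟨fun x => (hg x).differentiableAt, by simp, ?_⟩
    rw [this]; exact hc
  have hcd : ContDiff ℝ 4 φ := by
    have := Cd s.d0 (Cd s.d1 (Cd s.d2 (Cd (n := 0) s.d3 (by exact_mod_cast contDiff_zero.2 s.hc))))
    exact_mod_cast this
  refine ⟨c + U 0, fun z => φ (z - 1), by simpa using hci, hcd.comp (contDiff_id.sub contDiff_const), ⟨1, by norm_num, by simpa using nz⟩, ?_, ?_, ?_, ?_, ?_, ?_, ?_, ?_⟩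
  · intro z hz
    obtain ⟨u1, u2⟩ := hPU z hz
    rw [sh s.d0, sh s.d1, sh s.d2, sh s.d3, u1, u2]
    have := os_eq s hP α0 R0 e2 e1 (y := z - 1) ⟨by linarith [hz.1], by linarith [hz.2]⟩
    simp only
    rw [this]
    push_cast
    ring
  · simp only [zero_sub]; rw [s.ev, b0]
  · rw [sh s.d0]; simp only [zero_sub]; rw [od, b1, neg_zero]
  · norm_num; exact b0
  · rw [sh s.d0]; norm_num; exact b1
  · simp only [Complex.add_im, Complex.ofReal_im, add_zero]
    calc k1 * √(κ / τ2) * (α * R) ^ (-(1:ℝ) / 2) = k1 * (√(κ / τ2) * (α * R) ^ (-(1:ℝ) / 2)) := by ring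
      _ ≤ k1 * (α * μ) := by gcongr
      _ = α * (k1 * μ) := by ring
      _ ≤ _ := by gcongr
  · simp only [Complex.add_im, Complex.ofReal_im, add_zero]
    have k20 : 0 ≤ k2 := k10.trans hk
    calc α * c.im ≤ α * (k2 * μ) := by gcongr
      _ = k2 * (α * μ) := by ring
      _ ≤ k2 * (√(κ / τ1) * (α * R) ^ (-(1:ℝ) / 2)) := by gcongr
      _ = _ := by ring
  · intro z _
    simp only
    rw [show 2 - z - 1 = -(z - 1) by ring, s.ev]

end OS

end

/-- **Spectral instability of generic channel flows.** For a real-analytic shear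
profile `U` on `[0,2]`, symmetric about `z = 1`, with `U'(0) > 0` and `U'(1) = 0`,
there are marginal stability curves `α_low(R) < α_up(R)`, a critical Reynolds
number `R_c`, and constants `0 < k₁ ≤ k₂`, such that for all `R ≥ R_c` and all
`α ∈ (α_low(R), α_up(R))` there is an unstable Orr–Sommerfeld eigenvalue `c`
(`Im c > 0`) with nonzero eigenfunction `φ` satisfying no-slip conditions at both
walls, growth rate `α Im c ≈ (αR)^{-1/2}`, and the symmetry `φ(2 - z) = φ(z)`
(horizontal velocity `∂_z φ` odd, vertical velocity even about `z = 1`). -/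
theorem spectral_instability_channel_flow
    (U : ℝ → ℝ)
    (hUanalytic : AnalyticOnNhd ℝ U (Set.Icc 0 2))
    (hsym : ∀ z ∈ Set.Icc (0:ℝ) 2, U (2 - z) = U z)
    (hU'0 : 0 < deriv U 0)
    (hU'1 : deriv U 1 = 0) :
    ∃ αlow αup : ℝ → ℝ, ∃ Rc : ℝ, 0 < Rc ∧
    ∃ k₁ k₂ : ℝ, 0 < k₁ ∧ k₁ ≤ k₂ ∧
      ∀ R : ℝ, Rc ≤ R →
        0 < αlow R ∧ αlow R < αup R ∧
        ∀ α : ℝ, αlow R < α → α < αup R →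
          ∃ c : ℂ, ∃ φ : ℝ → ℂ,
            0 < c.im ∧
            ContDiff ℝ 4 φ ∧
            (∃ z ∈ Set.Icc (0:ℝ) 2, φ z ≠ 0) ∧
            -- Orr–Sommerfeld equation on (0,2)
            (∀ z ∈ Set.Ioo (0:ℝ) 2,
              (1 / (Complex.I * Complex.ofReal α * Complex.ofReal R))
                  * (deriv (deriv (deriv (deriv φ))) z
                      - 2 * (Complex.ofReal α)^2 * deriv (deriv φ) z
                      + (Complex.ofReal α)^4 * φ z)
                = (Complex.ofReal (U z) - c) * (deriv (deriv φ) z - (Complex.ofReal α)^2 * φ z)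
                    - Complex.ofReal (deriv (deriv U) z) * φ z) ∧
            -- no-slip boundary conditions at both walls
            φ 0 = 0 ∧ deriv φ 0 = 0 ∧ φ 2 = 0 ∧ deriv φ 2 = 0 ∧
            -- growth rate α·Im c ≈ (αR)^{-1/2}
            k₁ * (α * R) ^ (-(1:ℝ)/2) ≤ α * c.im ∧
            α * c.im ≤ k₂ * (α * R) ^ (-(1:ℝ)/2) ∧
            -- symmetry of the eigenfunction about z = 1
            (∀ z ∈ Set.Icc (0:ℝ) 2, φ (2 - z) = φ z) := by
  exact OS.main_thm U hUanalytic hsym hU'0 hU'1
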